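/- Let m = 6, d = 3, and G := G₁x₁³+⋯+G₆x₆³ ∈ ℤ[x₁,…,x₆] with G₁,…,G₆ ∈ ℤ∖{0} (a diagonal cubic; its complex projective hypersurface is smooth). Fix a real ε > 0. Then there exists a real constant C > 0, depending only on G and ε, such that for every prime p ≥ C, every integer r ≥ 1, and q := p^r, one has #S_G(q,ε) ≤ C·q³ and M_G(q,6) ≤ C·q⁶. -/

import Mathlib

open MvPolynomial
open scoped Classical

/-- Number of points of the projective subset of `ℙ^{m-1}(k)` cut out by the
(scale-invariant) condition `P`. -/
noncomputable def projCount {m : ℕ} (k : Type) [Field k]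
    (P : (Fin m → k) → Prop) : ℕ :=
  Nat.card {x : Fin m → k // x ≠ 0 ∧ P x} / (Nat.card k - 1)

/-- `#ℙ^j(𝔽_q) = 1 + q + ⋯ + q^j`. -/
def projCard (q j : ℕ) : ℕ := ∑ i ∈ Finset.range (j + 1), q ^ i

/-- `E_c(q) := #{[x] ∈ ℙ^{m-1}(𝔽_q) : G(x) = 0, c·x = 0} - #ℙ^{m-3}(𝔽_q)`. -/
noncomputable def Ec {m : ℕ} (K : Type) [Field K]
    (G : MvPolynomial (Fin m) ℤ) (c : Fin m → K) : ℤ :=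
  (projCount K (fun x => eval x (map (Int.castRingHom K) G) = 0 ∧
      ∑ i, c i * x i = 0) : ℤ) -
    (projCard (Nat.card K) (m - 3) : ℤ)

namespace Polynomial.Stepanov

open Finset hiding card
open Fintype (card)
open Function (Injective ne_iff onFun update_of_ne update_self)

/-- The Iverson bracket. -/
local notation "δ[" p "]" => (if p then (1 : ℤ) else 0)

/-- An increasing multiplicative filtration of a ring by additive subgroups, indexed by `ℤ` and
vanishing in negative degrees. -/
structure Filt (A : Type*) [CommRing A] where
  S : ℤ → AddSubgroup A
  mono : ∀ {a b : ℤ}, a ≤ b → S a ≤ S b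
  one_mem : (1 : A) ∈ S 0
  mul_mem : ∀ {a b : ℤ} {x y : A}, x ∈ S a → y ∈ S b → x * y ∈ S (a + b)
  neg : ∀ {a : ℤ} {x : A}, a < 0 → x ∈ S a → x = 0

namespace Filt

variable {A : Type*} [CommRing A] (F : Filt A)

/-- The filtration by powers of the variable on polynomials over a filtered ring. -/
def poly : Filt A[X] where
  S a :=
    { carrier := {u | (∀ i, u.coeff i ∈ F.S a) ∧ ∀ i : ℕ, a < i → u.coeff i = 0}
      zero_mem' := ⟨fun i => by simp, fun i _ => by simp⟩
      add_mem' := fun {u v} hu hv => ⟨fun i => by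
        rw [coeff_add]; exact add_mem (hu.1 i) (hv.1 i), fun i hi => by
        rw [coeff_add, hu.2 i hi, hv.2 i hi, add_zero]⟩
      neg_mem' := fun {u} hu => ⟨fun i => by rw [coeff_neg]; exact neg_mem (hu.1 i), fun i hi => by
        rw [coeff_neg, hu.2 i hi, neg_zero]⟩ }
  mono h u hu := ⟨fun i => F.mono h (hu.1 i), fun i hi => hu.2 i (h.trans_lt hi)⟩
  one_mem := ⟨fun i => by
    rw [coeff_one]; split_ifs
    · exact F.one_mem
    · exact zero_mem _, fun i hi => by
    rw [coeff_one, if_neg]; omega⟩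
  mul_mem {a b x y} hx hy := ⟨fun i => by
    rw [coeff_mul]; exact sum_mem fun p _ => F.mul_mem (hx.1 _) (hy.1 _), fun i hi => by
    rw [coeff_mul]
    refine sum_eq_zero fun p hp => ?_
    rw [Finset.HasAntidiagonal.mem_antidiagonal] at hp
    rcases lt_or_ge a (p.1 : ℤ) with h | h
    · rw [hx.2 _ h, zero_mul]
    · rw [hy.2 _ (by omega), mul_zero]⟩
  neg {a x} ha hx := by
    ext i
    rw [coeff_zero]
    exact F.neg ha (hx.1 i)

/-- The filtration of a ring concentrated in degree zero. -/
def trivial (A : Type*) [CommRing A] : Filt A where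
  S a := if 0 ≤ a then ⊤ else ⊥
  mono {a b} h := by split_ifs <;> first | exact le_rfl | exact le_top | exact bot_le | omega
  one_mem := by simp
  mul_mem {a b x y} hx hy := by
    by_cases ha : 0 ≤ a <;> by_cases hb : 0 ≤ b
    · rw [if_pos (by omega)]; trivial
    · rw [if_neg hb] at hy; rw [AddSubgroup.mem_bot.1 hy, mul_zero]; exact zero_mem _
    · rw [if_neg ha] at hx; rw [AddSubgroup.mem_bot.1 hx, zero_mul]; exact zero_mem _
    · rw [if_neg ha] at hx; rw [AddSubgroup.mem_bot.1 hx, zero_mul]; exact zero_mem _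
  neg {a x} ha hx := by rw [if_neg (by omega)] at hx; exact AddSubgroup.mem_bot.1 hx

variable {F}

theorem pow_mem {a : ℤ} {x : A} (hx : x ∈ F.S a) (n : ℕ) : x ^ n ∈ F.S (n * a) := by
  induction n with
  | zero => simpa using F.one_mem
  | succ n ih =>
    rw [pow_succ]
    have := F.mul_mem ih hx
    convert this using 2
    push_cast; ring

theorem C_mem {a : ℤ} {x : A} (hx : x ∈ F.S a) : C x ∈ F.poly.S a := by
  refine ⟨fun i => ?_, fun i hi => ?_⟩
  · rw [coeff_C]; split_ifs
    · exact hx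
    · exact zero_mem _
  · rw [coeff_C]; split_ifs with h
    · exact F.neg (by omega) hx
    · rfl

theorem X_mem : (X : A[X]) ∈ F.poly.S 1 := by
  refine ⟨fun i => ?_, fun i hi => ?_⟩
  · rw [coeff_X]; split_ifs
    · exact F.mono zero_le_one F.one_mem
    · exact zero_mem _
  · rw [coeff_X, if_neg]; omega

theorem mem_trivial {A : Type*} [CommRing A] {a : ℤ} (ha : 0 ≤ a) (x : A) :
    x ∈ (trivial A).S a := by
  simp only [trivial, if_pos ha]
  exact AddSubgroup.mem_top x

theorem mem_poly_trivial {A : Type*} [CommRing A] {a : ℕ} {x : A[X]} :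
    x ∈ (trivial A).poly.S a ↔ x.natDegree ≤ a := by
  constructor
  · intro h
    exact natDegree_le_iff_coeff_eq_zero.2 fun i hi => h.2 i (by exact_mod_cast hi)
  · intro h
    exact ⟨fun i => mem_trivial (by omega) _, fun i hi =>
      natDegree_le_iff_coeff_eq_zero.1 h i (by exact_mod_cast hi)⟩

/-- Remainders by a monic polynomial stay in a controlled piece of the filtration. -/
theorem modByMonic_mem {H u : A[X]} (hH : H.Monic) {h B : ℤ} (h0 : 0 ≤ h)
    (hHc : ∀ i, H.coeff i ∈ F.S h) (n : ℕ) (hn : u.degree < n)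
    (hu : ∀ i, u.coeff i ∈ F.S B) (i : ℕ) : (u %ₘ H).coeff i ∈ F.S (B + h * n) := by
  nontriviality A
  induction n generalizing u B with
  | zero =>
    have : u = 0 := by simpa using hn
    simp [this]
  | succ n ih =>
    by_cases hd : u.degree < H.degree
    · rw [(modByMonic_eq_self_iff hH).2 hd]
      exact F.mono (by nlinarith [Nat.cast_nonneg (α := ℤ) (n + 1)]) (hu i)
    · push Not at hd
      have hDn : H.natDegree ≤ n := by
        have h1 : H.degree < (n + 1 : ℕ) := hd.trans_lt hn
        rw [degree_eq_natDegree hH.ne_zero] at h1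
        have := Nat.cast_lt.1 h1
        omega
      have key : (u - C (u.coeff n) * X ^ (n - H.natDegree) * H).degree < (n : WithBot ℕ) := by
        rw [degree_lt_iff_coeff_zero]
        intro m hm
        have e : m = (m - (n - H.natDegree)) + (n - H.natDegree) := by omega
        rw [coeff_sub, mul_assoc, coeff_C_mul, X_pow_mul]
        conv_lhs => enter [2, 2]; rw [e]
        rw [coeff_mul_X_pow]
        rcases hm.eq_or_lt with rfl | hm
        · have : n - (n - H.natDegree) = H.natDegree := by omega
          rw [this, coeff_natDegree, hH.leadingCoeff, mul_one, sub_self]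
        · rw [coeff_eq_zero_of_natDegree_lt (p := H) (by omega), mul_zero, sub_zero]
          exact coeff_eq_zero_of_degree_lt (hn.trans_le (by exact_mod_cast hm))
      have e1 : u %ₘ H = (u - C (u.coeff n) * X ^ (n - H.natDegree) * H) %ₘ H := by
        rw [sub_modByMonic, (modByMonic_eq_zero_iff_dvd hH).2 (Dvd.intro_left _ rfl), sub_zero]
      rw [e1]
      have := ih (B := B + h) key ?_
      · refine F.mono ?_ this
        push_cast; linarith
      · intro j
        rw [coeff_sub]
        refine sub_mem (F.mono (by linarith) (hu j)) ?_
        rw [mul_assoc, coeff_C_mul]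
        refine F.mul_mem (hu n) ?_
        rw [X_pow_mul, coeff_mul_X_pow']
        split_ifs
        · exact hHc _
        · exact zero_mem _

end Filt

/-- The determinant of a matrix of polynomials has degree at most the sum of the column bounds. -/
theorem natDegree_det_le {R ι : Type*} [CommRing R] [Fintype ι] [DecidableEq ι]
    (M : Matrix ι ι R[X]) (b : ι → ℕ) (h : ∀ i j, (M i j).natDegree ≤ b j) :
    M.det.natDegree ≤ ∑ j, b j := by
  rw [Matrix.det_apply]
  refine natDegree_sum_le_of_forall_le _ _ fun σ _ => ?_
  rw [Units.smul_def]
  refine (natDegree_smul_le _ _).trans ((natDegree_prod_le _ _).trans ?_)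
  exact sum_le_sum fun i _ => h _ _

theorem natDegree_resultant_le {R : Type*} [CommRing R] (f g : R[X][X]) (m n d a : ℕ)
    (hf : ∀ i, (f.coeff i).natDegree ≤ d) (hg : ∀ i, (g.coeff i).natDegree ≤ a) :
    (resultant f g m n).natDegree ≤ m * a + n * d := by
  have := natDegree_det_le (sylvester f g m n) (fun j => j.addCases (fun _ => a) (fun _ => d)) ?_
  · refine this.trans (le_of_eq ?_)
    rw [Fin.sum_univ_add]
    simp
  · intro i j
    induction j using Fin.addCases with
    | left j =>
      simp only [sylvester, Matrix.of_apply, Fin.addCases_left]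
      split_ifs
      · exact hg _
      · simp
    | right j =>
      simp only [sylvester, Matrix.of_apply, Fin.addCases_right]
      split_ifs
      · exact hf _
      · simp

/-- A bivariate polynomial coprime to a monic irreducible one has nonzero resultant with it. -/
theorem resultant_ne_zero_of_not_dvd {k : Type*} [Field k] {f g : k[X][X]} (hf : f.Monic)
    (hi : Irreducible f) (h : ¬ f ∣ g) : resultant f g ≠ 0 := by
  let K := FractionRing k[X]
  have hinj : Injective (algebraMap k[X] K) := IsFractionRing.injective _ _
  have h1 : Irreducible (f.map (algebraMap k[X] K)) :=
    (hf.irreducible_iff_irreducible_map_fraction_map).1 hi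
  have h2 : ¬ f.map (algebraMap k[X] K) ∣ g.map (algebraMap k[X] K) := by
    rwa [map_dvd_map _ hinj hf]
  have h3 := resultant_ne_zero _ _ ((h1.coprime_iff_not_dvd).2 h2)
  rw [natDegree_map_eq_of_injective hinj, natDegree_map_eq_of_injective hinj,
    resultant_map_map] at h3
  intro h0
  rw [h0, map_zero] at h3
  exact h3 rfl

theorem resultant_mem {R : Type*} [CommRing R] (f g : R[X]) (hf : f.natDegree ≠ 0) :
    ∃ a b : R[X], f * a + g * b = C (resultant f g) := by
  obtain ⟨a, b, -, -, h⟩ := exists_mul_add_mul_eq_C_resultant f g le_rfl le_rfl (Or.inl hf)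
  exact ⟨a, b, h⟩

namespace Filt

variable {A : Type*} [CommRing A] (F : Filt A)

/-- Power series whose coefficients grow linearly, with slope `s`, in the filtration. -/
def ps (s c : ℤ) : AddSubgroup (PowerSeries A) where
  carrier := {u | ∀ i : ℕ, PowerSeries.coeff i u ∈ F.S (s * i + c)}
  zero_mem' i := by simp
  add_mem' hu hv i := by rw [map_add]; exact add_mem (hu i) (hv i)
  neg_mem' hu i := by rw [map_neg]; exact neg_mem (hu i)

variable {F} {s : ℤ}

theorem ps_mono (s : ℤ) {a b : ℤ} (h : a ≤ b) : F.ps s a ≤ F.ps s b :=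
  fun _ hu i => F.mono (by linarith) (hu i)

theorem ps_mul_mem {a b : ℤ} {u v : PowerSeries A} (hu : u ∈ F.ps s a) (hv : v ∈ F.ps s b) :
    u * v ∈ F.ps s (a + b) := fun i => by
  rw [PowerSeries.coeff_mul]
  refine sum_mem fun p hp => ?_
  rw [Finset.HasAntidiagonal.mem_antidiagonal] at hp
  have := F.mul_mem (hu p.1) (hv p.2)
  convert this using 2
  rw [← hp]; push_cast; ring

theorem ps_C_mem (hs : 0 ≤ s) {a : ℤ} {x : A} (hx : x ∈ F.S a) :
    PowerSeries.C x ∈ F.ps s a := fun i => by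
  rw [PowerSeries.coeff_C]
  split_ifs
  · exact F.mono (by nlinarith [Nat.cast_nonneg (α := ℤ) i]) hx
  · exact zero_mem _

theorem ps_X_mem : (PowerSeries.X : PowerSeries A) ∈ F.ps s (-s) := fun i => by
  rw [PowerSeries.coeff_X]
  split_ifs with h
  · rw [h]; convert F.one_mem using 2; push_cast; ring
  · exact zero_mem _

theorem ps_pow_mem (hs : 0 ≤ s) {a : ℤ} {u : PowerSeries A} (hu : u ∈ F.ps s a) (n : ℕ) :
    u ^ n ∈ F.ps s (n * a) := by
  induction n with
  | zero => simpa using ps_C_mem hs F.one_mem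
  | succ n ih =>
    rw [pow_succ]
    have := ps_mul_mem ih hu
    convert this using 2
    push_cast; ring

/-- The nonlinear part of the expansion of `f(x + e²τ, y + eZ) - f(x, y)`, divided by `-e²`. -/
noncomputable def step (e : A) (g : ℕ → ℕ → A) (N : ℕ) (Z : PowerSeries A) : PowerSeries A :=
  -∑ i ∈ range N, ∑ j ∈ range N, if 2 ≤ 2 * i + j then
    PowerSeries.C (e ^ (2 * i + j - 2) * g i j) * PowerSeries.X ^ i * Z ^ j else 0

theorem step_mem {e : A} {g : ℕ → ℕ → A} {B : ℤ} (hB : 0 ≤ B) (he : e ∈ F.S B)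
    (hg : ∀ i j, g i j ∈ F.S B) (N : ℕ) {Z : PowerSeries A} (hZ : Z ∈ F.ps (2 * B) (-B)) :
    step e g N Z ∈ F.ps (2 * B) (-B) := by
  refine neg_mem (sum_mem fun i _ => sum_mem fun j _ => ?_)
  split_ifs with h
  · have h2 : 0 ≤ 2 * B := by linarith
    have := ps_mul_mem (ps_mul_mem (ps_C_mem h2 (F.mul_mem (pow_mem he (2 * i + j - 2)) (hg i j)))
      (ps_pow_mem h2 ps_X_mem i)) (ps_pow_mem h2 hZ j)
    refine ps_mono _ (le_of_eq ?_) this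
    rw [Nat.cast_sub h]; push_cast; ring
  · exact zero_mem _

theorem step_congr (e : A) (g : ℕ → ℕ → A) (N n : ℕ) {Z W : PowerSeries A}
    (hZ : PowerSeries.X ∣ Z) (hW : PowerSeries.X ∣ W) (h : PowerSeries.X ^ n ∣ Z - W) :
    PowerSeries.X ^ (n + 1) ∣ step e g N Z - step e g N W := by
  have e1 : step e g N Z - step e g N W = -∑ i ∈ range N, ∑ j ∈ range N, if 2 ≤ 2 * i + j then
        PowerSeries.C (e ^ (2 * i + j - 2) * g i j) * (PowerSeries.X ^ i * (Z ^ j - W ^ j))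
        else 0 := by
    rw [step, step, ← neg_sub', ← sum_sub_distrib]
    congr 1
    refine sum_congr rfl fun i _ => ?_
    rw [← sum_sub_distrib]
    refine sum_congr rfl fun j _ => ?_
    split_ifs <;> ring
  rw [e1]
  refine (dvd_neg.2 (dvd_sum fun i _ => dvd_sum fun j _ => ?_))
  split_ifs with hij
  · refine Dvd.dvd.mul_left ?_ _
    rcases i with _ | i
    · obtain ⟨j, rfl⟩ : ∃ m, j = m + 1 := ⟨j - 1, by omega⟩
      rw [pow_zero, one_mul, ← (Commute.all Z W).mul_geom_sum₂, pow_succ]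
      refine mul_dvd_mul h (dvd_sum fun l hl => ?_)
      rw [mem_range] at hl
      rcases l with _ | l
      · exact Dvd.dvd.mul_left (dvd_pow hW (by omega)) _
      · exact Dvd.dvd.mul_right (dvd_pow hZ (by omega)) _
    · rw [add_comm n, pow_add]
      refine mul_dvd_mul (by rw [pow_one]; exact dvd_pow_self _ (by omega)) (h.trans ?_)
      exact sub_dvd_pow_sub_pow _ _ _
  · exact dvd_zero _

theorem X_dvd_of_mem_ps {B : ℤ} (hB : 0 < B) {Z : PowerSeries A} (hZ : Z ∈ F.ps (2 * B) (-B)) :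
    PowerSeries.X ∣ Z := by
  rw [PowerSeries.X_dvd_iff, ← PowerSeries.coeff_zero_eq_constantCoeff_apply]
  exact F.neg (by simpa using hB) (hZ 0)

theorem exists_step_eq {e : A} {g : ℕ → ℕ → A} {B : ℤ} (hB : 0 < B) (he : e ∈ F.S B)
    (hg : ∀ i j, g i j ∈ F.S B) (N : ℕ) :
    ∃ Z ∈ F.ps (2 * B) (-B), Z = step e g N Z := by
  let x : ℕ → PowerSeries A := fun n => (step e g N)^[n] 0
  have hx : ∀ n, x n ∈ F.ps (2 * B) (-B) := fun n => by
    induction n with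
    | zero => exact zero_mem _
    | succ n ih =>
      simp only [x, Function.iterate_succ_apply']
      exact step_mem hB.le he hg N ih
  have hx1 : ∀ n, x (n + 1) = step e g N (x n) := fun n => Function.iterate_succ_apply' _ _ _
  have hd : ∀ n, PowerSeries.X ^ n ∣ x (n + 1) - x n := fun n => by
    induction n with
    | zero => simp
    | succ n ih =>
      rw [hx1 (n + 1), hx1 n]
      exact step_congr e g N n (hx1 n ▸ X_dvd_of_mem_ps hB (hx (n + 1)))
        (X_dvd_of_mem_ps hB (hx n)) (by rw [← hx1]; exact ih)
  have hd2 : ∀ n m, PowerSeries.X ^ n ∣ x (n + m) - x n := fun n m => by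
    induction m with
    | zero => simp
    | succ m ih =>
      have := dvd_add ((pow_dvd_pow _ (by omega)).trans (hd (n + m))) ih
      rwa [sub_add_sub_cancel] at this
  let Z : PowerSeries A := PowerSeries.mk fun n => PowerSeries.coeff n (x (n + 1))
  have hZx : ∀ n, PowerSeries.X ^ n ∣ Z - x n := fun n => by
    rw [PowerSeries.X_pow_dvd_iff]
    intro m hm
    rw [map_sub, PowerSeries.coeff_mk]
    have := PowerSeries.X_pow_dvd_iff.1 (hd2 (m + 1) (n - (m + 1))) m (by omega)
    rw [map_sub, show m + 1 + (n - (m + 1)) = n by omega, sub_eq_zero] at this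
    rw [this, sub_self]
  have hZ : Z ∈ F.ps (2 * B) (-B) := fun i => by
    rw [PowerSeries.coeff_mk]
    exact hx _ i
  refine ⟨Z, hZ, ?_⟩
  rw [← sub_eq_zero]
  ext n
  have h1 := hZx (n + 1)
  have h2 := step_congr e g N n (X_dvd_of_mem_ps hB hZ) (X_dvd_of_mem_ps hB (hx n)) (hZx n)
  rw [← hx1] at h2
  have := dvd_sub h1 h2
  rw [sub_sub_sub_cancel_right] at this
  exact PowerSeries.X_pow_dvd_iff.1 this n (by omega)

end Filt

section Taylor

variable {k : Type*} [CommRing k] {A : Type*} [CommRing A]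

/-- The substitution `u(x, y) ↦ u(x + ξ, y + ζ)`, as a polynomial in `ξ` over polynomials
in `ζ`. -/
noncomputable def taylorTwo (φ : k[X][X] →+* A) : k[X][X] →+* A[X][X] :=
  eval₂RingHom (eval₂RingHom ((C.comp C).comp (φ.comp (C.comp C))) (C (C (φ (C X))) + X))
    (C (C (φ X) + X))

theorem eval_taylorTwo {A' : Type*} [CommRing A'] (φ : k[X][X] →+* A) (ψ : A →+* A') (ξ ζ : A')
    (u : k[X][X]) : eval₂ (eval₂RingHom ψ ζ) ξ (taylorTwo φ u) =
      eval₂ (eval₂RingHom ((ψ.comp φ).comp (C.comp C)) (ψ (φ (C X)) + ξ)) (ψ (φ X) + ζ) u := by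
  have : (eval₂RingHom (eval₂RingHom ψ ζ) ξ).comp (taylorTwo φ) =
      eval₂RingHom (eval₂RingHom ((ψ.comp φ).comp (C.comp C)) (ψ (φ (C X)) + ξ)) (ψ (φ X) + ζ) := by
    ext <;> simp [taylorTwo]
  exact congrArg (fun h : k[X][X] →+* A' => h u) this

/-- The bidegree filtration on bivariate polynomials. -/
noncomputable abbrev bideg (k : Type*) [CommRing k] : Filt k[X][X] := (Filt.trivial k).poly.poly

theorem map_mem_of_mem_bideg (F : Filt A) (φ : k[X][X] →+* A)
    (hC : ∀ c, φ (C (C c)) ∈ F.S 0) (hx : φ (C X) ∈ F.S 1) (hy : φ X ∈ F.S 1) {n : ℕ}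
    {u : k[X][X]} (hu : u ∈ (bideg k).S n) : φ u ∈ F.S (2 * n) := by
  rw [as_sum_range_C_mul_X_pow u, map_sum]
  refine sum_mem fun i _ => ?_
  rcases lt_or_ge (n : ℤ) i with hi | hi
  · rw [hu.2 i hi]; simp
  rw [map_mul, map_pow]
  have h1 : φ (C (u.coeff i)) ∈ F.S n := by
    rw [as_sum_range_C_mul_X_pow (u.coeff i), map_sum, map_sum]
    refine sum_mem fun j _ => ?_
    rcases lt_or_ge (n : ℤ) j with hj | hj
    · rw [(hu.1 i).2 j hj]; simp
    rw [map_mul, map_mul, map_pow, map_pow]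
    exact F.mono (by linarith) (F.mul_mem (hC _) (Filt.pow_mem hx j))
  exact F.mono (by linarith) (F.mul_mem h1 (Filt.pow_mem hy i))

theorem taylorTwo_mem (F : Filt A) (φ : k[X][X] →+* A)
    (hC : ∀ c, φ (C (C c)) ∈ F.S 0) (hx : φ (C X) ∈ F.S 1) (hy : φ X ∈ F.S 1) {n : ℕ}
    {u : k[X][X]} (hu : u ∈ (bideg k).S n) : taylorTwo φ u ∈ F.poly.poly.S (2 * n) := by
  refine map_mem_of_mem_bideg F.poly.poly (taylorTwo φ) ?_ ?_ ?_ hu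
  · intro c
    simp only [taylorTwo, coe_eval₂RingHom, eval₂_C, RingHom.comp_apply]
    exact Filt.C_mem (Filt.C_mem (hC c))
  · simp only [taylorTwo, coe_eval₂RingHom, eval₂_C, eval₂_X]
    exact add_mem (Filt.C_mem (Filt.C_mem hx)) Filt.X_mem
  · simp only [taylorTwo, coe_eval₂RingHom, eval₂_X]
    exact Filt.C_mem (add_mem (Filt.C_mem hy) Filt.X_mem)

/-- The mixed divided derivatives of a bivariate polynomial. -/
noncomputable def dd (f : k[X][X]) (i j : ℕ) : k[X][X] :=
  ((taylorTwo (RingHom.id k[X][X]) f).coeff i).coeff j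

theorem bideg_C_C_mem (c : k) : C (C c) ∈ (bideg k).S 0 :=
  Filt.C_mem (Filt.C_mem (Filt.mem_trivial le_rfl c))

theorem bideg_C_X_mem : C (X : k[X]) ∈ (bideg k).S 1 := Filt.C_mem Filt.X_mem

theorem bideg_X_mem : (X : k[X][X]) ∈ (bideg k).S 1 := Filt.X_mem

theorem dd_mem {n : ℕ} {f : k[X][X]} (hf : f ∈ (bideg k).S n) (i j : ℕ) :
    dd f i j ∈ (bideg k).S (2 * n) :=
  ((taylorTwo_mem (bideg k) (RingHom.id _) bideg_C_C_mem bideg_C_X_mem bideg_X_mem hf).1 i).1 j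

theorem dd_zero_zero (f : k[X][X]) : dd f 0 0 = f := by
  have h := eval_taylorTwo (RingHom.id k[X][X]) (RingHom.id k[X][X]) 0 0 f
  rw [eval₂_at_zero] at h
  simp only [coe_eval₂RingHom, eval₂_at_zero, RingHom.id_apply] at h
  rw [dd, h]
  have : eval₂RingHom (eval₂RingHom (((RingHom.id k[X][X]).comp (RingHom.id k[X][X])).comp
      (C.comp C)) (C X + 0)) (X + 0) = RingHom.id k[X][X] := by
    ext <;> simp
  simpa using congrArg (fun h : k[X][X] →+* _ => h f) this

theorem dd_zero_one (f : k[X][X]) : dd f 0 1 = derivative f := by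
  have h : taylor X (f.map C) = (taylorTwo (RingHom.id k[X][X]) f).coeff 0 := by
    have : ((taylorAlgHom (X : k[X][X])).toRingHom).comp (mapRingHom C) =
        (evalRingHom 0).comp (taylorTwo (RingHom.id k[X][X])) := by
      ext <;> simp [taylorTwo, add_comm]
    have := congrArg (fun h : k[X][X] →+* _ => h f) this
    simpa [coeff_zero_eq_eval_zero] using this
  rw [dd, ← h, taylor_coeff_one, derivative_map, eval_map, eval₂_C_X]

end Taylor

section

theorem Filt.sub_mul_step {A : Type*} [CommRing A] (e : A) (g : ℕ → ℕ → A) (N : ℕ)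
    (Z a b : PowerSeries A) : a - b * Filt.step e g N Z = a + b * ∑ i ∈ range N,
      ∑ j ∈ range N, if 2 ≤ 2 * i + j then
        PowerSeries.C (e ^ (2 * i + j - 2) * g i j) * PowerSeries.X ^ i * Z ^ j else 0 := by
  rw [Filt.step, mul_neg, sub_neg_eq_add]

variable {k : Type*} [CommRing k]

/-- The substitution `x ↦ x + e²τ`, `y ↦ y + eZ` into power series in `τ`. -/
noncomputable def expand (e : k[X][X]) (Z : PowerSeries k[X][X]) :
    k[X][X] →+* PowerSeries k[X][X] :=
  eval₂RingHom (eval₂RingHom ((PowerSeries.C).comp (C.comp C))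
    (PowerSeries.C (C X) + PowerSeries.C (e ^ 2) * PowerSeries.X))
    (PowerSeries.C X + PowerSeries.C e * Z)

theorem expand_C_C (e : k[X][X]) (Z) (c : k) : expand e Z (C (C c)) = PowerSeries.C (C (C c)) := by
  simp [expand]

theorem expand_C_X (e : k[X][X]) (Z) : expand e Z (C X) =
    PowerSeries.C (C X) + PowerSeries.C (e ^ 2) * PowerSeries.X := by
  simp [expand]

theorem expand_X (e : k[X][X]) (Z) : expand e Z X = PowerSeries.C X + PowerSeries.C e * Z := by
  simp [expand]

/-- Along the curve `f = const`, the coordinate `y` expands as a power series in the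
coordinate `x`, with coefficients of linearly growing bidegree. -/
theorem exists_expand (f : k[X][X]) (n : ℕ) (hn : 0 < n) (hf : f ∈ (bideg k).S n) :
    ∃ Z ∈ (bideg k).ps (4 * n) (-(2 * n)), expand (derivative f) Z f = PowerSeries.C f := by
  obtain ⟨e, he⟩ : ∃ e, e = derivative f := ⟨_, rfl⟩
  rw [← he]
  have heS : e ∈ (bideg k).S (2 * n) := by rw [he, ← dd_zero_one]; exact dd_mem hf 0 1
  obtain ⟨Z, hZ, hZs⟩ := Filt.exists_step_eq (F := bideg k) (e := e) (g := dd f) (B := 2 * n)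
    (by positivity) heS (fun i j => dd_mem hf i j) (2 * n + 2)
  rw [← mul_assoc, show (2 * 2 : ℤ) = 4 by norm_num] at hZ
  refine ⟨Z, hZ, ?_⟩
  have hT := taylorTwo_mem (bideg k) (RingHom.id k[X][X]) bideg_C_C_mem bideg_C_X_mem
    bideg_X_mem hf
  have h := eval_taylorTwo (RingHom.id k[X][X]) (PowerSeries.C)
    (PowerSeries.C (e ^ 2) * PowerSeries.X) (PowerSeries.C e * Z) f
  have h1 : (taylorTwo (RingHom.id k[X][X]) f).natDegree < 2 * n + 2 := by
    have : (taylorTwo (RingHom.id k[X][X]) f).natDegree ≤ 2 * n :=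
      natDegree_le_iff_coeff_eq_zero.2 fun i hi => hT.2 i (by exact_mod_cast hi)
    omega
  have h2 : ∀ i, ((taylorTwo (RingHom.id k[X][X]) f).coeff i).natDegree < 2 * n + 2 := fun i => by
    have : ((taylorTwo (RingHom.id k[X][X]) f).coeff i).natDegree ≤ 2 * n :=
      natDegree_le_iff_coeff_eq_zero.2 fun j hj => (hT.1 i).2 j (by exact_mod_cast hj)
    omega
  rw [eval₂_eq_sum_range' _ h1] at h
  simp only [coe_eval₂RingHom] at h
  have h3 : ∀ i, eval₂ (PowerSeries.C) (PowerSeries.C e * Z)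
      ((taylorTwo (RingHom.id k[X][X]) f).coeff i) = ∑ j ∈ range (2 * n + 2),
        PowerSeries.C (dd f i j) * (PowerSeries.C e * Z) ^ j := fun i => by
    rw [eval₂_eq_sum_range' _ (h2 i)]; rfl
  have h4 : expand e Z f = eval₂ (eval₂RingHom (((PowerSeries.C).comp (RingHom.id k[X][X])).comp
      (C.comp C)) (PowerSeries.C ((RingHom.id k[X][X]) (C X)) +
        PowerSeries.C (e ^ 2) * PowerSeries.X))
      (PowerSeries.C ((RingHom.id k[X][X]) X) + PowerSeries.C e * Z) f := rfl
  rw [h4, ← h]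
  have h5 : ∀ i j : ℕ, PowerSeries.C (dd f i j) * (PowerSeries.C e * Z) ^ j *
      (PowerSeries.C (e ^ 2) * PowerSeries.X) ^ i =
      (if i = 0 then if j = 0 then PowerSeries.C f else 0 else 0) +
      (if i = 0 then if j = 1 then PowerSeries.C (e ^ 2) * Z else 0 else 0) +
      PowerSeries.C (e ^ 2) * (if 2 ≤ 2 * i + j then
        PowerSeries.C (e ^ (2 * i + j - 2) * dd f i j) * PowerSeries.X ^ i * Z ^ j else 0) := by
    intro i j
    by_cases hij : 2 ≤ 2 * i + j
    · have e1 : ¬ (i = 0 ∧ j = 0) := by omega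
      have e2 : ¬ (i = 0 ∧ j = 1) := by omega
      rw [← ite_and, ← ite_and, if_neg e1, if_neg e2, if_pos hij]
      obtain ⟨m, hm⟩ := Nat.exists_eq_add_of_le hij
      have : PowerSeries.C (e ^ 2) * PowerSeries.C (e ^ (2 * i + j - 2)) =
          PowerSeries.C e ^ (2 * i + j) := by
        rw [← map_mul, ← pow_add, ← map_pow, show 2 + (2 * i + j - 2) = 2 * i + j by omega]
      rw [map_mul, zero_add, zero_add, ← mul_assoc, ← mul_assoc, ← mul_assoc, this, map_pow]
      ring
    · have : i = 0 := by omega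
      subst this
      have : j = 0 ∨ j = 1 := by omega
      rcases this with rfl | rfl
      · simp [dd_zero_zero]
      · simp [dd_zero_one, ← he]; ring
  have h6 : ∑ i ∈ range (2 * n + 2), eval₂ (PowerSeries.C) (PowerSeries.C e * Z)
      ((taylorTwo (RingHom.id k[X][X]) f).coeff i) * (PowerSeries.C (e ^ 2) * PowerSeries.X) ^ i =
      PowerSeries.C f + PowerSeries.C (e ^ 2) * Z - PowerSeries.C (e ^ 2) *
        Filt.step e (dd f) (2 * n + 2) Z := by
    rw [Filt.sub_mul_step]
    simp only [h3, sum_mul, h5, sum_add_distrib, ← mul_sum]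
    congr 2
    · rw [sum_eq_single 0 (fun i _ hi => by simp [hi]) (by simp)]
      simp
    · rw [sum_eq_single 0 (fun i _ hi => by simp [hi]) (by simp)]
      simp
  rw [h6, ← hZs]
  ring

/-- The coefficients of the expansion of a monomial. -/
theorem expand_monomial_mem {e : k[X][X]} {Z : PowerSeries k[X][X]} {n : ℕ}
    (he : e ∈ (bideg k).S (2 * n)) (hZ : Z ∈ (bideg k).ps (4 * n) (-(2 * n))) (i j l : ℕ) :
    ∀ m, (((PowerSeries.coeff l (expand e Z (C X ^ i * X ^ j))).coeff m).natDegree ≤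
      i + (4 * n * l + j)) ∧ (4 * n * l + j < m →
        (PowerSeries.coeff l (expand e Z (C X ^ i * X ^ j))).coeff m = 0) := by
  have hX : expand e Z X ∈ (bideg k).ps (4 * n) 1 := by
    rw [expand_X]
    refine add_mem (Filt.ps_C_mem (by positivity) bideg_X_mem) (Filt.ps_mono _ ?_
      (Filt.ps_mul_mem (Filt.ps_C_mem (by positivity) he) hZ))
    linarith
  have hXj := Filt.ps_pow_mem (by positivity) hX j
  have key : ∀ s ≤ l, PowerSeries.coeff (l - s) (PowerSeries.C (e ^ (2 * s)) * (expand e Z X) ^ j)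
      ∈ (bideg k).S ((4 * n * l + j : ℕ) : ℤ) := by
    intro s hs
    have := Filt.ps_mul_mem (Filt.ps_C_mem (s := 4 * n) (by positivity)
      (Filt.pow_mem he (2 * s))) hXj (l - s)
    refine (bideg k).mono ?_ this
    rw [Nat.cast_sub hs]; push_cast; nlinarith
  have e1 : PowerSeries.coeff l (expand e Z (C X ^ i * X ^ j)) = ∑ s ∈ range (i + 1),
      if s ≤ l then C (X ^ (i - s) * (i.choose s : k[X])) *
        PowerSeries.coeff (l - s) (PowerSeries.C (e ^ (2 * s)) * (expand e Z X) ^ j) else 0 := by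
    rw [map_mul, map_pow, map_pow, expand_C_X, add_comm, add_pow, sum_mul, map_sum]
    refine sum_congr rfl fun s _ => ?_
    have : (PowerSeries.C (e ^ 2) * PowerSeries.X) ^ s * PowerSeries.C (C X) ^ (i - s) *
        ((i.choose s : ℕ) : PowerSeries k[X][X]) * (expand e Z) X ^ j =
        PowerSeries.C (C (X ^ (i - s) * (i.choose s : k[X]))) *
          ((PowerSeries.C (e ^ (2 * s)) * (expand e Z X) ^ j) * PowerSeries.X ^ s) := by
      simp only [map_mul, map_pow, map_natCast]
      ring
    rw [this, PowerSeries.coeff_C_mul, PowerSeries.coeff_mul_X_pow']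
    split_ifs <;> simp
  intro m
  rw [e1, finset_sum_coeff]
  constructor
  · refine natDegree_sum_le_of_forall_le _ _ fun s hs => ?_
    split_ifs with h
    · rw [coeff_C_mul]
      refine natDegree_mul_le.trans (add_le_add ?_ ?_)
      · refine natDegree_mul_le.trans ?_
        rw [natDegree_natCast, add_zero]
        exact (natDegree_X_pow_le _).trans (by omega)
      · exact Filt.mem_poly_trivial.1 ((key s h).1 m)
    · simp
  · intro hm
    refine sum_eq_zero fun s _ => ?_
    split_ifs with h
    · rw [coeff_C_mul, (key s h).2 m (by exact_mod_cast hm), mul_zero]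
    · simp

end

section

variable {k : Type*} [Field k]

/-- A ring homomorphism into power series which expands functions at the point `(x₀, y₀)` of the
curve `f = 0`, in the parameter `x - x₀`. -/
structure IsLocal (f : k[X][X]) (x₀ y₀ : k) (φ : k[X][X] →+* PowerSeries k) : Prop where
  map_C : ∀ u, φ (C u) = (taylor x₀ u : k[X])
  map_self : φ f = 0
  constantCoeff : ∀ u, PowerSeries.constantCoeff (φ u) = evalEval x₀ y₀ u

theorem exists_isLocal {f : k[X][X]} {n : ℕ} (hn : 0 < n)
    {Z : PowerSeries k[X][X]} (hZ : Z ∈ (bideg k).ps (4 * n) (-(2 * n)))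
    (hf : expand (derivative f) Z f = PowerSeries.C f)
    {x₀ y₀ : k} (h0 : evalEval x₀ y₀ f = 0) (h1 : evalEval x₀ y₀ (derivative f) ≠ 0) :
    ∃ φ, IsLocal f x₀ y₀ φ ∧ ∀ u l, PowerSeries.coeff l (φ u) =
      (evalEval x₀ y₀ (derivative f))⁻¹ ^ (2 * l) *
        evalEval x₀ y₀ (PowerSeries.coeff l (expand (derivative f) Z u)) := by
  obtain ⟨e, he⟩ : ∃ e, e = derivative f := ⟨_, rfl⟩
  rw [← he] at hf h1 ⊢
  let φ : k[X][X] →+* PowerSeries k := (PowerSeries.rescale ((evalEval x₀ y₀ e)⁻¹ ^ 2)).comp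
      ((PowerSeries.map (evalEvalRingHom x₀ y₀)).comp (expand e Z))
  have hφ : ∀ u l, PowerSeries.coeff l (φ u) = (evalEval x₀ y₀ e)⁻¹ ^ (2 * l) *
        evalEval x₀ y₀ (PowerSeries.coeff l (expand e Z u)) := fun u l => by
    simp [φ, PowerSeries.coeff_rescale, pow_mul]
  refine ⟨φ, ⟨?_, ?_, ?_⟩, hφ⟩
  · intro u
    have : φ.comp C = (Polynomial.coeToPowerSeries.ringHom).comp
        (taylorAlgHom (R := k) x₀ : k[X] →+* k[X]) := by
      refine ringHom_ext' ?_ ?_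
      · ext c l
        simp only [RingHom.comp_apply, hφ, expand_C_C, PowerSeries.coeff_C]
        split_ifs with h
        · simp [h]
        · simp [PowerSeries.coeff_C, h]
      · ext l
        simp only [RingHom.comp_apply, hφ, expand_C_X]
        rcases l with - | - | l
        · simp [taylor_X, evalEval]
        · simp [taylor_X, PowerSeries.coeff_C, PowerSeries.coeff_X, h1]
        · simp [taylor_X, PowerSeries.coeff_C, PowerSeries.coeff_X, ← map_pow]
    exact congrArg (fun ψ => ψ u) this
  · ext l
    rw [hφ, hf, PowerSeries.coeff_C]
    split_ifs <;> simp [h0]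
  · intro u
    rw [← PowerSeries.coeff_zero_eq_constantCoeff_apply, hφ]
    have : (PowerSeries.constantCoeff.comp (expand e Z)) = RingHom.id _ := by
      have hZ0 : PowerSeries.constantCoeff Z = 0 := by
        rw [← PowerSeries.coeff_zero_eq_constantCoeff_apply]
        exact (bideg k).neg (by push_cast; omega) (hZ 0)
      refine ringHom_ext' (ringHom_ext' ?_ ?_) ?_
      · ext c : 1
        simp only [RingHom.comp_apply, expand_C_C]
        simp
      · simp only [RingHom.comp_apply, expand_C_X]
        simp
      · simp only [RingHom.comp_apply, expand_X]
        simp [hZ0]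
    have h2 := congrArg (fun ψ => ψ u) this
    simp only [RingHom.comp_apply, RingHom.id_apply] at h2
    rw [PowerSeries.coeff_zero_eq_constantCoeff_apply, h2]
    simp

variable {f : k[X][X]} {x₀ y₀ : k} {φ : k[X][X] →+* PowerSeries k}

theorem X_sub_C_pow_dvd_of_coe_taylor {N : ℕ} {u : k[X]}
    (h : (PowerSeries.X : PowerSeries k) ^ N ∣ (taylor x₀ u : k[X])) : (X - C x₀) ^ N ∣ u := by
  rw [X_sub_C_pow_dvd_iff]
  rw [PowerSeries.X_pow_dvd_iff] at h
  rw [X_pow_dvd_iff]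
  intro d hd
  have := h d hd
  rwa [coeff_coe] at this

theorem IsLocal.order_le (hφ : IsLocal f x₀ y₀ φ) (hf : f.Monic) (hi : Irreducible f)
    (hD : f.natDegree ≠ 0) {w : k[X][X]} (hw : ¬ f ∣ w) {N : ℕ}
    (h : (PowerSeries.X : PowerSeries k) ^ N ∣ φ w) : N ≤ (resultant f w).natDegree := by
  obtain ⟨a, b, hab⟩ := resultant_mem f w hD
  have h0 := resultant_ne_zero_of_not_dvd hf hi hw
  have h1 : (PowerSeries.X : PowerSeries k) ^ N ∣ φ (C (resultant f w)) := by
    rw [← hab, map_add, map_mul, map_mul, hφ.map_self, zero_mul, zero_add]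
    exact h.mul_right _
  rw [hφ.map_C] at h1
  have := natDegree_le_of_dvd (X_sub_C_pow_dvd_of_coe_taylor h1) h0
  rwa [natDegree_pow, natDegree_X_sub_C, mul_one] at this

theorem not_dvd_of_natDegree_lt (hf : f.Monic) {w : k[X][X]} (hw : w ≠ 0)
    (h : w.natDegree < f.natDegree) : ¬ f ∣ w := fun hd =>
  absurd (natDegree_le_of_dvd hd hw) (not_le.2 h)

theorem IsLocal.map_ne_zero (hφ : IsLocal f x₀ y₀ φ) (hf : f.Monic) (hi : Irreducible f)
    (hD : f.natDegree ≠ 0) {w : k[X][X]} (hw : ¬ f ∣ w) : φ w ≠ 0 := fun h => by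
  have := hφ.order_le hf hi hD hw (N := (resultant f w).natDegree + 1) (by rw [h]; exact dvd_zero _)
  omega

end

section

variable {k : Type*} [Field k]

theorem exists_pow_eq_C_add {p : ℕ} [Fact p.Prime] [CharP k p] (r : ℕ) (v : PowerSeries k) :
    ∃ t, v ^ p ^ r = PowerSeries.C (PowerSeries.constantCoeff v ^ p ^ r) +
      PowerSeries.X ^ p ^ r * t := by
  haveI : CharP (PowerSeries k) p := charP_of_injective_ringHom PowerSeries.C_injective p
  obtain ⟨t, ht⟩ : PowerSeries.X ∣ v - PowerSeries.C (PowerSeries.constantCoeff v) :=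
    PowerSeries.X_dvd_iff.2 (by simp)
  refine ⟨t ^ p ^ r, ?_⟩
  conv_lhs => rw [← sub_add_cancel v (PowerSeries.C (PowerSeries.constantCoeff v)), ht,
    add_pow_char_pow, mul_pow, ← map_pow, add_comm]

variable {f : k[X][X]} {x₀ y₀ : k} {φ : k[X][X] →+* PowerSeries k} {ι : Type*} [Fintype ι]

theorem IsLocal.sum_mul_pow_ne_zero {p : ℕ} [Fact p.Prime] [CharP k p] {r : ℕ}
    (hφ : IsLocal f x₀ y₀ φ) (hf : f.Monic) (hi : Irreducible f) (hD : f.natDegree ≠ 0)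
    (u w : ι → k[X][X]) (hw : ∃ o, ¬ f ∣ w o)
    (hu : ∀ c : ι → k, c ≠ 0 → ¬ f ∣ ∑ o, C (C (c o)) * u o)
    (hq : ∀ c : ι → k, (resultant f (∑ o, C (C (c o)) * u o)).natDegree < p ^ r) :
    φ (∑ o, u o * w o ^ p ^ r) ≠ 0 := by
  intro h0
  have hex : ∃ n, ∃ o, PowerSeries.coeff n (φ (w o)) ≠ 0 := by
    obtain ⟨o, ho⟩ := hw
    have := hφ.map_ne_zero hf hi hD ho
    by_contra! hc
    exact this (PowerSeries.ext fun n => by simpa using hc n o)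
  obtain ⟨o₁, ho₁⟩ := Nat.find_spec hex
  have hmin : ∀ o, PowerSeries.X ^ Nat.find hex ∣ φ (w o) := fun o =>
    PowerSeries.X_pow_dvd_iff.2 fun m hm => by
      by_contra hc
      exact Nat.find_min hex hm ⟨o, hc⟩
  obtain ⟨n₀, hn₀⟩ : ∃ n, n = Nat.find hex := ⟨_, rfl⟩
  rw [← hn₀] at hmin ho₁
  choose v hv using hmin
  choose t ht using fun o => exists_pow_eq_C_add (p := p) r (v o)
  set c : ι → k := fun o => PowerSeries.constantCoeff (v o) ^ p ^ r with hc
  have hc0 : c ≠ 0 := fun h => by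
    have h1 := congrFun h o₁
    rw [hv, PowerSeries.coeff_X_pow_mul', if_pos le_rfl, Nat.sub_self,
      PowerSeries.coeff_zero_eq_constantCoeff_apply] at ho₁
    exact pow_ne_zero _ ho₁ h1
  have hCC : ∀ a : k, φ (C (C a)) = PowerSeries.C a := fun a => by rw [hφ.map_C]; simp
  have h1 : φ (∑ o, C (C (c o)) * u o) = - (PowerSeries.X ^ p ^ r * ∑ o, t o * φ (u o)) := by
    have h2 : PowerSeries.X ^ (n₀ * p ^ r) * ∑ o, φ (u o) * v o ^ p ^ r = 0 := by
      rw [← h0, map_sum, mul_sum]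
      refine sum_congr rfl fun o _ => ?_
      rw [map_mul, map_pow, hv, mul_pow, pow_mul]
      ring
    rw [mul_eq_zero, or_iff_right (pow_ne_zero _ PowerSeries.X_ne_zero)] at h2
    rw [eq_neg_iff_add_eq_zero, ← h2, map_sum, mul_sum, ← sum_add_distrib]
    refine sum_congr rfl fun o _ => ?_
    rw [map_mul, hCC, ht]
    ring
  have h3 := hφ.order_le hf hi hD (hu c hc0) (N := p ^ r) (by
    rw [h1]; exact (Dvd.intro _ rfl).neg_right)
  exact absurd (hq c) (not_lt.2 h3)

theorem IsLocal.X_pow_dvd_sum_mul_pow {p : ℕ} [Fact p.Prime] [CharP k p] {r M : ℕ}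
    (hφ : IsLocal f x₀ y₀ φ) (hM : M ≤ p ^ r) (u w : ι → k[X][X])
    (h : ∀ l < M, ∑ o, PowerSeries.coeff l (φ (u o)) * evalEval x₀ y₀ (w o) ^ p ^ r = 0) :
    PowerSeries.X ^ M ∣ φ (∑ o, u o * w o ^ p ^ r) := by
  choose t ht using fun o => exists_pow_eq_C_add (p := p) r (φ (w o))
  have : φ (∑ o, u o * w o ^ p ^ r) = ∑ o, φ (u o) * PowerSeries.C (evalEval x₀ y₀ (w o) ^ p ^ r) +
      PowerSeries.X ^ p ^ r * ∑ o, φ (u o) * t o := by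
    rw [map_sum, mul_sum, ← sum_add_distrib]
    refine sum_congr rfl fun o _ => ?_
    rw [map_mul, map_pow, ht, hφ.constantCoeff]
    ring
  rw [this]
  refine dvd_add (PowerSeries.X_pow_dvd_iff.2 fun l hl => ?_)
    ((pow_dvd_pow _ hM).trans (Dvd.intro _ rfl))
  rw [map_sum]
  simpa only [PowerSeries.coeff_mul_C] using h l hl

theorem eq_prod_X_sub_C_of_isUnit_sub {A ι : Type*} [CommRing A] [IsDomain A] {g : A[X]}
    (hg : g.Monic) {R : Finset ι} (hR : g.natDegree = R.card) (η : ι → A)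
    (hη : ∀ y ∈ R, ∀ z ∈ R, y ≠ z → IsUnit (η y - η z)) (h0 : ∀ y ∈ R, g.eval (η y) = 0) :
    g = ∏ y ∈ R, (X - C (η y)) := by
  refine eq_of_monic_of_dvd_of_natDegree_le (monic_prod_X_sub_C _ _) hg ?_ ?_
  · refine prod_dvd_of_coprime ?_ fun y hy => dvd_iff_isRoot.2 (h0 y hy)
    intro y hy z hz hyz
    exact isCoprime_X_sub_C_of_isUnit_sub (hη y hy z hz hyz)
  · rw [natDegree_prod_of_monic _ _ fun y _ => monic_X_sub_C _]
    simp [hR]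

theorem X_pow_dvd_resultant [IsAlgClosed k] (hf : f.Monic) (Ψ : k[X][X]) {M : ℕ} {S : Finset k}
    (hx : ∀ y, evalEval x₀ y f = 0 → evalEval x₀ y (derivative f) ≠ 0)
    (hS : ∀ y ∈ S, evalEval x₀ y f = 0)
    (hloc : ∀ y, evalEval x₀ y f = 0 → ∃ φ, IsLocal f x₀ y φ ∧
      (y ∈ S → PowerSeries.X ^ M ∣ φ Ψ)) : (X - C x₀) ^ (S.card * M) ∣ resultant f Ψ := by
  set f₀ := f.map (evalRingHom x₀) with hf₀
  have hf₀m : f₀.Monic := hf.map _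
  have hev : ∀ (g : k[X][X]) y, (g.map (evalRingHom x₀)).eval y = evalEval x₀ y g := fun g y =>
    (map_evalRingHom_eval x₀ y g)
  set R := f₀.roots.toFinset with hR
  have hmem : ∀ y, y ∈ R ↔ evalEval x₀ y f = 0 := fun y => by
    rw [hR, Multiset.mem_toFinset, mem_roots hf₀m.ne_zero, IsRoot.def, hev]
  have hcard : R.card = f.natDegree := by
    rw [hR, Multiset.toFinset_card_of_nodup, ← hf.natDegree_map (evalRingHom x₀)]
    · exact (splits_iff_card_roots.1 (IsAlgClosed.splits f₀))
    · rw [Multiset.nodup_iff_count_le_one]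
      intro y
      rw [count_roots]
      by_contra! hlt
      have h2 := (one_lt_rootMultiplicity_iff_isRoot hf₀m.ne_zero).1 hlt
      rw [IsRoot.def, IsRoot.def, hev, hf₀, derivative_map, hev] at h2
      exact hx y h2.1 h2.2
  haveI : Nonempty (k[X][X] →+* PowerSeries k) := ⟨(PowerSeries.C).comp (evalEvalRingHom 0 0)⟩
  choose! φ hφ hφS using hloc
  let T : k[X] →+* PowerSeries k := (Polynomial.coeToPowerSeries.ringHom).comp
    (taylorAlgHom (R := k) x₀ : k[X] →+* k[X])
  have hT : ∀ y, evalEval x₀ y f = 0 → RingHom.comp (φ y) (C : k[X] →+* k[X][X]) = T := fun y hy =>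
    RingHom.ext fun u => (hφ y hy).map_C u
  have hη : ∀ y, evalEval x₀ y f = 0 → ∀ g : k[X][X], (g.map T).eval (φ y X) = φ y g := by
    intro y hy g
    rw [eval_map, ← hT y hy]
    conv_rhs => rw [← eval₂_C_X (p := g), hom_eval₂]
  have hprod : f.map T = ∏ y ∈ R, (X - C (φ y X)) := by
    refine eq_prod_X_sub_C_of_isUnit_sub (hf.map T) (by rw [hf.natDegree_map, hcard]) _ ?_ ?_
    · intro y hy z hz hyz
      rw [PowerSeries.isUnit_iff_constantCoeff, map_sub, (hφ y ((hmem y).1 hy)).constantCoeff,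
        (hφ z ((hmem z).1 hz)).constantCoeff]
      simpa [evalEval, sub_eq_zero] using hyz
    · intro y hy
      rw [hη y ((hmem y).1 hy), (hφ y ((hmem y).1 hy)).map_self]
  have hres : T (resultant f Ψ) = ∏ y ∈ R, φ y Ψ := by
    rw [← resultant_map_map, ← hf.natDegree_map T, hprod, resultant_prod_left]
    · refine prod_congr rfl fun y hy => ?_
      rw [natDegree_X_sub_C, resultant_X_sub_C_left _ _ _ natDegree_map_le, hη y ((hmem y).1 hy)]
    · simp
    · exact natDegree_map_le
  refine X_sub_C_pow_dvd_of_coe_taylor ?_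
  change _ ∣ T (resultant f Ψ)
  rw [hres, mul_comm, pow_mul, ← prod_const]
  have hSR : S ⊆ R := fun y hy => (hmem y).2 (hS y hy)
  exact (prod_dvd_prod_of_dvd _ _ fun y hy => hφS y (hS y hy) hy).trans
    (prod_dvd_prod_of_subset _ _ _ hSR)

/-- A function vanishing to order `M` at each of a set `S` of points of the curve has a norm
of degree at least `M * #S`. -/
theorem card_mul_le_natDegree_resultant [IsAlgClosed k] (hf : f.Monic) {Ψ : k[X][X]}
    (h0 : resultant f Ψ ≠ 0) {M : ℕ} {S : Finset (k × k)}
    (hx : ∀ P ∈ S, ∀ y, evalEval P.1 y f = 0 → evalEval P.1 y (derivative f) ≠ 0)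
    (hS : ∀ P ∈ S, evalEval P.1 P.2 f = 0)
    (hloc : ∀ x y, evalEval x y f = 0 → evalEval x y (derivative f) ≠ 0 →
      ∃ φ, IsLocal f x y φ ∧ ((x, y) ∈ S → PowerSeries.X ^ M ∣ φ Ψ)) :
    S.card * M ≤ (resultant f Ψ).natDegree := by
  set s : k → Finset k := fun x => (S.filter fun P => P.1 = x).image Prod.snd with hs
  have hms : ∀ x y, y ∈ s x ↔ (x, y) ∈ S := fun x y => by simp [hs]
  have hcs : S.card = ∑ x ∈ S.image Prod.fst, (s x).card := by
    rw [card_eq_sum_card_image Prod.fst]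
    refine sum_congr rfl fun x _ => (card_image_of_injOn ?_).symm
    rintro ⟨a, b⟩ ha ⟨a', b'⟩ ha' h
    simp only [coe_filter, Set.mem_setOf_eq] at ha ha' h
    rw [Prod.mk.injEq]; exact ⟨ha.2.trans ha'.2.symm, h⟩
  have hdvd : ∏ x ∈ S.image Prod.fst, (X - C x) ^ ((s x).card * M) ∣ resultant f Ψ := by
    refine prod_dvd_of_coprime ?_ ?_
    · intro x _ y _ hxy
      exact (pairwise_coprime_X_sub_C Function.injective_id hxy).pow
    · intro x hx'
      obtain ⟨P, hP, rfl⟩ := mem_image.1 hx'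
      refine X_pow_dvd_resultant hf Ψ (hx P hP) (fun y hy => hS _ ((hms _ _).1 hy)) ?_
      intro y hy
      obtain ⟨φ, h1, h2⟩ := hloc P.1 y hy (hx P hP y hy)
      exact ⟨φ, h1, fun h => h2 ((hms _ _).1 h)⟩
  have := natDegree_le_of_dvd hdvd h0
  rw [natDegree_prod_of_monic _ _ fun x _ => (monic_X_sub_C x).pow _] at this
  simpa [hcs, sum_mul] using this

end

section

/-- The filtration of a polynomial ring by the filtration of the coefficients. -/
def Filt.coeffs {A : Type*} [CommRing A] (F : Filt A) : Filt A[X] where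
  S a :=
    { carrier := {u | ∀ i, u.coeff i ∈ F.S a}
      zero_mem' := fun i => by simp
      add_mem' := fun hu hv i => by rw [coeff_add]; exact add_mem (hu i) (hv i)
      neg_mem' := fun hu i => by rw [coeff_neg]; exact neg_mem (hu i) }
  mono h _ hu i := F.mono h (hu i)
  one_mem i := by
    rw [coeff_one]; split_ifs
    · exact F.one_mem
    · exact zero_mem _
  mul_mem hx hy i := by rw [coeff_mul]; exact sum_mem fun p _ => F.mul_mem (hx _) (hy _)
  neg ha hx := by
    ext i
    rw [coeff_zero]
    exact F.neg ha (hx i)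

/-- The filtration of bivariate polynomials by the degree in the first variable. -/
noncomputable abbrev xdeg (k : Type*) [CommRing k] : Filt k[X][X] := (Filt.trivial k).poly.coeffs

theorem mem_xdeg {k : Type*} [CommRing k] {a : ℕ} {u : k[X][X]} :
    u ∈ (xdeg k).S a ↔ ∀ i, (u.coeff i).natDegree ≤ a :=
  forall_congr' fun _ => Filt.mem_poly_trivial

theorem mem_bideg {k : Type*} [CommRing k] {a : ℕ} {u : k[X][X]} :
    u ∈ (bideg k).S a ↔ (∀ i, (u.coeff i).natDegree ≤ a) ∧ u.natDegree ≤ a := by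
  constructor
  · intro h
    exact ⟨fun i => Filt.mem_poly_trivial.1 (h.1 i),
      natDegree_le_iff_coeff_eq_zero.2 fun i hi => h.2 i (by exact_mod_cast hi)⟩
  · intro h
    exact ⟨fun i => Filt.mem_poly_trivial.2 (h.1 i), fun i hi =>
      natDegree_le_iff_coeff_eq_zero.1 h.2 i (by exact_mod_cast hi)⟩

variable {k : Type*} [Field k]

/-- Evaluation of trivariate polynomials. -/
noncomputable def ev3 (x y z : k) : k[X][X][X] →+* k := eval₂RingHom (evalEvalRingHom x y) z

theorem ev3_eq (x y z : k) (g : k[X][X][X]) : ev3 x y z g = eval₂ (evalEvalRingHom x y) z g := rfl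

theorem evalEval_eq_sum {u : k[X][X]} {D L : ℕ} (hD : u.natDegree < D)
    (hL : ∀ i, (u.coeff i).natDegree < L) (x y : k) :
    evalEval x y u = ∑ j : Fin D, ∑ s : Fin L, (u.coeff j).coeff s * x ^ (s : ℕ) * y ^ (j : ℕ) := by
  have h1 : evalEval x y u = eval₂ (evalRingHom x) y u := by rw [← map_evalRingHom_eval, eval_map]
  rw [h1, eval₂_eq_sum_range' _ hD, ← Fin.sum_univ_eq_sum_range]
  refine sum_congr rfl fun j _ => ?_
  rw [coe_evalRingHom, eval_eq_sum_range' (hL _), ← Fin.sum_univ_eq_sum_range, sum_mul]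

/-- Reduction of a function on the graph-like surface `f = H = 0` to a normal form. -/
theorem exists_reduction {f : k[X][X]} {n : ℕ} (hf : f.Monic) (hD : f.natDegree ≠ 0)
    (hfn : f ∈ (bideg k).S n) {H : k[X][X][X]} (hH : H.Monic) (hHn : ∀ i, H.coeff i ∈ (bideg k).S n)
    {c : k[X][X]} {A B : ℕ} (hcA : ∀ m, (c.coeff m).natDegree ≤ A) (hcB : c.natDegree ≤ B)
    {j : ℕ} (hj : j < n) :
    ∃ κ : Fin H.natDegree → Fin f.natDegree → Fin (A + n * n + n * (B + n * n + 1) + 1) → k,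
      ∀ x y z, evalEval x y f = 0 → ev3 x y z H = 0 → evalEval x y c * z ^ j =
        ∑ i, ∑ j, ∑ s, κ i j s * x ^ (s : ℕ) * y ^ (j : ℕ) * z ^ (i : ℕ) := by
  set R : k[X][X][X] := X ^ j %ₘ H with hR
  have hRm : ∀ i, R.coeff i ∈ (bideg k).S ((n * n : ℕ) : ℤ) := fun i => by
    have := (bideg k).modByMonic_mem hH (u := X ^ j) (B := 0) (h := n) (by positivity) hHn (j + 1)
      (by rw [degree_X_pow]; exact_mod_cast Nat.lt_succ_self j) (fun i => by
        rw [coeff_X_pow]; split_ifs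
        · exact (bideg k).one_mem
        · exact zero_mem _) i
    refine (bideg k).mono ?_ this
    push_cast
    nlinarith
  have hcR1 : ∀ i m, ((c * R.coeff i).coeff m).natDegree ≤ A + n * n := fun i => by
    have h1 : c ∈ (xdeg k).S A := mem_xdeg.2 hcA
    have h2 : R.coeff i ∈ (xdeg k).S ((n * n : ℕ) : ℤ) := mem_xdeg.2 (mem_bideg.1 (hRm i)).1
    have := (xdeg k).mul_mem h1 h2
    exact mem_xdeg.1 (by exact_mod_cast this)
  have hcR2 : ∀ i, (c * R.coeff i).natDegree ≤ B + n * n := fun i =>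
    natDegree_mul_le.trans (add_le_add hcB (mem_bideg.1 (hRm i)).2)
  have hg1 : ∀ i m, (((c * R.coeff i) %ₘ f).coeff m).natDegree <
      A + n * n + n * (B + n * n + 1) + 1 := fun i m => by
    have := (Filt.trivial k).poly.modByMonic_mem hf (u := c * R.coeff i) (B := (A + n * n : ℕ))
      (h := n) (by positivity) (fun i => Filt.mem_poly_trivial.2 ((mem_bideg.1 hfn).1 i))
      (B + n * n + 1) (degree_le_natDegree.trans_lt (by
        have := hcR2 i
        exact_mod_cast Nat.lt_succ_of_le this))
      (fun m => Filt.mem_poly_trivial.2 (hcR1 i m)) m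
    exact Nat.lt_succ_of_le (Filt.mem_poly_trivial.1 (by exact_mod_cast this))
  have hg2 : ∀ i, ((c * R.coeff i) %ₘ f).natDegree < f.natDegree := fun i =>
    natDegree_modByMonic_lt _ hf (fun h => hD (by rw [h, natDegree_one]))
  refine ⟨fun i m s => (((c * R.coeff i) %ₘ f).coeff m).coeff s, fun x y z hfx hHx => ?_⟩
  have e1 : z ^ j = ∑ i : Fin H.natDegree, evalEval x y (R.coeff i) * z ^ (i : ℕ) := by
    have h1 : ev3 x y z (X ^ j) = ev3 x y z R := by
      conv_lhs => rw [← modByMonic_add_div (X ^ j) H, map_add, map_mul, hHx, zero_mul, add_zero]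
    have h2 : ev3 x y z (X ^ j) = z ^ j := by simp [ev3]
    by_cases h1' : H = 1
    · rw [h1', map_one] at hHx
      exact absurd hHx one_ne_zero
    rw [← h2, h1, ev3_eq, eval₂_eq_sum_range' _ (natDegree_modByMonic_lt _ hH h1'),
      ← Fin.sum_univ_eq_sum_range (fun i => (evalEvalRingHom x y) (R.coeff i) * z ^ i)]
    rfl
  have e2 : ∀ i, evalEval x y (c * R.coeff i) = evalEval x y ((c * R.coeff i) %ₘ f) := fun i => by
    have := congrArg (evalEvalRingHom x y) (modByMonic_add_div (c * R.coeff i) f)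
    rw [map_add, map_mul] at this
    simp only [coe_evalEvalRingHom, hfx, zero_mul, add_zero] at this
    exact this.symm
  rw [e1, mul_sum]
  refine sum_congr rfl fun i _ => ?_
  rw [← mul_assoc, ← evalEval_mul, e2, evalEval_eq_sum (hg2 i) (hg1 i), sum_mul]
  refine sum_congr rfl fun m _ => ?_
  rw [sum_mul]

theorem exists_ne_zero_sum_eq_zero {T I : Type*} [Fintype T] [Fintype I]
    (h : card I < card T) (v : T → I → k) :
    ∃ μ : T → k, μ ≠ 0 ∧ ∀ i, ∑ t, μ t * v t i = 0 := by
  let L : (T → k) →ₗ[k] (I → k) := (Matrix.of v).vecMulLinear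
  have := LinearMap.ker_ne_bot_of_finrank_lt (f := L) (by simpa using h)
  obtain ⟨μ, hμ, h0⟩ := Submodule.exists_mem_ne_zero_of_ne_bot this
  exact ⟨μ, h0, fun i => congrFun hμ i⟩

/-- The bivariate polynomial with given coefficients. -/
noncomputable def ofCoeffs {a D : ℕ} (c : Fin a × Fin D → k) : k[X][X] :=
  ∑ o, C (C (c o)) * (C X ^ (o.1 : ℕ) * X ^ (o.2 : ℕ))

theorem coeff_ofCoeffs {a D : ℕ} (c : Fin a × Fin D → k) (i j : ℕ) :
    ((ofCoeffs c).coeff j).coeff i = if h : i < a ∧ j < D then c (⟨i, h.1⟩, ⟨j, h.2⟩) else 0 := by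
  have : ∀ o : Fin a × Fin D, ((C (C (c o)) * (C X ^ (o.1 : ℕ) * X ^ (o.2 : ℕ))).coeff j).coeff i =
      if j = o.2 then (if i = o.1 then c o else 0) else 0 := fun o => by
    rw [← map_pow, ← mul_assoc, ← map_mul, coeff_C_mul_X_pow]
    split_ifs with h1 h2 <;> simp_all [coeff_X_pow]
  rw [ofCoeffs, finset_sum_coeff, finset_sum_coeff]
  simp only [this]
  split_ifs with h
  · rw [sum_eq_single (⟨i, h.1⟩, ⟨j, h.2⟩)]
    · simp
    · rintro ⟨⟨a1, b1⟩, ⟨a2, b2⟩⟩ _ hne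
      split_ifs with h1 h2
      · simp_all
      · rfl
      · rfl
    · simp
  · refine sum_eq_zero fun o _ => ?_
    split_ifs with h1 h2
    · exact absurd ⟨h2 ▸ o.1.2, h1 ▸ o.2.2⟩ h
    · rfl
    · rfl

theorem natDegree_coeff_ofCoeffs_le {a D : ℕ} (c : Fin a × Fin D → k) (j : ℕ) :
    ((ofCoeffs c).coeff j).natDegree ≤ a :=
  natDegree_le_iff_coeff_eq_zero.2 fun i hi => by rw [coeff_ofCoeffs, dif_neg]; omega

theorem natDegree_ofCoeffs_lt {a D : ℕ} (hD : 0 < D) (c : Fin a × Fin D → k) :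
    (ofCoeffs c).natDegree < D := by
  refine (Nat.le_sub_one_iff_lt hD).1 (natDegree_le_iff_coeff_eq_zero.2 fun j hj => ?_)
  ext i
  rw [coeff_ofCoeffs, dif_neg, coeff_zero]; omega

theorem ofCoeffs_ne_zero {a D : ℕ} {c : Fin a × Fin D → k} (hc : c ≠ 0) : ofCoeffs c ≠ 0 := by
  intro h
  apply hc
  ext o
  have := coeff_ofCoeffs c o.1 o.2
  rw [dif_pos ⟨o.1.2, o.2.2⟩, h] at this
  simpa using this.symm

theorem evalEval_ofCoeffs {a D : ℕ} (c : Fin a × Fin D → k) (x y : k) :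
    evalEval x y (ofCoeffs c) = ∑ o, c o * (x ^ (o.1 : ℕ) * y ^ (o.2 : ℕ)) := by
  rw [← coe_evalEvalRingHom, ofCoeffs, map_sum]
  simp [evalEval]

end

section

variable {k : Type*} [Field k]

/-- The linear system whose solution gives the auxiliary function. -/
theorem exists_solution {f : k[X][X]} {n : ℕ} (hf : f.Monic) (hD : f.natDegree ≠ 0)
    (hfn : f ∈ (bideg k).S n) {H : k[X][X][X]} (hH : H.Monic) (hHn : ∀ i, H.coeff i ∈ (bideg k).S n)
    {Z : PowerSeries k[X][X]} (hZ : Z ∈ (bideg k).ps (4 * n) (-(2 * n))) {a b M : ℕ}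
    (hlin : M * H.natDegree * f.natDegree * (a + b + 8 * n ^ 2 * M + 8 * n ^ 3) <
      a * f.natDegree * (b * f.natDegree)) :
    ∃ μ : (Fin a × Fin f.natDegree) × (Fin b × Fin f.natDegree) → k, μ ≠ 0 ∧
      ∀ l < M, ∀ x y z, evalEval x y f = 0 → ev3 x y z H = 0 →
        ∑ t, μ t * (evalEval x y (PowerSeries.coeff l (expand (derivative f) Z
          (C X ^ (t.1.1 : ℕ) * X ^ (t.1.2 : ℕ)))) * (x ^ (t.2.1 : ℕ) * z ^ (t.2.2 : ℕ))) = 0 := by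
  have hDn : f.natDegree ≤ n := (mem_bideg.1 hfn).2
  have hn : 0 < n := by omega
  have he : derivative f ∈ (bideg k).S (2 * n) := by rw [← dd_zero_one]; exact dd_mem hfn 0 1
  set A := a + (4 * n * M + n) + b with hA
  set B := 4 * n * M + n with hB
  set L := A + n * n + n * (B + n * n + 1) + 1 with hL
  have hLle : L ≤ a + b + 8 * n ^ 2 * M + 8 * n ^ 3 := by
    have h1 : n * 1 ≤ n * n := Nat.mul_le_mul_left _ hn
    have h2 : n * n * 1 ≤ n * n * n := Nat.mul_le_mul_left _ hn
    have h3 : n * M ≤ n * n * M := Nat.mul_le_mul_right _ (by omega)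
    simp only [hL, hA, hB]
    nlinarith
  have hred : ∀ (t : (Fin a × Fin f.natDegree) × (Fin b × Fin f.natDegree)) (l : Fin M),
      ∃ κ : Fin H.natDegree → Fin f.natDegree → Fin L → k,
      ∀ x y z, evalEval x y f = 0 → ev3 x y z H = 0 →
        evalEval x y (PowerSeries.coeff l (expand (derivative f) Z
          (C X ^ (t.1.1 : ℕ) * X ^ (t.1.2 : ℕ)))) * (x ^ (t.2.1 : ℕ) * z ^ (t.2.2 : ℕ)) =
        ∑ i, ∑ j, ∑ s, κ i j s * x ^ (s : ℕ) * y ^ (j : ℕ) * z ^ (i : ℕ) := by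
    intro t l
    obtain ⟨c, hc⟩ : ∃ c, c = PowerSeries.coeff l (expand (derivative f) Z
          (C X ^ (t.1.1 : ℕ) * X ^ (t.1.2 : ℕ))) := ⟨_, rfl⟩
    have hm := expand_monomial_mem he hZ t.1.1 t.1.2 l
    rw [← hc] at hm ⊢
    have hl : 4 * n * l + t.1.2 ≤ B := by
      have h1 : 4 * n * l ≤ 4 * n * M := Nat.mul_le_mul_left _ l.2.le
      have h2 := t.1.2.2
      omega
    obtain ⟨κ, hκ⟩ := exists_reduction hf hD hfn hH hHn (c := c * C (X ^ (t.2.1 : ℕ))) (A := A)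
      (B := B) (j := t.2.2) (fun m => by
        rw [coeff_mul_C]
        refine natDegree_mul_le.trans (add_le_add ((hm m).1.trans ?_)
          ((natDegree_X_pow_le _).trans t.2.1.2.le))
        have := t.1.1.2
        omega) (by
        refine natDegree_mul_C_le _ _ |>.trans (natDegree_le_iff_coeff_eq_zero.2 fun m hm' => ?_)
        exact (hm m).2 (by omega)) (t.2.2.2.trans_le hDn)
    refine ⟨κ, fun x y z h1 h2 => ?_⟩
    rw [← hκ x y z h1 h2, evalEval_mul]
    simp [evalEval, mul_assoc]
  choose κ hκ using hred
  obtain ⟨μ, hμ, h0⟩ := exists_ne_zero_sum_eq_zero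
    (I := Fin M × Fin H.natDegree × Fin f.natDegree × Fin L) (by
      simp only [Fintype.card_prod, Fintype.card_fin]
      refine lt_of_le_of_lt ?_ hlin
      calc M * (H.natDegree * (f.natDegree * L)) = M * H.natDegree * f.natDegree * L := by ring
        _ ≤ _ := Nat.mul_le_mul_left _ hLle)
    (fun t i => κ t i.1 i.2.1 i.2.2.1 i.2.2.2)
  refine ⟨μ, hμ, fun l hl x y z h1 h2 => ?_⟩
  have : ∀ t : (Fin a × Fin f.natDegree) × (Fin b × Fin f.natDegree),
      μ t * (evalEval x y (PowerSeries.coeff l (expand (derivative f) Z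
        (C X ^ (t.1.1 : ℕ) * X ^ (t.1.2 : ℕ)))) * (x ^ (t.2.1 : ℕ) * z ^ (t.2.2 : ℕ))) =
      ∑ i, ∑ j, ∑ s, (μ t * κ t ⟨l, hl⟩ i j s) * (x ^ (s : ℕ) * y ^ (j : ℕ) * z ^ (i : ℕ)) :=
      fun t => by
    rw [hκ t ⟨l, hl⟩ x y z h1 h2]
    simp only [mul_sum, mul_assoc]
  rw [sum_congr rfl fun t _ => this t, sum_comm]
  refine sum_eq_zero fun i _ => ?_
  rw [sum_comm]
  refine sum_eq_zero fun j _ => ?_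
  rw [sum_comm]
  refine sum_eq_zero fun s _ => ?_
  rw [← sum_mul, h0 (⟨l, hl⟩, i, j, s), zero_mul]

/-- Stepanov's method: points `(x, y)` of an irreducible curve with `x ^ q = x` such that
`(x, y, y ^ q)` lies on a given surface are few. -/
theorem card_mul_le [IsAlgClosed k] {p : ℕ} [Fact p.Prime] [CharP k p] {r : ℕ}
    {f : k[X][X]} {n : ℕ} (hf : f.Monic) (hi : Irreducible f) (hD : f.natDegree ≠ 0)
    (hfn : f ∈ (bideg k).S n) {H : k[X][X][X]} (hH : H.Monic) (hHn : ∀ i, H.coeff i ∈ (bideg k).S n)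
    {a b M : ℕ} (hM : M ≤ p ^ r) (haq : f.natDegree * (a + n) < p ^ r)
    (hlin : M * H.natDegree * f.natDegree * (a + b + 8 * n ^ 2 * M + 8 * n ^ 3) <
      a * f.natDegree * (b * f.natDegree))
    {S : Finset (k × k)} (hS : ∀ P ∈ S, P.1 ^ p ^ r = P.1 ∧ evalEval P.1 P.2 f = 0 ∧
      (∀ y, evalEval P.1 y f = 0 → evalEval P.1 y (derivative f) ≠ 0) ∧
      ev3 P.1 P.2 (P.2 ^ p ^ r) H = 0) :
    S.card * M ≤ f.natDegree * (a + p ^ r * b) + n * (f.natDegree * (1 + p ^ r)) := by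
  rcases S.eq_empty_or_nonempty with rfl | ⟨P₁, hP₁⟩
  · simp
  have hDn : f.natDegree ≤ n := (mem_bideg.1 hfn).2
  have hn : 0 < n := by omega
  obtain ⟨Z, hZ, hZf⟩ := exists_expand f n hn hfn
  obtain ⟨μ, hμ, h0⟩ := exists_solution hf hD hfn hH hHn hZ hlin
  have hroot : ∀ t, ∃ c : k, c ^ p ^ r = μ t := fun t =>
    IsAlgClosed.exists_pow_nat_eq _ (pow_pos (Fact.out : p.Prime).pos r)
  choose c hc using hroot
  set u : Fin a × Fin f.natDegree → k[X][X] := fun o => C X ^ (o.1 : ℕ) * X ^ (o.2 : ℕ) with hu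
  set w : Fin a × Fin f.natDegree → k[X][X] := fun o => ofCoeffs (fun s => c (o, s)) with hw
  have hnd : ∀ {a' : ℕ} {c' : Fin a' × Fin f.natDegree → k}, c' ≠ 0 → ¬ f ∣ ofCoeffs c' :=
    fun hc' => not_dvd_of_natDegree_lt hf (ofCoeffs_ne_zero hc')
      (natDegree_ofCoeffs_lt (Nat.pos_of_ne_zero hD) _)
  have hevw : ∀ x y, x ^ p ^ r = x → ∀ o, evalEval x y (w o) ^ p ^ r =
      ∑ s : Fin b × Fin f.natDegree, μ (o, s) * (x ^ (s.1 : ℕ) * (y ^ p ^ r) ^ (s.2 : ℕ)) :=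
    fun x y hx o => by
      rw [hw, evalEval_ofCoeffs, sum_pow_char_pow]
      refine sum_congr rfl fun s _ => ?_
      rw [mul_pow, mul_pow, hc, ← pow_mul, mul_comm (s.1 : ℕ), pow_mul, hx, ← pow_mul, ← pow_mul,
        mul_comm (s.2 : ℕ)]
  have hloc : ∀ x y, evalEval x y f = 0 → evalEval x y (derivative f) ≠ 0 → ∃ φ, IsLocal f x y φ ∧
        ((x, y) ∈ S → PowerSeries.X ^ M ∣ φ (∑ o, u o * w o ^ p ^ r)) := by
    intro x y h1 h2
    obtain ⟨φ, hφ, hcoef⟩ := exists_isLocal hn hZ hZf h1 h2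
    refine ⟨φ, hφ, fun hmem => hφ.X_pow_dvd_sum_mul_pow hM u w fun l hl => ?_⟩
    obtain ⟨h3, -, -, h4⟩ := hS _ hmem
    have h5 := h0 l hl x y _ h1 h4
    rw [Fintype.sum_prod_type] at h5
    simp only [hcoef, hevw x y h3]
    rw [← mul_zero ((evalEval x y (derivative f))⁻¹ ^ (2 * l)), ← h5, mul_sum]
    refine sum_congr rfl fun o _ => ?_
    rw [mul_assoc]
    congr 1
    rw [mul_sum]
    refine sum_congr rfl fun s _ => ?_
    simp only [hu]
    ring
  have hΨ : ¬ f ∣ ∑ o, u o * w o ^ p ^ r := by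
    obtain ⟨-, h1, h2, -⟩ := hS _ hP₁
    obtain ⟨φ, hφ, -⟩ := hloc _ _ h1 (h2 _ h1)
    intro hdvd
    refine hφ.sum_mul_pow_ne_zero hf hi hD u w ?_ (fun c' hc' => hnd hc') (fun c' => ?_)
      (r := r) (p := p) ?_
    · by_contra! hall
      apply hμ
      ext ⟨o, s⟩
      by_contra hne
      refine hnd (c' := fun s => c (o, s)) (fun h => hne ?_) (hall o)
      rw [← hc, show c (o, s) = 0 from congrFun h s,
        zero_pow (pow_pos (Fact.out : p.Prime).pos r).ne']
      rfl
    · refine lt_of_le_of_lt (natDegree_resultant_le f (ofCoeffs c') _ _ n a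
        (mem_bideg.1 hfn).1 (natDegree_coeff_ofCoeffs_le _)) (lt_of_le_of_lt ?_ haq)
      have := natDegree_ofCoeffs_lt (Nat.pos_of_ne_zero hD) c'
      rw [mul_add]
      exact Nat.add_le_add_left (Nat.mul_le_mul_right _ this.le) _
    · obtain ⟨g, hg⟩ := hdvd
      rw [hg, map_mul, hφ.map_self, zero_mul]
  refine (card_mul_le_natDegree_resultant hf (resultant_ne_zero_of_not_dvd hf hi hΨ)
    (fun P hP => (hS P hP).2.2.1) (fun P hP => (hS P hP).2.1) hloc).trans ?_
  have hd1 : (∑ o, u o * w o ^ p ^ r).natDegree ≤ f.natDegree * (1 + p ^ r) := by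
    refine natDegree_sum_le_of_forall_le _ _ fun o _ => ?_
    have h1 : (u o).natDegree ≤ f.natDegree := by
      simp only [hu, ← map_pow]
      exact (natDegree_C_mul_X_pow_le _ _).trans o.2.2.le
    have h2 := natDegree_ofCoeffs_lt (Nat.pos_of_ne_zero hD) (fun s => c (o, s))
    refine natDegree_mul_le.trans ?_
    rw [mul_add, mul_one]
    refine add_le_add h1 (natDegree_pow_le.trans ?_)
    rw [mul_comm]
    exact Nat.mul_le_mul_right _ h2.le
  have hd2 : ∀ i, ((∑ o, u o * w o ^ p ^ r).coeff i).natDegree ≤ a + p ^ r * b := by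
    rw [← mem_xdeg]
    refine sum_mem fun o _ => ?_
    push_cast
    refine (xdeg k).mul_mem (mem_xdeg.2 fun i => ?_)
      ((by push_cast; rfl : ((p ^ r : ℕ) : ℤ) * b = (p : ℤ) ^ r * b) ▸
      (xdeg k).pow_mem (mem_xdeg.2 (natDegree_coeff_ofCoeffs_le _)) (p ^ r))
    simp only [hu, ← map_pow]
    rw [coeff_C_mul_X_pow]
    split_ifs
    · exact (natDegree_X_pow_le _).trans o.1.2.le
    · simp
  refine (natDegree_resultant_le f _ _ _ n _ (mem_bideg.1 hfn).1 hd2).trans ?_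
  rw [mul_comm n]
  exact Nat.add_le_add_left (Nat.mul_le_mul_right _ hd1) _

/-- The choice of parameters in Stepanov's method. -/
theorem stepanov_parameters {n D d q : ℕ} (hD : 0 < D) (hDn : D ≤ n) (hd : d ≤ n)
    (hq : (100 * n ^ 2) ^ 2 ≤ q) :
    D * ((q - 1) / D - n + n) < q ∧ D * q.sqrt ≤ q ∧
      D * q.sqrt * d * D * ((q - 1) / D - n + (d * q.sqrt + 40 * n ^ 5) +
        8 * n ^ 2 * (D * q.sqrt) + 8 * n ^ 3) <
      ((q - 1) / D - n) * D * ((d * q.sqrt + 40 * n ^ 5) * D) := by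
  have hn : 0 < n := by omega
  have hq0 : 0 < q := lt_of_lt_of_le (by positivity) hq
  set s := q.sqrt with hs
  have hs1 : 100 * n ^ 2 ≤ s := Nat.le_sqrt.2 (by rw [← pow_two]; exact hq)
  have hs2 : s * s ≤ q := Nat.sqrt_le q
  have hnn : n ≤ n ^ 2 := Nat.le_self_pow (by norm_num) n
  obtain ⟨t, ht⟩ : ∃ t, t = (q - 1) / D := ⟨_, rfl⟩
  have h1 : D * t ≤ q - 1 := ht ▸ Nat.mul_div_le _ _
  have h2 : q ≤ D * t + D := by
    have := Nat.lt_mul_div_succ (q - 1) hD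
    rw [← ht, mul_add, mul_one] at this
    omega
  rw [← ht]
  have hq3 : 100 * n ^ 2 * (100 * n ^ 2) ≤ q := (Nat.mul_le_mul hs1 hs1).trans hs2
  have hn2 : 1 ≤ n ^ 2 := Nat.one_le_pow _ _ hn
  have hq4 : 100 * n ^ 2 ≤ q := (Nat.le_mul_of_pos_right _ (by positivity)).trans hq3
  have htn : n ≤ t := by
    by_contra! hlt
    have : D * t + D ≤ D * n := by rw [← Nat.mul_succ]; exact Nat.mul_le_mul_left _ hlt
    have h5 : D * n ≤ n * n := Nat.mul_le_mul_right _ hDn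
    nlinarith
  obtain ⟨a, rfl⟩ := Nat.exists_eq_add_of_le' htn
  rw [Nat.add_sub_cancel]
  have ha : q ≤ 2 * (D * a) := by
    have h5 : D * n ≤ n * n := Nat.mul_le_mul_right _ hDn
    nlinarith
  refine ⟨by omega, ?_, ?_⟩
  · exact (Nat.mul_le_mul_right _ (hDn.trans (hnn.trans (by omega)))).trans hs2
  · have ha' : q ≤ 2 * n * a := by nlinarith
    have key : s * d * (d * s + 40 * n ^ 5 + 8 * n ^ 2 * (D * s) + 8 * n ^ 3) <
        a * (40 * n ^ 5) := by
      have e1 : d * s + 40 * n ^ 5 + 8 * n ^ 2 * (D * s) + 8 * n ^ 3 ≤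
          9 * n ^ 3 * s + 48 * n ^ 5 := by
        have f1 : d * s ≤ n ^ 3 * s := Nat.mul_le_mul_right _ (hd.trans
          (Nat.le_self_pow (by norm_num) n))
        have f2 : n ^ 2 * (D * s) ≤ n ^ 2 * (n * s) :=
          Nat.mul_le_mul_left _ (Nat.mul_le_mul_right _ hDn)
        have f3 : n ^ 3 ≤ n ^ 5 := Nat.pow_le_pow_right hn (by norm_num)
        nlinarith
      have e2 : s * d * (d * s + 40 * n ^ 5 + 8 * n ^ 2 * (D * s) + 8 * n ^ 3) ≤
          s * n * (9 * n ^ 3 * s + 48 * n ^ 5) :=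
        Nat.mul_le_mul (Nat.mul_le_mul_left _ hd) e1
      have e3 : s * n * (9 * n ^ 3 * s + 48 * n ^ 5) ≤ 10 * n ^ 4 * (s * s) := by
        have : 48 * n ^ 6 * s ≤ n ^ 4 * s * s := by
          calc 48 * n ^ 6 * s = n ^ 4 * s * (48 * n ^ 2) := by ring
            _ ≤ n ^ 4 * s * s := Nat.mul_le_mul_left _ (by omega)
        nlinarith
      have e4 : 10 * n ^ 4 * (s * s) ≤ 10 * n ^ 4 * q := Nat.mul_le_mul_left _ hs2
      have e5 : 10 * n ^ 4 * q < 20 * n ^ 4 * q :=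
        Nat.mul_lt_mul_of_pos_right (Nat.mul_lt_mul_of_pos_right (by norm_num) (by positivity)) hq0
      have e6 : 20 * n ^ 4 * q ≤ 20 * n ^ 4 * (2 * n * a) := Nat.mul_le_mul_left _ ha'
      have e7 : 20 * n ^ 4 * (2 * n * a) = a * (40 * n ^ 5) := by ring
      omega
    have hDD : 0 < D * D := by positivity
    have := Nat.mul_lt_mul_of_pos_left key hDD
    nlinarith

theorem card_le [IsAlgClosed k] {p : ℕ} [Fact p.Prime] [CharP k p] {r : ℕ}
    {f : k[X][X]} {n : ℕ} (hf : f.Monic) (hi : Irreducible f) (hD : f.natDegree ≠ 0)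
    (hfn : f ∈ (bideg k).S n) {H : k[X][X][X]} (hH : H.Monic) (hHn : ∀ i, H.coeff i ∈ (bideg k).S n)
    (hHd : H.natDegree ≤ n) (hq : (100 * n ^ 2) ^ 2 ≤ p ^ r)
    {S : Finset (k × k)} (hS : ∀ P ∈ S, P.1 ^ p ^ r = P.1 ∧ evalEval P.1 P.2 f = 0 ∧
      (∀ y, evalEval P.1 y f = 0 → evalEval P.1 y (derivative f) ≠ 0) ∧
      ev3 P.1 P.2 (P.2 ^ p ^ r) H = 0) :
    S.card ≤ H.natDegree * p ^ r + 200 * n ^ 5 * (p ^ r).sqrt := by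
  have hDn : f.natDegree ≤ n := (mem_bideg.1 hfn).2
  have hn : 0 < n := by omega
  obtain ⟨h1, h2, h3⟩ := stepanov_parameters (Nat.pos_of_ne_zero hD) hDn hHd hq
  have h := card_mul_le hf hi hD hfn hH hHn h2 h1 h3 hS
  obtain ⟨q, hqe⟩ : ∃ q, q = p ^ r := ⟨_, rfl⟩
  rw [← hqe] at hq h ⊢
  obtain ⟨s, hs⟩ : ∃ s, s = q.sqrt := ⟨_, rfl⟩
  have hs1 : 100 * n ^ 2 ≤ s := by rw [hs]; exact Nat.le_sqrt.2 (by rw [← pow_two]; exact hq)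
  have hs2 : q ≤ s * s + s + s := by rw [hs]; exact Nat.sqrt_le_add q
  have hn2 : 1 ≤ n ^ 2 := Nat.one_le_pow _ _ hn
  rw [← hs] at h ⊢
  have ha : (q - 1) / f.natDegree - n ≤ q :=
    (Nat.sub_le _ _).trans ((Nat.div_le_self _ _).trans (Nat.sub_le _ _))
  have h5 : S.card * s ≤ q + q * (H.natDegree * s + 40 * n ^ 5) + n * (1 + q) := by
    refine Nat.le_of_mul_le_mul_left ?_ (Nat.pos_of_ne_zero hD)
    calc f.natDegree * (S.card * s) = S.card * (f.natDegree * s) := by ring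
      _ ≤ _ := h
      _ = f.natDegree * ((q - 1) / f.natDegree - n + q * (H.natDegree * s + 40 * n ^ 5) +
          n * (1 + q)) := by ring
      _ ≤ _ := Nat.mul_le_mul_left _ (by omega)
  have hq0 : 1 ≤ q := le_trans (Nat.one_le_pow _ _ (by positivity)) hq
  have hn5 : n ≤ n ^ 5 := Nat.le_self_pow (by norm_num) n
  have hn51 : 1 ≤ n ^ 5 := Nat.one_le_pow _ _ hn
  have h6 : S.card * s ≤ (H.natDegree * q + 200 * n ^ 5 * s) * s := by
    have e1 : q + q * (H.natDegree * s + 40 * n ^ 5) + n * (1 + q) ≤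
        H.natDegree * q * s + 43 * n ^ 5 * q := by
      have : n * (1 + q) ≤ n ^ 5 * (2 * q) := Nat.mul_le_mul hn5 (by omega)
      nlinarith
    have e2 : 43 * n ^ 5 * q ≤ 43 * n ^ 5 * (3 * (s * s)) := Nat.mul_le_mul_left _ (by nlinarith)
    nlinarith
  exact Nat.le_of_mul_le_mul_right h6 (by omega)

end

section

/-- Base change of bivariate polynomials. -/
noncomputable def bmap {K k : Type*} [CommRing K] [CommRing k] (φ : K →+* k) : K[X][X] →+* k[X][X] :=
  mapRingHom (mapRingHom φ)

section bmap

variable {K k : Type*} [CommRing K] [CommRing k] (φ : K →+* k)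

theorem bmap_apply (F : K[X][X]) : bmap φ F = F.map (mapRingHom φ) := rfl

theorem evalEval_bmap (F : K[X][X]) (x y : K) :
    evalEval (φ x) (φ y) (bmap φ F) = φ (evalEval x y F) :=
  map_mapRingHom_evalEval φ F x y

theorem derivative_bmap (F : K[X][X]) : derivative (bmap φ F) = bmap φ (derivative F) :=
  derivative_map _ _

theorem coeff_coeff_bmap (F : K[X][X]) (i j : ℕ) :
    ((bmap φ F).coeff i).coeff j = φ ((F.coeff i).coeff j) := by
  simp [bmap_apply]

theorem bmap_injective (hφ : Injective φ) : Injective (bmap φ) :=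
  map_injective _ (map_injective _ hφ)

theorem bmap_mem {F : K[X][X]} {n : ℕ} (h : F ∈ (bideg K).S n) : bmap φ F ∈ (bideg k).S n := by
  rw [mem_bideg] at h ⊢
  refine ⟨fun i => ?_, natDegree_map_le.trans h.2⟩
  rw [bmap_apply, coeff_map]
  exact natDegree_map_le.trans (h.1 i)

end bmap

variable {k : Type*} [Field k]

theorem eval_resultant_eq_zero {f g : k[X][X]} (hf : f.natDegree ≠ 0) {x y : k}
    (h1 : evalEval x y f = 0) (h2 : evalEval x y g = 0) : (resultant f g).eval x = 0 := by
  obtain ⟨a, b, hab⟩ := resultant_mem f g hf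
  have := congrArg (evalEval x y) hab
  rw [evalEval_add, evalEval_mul, evalEval_mul, h1, h2, zero_mul, zero_mul, add_zero] at this
  rw [← evalEval_C x y, this]

theorem card_filter_eval_eq_zero_le [Fintype k] {u : k[X]} (hu : u ≠ 0) :
    (univ.filter fun x => u.eval x = 0).card ≤ u.natDegree := by
  refine le_trans (card_le_card fun x hx => ?_)
    ((Multiset.toFinset_card_le u.roots).trans (card_roots' u))
  rw [Multiset.mem_toFinset, mem_roots hu]
  exact (mem_filter.1 hx).2

theorem natDegree_resultant_le_sq {f g : k[X][X]} {n m : ℕ} (hf : f ∈ (bideg k).S n)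
    (hg : g ∈ (bideg k).S m) : (resultant f g).natDegree ≤ 2 * n * m := by
  rw [mem_bideg] at hf hg
  refine (natDegree_resultant_le f g _ _ n m hf.1 hg.1).trans ?_
  have h1 : f.natDegree * m ≤ n * m := Nat.mul_le_mul_right _ hf.2
  have h2 : g.natDegree * n ≤ m * n := Nat.mul_le_mul_right _ hg.2
  nlinarith

theorem derivative_mem {f : k[X][X]} {n : ℕ} (hf : f ∈ (bideg k).S n) :
    derivative f ∈ (bideg k).S n := by
  rw [mem_bideg] at hf ⊢
  refine ⟨fun i => ?_, (natDegree_derivative_le f).trans ((Nat.sub_le _ _).trans hf.2)⟩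
  rw [coeff_derivative]
  have : ((i : k[X]) + 1) = C ((i : k) + 1) := by simp
  rw [this]
  exact (natDegree_mul_C_le _ _).trans (hf.1 _)

theorem not_dvd_derivative {p : ℕ} [CharP k p] {f : k[X][X]} (hf : f.Monic)
    (hD : f.natDegree ≠ 0) (hp : f.natDegree < p) : ¬ f ∣ derivative f := by
  refine not_dvd_of_natDegree_lt hf (fun h => ?_) (natDegree_derivative_lt hD)
  have h1 := congrArg (fun g => (coeff g (f.natDegree - 1)).coeff 0) h
  have h2 : f.natDegree - 1 + 1 = f.natDegree := by omega
  simp only [coeff_derivative, h2, hf.coeff_natDegree, one_mul, coeff_zero] at h1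
  have h3 : ((f.natDegree - 1 : ℕ) : k[X]) + 1 = C ((f.natDegree : ℕ) : k) := by
    rw [← Nat.cast_add_one, h2]; simp
  rw [h3, coeff_C_zero, CharP.cast_eq_zero_iff k p] at h1
  exact absurd (Nat.le_of_dvd (Nat.pos_of_ne_zero hD) h1) (not_le.2 hp)

theorem irreducible_of_minimal {f g : k[X][X]} {x y : k} (hg : g.Monic) (hgf : g ∣ f)
    (h0 : evalEval x y g = 0) (hmin : ∀ h : k[X][X], h.Monic → h ∣ f → evalEval x y h = 0 →
      g.natDegree ≤ h.natDegree) : Irreducible g := by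
  rw [hg.irreducible_iff_natDegree]
  refine ⟨fun h => by simp [h] at h0, fun a b ha hb hab => ?_⟩
  have hdeg : g.natDegree = a.natDegree + b.natDegree := by rw [← hab, ha.natDegree_mul hb]
  rw [← hab, evalEval_mul, mul_eq_zero] at h0
  rcases h0 with h0 | h0
  · have := hmin a ha ((Dvd.intro _ hab).trans hgf) h0
    omega
  · have := hmin b hb ((Dvd.intro_left _ hab).trans hgf) h0
    omega

variable {K : Type*} [Field K] [Fintype K] [Algebra K k]

theorem pow_card_eq_iff (x : k) : x ^ card K = x ↔ ∃ a : K, algebraMap K k a = x := by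
  constructor
  · intro h
    have h1 : (X ^ card K - X : K[X]) = ∏ a : K, (X - C a) := by
      have hm : (X ^ card K - X : K[X]).Monic :=
        monic_X_pow_sub (by rw [degree_X]; exact_mod_cast Fintype.one_lt_card)
      rw [← prod_multiset_X_sub_C_of_monic_of_roots_card_eq hm, FiniteField.roots_X_pow_card_sub_X]
      · rfl
      · rw [FiniteField.roots_X_pow_card_sub_X,
          FiniteField.X_pow_card_sub_X_natDegree_eq _ Fintype.one_lt_card]
        rfl
    have h2 := congrArg (fun u => eval₂ (algebraMap K k) x u) h1
    simp only [eval₂_sub, eval₂_X_pow, eval₂_X, h, sub_self, eval₂_finset_prod, eval₂_C] at h2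
    obtain ⟨a, -, ha⟩ := prod_eq_zero_iff.1 h2.symm
    exact ⟨a, (sub_eq_zero.1 ha).symm⟩
  · rintro ⟨a, rfl⟩
    rw [← map_pow, FiniteField.pow_card]

theorem bmap_frobenius_bmap {p : ℕ} [ExpChar k p] {r : ℕ} (hK : card K = p ^ r)
    (F : K[X][X]) : bmap (iterateFrobenius k p r) (bmap (algebraMap K k) F) =
      bmap (algebraMap K k) F := by
  ext i j
  rw [coeff_coeff_bmap, coeff_coeff_bmap, iterateFrobenius_def, ← hK]
  exact (pow_card_eq_iff _).2 ⟨_, rfl⟩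

theorem exists_bmap_eq {p : ℕ} [ExpChar k p] {r : ℕ} (hK : card K = p ^ r)
    {g : k[X][X]} (hg : bmap (iterateFrobenius k p r) g = g) :
    ∃ G : K[X][X], bmap (algebraMap K k) G = g := by
  have h : g ∈ lifts (mapRingHom (algebraMap K k)) := by
    rw [lifts_iff_coeff_lifts]
    intro i
    have : g.coeff i ∈ lifts (algebraMap K k) := by
      rw [lifts_iff_coeff_lifts]
      intro j
      refine (pow_card_eq_iff (K := K) _).1 ?_
      rw [hK, ← iterateFrobenius_def, ← coeff_coeff_bmap, hg]
    exact (mem_lifts _).1 this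
  exact (mem_lifts _).1 h

/-- A curve which is irreducible over a finite field and has a smooth rational point is
absolutely irreducible. -/
theorem irreducible_bmap {p : ℕ} [ExpChar k p] {r : ℕ} (hK : card K = p ^ r)
    {F : K[X][X]} (hF : F.Monic) (hi : Irreducible F) {x y : K} (h0 : evalEval x y F = 0)
    (h1 : evalEval x y (derivative F) ≠ 0) : Irreducible (bmap (algebraMap K k) F) := by
  set f := bmap (algebraMap K k) F with hf
  set φ := algebraMap K k with hφ
  have hφi : Injective φ := φ.injective
  have hfm : f.Monic := hF.map _
  have hf0 : evalEval (φ x) (φ y) f = 0 := by rw [hf, evalEval_bmap, h0, map_zero]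
  have hf1 : evalEval (φ x) (φ y) (derivative f) ≠ 0 := by
    rw [hf, derivative_bmap, evalEval_bmap]
    exact (map_ne_zero_iff _ hφi).2 h1
  have hex : ∃ d, ∃ g : k[X][X], g.Monic ∧ g ∣ f ∧ evalEval (φ x) (φ y) g = 0 ∧ g.natDegree = d :=
    ⟨_, f, hfm, dvd_rfl, hf0, rfl⟩
  obtain ⟨g, hg, hgf, hg0, hgd⟩ := Nat.find_spec hex
  have hmin : ∀ h : k[X][X], h.Monic → h ∣ f → evalEval (φ x) (φ y) h = 0 →
      g.natDegree ≤ h.natDegree := fun h h1 h2 h3 => by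
    rw [hgd]; exact Nat.find_min' hex ⟨h, h1, h2, h3, rfl⟩
  have hgi := irreducible_of_minimal hg hgf hg0 hmin
  obtain ⟨ψ, hψ⟩ : ∃ ψ, ψ = iterateFrobenius k p r := ⟨_, rfl⟩
  have hψφ : ∀ a, ψ (φ a) = φ a := fun a => by
    rw [hψ, iterateFrobenius_def, ← hK]; exact (pow_card_eq_iff _).2 ⟨a, rfl⟩
  have hψf : bmap ψ f = f := by rw [hψ]; exact bmap_frobenius_bmap hK F
  have hg'0 : evalEval (φ x) (φ y) (bmap ψ g) = 0 := by
    rw [← hψφ x, ← hψφ y, evalEval_bmap, hg0, map_zero]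
  have hg'f : bmap ψ g ∣ f := by rw [← hψf]; exact map_dvd _ hgf
  have hg'm : (bmap ψ g).Monic := hg.map _
  have hg'd : (bmap ψ g).natDegree = g.natDegree := hg.natDegree_map _
  have hg'i := irreducible_of_minimal hg'm hg'f hg'0 (by rwa [hg'd])
  have hfix : bmap ψ g = g := by
    by_contra hne
    obtain ⟨h, hh⟩ := hg'f
    have h2 : g ∣ bmap ψ g * h := hh ▸ hgf
    rcases hgi.prime.dvd_or_dvd h2 with h3 | ⟨h', rfl⟩
    · exact hne (eq_of_monic_of_dvd_of_natDegree_le hg hg'm h3 hg'd.le).symm.symm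
    · apply hf1
      rw [hh]
      obtain ⟨g', hg'⟩ : ∃ g', g' = bmap ψ g := ⟨_, rfl⟩
      rw [← hg'] at hg'0 ⊢
      simp only [derivative_mul, evalEval_add, evalEval_mul, hg'0, hg0]
      ring
  rw [hψ] at hfix
  obtain ⟨G, hG⟩ := exists_bmap_eq hK hfix
  have hGm : G.Monic := by
    rw [← hG] at hg
    exact monic_of_injective (map_injective _ hφi) hg
  have hGF : G ∣ F := by
    rw [← hG] at hgf
    exact (map_dvd_map (mapRingHom φ) (map_injective _ hφi) hGm).1 hgf
  obtain ⟨Q, hQ⟩ := hGF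
  rcases hi.isUnit_or_isUnit hQ with hu | hu
  · refine absurd ?_ hgi.not_isUnit
    rw [← hG]; exact hu.map _
  · rw [hf, hQ, map_mul, hG]
    exact (irreducible_mul_isUnit (hu.map (bmap φ))).2 hgi

end

theorem eval₂RingHom_sub {A B : Type*} [CommRing A] [CommRing B] (φ : A →+* B) (b : B) (u v : A[X]) :
    eval₂RingHom φ b (u - v) = eval₂RingHom φ b u - eval₂RingHom φ b v := map_sub _ _ _

section fibre

variable {k : Type*} [Field k]

theorem separable_map_evalRingHom {f : k[X][X]} (hf : f.natDegree ≠ 0) {x : k}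
    (h : (resultant f (derivative f)).eval x ≠ 0) : (f.map (evalRingHom x)).Separable := by
  obtain ⟨a, b, hab⟩ := resultant_mem f (derivative f) hf
  have h1 := congrArg (Polynomial.map (evalRingHom x)) hab
  rw [Polynomial.map_add, Polynomial.map_mul, Polynomial.map_mul, map_C, coe_evalRingHom,
    ← derivative_map] at h1
  obtain ⟨c, hc⟩ : ∃ c, c = (resultant f (derivative f)).eval x := ⟨_, rfl⟩
  rw [← hc] at h h1
  refine ⟨C c⁻¹ * a.map (evalRingHom x), C c⁻¹ * b.map (evalRingHom x), ?_⟩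
  rw [mul_assoc, mul_assoc, ← mul_add, mul_comm (a.map _), mul_comm (b.map _), h1, ← C_mul,
    inv_mul_cancel₀ h, C_1]

theorem card_roots_map_evalRingHom [IsAlgClosed k] {f : k[X][X]} (hf : f.Monic)
    (hD : f.natDegree ≠ 0) {x : k} (h : (resultant f (derivative f)).eval x ≠ 0) :
    (f.map (evalRingHom x)).roots.toFinset.card = f.natDegree := by
  rw [Multiset.toFinset_card_of_nodup (nodup_roots (separable_map_evalRingHom hD h)),
    splits_iff_card_roots.1 (IsAlgClosed.splits _), hf.natDegree_map]

theorem evalEval_derivative_ne_zero {f : k[X][X]} (hD : f.natDegree ≠ 0) {x y : k}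
    (h : (resultant f (derivative f)).eval x ≠ 0) (h0 : evalEval x y f = 0) :
    evalEval x y (derivative f) ≠ 0 := fun h1 => h (eval_resultant_eq_zero hD h0 h1)

/-- The quotient `(f(z) - f(y)) / (z - y)`. -/
noncomputable def diffQuot (f : k[X][X]) : k[X][X][X] := (f.map C - C f) /ₘ (X - C X)

theorem X_sub_C_mul_diffQuot (f : k[X][X]) : (X - C X) * diffQuot f = f.map C - C f := by
  rw [diffQuot, mul_divByMonic_eq_iff_isRoot]
  simp [IsRoot, eval_map, eval₂_C_X]

theorem ev3_diffQuot (f : k[X][X]) (x y z : k) :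
    (z - y) * ev3 x y z (diffQuot f) = evalEval x z f - evalEval x y f := by
  have h1 : ev3 x y z (f.map C) = evalEval x z f := by
    rw [ev3_eq, eval₂_map, ← eval₂_evalRingHom]
    congr 1
    ext <;> simp
  have h2 : ev3 x y z (C f) = evalEval x y f := by rw [ev3_eq, eval₂_C]; rfl
  have h3 : ev3 x y z (X - C X) = z - y := by
    refine (eval₂RingHom_sub _ _ _ _).trans ?_
    change eval₂ _ _ _ - eval₂ _ _ _ = _
    rw [eval₂_C, eval₂_X]; simp
  rw [← h3, ← map_mul, X_sub_C_mul_diffQuot, ← h1, ← h2]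
  exact eval₂RingHom_sub _ _ _ _

theorem natDegree_map_C_sub_C (f : k[X][X]) : (f.map C - C f : k[X][X][X]).natDegree = f.natDegree := by
  rw [natDegree_sub_C, natDegree_map_eq_of_injective C_injective]

theorem monic_diffQuot {f : k[X][X]} (hf : f.Monic) (hD : f.natDegree ≠ 0) :
    (diffQuot f).Monic := by
  refine Monic.of_mul_monic_left (monic_X_sub_C X) ?_
  rw [X_sub_C_mul_diffQuot]
  refine (hf.map C).sub_of_left (degree_C_le.trans_lt ?_)
  rw [degree_eq_natDegree (hf.map C).ne_zero, natDegree_map_eq_of_injective C_injective]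
  exact_mod_cast Nat.pos_of_ne_zero hD

theorem natDegree_diffQuot (f : k[X][X]) : (diffQuot f).natDegree = f.natDegree - 1 := by
  rw [diffQuot, natDegree_divByMonic _ (monic_X_sub_C _), natDegree_X_sub_C, natDegree_map_C_sub_C]

theorem coeff_diffQuot_mem {f : k[X][X]} {n : ℕ} (hf : f ∈ (bideg k).S n) (i : ℕ) :
    (diffQuot f).coeff i ∈ (bideg k).S n := by
  rw [diffQuot, coeff_divByMonic_X_sub_C]
  refine sum_mem fun j hj => ?_
  rw [natDegree_map_C_sub_C, mem_Icc] at hj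
  rw [mem_bideg] at hf ⊢
  rw [coeff_sub, coeff_map, coeff_C_ne_zero (by omega), sub_zero]
  refine ⟨fun l => ?_, ?_⟩
  · rw [coeff_mul_C, coeff_X_pow]
    split_ifs
    · simpa using hf.1 j
    · simp
  · refine (natDegree_mul_C_le _ _).trans ((natDegree_X_pow_le _).trans ?_)
    have := hf.2
    omega

end fibre

section curve

variable {K : Type*} [Field K] [Fintype K]

/-- The rational points of an affine plane curve. -/
noncomputable def points (F : K[X][X]) : Finset (K × K) :=
  univ.filter fun P => evalEval P.1 P.2 F = 0

theorem mem_points {F : K[X][X]} {P : K × K} : P ∈ points F ↔ evalEval P.1 P.2 F = 0 := by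
  simp [points]

/-- The points of a monic curve lying over few abscissae are few. -/
theorem card_points_filter_le {F : K[X][X]} (hF : F.Monic) {u : K[X]} (hu : u ≠ 0) :
    ((points F).filter fun P => u.eval P.1 = 0).card ≤ u.natDegree * F.natDegree := by
  have h1 : (points F).filter (fun P => u.eval P.1 = 0) ⊆
      (univ.filter fun x => u.eval x = 0).biUnion fun x =>
        (F.map (evalRingHom x)).roots.toFinset.image fun y => (x, y) := by
    rintro ⟨x, y⟩ h
    rw [mem_filter, mem_points] at h
    rw [mem_biUnion]
    refine ⟨x, by simpa using h.2, mem_image.2 ⟨y, ?_, rfl⟩⟩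
    rw [Multiset.mem_toFinset, mem_roots (hF.map _).ne_zero, IsRoot.def, map_evalRingHom_eval]
    exact h.1
  refine (card_le_card h1).trans ((card_biUnion_le_card_mul _ _ F.natDegree ?_).trans
    (Nat.mul_le_mul_right _ (card_filter_eval_eq_zero_le hu)))
  intro x _
  refine card_image_le.trans ((Multiset.toFinset_card_le _).trans ((card_roots' _).trans ?_))
  exact (hF.natDegree_map _).le

theorem resultant_derivative_ne_zero {p n : ℕ} [CharP K p] {F : K[X][X]} (hF : F.Monic)
    (hi : Irreducible F) (hD : F.natDegree ≠ 0) (hn : F ∈ (bideg K).S n) (hp : n < p) :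
    resultant F (derivative F) ≠ 0 :=
  resultant_ne_zero_of_not_dvd hF hi (not_dvd_derivative (p := p) hF hD
    (((mem_bideg.1 hn).2).trans_lt hp))

theorem card_points_filter_resultant_le {p n : ℕ} [CharP K p] {F : K[X][X]} (hF : F.Monic)
    (hi : Irreducible F) (hD : F.natDegree ≠ 0) (hn : F ∈ (bideg K).S n) (hp : n < p) :
    ((points F).filter fun P => (resultant F (derivative F)).eval P.1 = 0).card ≤ 2 * n ^ 3 := by
  refine (card_points_filter_le hF (resultant_derivative_ne_zero hF hi hD hn hp)).trans ?_
  refine (Nat.mul_le_mul (natDegree_resultant_le_sq hn (derivative_mem hn))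
    (mem_bideg.1 hn).2).trans (le_of_eq (by ring))

end curve

section

variable {K : Type*} [Field K] [Fintype K]

theorem resultant_bmap {k : Type*} [Field k] (φ : K →+* k) (F G : K[X][X]) :
    resultant (bmap φ F) (bmap φ G) = (resultant F G).map φ := by
  have hi : Injective (mapRingHom φ) := map_injective _ φ.injective
  rw [bmap_apply, bmap_apply, natDegree_map_eq_of_injective hi, natDegree_map_eq_of_injective hi,
    resultant_map_map]
  rfl

/-- The Weil bound for an absolutely irreducible plane curve. -/
theorem abs_card_points_sub_le {p r n : ℕ} [Fact p.Prime] [CharP K p] (hK : card K = p ^ r)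
    {F : K[X][X]} (hF : F.Monic) (hD : F.natDegree ≠ 0)
    (hn : F ∈ (bideg K).S n) (hp : n < p) (hq : (100 * n ^ 2) ^ 2 ≤ p ^ r)
    (hi : Irreducible (bmap (algebraMap K (AlgebraicClosure K)) F)) :
    |((points F).card : ℤ) - (p ^ r : ℕ)| ≤ 202 * n ^ 5 * (p ^ r).sqrt := by
  set k := AlgebraicClosure K
  haveI : CharP k p := charP_of_injective_algebraMap (algebraMap K k).injective p
  obtain ⟨φ, hφ⟩ : ∃ φ, φ = algebraMap K k := ⟨_, rfl⟩
  obtain ⟨f, hf⟩ : ∃ f, f = bmap φ F := ⟨_, rfl⟩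
  obtain ⟨R, hR⟩ : ∃ R, R = resultant F (derivative F) := ⟨_, rfl⟩
  have hfm : f.Monic := hf ▸ hF.map _
  have hfd : f.natDegree = F.natDegree := hf ▸ hF.natDegree_map _
  have hfn : f ∈ (bideg k).S n := hf ▸ bmap_mem φ hn
  have hfi : Irreducible f := by rw [hf, hφ]; exact hi
  have hRf : resultant f (derivative f) = R.map φ := by rw [hf, derivative_bmap, resultant_bmap, hR]
  have hR' : ∀ x, (resultant f (derivative f)).eval (φ x) = 0 ↔ R.eval x = 0 := fun x => by
    rw [hRf, eval_map_apply, map_eq_zero]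
  have hR0 : R ≠ 0 := fun h => by
    refine resultant_ne_zero_of_not_dvd hfm hfi (not_dvd_derivative (p := p) hfm (hfd ▸ hD)
      (((mem_bideg.1 hfn).2).trans_lt hp)) ?_
    rw [hRf, h, Polynomial.map_zero]
  have hRd : R.natDegree ≤ 2 * n * n := hR ▸ natDegree_resultant_le_sq hn (derivative_mem hn)
  have hn1 : F.natDegree ≤ n := (mem_bideg.1 hn).2
  set G := univ.filter fun x : K => R.eval x ≠ 0 with hG
  let Y : K → Finset k := fun x => (f.map (evalRingHom (φ x))).roots.toFinset
  have hY : ∀ x y, y ∈ Y x ↔ evalEval (φ x) y f = 0 := fun x y => by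
    simp only [Y]
    rw [Multiset.mem_toFinset, mem_roots (hfm.map _).ne_zero, IsRoot.def, map_evalRingHom_eval]
  have hYc : ∀ x ∈ G, (Y x).card = F.natDegree := fun x hx => by
    rw [← hfd]
    exact card_roots_map_evalRingHom hfm (hfd ▸ hD) (by rw [Ne, hR']; exact (mem_filter.1 hx).2)
  let P : Finset (k × k) := G.biUnion fun x => (Y x).image fun y => (φ x, y)
  have hPc : P.card = G.card * F.natDegree := by
    rw [card_biUnion, sum_congr rfl, sum_const, smul_eq_mul]
    · intro x hx
      rw [card_image_of_injective _ (Prod.mk_right_injective _), hYc x hx]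
    · intro x _ x' _ hne
      rw [onFun, disjoint_left]
      simp only [mem_image, not_exists, not_and]
      rintro _ ⟨y, _, rfl⟩ y' _ h
      exact hne (φ.injective (Prod.mk.inj h).1).symm
  have hGc : card K ≤ G.card + 2 * n ^ 2 := by
    have h1 := card_filter_add_card_filter_not (s := (univ : Finset K)) (fun x => R.eval x = 0)
    have h2 := card_filter_eval_eq_zero_le hR0
    rw [card_univ] at h1
    rw [hG]
    nlinarith
  have hPm : ∀ Q ∈ P, ∃ x, R.eval x ≠ 0 ∧ φ x = Q.1 ∧ evalEval Q.1 Q.2 f = 0 := by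
    intro Q hQ
    obtain ⟨x, hx, hQ⟩ := mem_biUnion.1 hQ
    obtain ⟨y, hy, rfl⟩ := mem_image.1 hQ
    exact ⟨x, (mem_filter.1 hx).2, rfl, (hY x y).1 hy⟩
  have hcond : ∀ Q ∈ P, Q.1 ^ p ^ r = Q.1 ∧ evalEval Q.1 Q.2 f = 0 ∧
      (∀ y, evalEval Q.1 y f = 0 → evalEval Q.1 y (derivative f) ≠ 0) := by
    intro Q hQ
    obtain ⟨x, hx, h1, h2⟩ := hPm Q hQ
    refine ⟨?_, h2, fun y hy => evalEval_derivative_ne_zero (hfd ▸ hD) ?_ hy⟩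
    · rw [← h1, ← map_pow, ← hK, FiniteField.pow_card]
    · rw [← h1, Ne, hR']; exact hx
  have hnn : 1 ≤ n := le_trans (Nat.pos_of_ne_zero hD) hn1
  have hs1 : (P.filter fun Q => Q.2 ^ p ^ r = Q.2).card ≤
      1 * p ^ r + 200 * n ^ 5 * (p ^ r).sqrt := by
    rw [← natDegree_X_sub_C (X : k[X][X])]
    refine card_le hfm hfi (hfd ▸ hD) hfn (monic_X_sub_C _) (fun i => ?_) ?_ hq fun Q hQ => ?_
    · rw [coeff_sub]
      refine sub_mem ?_ ?_
      · rw [coeff_X]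
        split_ifs
        · exact (bideg k).mono (Int.natCast_nonneg n) (bideg k).one_mem
        · exact zero_mem _
      · rw [coeff_C]
        split_ifs
        · rw [mem_bideg]
          refine ⟨fun i => ?_, natDegree_X_le.trans hnn⟩
          rw [coeff_X]
          split_ifs <;> simp
        · exact zero_mem _
    · rw [natDegree_X_sub_C]; exact hnn
    · rw [mem_filter] at hQ
      obtain ⟨h1, h2, h3⟩ := hcond Q hQ.1
      refine ⟨h1, h2, h3, ?_⟩
      refine (eval₂RingHom_sub _ _ _ _).trans ?_
      change eval₂ _ _ _ - eval₂ _ _ _ = _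
      rw [eval₂_C, eval₂_X, hQ.2]; simp
  have hs2 : (P.filter fun Q => ¬ Q.2 ^ p ^ r = Q.2).card ≤
      (F.natDegree - 1) * p ^ r + 200 * n ^ 5 * (p ^ r).sqrt := by
    rw [← hfd, ← natDegree_diffQuot]
    refine card_le hfm hfi (hfd ▸ hD) hfn (monic_diffQuot hfm (hfd ▸ hD))
      (coeff_diffQuot_mem hfn) ?_ hq fun Q hQ => ?_
    · rw [natDegree_diffQuot]; omega
    · rw [mem_filter] at hQ
      obtain ⟨h1, h2, h3⟩ := hcond Q hQ.1
      refine ⟨h1, h2, h3, ?_⟩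
      have h4 := ev3_diffQuot f Q.1 Q.2 (Q.2 ^ p ^ r)
      have h5 : evalEval Q.1 (Q.2 ^ p ^ r) f = 0 := by
        obtain ⟨ψ, hψ⟩ : ∃ ψ, ψ = iterateFrobenius k p r := ⟨_, rfl⟩
        have hψf : bmap ψ f = f := by rw [hψ, hf, hφ]; exact bmap_frobenius_bmap hK F
        have h6 := evalEval_bmap ψ f Q.1 Q.2
        rw [h2, map_zero, hψf, hψ, iterateFrobenius_def, iterateFrobenius_def, h1] at h6
        exact h6
      rw [h5, h2, sub_zero] at h4
      exact (mul_eq_zero.1 h4).resolve_left (sub_ne_zero.2 hQ.2)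
  have hsum := card_filter_add_card_filter_not (s := P) (fun Q => Q.2 ^ p ^ r = Q.2)
  have hN := card_filter_add_card_filter_not (s := points F) (fun Q => R.eval Q.1 = 0)
  have hN1 : ((points F).filter fun Q => R.eval Q.1 = 0).card ≤ 2 * n ^ 3 := by
    refine (card_points_filter_le hF hR0).trans ((Nat.mul_le_mul hRd hn1).trans (le_of_eq (by ring)))
  have hN2 : ((points F).filter fun Q => ¬ R.eval Q.1 = 0).card =
      (P.filter fun Q => Q.2 ^ p ^ r = Q.2).card := by
    refine card_bij (fun Q _ => (φ Q.1, φ Q.2)) ?_ ?_ ?_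
    · rintro ⟨x, y⟩ hQ
      rw [mem_filter, mem_points] at hQ
      rw [mem_filter]
      refine ⟨mem_biUnion.2 ⟨x, by simpa [hG] using hQ.2, mem_image.2 ⟨φ y, ?_, rfl⟩⟩, ?_⟩
      · rw [hY, hf, evalEval_bmap, hQ.1, map_zero]
      · rw [← map_pow, ← hK, FiniteField.pow_card]
    · rintro ⟨x, y⟩ _ ⟨x', y'⟩ _ h
      rw [Prod.mk.injEq] at h ⊢
      exact ⟨φ.injective h.1, φ.injective h.2⟩
    · rintro ⟨x', y'⟩ hQ
      rw [mem_filter] at hQ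
      obtain ⟨x, hx, h1, h2⟩ := hPm _ hQ.1
      obtain ⟨y, hy⟩ := (pow_card_eq_iff (K := K) y').1 (hK ▸ hQ.2)
      rw [← hφ] at hy
      dsimp only at h1 h2
      refine ⟨(x, y), ?_, by rw [h1, hy]⟩
      rw [mem_filter, mem_points]
      refine ⟨φ.injective ?_, hx⟩
      rw [map_zero, ← evalEval_bmap, ← hf, h1, hy, h2]
  have hsq : 1 ≤ (p ^ r).sqrt := Nat.sqrt_pos.2 (pow_pos (Fact.out : p.Prime).pos r)
  rw [hK] at hGc
  rw [hN2] at hN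
  generalize (P.filter fun Q => Q.2 ^ p ^ r = Q.2).card = a at *
  generalize (P.filter fun Q => ¬ Q.2 ^ p ^ r = Q.2).card = b at *
  generalize ((points F).filter fun Q => R.eval Q.1 = 0).card = c at *
  rw [hPc] at hsum
  generalize (p ^ r).sqrt = s at *
  generalize p ^ r = q at *
  generalize G.card = g at *
  obtain ⟨D, hDe⟩ : ∃ D, F.natDegree = D + 1 := ⟨F.natDegree - 1, by omega⟩
  rw [hDe] at hsum hs2 hn1
  simp only [Nat.add_sub_cancel] at hs2
  rw [← hN]
  have hn3 : n ^ 3 ≤ n ^ 5 * s :=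
    (Nat.pow_le_pow_right hnn (by norm_num)).trans (Nat.le_mul_of_pos_right _ hsq)
  have h6 : q * (D + 1) ≤ (g + 2 * n ^ 2) * (D + 1) := Nat.mul_le_mul_right _ hGc
  have h7 : 2 * n ^ 2 * (D + 1) ≤ 2 * n ^ 3 := by
    calc 2 * n ^ 2 * (D + 1) ≤ 2 * n ^ 2 * n := Nat.mul_le_mul_left _ hn1
      _ = _ := by ring
  zify at *
  rw [abs_le]
  constructor <;> nlinarith

end

section

theorem coeff_coeff_swap {R : Type*} [CommRing R] (F : R[X][X]) (i j : ℕ) :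
    ((Bivariate.swap F).coeff i).coeff j = (F.coeff j).coeff i := by
  induction F using Polynomial.induction_on' with
  | add p q hp hq => rw [map_add, coeff_add, coeff_add, hp, hq, coeff_add, coeff_add]
  | monomial n u =>
    induction u using Polynomial.induction_on' with
    | add p q hp hq =>
      rw [(monomial n).map_add, map_add, coeff_add, coeff_add, hp, hq, coeff_add, coeff_add]
    | monomial m r =>
      rw [Bivariate.swap_monomial_monomial]
      simp only [coeff_monomial]
      split_ifs <;> simp_all [coeff_monomial]

theorem natDegree_swap_le_iff {R : Type*} [CommRing R] {F : R[X][X]} {a : ℕ} :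
    (Bivariate.swap F).natDegree ≤ a ↔ ∀ i, (F.coeff i).natDegree ≤ a := by
  simp only [natDegree_le_iff_coeff_eq_zero, Polynomial.ext_iff, coeff_coeff_swap, coeff_zero]
  exact ⟨fun h i N hN => h N hN i, fun h N hN i => h i N hN⟩

theorem natDegree_swap_le_of_dvd {R : Type*} [CommRing R] [IsDomain R] {u v : R[X][X]} (h : u ∣ v)
    (h0 : v ≠ 0) : (Bivariate.swap u).natDegree ≤ (Bivariate.swap v).natDegree := by
  obtain ⟨w, rfl⟩ := h
  obtain ⟨hu, hw⟩ := mul_ne_zero_iff.1 h0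
  rw [map_mul, natDegree_mul]
  · exact Nat.le_add_right _ _
  · intro h; exact hu (Bivariate.swap.injective (h.trans (map_zero Bivariate.swap).symm))
  · intro h; exact hw (Bivariate.swap.injective (h.trans (map_zero Bivariate.swap).symm))

variable {k : Type*} [Field k]

theorem mem_bideg_iff_swap {u : k[X][X]} {a : ℕ} : u ∈ (bideg k).S (a : ℕ) ↔
    (Bivariate.swap u).natDegree ≤ a ∧ u.natDegree ≤ a := by
  rw [mem_bideg, natDegree_swap_le_iff]

theorem mem_bideg_of_dvd {u v : k[X][X]} {a : ℕ} (hv : v ∈ (bideg k).S (a : ℕ)) (h0 : v ≠ 0)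
    (h : u ∣ v) : u ∈ (bideg k).S (a : ℕ) := by
  rw [mem_bideg_iff_swap] at hv ⊢
  exact ⟨(natDegree_swap_le_of_dvd h h0).trans hv.1, (natDegree_le_of_dvd h h0).trans hv.2⟩

theorem exists_monic_irreducible_dvd {R : Type*} [CommRing R] [IsDomain R] [WfDvdMonoid R[X]]
    {F : R[X]} (hF : F.Monic) (hD : F.natDegree ≠ 0) :
    ∃ A B : R[X], A.Monic ∧ Irreducible A ∧ B.Monic ∧ A.natDegree ≠ 0 ∧ ¬ A ∣ B ∧
      ∃ e, e ≠ 0 ∧ F = A ^ e * B := by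
  obtain ⟨A', hA', v, hv⟩ := WfDvdMonoid.exists_irreducible_factor
    (a := F) (fun h => hD (natDegree_eq_zero_of_isUnit h)) hF.ne_zero
  have h1 : A'.leadingCoeff * v.leadingCoeff = 1 := by
    rw [← leadingCoeff_mul, ← hv, hF.leadingCoeff]
  have h2 : IsUnit (C v.leadingCoeff) := (IsUnit.of_mul_eq_one_right _ h1).map C
  obtain ⟨A, hAe⟩ : ∃ A, A = C v.leadingCoeff * A' := ⟨_, rfl⟩
  have hA : Irreducible A := by rw [hAe]; exact (irreducible_isUnit_mul h2).2 hA'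
  have hAm : A.Monic := by
    rw [hAe]; exact monic_C_mul_of_mul_leadingCoeff_eq_one (by rw [mul_comm]; exact h1)
  have hAF : A ∣ F := by rw [hAe]; exact h2.mul_left_dvd.2 ⟨v, hv⟩
  have hAd : A.natDegree ≠ 0 := fun h => hA.not_isUnit (by
    rw [hAm.natDegree_eq_zero.1 h]; exact isUnit_one)
  have hfin : FiniteMultiplicity A F := FiniteMultiplicity.of_not_isUnit hA.not_isUnit hF.ne_zero
  obtain ⟨B, hB, hAB⟩ := hfin.exists_eq_pow_mul_and_not_dvd
  refine ⟨A, B, hAm, hA, Monic.of_mul_monic_left (hAm.pow _) (hB ▸ hF), hAd, hAB, _, ?_, hB⟩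
  rw [Ne, multiplicity_eq_zero]
  exact not_not.2 hAF

variable {K : Type*} [Field K] [Fintype K]

theorem card_points_inter_le {A B : K[X][X]} {n : ℕ} (hA : A.Monic) (hi : Irreducible A)
    (hn : A ∈ (bideg K).S n) (hB : B ∈ (bideg K).S n) (hAB : ¬ A ∣ B) :
    (points A ∩ points B).card ≤ 2 * n ^ 3 := by
  by_cases hD : A.natDegree = 0
  · rw [hA.natDegree_eq_zero.1 hD] at hi
    exact absurd isUnit_one hi.not_isUnit
  have h0 := resultant_ne_zero_of_not_dvd hA hi hAB
  refine le_trans (card_le_card fun P hP => ?_) ((card_points_filter_le hA h0).trans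
    ((Nat.mul_le_mul (natDegree_resultant_le_sq hn hB) (mem_bideg.1 hn).2).trans
      (le_of_eq (by ring))))
  rw [mem_inter, mem_points, mem_points] at hP
  rw [mem_filter, mem_points]
  exact ⟨hP.1, eval_resultant_eq_zero hD hP.1 hP.2⟩

theorem points_pow_mul {A B : K[X][X]} {e : ℕ} (he : e ≠ 0) :
    points (A ^ e * B) = points A ∪ points B := by
  ext P
  rw [mem_union, mem_points, mem_points, mem_points, evalEval_mul, evalEval_pow, mul_eq_zero,
    pow_eq_zero_iff he]

/-- Estimates for bounded weights on the points of irreducible curves extend to all curves. -/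
theorem exists_sum_points {n : ℕ} {w : K × K → ℝ} {b q : ℝ} (hw : ∀ P, |w P| ≤ 1) {F : K[X][X]}
    (hF : F.Monic) (hn : F ∈ (bideg K).S n)
    (h : ∀ A : K[X][X], A.Monic → Irreducible A → A ∈ (bideg K).S n → A ∣ F →
      ∃ m : ℤ, |∑ P ∈ points A, w P - m * q| ≤ b) (hb : 0 ≤ b) :
    ∃ m : ℤ, |∑ P ∈ points F, w P - m * q| ≤ n * (b + 2 * n ^ 3) := by
  suffices H : ∀ d : ℕ, ∀ F : K[X][X], F.natDegree ≤ d → F.Monic → F ∈ (bideg K).S n →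
      (∀ A : K[X][X], A.Monic → Irreducible A → A ∈ (bideg K).S n → A ∣ F →
        ∃ m : ℤ, |∑ P ∈ points A, w P - m * q| ≤ b) →
      ∃ m : ℤ, |∑ P ∈ points F, w P - m * q| ≤ d * (b + 2 * n ^ 3) by
    obtain ⟨m, hm⟩ := H _ F le_rfl hF hn h
    refine ⟨m, hm.trans ?_⟩
    gcongr
    exact (mem_bideg.1 hn).2
  intro d
  induction d with
  | zero =>
    intro F hd hF _ _
    rw [hF.natDegree_eq_zero.1 (Nat.le_zero.1 hd)]
    refine ⟨0, ?_⟩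
    have : points (1 : K[X][X]) = ∅ := by ext P; simp [mem_points]
    simp [this]
  | succ d ih =>
    intro F hd hF hn h
    by_cases hD : F.natDegree = 0
    · obtain ⟨m, hm⟩ := ih F (by omega) hF hn h
      refine ⟨m, hm.trans ?_⟩
      gcongr
      omega
    obtain ⟨A, B, hA, hAi, hB, hAd, hAB, e, he, rfl⟩ := exists_monic_irreducible_dvd hF hD
    have hAF : A ∣ A ^ e * B := (dvd_pow_self A he).mul_right B
    have hAn := mem_bideg_of_dvd hn hF.ne_zero hAF
    have hBn := mem_bideg_of_dvd hn hF.ne_zero (Dvd.intro_left _ rfl : B ∣ A ^ e * B)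
    have hBd : B.natDegree ≤ d := by
      rw [(hA.pow e).natDegree_mul hB, hA.natDegree_pow] at hd
      have := Nat.mul_pos (Nat.pos_of_ne_zero he) (Nat.pos_of_ne_zero hAd)
      omega
    obtain ⟨m1, h1⟩ := h A hA hAi hAn hAF
    obtain ⟨m2, h2⟩ := ih B hBd hB hBn fun A' h1 h2 h3 h4 => h A' h1 h2 h3 (h4.mul_left _)
    refine ⟨m1 + m2, ?_⟩
    have h3 : |∑ P ∈ points A ∩ points B, w P| ≤ 2 * n ^ 3 := by
      refine (abs_sum_le_sum_abs _ _).trans ((sum_le_sum fun P _ => hw P).trans ?_)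
      rw [sum_const, nsmul_eq_mul, mul_one]
      exact_mod_cast card_points_inter_le hA hAi hAn hBn hAB
    have h4 := sum_union_inter (s₁ := points A) (s₂ := points B) (f := w)
    rw [points_pow_mul he]
    push_cast
    rw [abs_le] at *
    constructor <;> linarith [h1.1, h1.2, h2.1, h2.2, h3.1, h3.2]

end

/-- A plane model of the double cover `f(y) = 0, z² = g(y)`: the polynomial whose roots are the
values of `l * y + z`. -/
noncomputable def doubleCover {R : Type*} [CommRing R] (f g : R[X]) (l : R) (N : ℕ) : R[X] :=
  resultant (f.map C) ((C X - C (C l) * X) ^ 2 - g.map C) f.natDegree N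

section doubleCover

variable {R S : Type*} [CommRing R] [CommRing S]

theorem doubleCover_map [Nontrivial S] (ψ : R →+* S) {f : R[X]} (hf : f.Monic) (g : R[X]) (l : R)
    (N : ℕ) : (doubleCover f g l N).map ψ = doubleCover (f.map ψ) (g.map ψ) (ψ l) N := by
  rw [doubleCover, doubleCover, hf.natDegree_map, ← coe_mapRingHom, ← resultant_map_map]
  congr 1
  · rw [coe_mapRingHom, map_map, map_map]
    congr 1
    ext <;> simp
  · simp only [Polynomial.map_sub, Polynomial.map_pow, Polynomial.map_mul, map_C, map_X, map_map,
      coe_mapRingHom]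
    congr 2
    ext <;> simp

theorem natDegree_cover_le (g : R[X]) (l : R) :
    ((C X - C (C l) * X) ^ 2 - g.map C : R[X][X]).natDegree ≤ max 2 g.natDegree := by
  refine (natDegree_sub_le _ _).trans (max_le_max ?_ natDegree_map_le)
  refine natDegree_pow_le_of_le 2 (m := 1) ?_
  refine (natDegree_sub_le _ _).trans (max_le (by simp) ((natDegree_C_mul_le _ _).trans ?_))
  exact natDegree_X_le

theorem doubleCover_eq_prod {k : Type*} [Field k] {f : k[X]} (hf : f.Monic) (hs : f.Splits)
    (g : k[X]) (l : k) {N : ℕ} (hN : max 2 g.natDegree ≤ N) :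
    doubleCover f g l N = (f.roots.map fun y => (X - C (l * y)) ^ 2 - C (g.eval y)).prod := by
  have h1 : f.natDegree = (f.map (C : k →+* k[X])).natDegree := (hf.natDegree_map C).symm
  rw [doubleCover, h1, resultant_eq_prod_eval _ _ _ ((natDegree_cover_le g l).trans hN) (hs.map C),
    (hf.map C).leadingCoeff, one_pow, one_mul, hs.roots_map_of_injective C_injective, Multiset.map_map]
  congr 2
  funext y
  simp [eval_map, eval₂_at_apply]

theorem monic_doubleCover [IsDomain R] {f : R[X]} (hf : f.Monic) (g : R[X]) (l : R) {N : ℕ}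
    (hN : max 2 g.natDegree ≤ N) :
    (doubleCover f g l N).Monic ∧ (doubleCover f g l N).natDegree = 2 * f.natDegree := by
  let k := AlgebraicClosure (FractionRing R)
  let ψ : R →+* k := (algebraMap (FractionRing R) k).comp (algebraMap R _)
  have hψ : Injective ψ :=
    (algebraMap (FractionRing R) k).injective.comp (IsFractionRing.injective R _)
  have h1 := doubleCover_map ψ hf g l N
  rw [doubleCover_eq_prod (hf.map ψ) (IsAlgClosed.splits _) _ _
    (le_trans (max_le_max le_rfl natDegree_map_le) hN)] at h1
  have h2 : ∀ p ∈ (f.map ψ).roots.map (fun y => (X - C (ψ l * y)) ^ 2 - C ((g.map ψ).eval y)),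
      p.Monic ∧ p.natDegree = 2 := by
    intro p hp
    obtain ⟨y, -, rfl⟩ := Multiset.mem_map.1 hp
    have h3 : ((X - C (ψ l * y)) ^ 2 : k[X]).natDegree = 2 := by
      rw [natDegree_pow, natDegree_X_sub_C]
    refine ⟨((monic_X_sub_C _).pow 2).sub_of_left (degree_C_le.trans_lt ?_), ?_⟩
    · rw [degree_eq_natDegree ((monic_X_sub_C _).pow 2).ne_zero, h3]; norm_num
    · rw [natDegree_sub_C, h3]
  have h4 : ((doubleCover f g l N).map ψ).Monic := by
    rw [h1]
    refine Multiset.prod_induction Monic _ (fun a b => Monic.mul) monic_one fun p hp => (h2 p hp).1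
  refine ⟨monic_of_injective hψ h4, ?_⟩
  rw [← natDegree_map_eq_of_injective hψ, h1, natDegree_multiset_prod_of_monic _ fun p hp => (h2 p hp).1,
    Multiset.map_congr rfl fun p hp => (h2 p hp).2]
  rw [Multiset.map_const', Multiset.sum_replicate, Multiset.card_map,
    splits_iff_card_roots.1 (IsAlgClosed.splits _), hf.natDegree_map, smul_eq_mul, mul_comm]

end doubleCover

theorem natDegree_resultant_le' {R : Type*} [CommRing R] (f g : R[X][X][X]) (m n d a : ℕ)
    (hf : ∀ i j, ((f.coeff i).coeff j).natDegree ≤ d)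
    (hg : ∀ i j, ((g.coeff i).coeff j).natDegree ≤ a) (i : ℕ) :
    ((resultant f g m n).coeff i).natDegree ≤ m * a + n * d := by
  have h1 := natDegree_resultant_le (f.map (Bivariate.swap (R := R)).toRingEquiv.toRingHom)
    (g.map (Bivariate.swap (R := R)).toRingEquiv.toRingHom) m n d a
    (fun i => by rw [coeff_map]; exact natDegree_swap_le_iff.2 (hf i))
    (fun i => by rw [coeff_map]; exact natDegree_swap_le_iff.2 (hg i))
  rw [resultant_map_map] at h1
  exact natDegree_swap_le_iff.1 h1 i

section field

variable {k : Type*} [Field k]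

theorem doubleCover_mem {f g : k[X][X]} {n : ℕ} (hfm : f.Monic) (hf : f ∈ (bideg k).S n)
    (hg : g ∈ (bideg k).S n) (l : k) :
    doubleCover f g (C l) (n + 2) ∈ (bideg k).S (2 * n ^ 2 + 2 * n : ℕ) := by
  rw [mem_bideg] at hf hg ⊢
  constructor
  · intro i
    refine (natDegree_resultant_le' _ _ _ _ n n (fun i j => ?_) (fun i j => ?_) i).trans ?_
    · rw [coeff_map, coeff_C]
      split_ifs
      · exact hf.1 i
      · simp
    · have h1 : (C X - C (C (C l)) * X : k[X][X][X]) ^ 2 =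
          ((C X - C (C l) * X : k[X][X]) ^ 2).map (mapRingHom C) := by
        simp
      rw [h1, coeff_sub, coeff_sub, coeff_map, coeff_map, coe_mapRingHom, coeff_map]
      refine (natDegree_sub_le _ _).trans (max_le (by simp) ?_)
      rw [coeff_C]
      split_ifs
      · exact hg.1 i
      · simp
    · have := Nat.mul_le_mul_right n hf.2
      nlinarith
  · rw [(monic_doubleCover hfm g (C l) (by have := hg.2; omega)).2]
    have := hf.2
    nlinarith

theorem separable_doubleCover [IsAlgClosed k] (h2 : (2 : k) ≠ 0) {f g : k[X]} (hf : f.Monic)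
    (hs : f.Separable) (hfg : ∀ y, f.eval y = 0 → g.eval y ≠ 0) {N : ℕ}
    (hN : max 2 g.natDegree ≤ N) : ∃ S : Finset k, S.card ≤ (2 * f.natDegree) ^ 2 ∧
      ∀ l, l ∉ S → (doubleCover f g l N).Separable := by
  choose s hs' using fun y => IsAlgClosed.exists_pow_nat_eq (g.eval y) (n := 2) (by norm_num)
  let Y := f.roots.toFinset
  have hYf : Y.val = f.roots := by
    rw [Multiset.toFinset_val, Multiset.dedup_eq_self.2 (nodup_roots hs)]
  let e : Bool → k := fun b => if b then 1 else -1
  have he : ∀ b, e b ^ 2 = 1 := fun b => by cases b <;> simp [e]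
  let W := Y ×ˢ (univ : Finset Bool)
  refine ⟨(W ×ˢ W).image fun P => (e P.2.2 * s P.2.1 - e P.1.2 * s P.1.1) / (P.1.1 - P.2.1), ?_, ?_⟩
  · refine card_image_le.trans ?_
    have h1 : Y.card ≤ f.natDegree := (Multiset.toFinset_card_le _).trans (card_roots' f)
    simp only [W, card_product, card_univ, Fintype.card_bool]
    nlinarith [Nat.mul_le_mul h1 h1]
  · intro l hl
    rw [doubleCover_eq_prod hf (IsAlgClosed.splits f) g l hN, ← hYf]
    have h1 : (Y.val.map fun y => (X - C (l * y)) ^ 2 - C (g.eval y)).prod =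
        ∏ P ∈ W, (X - C (l * P.1 + e P.2 * s P.1)) := by
      rw [prod_product]
      refine prod_congr rfl fun y _ => ?_
      rw [Fintype.prod_bool, ← hs' y]
      simp only [e, if_true, Bool.false_eq_true, if_false, C_add, C_mul, C_neg, C_1, C_pow]
      ring
    rw [h1, separable_prod_X_sub_C_iff']
    rintro ⟨y, b⟩ hP ⟨y', b'⟩ hQ h
    dsimp only at h
    by_cases hy : y = y'
    · subst hy
      have hg : s y ≠ 0 := fun h0 => by
        have := hfg y ?_
        · rw [← hs' y, h0] at this
          norm_num at this
        · have := (mem_product.1 hP).1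
          rw [Multiset.mem_toFinset, mem_roots hf.ne_zero] at this
          exact this
      have h3 : e b = e b' := mul_right_cancel₀ hg (add_left_cancel h)
      have h4 : b = b' := by
        revert h3
        cases b <;> cases b' <;> simp only [e, if_true, Bool.false_eq_true, if_false, imp_self]
        · intro h5; exact absurd (by linear_combination -h5) h2
        · intro h5; exact absurd (by linear_combination h5) h2
      rw [h4]
    · refine absurd (mem_image.2 ⟨((y, b), (y', b')), mk_mem_product hP hQ, ?_⟩) hl
      dsimp only
      rw [div_eq_iff (sub_ne_zero.2 hy)]
      linear_combination -h

theorem eq_of_separable_doubleCover {f g : k[X]} (hf : f.Monic) (hs : f.Splits) {l : k} {N : ℕ}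
    (hN : max 2 g.natDegree ≤ N) (h : (doubleCover f g l N).Separable) {y z y' z' : k}
    (hy : f.eval y = 0) (hy' : f.eval y' = 0) (hz : z ^ 2 = g.eval y) (hz' : z' ^ 2 = g.eval y')
    (he : l * y + z = l * y' + z') : y = y' ∧ z = z' := by
  by_cases hne : y = y'
  · subst hne
    exact ⟨rfl, add_left_cancel he⟩
  exfalso
  rw [doubleCover_eq_prod hf hs g l hN] at h
  obtain ⟨t, ht⟩ := Multiset.exists_cons_of_mem ((mem_roots hf.ne_zero).2 hy)
  have hy't : y' ∈ t := by
    have := (mem_roots hf.ne_zero).2 hy'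
    rw [ht, Multiset.mem_cons] at this
    exact this.resolve_left (Ne.symm hne)
  obtain ⟨u, hu⟩ := Multiset.exists_cons_of_mem hy't
  rw [ht, hu, Multiset.map_cons, Multiset.map_cons, Multiset.prod_cons, Multiset.prod_cons,
    ← mul_assoc] at h
  have hd : ∀ y z, z ^ 2 = g.eval y → l * y + z = l * y' + z' →
      X - C (l * y' + z') ∣ (X - C (l * y)) ^ 2 - C (g.eval y) := by
    intro y z h1 h2
    rw [dvd_iff_isRoot, IsRoot.def, ← h2, ← h1]
    simp
  have h3 := h.squarefree _ ((mul_dvd_mul (hd y z hz he) (hd y' z' hz' rfl)).mul_right _)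
  exact not_isUnit_X_sub_C _ h3

theorem eval_doubleCover_eq_zero_iff {f g : k[X]} (hf : f.Monic) (hs : f.Splits) {l : k} {N : ℕ}
    (hN : max 2 g.natDegree ≤ N) (t : k) : (doubleCover f g l N).eval t = 0 ↔
      ∃ y z, f.eval y = 0 ∧ z ^ 2 = g.eval y ∧ t = l * y + z := by
  rw [doubleCover_eq_prod hf hs g l hN, eval_multiset_prod, Multiset.prod_eq_zero_iff,
    Multiset.map_map, Multiset.mem_map]
  constructor
  · rintro ⟨y, hy, h⟩
    refine ⟨y, t - l * y, (mem_roots hf.ne_zero).1 hy, ?_, by ring⟩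
    simpa [sub_eq_zero] using h
  · rintro ⟨y, z, hy, hz, rfl⟩
    refine ⟨y, (mem_roots hf.ne_zero).2 hy, ?_⟩
    simp [← hz]

end field

section

theorem resultant_derivative_eval_ne_zero {k : Type*} [Field k] [IsAlgClosed k] {f : k[X][X]}
    (hf : f.Monic) {x : k} (h : (f.map (evalRingHom x)).Separable) :
    (resultant f (derivative f)).eval x ≠ 0 := by
  have h1 : (resultant f (derivative f)).eval x = resultant (f.map (evalRingHom x))
      ((derivative f).map (evalRingHom x)) (f.map (evalRingHom x)).natDegree
      (derivative f).natDegree := by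
    rw [hf.natDegree_map, resultant_map_map]; rfl
  rw [h1, resultant_eq_prod_eval _ _ _ natDegree_map_le (IsAlgClosed.splits _),
    (hf.map _).leadingCoeff, one_pow, one_mul]
  refine Multiset.prod_ne_zero fun h0 => ?_
  obtain ⟨y, hy, h2⟩ := Multiset.mem_map.1 h0
  rw [mem_roots (hf.map _).ne_zero, IsRoot.def] at hy
  obtain ⟨a, b, hab⟩ := h
  have h3 := congrArg (Polynomial.eval y) hab
  rw [derivative_map, Polynomial.eval_add, Polynomial.eval_mul, Polynomial.eval_mul, hy, h2] at h3
  simp at h3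

variable {K : Type*} [Field K] [Fintype K]

theorem bmap_doubleCover {k : Type*} [Field k] (φ : K →+* k) {f : K[X][X]} (hf : f.Monic)
    (g : K[X][X]) (l : K) (N : ℕ) : bmap φ (doubleCover f g (C l) N) =
      doubleCover (bmap φ f) (bmap φ g) (C (φ l)) N := by
  rw [bmap_apply, doubleCover_map _ hf]
  simp [bmap_apply]

theorem exists_resultant_doubleCover_ne_zero {p n : ℕ} [CharP K p] (hp : n < p) (hp2 : 2 < p)
    {f g : K[X][X]} (hf : f.Monic) (hi : Irreducible f) (hD : f.natDegree ≠ 0)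
    (hn : f ∈ (bideg K).S n) (hg : g ∈ (bideg K).S n) (hfg : ¬ f ∣ g)
    (hK : (2 * n) ^ 2 < card K) :
    ∃ l : K, resultant (doubleCover f g (C l) (n + 2))
      (derivative (doubleCover f g (C l) (n + 2))) ≠ 0 := by
  let k := AlgebraicClosure K
  obtain ⟨φ, hφ⟩ : ∃ φ : K →+* k, φ = algebraMap K k := ⟨_, rfl⟩
  haveI : CharP k p := charP_of_injective_ringHom φ.injective p
  have h2 : (2 : k) ≠ 0 := by
    intro h
    have := (CharP.cast_eq_zero_iff k p 2).1 (by exact_mod_cast h)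
    exact absurd (Nat.le_of_dvd (by norm_num) this) (by omega)
  have hU : resultant f (derivative f) * resultant f g ≠ 0 :=
    mul_ne_zero (resultant_derivative_ne_zero hf hi hD hn hp)
      (resultant_ne_zero_of_not_dvd hf hi hfg)
  obtain ⟨x, hx⟩ : ∃ x : k, ((resultant f (derivative f) * resultant f g).map φ).eval x ≠ 0 := by
    by_contra! h
    exact (Polynomial.map_ne_zero_iff φ.injective).2 hU
      (Polynomial.funext fun x => by rw [h x, Polynomial.eval_zero])
  rw [Polynomial.map_mul, Polynomial.eval_mul, mul_ne_zero_iff, ← resultant_bmap,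
    ← resultant_bmap, ← derivative_bmap] at hx
  have hFm : (bmap φ f).Monic := hf.map _
  have hFd : (bmap φ f).natDegree = f.natDegree := hf.natDegree_map _
  have hN : max 2 (bmap φ g).natDegree ≤ n + 2 := by
    have := (mem_bideg.1 (bmap_mem φ hg)).2
    omega
  obtain ⟨S, hS, hS'⟩ := separable_doubleCover h2 (hFm.map (evalRingHom x))
    (g := (bmap φ g).map (evalRingHom x)) (separable_map_evalRingHom (by rwa [hFd]) hx.1)
    (fun y hy hy' => by
      rw [map_evalRingHom_eval] at hy hy'
      exact hx.2 (eval_resultant_eq_zero (by rwa [hFd]) hy hy'))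
    (le_trans (max_le_max le_rfl natDegree_map_le) hN)
  rw [hFm.natDegree_map, hFd] at hS
  obtain ⟨l, hl⟩ : ∃ l : K, φ l ∉ S := by
    by_contra! h
    have h3 := card_le_card (s := univ.image φ) (t := S) fun y hy => by
      obtain ⟨l, -, rfl⟩ := mem_image.1 hy
      exact h l
    rw [card_image_of_injective _ φ.injective, card_univ] at h3
    have h4 : (2 * f.natDegree) ^ 2 ≤ (2 * n) ^ 2 :=
      Nat.pow_le_pow_left (Nat.mul_le_mul_left _ (mem_bideg.1 hn).2) 2
    omega
  refine ⟨l, fun h0 => ?_⟩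
  have h5 := hS' _ hl
  have h6 := doubleCover_map (evalRingHom x) hFm (bmap φ g) (C (φ l)) (n + 2)
  rw [coe_evalRingHom, Polynomial.eval_C] at h6
  rw [← h6] at h5
  refine resultant_derivative_eval_ne_zero (monic_doubleCover hFm _ _ hN).1 h5 ?_
  rw [← bmap_doubleCover φ hf, derivative_bmap, resultant_bmap, h0, Polynomial.map_zero,
    Polynomial.eval_zero]

theorem card_points_doubleCover_filter {p n : ℕ} [CharP K p] [Fact p.Prime] (hp2 : 2 < p)
    {f g : K[X][X]} (hf : f.Monic) (hg : g ∈ (bideg K).S n) (l : K) :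
    ((((points (doubleCover f g (C l) (n + 2))).filter fun P => ¬ (resultant
      (doubleCover f g (C l) (n + 2)) (derivative (doubleCover f g (C l) (n + 2)))).eval P.1 = 0).card
        : ℕ) : ℤ) = ∑ P ∈ (points f).filter fun P => ¬ (resultant (doubleCover f g (C l) (n + 2))
          (derivative (doubleCover f g (C l) (n + 2)))).eval P.1 = 0,
            (1 + quadraticChar K (evalEval P.1 P.2 g)) := by
  have hN : max 2 g.natDegree ≤ n + 2 := by
    have := (mem_bideg.1 hg).2
    omega
  obtain ⟨F, hF⟩ : ∃ F, F = doubleCover f g (C l) (n + 2) := ⟨_, rfl⟩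
  have hFm : F.Monic := hF ▸ (monic_doubleCover hf _ _ hN).1
  rw [← hF]
  obtain ⟨R, hR⟩ : ∃ R, R = resultant F (derivative F) := ⟨_, rfl⟩
  rw [← hR]
  have hch : ringChar K ≠ 2 := by rw [ringChar.eq K p]; omega
  have h1 : ∀ a : K, 1 + quadraticChar K a =
      (((univ.filter fun z : K => z ^ 2 = a).card : ℕ) : ℤ) := fun a => by
    rw [add_comm, ← quadraticChar_card_sqrts hch]
    congr 2
    ext z; simp
  simp_rw [h1]
  rw [← Nat.cast_sum, ← card_sigma]
  norm_cast
  symm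
  by_cases hD : F.natDegree = 0
  · have hf1 : f = 1 := by
      rw [hF, (monic_doubleCover hf _ _ hN).2] at hD
      exact hf.natDegree_eq_zero.1 (by omega)
    have hF1 := hFm.natDegree_eq_zero.1 hD
    rw [hf1, hF1]
    have : points (1 : K[X][X]) = ∅ := by ext P; simp [mem_points]
    rw [this]; simp
  let k := AlgebraicClosure K
  obtain ⟨φ, hφ⟩ : ∃ φ : K →+* k, φ = algebraMap K k := ⟨_, rfl⟩
  have hmap : ∀ (x : K) (u : K[X][X]) (y : K), (u.map (φ.comp (evalRingHom x))).eval (φ y) =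
      φ (evalEval x y u) := fun x u y => by
    rw [← Polynomial.map_map, eval_map_apply, map_evalRingHom_eval]
  have hFx : ∀ x, F.map (φ.comp (evalRingHom x)) = doubleCover (f.map (φ.comp (evalRingHom x)))
      (g.map (φ.comp (evalRingHom x))) (φ l) (n + 2) := fun x => by
    rw [hF, doubleCover_map _ hf]
    simp
  have hNx : ∀ x, max 2 (g.map (φ.comp (evalRingHom x))).natDegree ≤ n + 2 := fun x =>
    le_trans (max_le_max le_rfl natDegree_map_le) hN
  have hsx : ∀ x, R.eval x ≠ 0 → (doubleCover (f.map (φ.comp (evalRingHom x)))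
      (g.map (φ.comp (evalRingHom x))) (φ l) (n + 2)).Separable := fun x hx => by
    rw [← hFx, ← Polynomial.map_map]
    exact (separable_map_evalRingHom hD (hR ▸ hx)).map
  have hinj : ∀ x, R.eval x ≠ 0 → ∀ y z y' z' : k,
      (f.map (φ.comp (evalRingHom x))).eval y = 0 → (f.map (φ.comp (evalRingHom x))).eval y' = 0 →
      z ^ 2 = (g.map (φ.comp (evalRingHom x))).eval y →
      z' ^ 2 = (g.map (φ.comp (evalRingHom x))).eval y' →
      φ l * y + z = φ l * y' + z' → y = y' ∧ z = z' := fun x hx y z y' z' h1 h2 h3 h4 h5 =>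
    eq_of_separable_doubleCover (hf.map _) (IsAlgClosed.splits _) (hNx x) (hsx x hx) h1 h2 h3 h4 h5
  have hfrob : ∀ (x : K) (u : K[X][X]) (y : k), (u.map (φ.comp (evalRingHom x))).eval
      (y ^ card K) = ((u.map (φ.comp (evalRingHom x))).eval y) ^ card K := by
    intro x u y
    haveI : CharP k p := charP_of_injective_ringHom φ.injective p
    obtain ⟨r, -, hr⟩ := FiniteField.card K p
    obtain ⟨ψ, hψ⟩ : ∃ ψ, ψ = iterateFrobenius k p r := ⟨_, rfl⟩
    have hψ' : ∀ a, a ^ card K = ψ a := fun a => by rw [hψ, iterateFrobenius_def, hr]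
    rw [hψ', hψ', ← eval_map_apply, Polynomial.map_map]
    congr 2
    refine RingHom.ext fun v => ?_
    rw [RingHom.comp_apply ψ, ← hψ', RingHom.comp_apply φ, ← map_pow φ, FiniteField.pow_card]
  refine card_bij (fun s _ => (s.1.1, l * s.1.2 + s.2)) ?_ ?_ ?_
  · rintro ⟨⟨x, y⟩, z⟩ h
    simp only [mem_sigma, mem_filter, mem_univ, true_and, mem_points] at h ⊢
    refine ⟨φ.injective ?_, h.1.2⟩
    rw [map_zero, ← hmap, hFx, eval_doubleCover_eq_zero_iff (hf.map _) (IsAlgClosed.splits _) (hNx x)]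
    refine ⟨φ y, φ z, ?_, ?_, by simp⟩
    · rw [hmap, h.1.1, map_zero]
    · rw [hmap, ← h.2, map_pow]
  · rintro ⟨⟨x, y⟩, z⟩ h ⟨⟨x', y'⟩, z'⟩ h' he
    simp only [mem_sigma, mem_filter, mem_univ, true_and, mem_points, Prod.mk.injEq] at h h' he
    obtain ⟨rfl, he⟩ := he
    obtain ⟨h3, h4⟩ := hinj x h.1.2 (φ y) (φ z) (φ y') (φ z') (by rw [hmap, h.1.1, map_zero])
      (by rw [hmap, h'.1.1, map_zero]) (by rw [hmap, ← h.2, map_pow])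
      (by rw [hmap, ← h'.2, map_pow]) (by rw [← map_mul, ← map_add, he, map_add, map_mul])
    obtain rfl := φ.injective h3
    obtain rfl := φ.injective h4
    rfl
  · rintro ⟨x, t⟩ h
    rw [mem_filter, mem_points] at h
    dsimp only at h
    have h1 : (doubleCover (f.map (φ.comp (evalRingHom x)))
      (g.map (φ.comp (evalRingHom x))) (φ l) (n + 2)).eval (φ t) = 0 := by
      rw [← hFx, hmap, h.1, map_zero]
    obtain ⟨y, z, hy, hz, ht⟩ :=
      (eval_doubleCover_eq_zero_iff (hf.map _) (IsAlgClosed.splits _) (hNx x) _).1 h1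
    have hq : card K ≠ 0 := Fintype.card_ne_zero
    obtain ⟨h3, h4⟩ := hinj x h.2 (y ^ card K) (z ^ card K) y z
      (by rw [hfrob, hy, zero_pow hq]) hy (by rw [hfrob, ← hz, ← pow_mul, ← pow_mul, mul_comm]) hz (by
        have h5 : φ t ^ card K = (φ l * y + z) ^ card K := by rw [ht]
        rw [← map_pow φ t, FiniteField.pow_card] at h5
        haveI : CharP k p := charP_of_injective_ringHom φ.injective p
        obtain ⟨r, -, hr⟩ := FiniteField.card K p
        rw [hr, add_pow_char_pow, ← hr, mul_pow, ← map_pow φ l, FiniteField.pow_card] at h5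
        rw [← h5, ht])
    rw [hφ] at hmap
    obtain ⟨y, rfl⟩ := (pow_card_eq_iff (K := K) y).1 h3
    obtain ⟨z, rfl⟩ := (pow_card_eq_iff (K := K) z).1 h4
    rw [hφ] at hy hz ht
    refine ⟨⟨⟨x, y⟩, z⟩, ?_, ?_⟩
    · simp only [mem_sigma, mem_filter, mem_univ, true_and, mem_points]
      rw [hmap] at hy hz
      refine ⟨⟨(algebraMap K k).injective (by rw [hy, map_zero]), h.2⟩,
        (algebraMap K k).injective (by rw [map_pow, hz])⟩
    · simp only [Prod.mk.injEq, true_and]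
      exact (algebraMap K k).injective (by rw [ht, map_add, map_mul])

end

section

variable {K : Type*} [Field K] [Fintype K] {p n : ℕ} [Fact p.Prime] [CharP K p]

theorem one_le_sqrt_card : 1 ≤ √(card K : ℝ) := by
  rw [Real.one_le_sqrt]
  exact_mod_cast Fintype.card_pos

theorem le_card_of_le_char {a : ℕ} (h : a ≤ p) : a ≤ card K := by
  obtain ⟨r, -, hr⟩ := FiniteField.card K p
  rw [hr]
  exact h.trans (Nat.le_self_pow r.ne_zero p)

theorem exists_card_points_of_irreducible (hp : n < p) (hp' : (100 * n ^ 2) ^ 2 ≤ p) {F : K[X][X]}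
    (hF : F.Monic) (hi : Irreducible F) (hn : F ∈ (bideg K).S n) :
    ∃ m : ℤ, |((points F).card : ℝ) - m * card K| ≤ (202 * n ^ 5 : ℕ) * √(card K : ℝ) := by
  have hD : F.natDegree ≠ 0 := fun h => hi.not_isUnit (by
    rw [hF.natDegree_eq_zero.1 h]; exact isUnit_one)
  by_cases h : Irreducible (bmap (algebraMap K (AlgebraicClosure K)) F)
  · refine ⟨1, ?_⟩
    obtain ⟨r, -, hr⟩ := FiniteField.card K p
    have h1 := abs_card_points_sub_le hr hF hD hn hp (hr ▸ le_card_of_le_char hp') h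
    rw [← hr] at h1
    have h2 : |((points F).card : ℝ) - card K| ≤
        202 * n ^ 5 * ((card K).sqrt : ℝ) := by exact_mod_cast h1
    rw [Int.cast_one, one_mul]
    refine h2.trans ?_
    push_cast
    gcongr
    exact Real.nat_sqrt_le_real_sqrt
  · refine ⟨0, ?_⟩
    have h1 : points F = (points F).filter fun P => (resultant F (derivative F)).eval P.1 = 0 := by
      rw [filter_true_of_mem]
      intro P hP
      rw [mem_points] at hP
      refine eval_resultant_eq_zero hD hP ?_
      by_contra h2
      obtain ⟨r, -, hr⟩ := FiniteField.card K p
      haveI : CharP (AlgebraicClosure K) p :=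
        charP_of_injective_algebraMap (algebraMap K (AlgebraicClosure K)).injective p
      exact h (irreducible_bmap hr hF hi hP h2)
    have h2 : (points F).card ≤ 2 * n ^ 3 := by
      rw [h1]; exact card_points_filter_resultant_le hF hi hD hn hp
    have h3 : 1 ≤ n := le_trans (Nat.pos_of_ne_zero hD) (mem_bideg.1 hn).2
    have h4 : 2 * n ^ 3 ≤ 202 * n ^ 5 :=
      Nat.mul_le_mul (by norm_num) (Nat.pow_le_pow_right h3 (by norm_num))
    rw [Int.cast_zero, zero_mul, sub_zero, Nat.abs_cast]
    calc ((points F).card : ℝ) ≤ (202 * n ^ 5 : ℕ) * 1 := by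
          rw [mul_one]; exact_mod_cast h2.trans h4
      _ ≤ _ := by gcongr; exact one_le_sqrt_card

theorem exists_card_points (hp : n < p) (hp' : (100 * n ^ 2) ^ 2 ≤ p) {F : K[X][X]}
    (hF : F.Monic) (hn : F ∈ (bideg K).S n) :
    ∃ m : ℤ, |((points F).card : ℝ) - m * card K| ≤ (204 * n ^ 6 : ℕ) * √(card K : ℝ) := by
  have h := exists_sum_points (w := fun _ => 1) (q := card K)
    (b := (202 * n ^ 5 : ℕ) * √(card K : ℝ)) (by simp) hF hn
    (fun A hA hi hAn _ => by simpa using exists_card_points_of_irreducible hp hp' hA hi hAn)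
    (by positivity)
  obtain ⟨m, hm⟩ := h
  refine ⟨m, ?_⟩
  simp only [sum_const, nsmul_eq_mul, mul_one] at hm
  refine hm.trans ?_
  have h1 : (1 : ℝ) ≤ √(card K : ℝ) := one_le_sqrt_card
  push_cast
  rcases Nat.eq_zero_or_pos n with rfl | h0
  · simp
  have h2 : (n : ℝ) ^ 3 ≤ n ^ 5 := pow_le_pow_right₀ (by exact_mod_cast h0) (by norm_num)
  have h3 : (n : ℝ) ^ 3 * 1 ≤ n ^ 5 * √(card K : ℝ) := by gcongr
  calc (n : ℝ) * (202 * n ^ 5 * √(card K : ℝ) + 2 * n ^ 3)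
      ≤ n * (202 * n ^ 5 * √(card K : ℝ) + 2 * (n ^ 5 * √(card K : ℝ))) := by gcongr; linarith
    _ = _ := by ring

theorem abs_quadraticChar_le_one (a : K) : |(quadraticChar K a : ℝ)| ≤ 1 := by
  by_cases h : a = 0
  · simp [h]
  · rcases quadraticChar_dichotomy h with h | h <;> simp [h]

theorem exists_sum_quadraticChar_of_irreducible (hp2 : 2 < p) {N : ℕ} (hN : N = 2 * n ^ 2 + 2 * n)
    (hp : N < p) (hp' : (100 * N ^ 2) ^ 2 ≤ p) {f g : K[X][X]}
    (hf : f.Monic) (hi : Irreducible f) (hn : f ∈ (bideg K).S n) (hg : g ∈ (bideg K).S n) :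
    ∃ m : ℤ, |∑ P ∈ points f, (quadraticChar K (evalEval P.1 P.2 g) : ℝ) - m * card K| ≤
      (412 * N ^ 6 : ℕ) * √(card K : ℝ) := by
  have hD : f.natDegree ≠ 0 := fun h => hi.not_isUnit (by
    rw [hf.natDegree_eq_zero.1 h]; exact isUnit_one)
  by_cases hfg : f ∣ g
  · refine ⟨0, ?_⟩
    rw [sum_eq_zero]
    · rw [Int.cast_zero, zero_mul, sub_zero, abs_zero]; positivity
    · intro P hP
      obtain ⟨h, rfl⟩ := hfg
      rw [mem_points] at hP
      rw [evalEval_mul, hP, zero_mul, MulChar.map_zero, Int.cast_zero]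
  have hn1 : 1 ≤ n := le_trans (Nat.pos_of_ne_zero hD) (mem_bideg.1 hn).2
  have hnN : n ≤ N := by rw [hN]; nlinarith
  have hnK : (2 * n) ^ 2 < card K := by
    have h1 : (100 * n ^ 2) ^ 2 ≤ (100 * N ^ 2) ^ 2 := by gcongr
    have h2 := h1.trans (le_card_of_le_char (K := K) hp')
    refine lt_of_lt_of_le ?_ h2
    nlinarith [Nat.mul_le_mul hn1 hn1]
  obtain ⟨l, hl⟩ := exists_resultant_doubleCover_ne_zero (hnN.trans_lt hp) hp2 hf hi hD hn hg hfg hnK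
  have hcard := card_points_doubleCover_filter hp2 hf hg l
  have hFn := doubleCover_mem hf hn hg l
  have hFm : (doubleCover f g (C l) (n + 2)).Monic :=
    (monic_doubleCover hf g (C l) (by have := (mem_bideg.1 hg).2; omega)).1
  rw [← hN] at hFn
  obtain ⟨F, hF⟩ : ∃ F, F = doubleCover f g (C l) (n + 2) := ⟨_, rfl⟩
  rw [← hF] at hl hcard hFn hFm
  obtain ⟨R, hR⟩ : ∃ R, R = resultant F (derivative F) := ⟨_, rfl⟩
  rw [← hR] at hl hcard
  have hRd : R.natDegree ≤ 2 * N * N := hR ▸ natDegree_resultant_le_sq hFn (derivative_mem hFn)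
  obtain ⟨m1, h1⟩ := exists_card_points hp hp' hFm hFn
  obtain ⟨m2, h2⟩ := exists_card_points_of_irreducible (hnN.trans_lt hp)
    (le_trans (by gcongr) hp') hf hi hn
  have hbF : ((points F).filter fun P => R.eval P.1 = 0).card ≤ 2 * N ^ 3 :=
    (card_points_filter_le hFm hl).trans ((Nat.mul_le_mul hRd (mem_bideg.1 hFn).2).trans
      (le_of_eq (by ring)))
  have hbf : ((points f).filter fun P => R.eval P.1 = 0).card ≤ 2 * N ^ 3 :=
    (card_points_filter_le hf hl).trans ((Nat.mul_le_mul hRd ((mem_bideg.1 hn).2.trans hnN)).trans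
      (le_of_eq (by ring)))
  have hsF := card_filter_add_card_filter_not (s := points F) (fun P => R.eval P.1 = 0)
  have hsf := card_filter_add_card_filter_not (s := points f) (fun P => R.eval P.1 = 0)
  have hsc := sum_filter_add_sum_filter_not (points f) (fun P => R.eval P.1 = 0)
    (fun P => (quadraticChar K (evalEval P.1 P.2 g) : ℝ))
  have hsb : |∑ P ∈ (points f).filter fun P => R.eval P.1 = 0,
      (quadraticChar K (evalEval P.1 P.2 g) : ℝ)| ≤ 2 * N ^ 3 := by
    refine (abs_sum_le_sum_abs _ _).trans
      ((sum_le_sum fun P _ => abs_quadraticChar_le_one _).trans ?_)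
    rw [sum_const, nsmul_eq_mul, mul_one]
    exact_mod_cast hbf
  rw [sum_add_distrib, sum_const, nsmul_eq_mul, mul_one] at hcard
  have hcard' := congrArg (Int.cast : ℤ → ℝ) hcard
  have hs : (1 : ℝ) ≤ √(card K : ℝ) := one_le_sqrt_card
  push_cast at hcard'
  refine ⟨m1 - m2, ?_⟩
  have hN0 : 1 ≤ N := hn1.trans hnN
  have e1 : (202 * n ^ 5 : ℕ) * √(card K : ℝ) ≤ 202 * N ^ 6 * √(card K : ℝ) := by
    push_cast
    have : (n : ℝ) ^ 5 ≤ N ^ 6 := by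
      exact_mod_cast (Nat.pow_le_pow_left hnN 5).trans (Nat.pow_le_pow_right hN0 (by norm_num))
    gcongr
  have e2 : (N : ℝ) ^ 3 ≤ N ^ 6 * √(card K : ℝ) := by
    have : (N : ℝ) ^ 3 ≤ N ^ 6 := pow_le_pow_right₀ (by exact_mod_cast hN0) (by norm_num)
    calc (N : ℝ) ^ 3 = N ^ 3 * 1 := (mul_one _).symm
      _ ≤ _ := by gcongr
  have hbF' : (((points F).filter fun P => R.eval P.1 = 0).card : ℝ) ≤ 2 * N ^ 3 := by
    exact_mod_cast hbF
  have hbf' : (((points f).filter fun P => R.eval P.1 = 0).card : ℝ) ≤ 2 * N ^ 3 := by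
    exact_mod_cast hbf
  have hsF' := congrArg (Nat.cast : ℕ → ℝ) hsF
  have hsf' := congrArg (Nat.cast : ℕ → ℝ) hsf
  push_cast at hsF' hsf' h1 ⊢
  have p1 : (0 : ℝ) ≤ (((points F).filter fun P => R.eval P.1 = 0).card : ℝ) := Nat.cast_nonneg _
  have p2 : (0 : ℝ) ≤ (((points f).filter fun P => R.eval P.1 = 0).card : ℝ) := Nat.cast_nonneg _
  rw [abs_le] at *
  constructor
  · linarith [h1.1, h1.2, h2.1, h2.2, hsb.1, hsb.2]
  · linarith [h1.1, h1.2, h2.1, h2.2, hsb.1, hsb.2]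

end

section

variable {K : Type*} [Field K] [Fintype K]

/-- The quadratic character of the first nonzero entry among three. -/
noncomputable def firstChar (x y z : K) : ℝ :=
  if x ≠ 0 then (quadraticChar K x : ℝ) else if y ≠ 0 then (quadraticChar K y : ℝ)
    else (quadraticChar K z : ℝ)

theorem abs_firstChar_le_one (x y z : K) : |firstChar x y z| ≤ 1 := by
  unfold firstChar
  split_ifs <;> exact abs_quadraticChar_le_one _

variable {p n : ℕ} [Fact p.Prime] [CharP K p]

theorem exists_sum_firstChar_of_irreducible (hp2 : 2 < p) {N : ℕ} (hN : N = 2 * n ^ 2 + 2 * n)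
    (hp : N < p) (hp' : (100 * N ^ 2) ^ 2 ≤ p) {f g₁ g₂ g₃ : K[X][X]}
    (hf : f.Monic) (hi : Irreducible f) (hn : f ∈ (bideg K).S n) (h₁ : g₁ ∈ (bideg K).S n)
    (h₂ : g₂ ∈ (bideg K).S n) (h₃ : g₃ ∈ (bideg K).S n) :
    ∃ m : ℤ, |∑ P ∈ points f, firstChar (evalEval P.1 P.2 g₁) (evalEval P.1 P.2 g₂)
      (evalEval P.1 P.2 g₃) - m * card K| ≤
      (414 * N ^ 6 : ℕ) * √(card K : ℝ) := by
  have hD : f.natDegree ≠ 0 := fun h => hi.not_isUnit (by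
    rw [hf.natDegree_eq_zero.1 h]; exact isUnit_one)
  have hn1 : 1 ≤ n := le_trans (Nat.pos_of_ne_zero hD) (mem_bideg.1 hn).2
  have hnN : n ≤ N := by rw [hN]; nlinarith
  have key : ∀ g : K[X][X], g ∈ (bideg K).S n → ¬ f ∣ g → ∀ w : K × K → ℝ, (∀ P, |w P| ≤ 1) →
      (∀ P, evalEval P.1 P.2 f = 0 → evalEval P.1 P.2 g ≠ 0 →
        w P = (quadraticChar K (evalEval P.1 P.2 g) : ℝ)) →
      ∃ m : ℤ, |∑ P ∈ points f, w P - m * card K| ≤ (414 * N ^ 6 : ℕ) * √(card K : ℝ) := by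
    intro g hg hfg w hw hwg
    obtain ⟨m, hm⟩ := exists_sum_quadraticChar_of_irreducible hp2 hN hp hp' hf hi hn hg
    refine ⟨m, ?_⟩
    have h1 : |∑ P ∈ points f, (w P - (quadraticChar K (evalEval P.1 P.2 g) : ℝ))| ≤
        ((points f ∩ points g).card : ℝ) := by
      have h2 : ∀ P ∈ points f, |w P - (quadraticChar K (evalEval P.1 P.2 g) : ℝ)| ≤
          if P ∈ points g then 1 else 0 := by
        intro P hP
        split_ifs with h
        · rw [mem_points] at h
          rw [h, MulChar.map_zero, Int.cast_zero, sub_zero]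
          exact hw P
        · rw [mem_points] at h hP
          rw [hwg P hP h, sub_self, abs_zero]
      refine (abs_sum_le_sum_abs _ _).trans ((sum_le_sum h2).trans (le_of_eq ?_))
      rw [sum_ite_mem, sum_const, nsmul_eq_mul, mul_one]
    have h2 : ((points f ∩ points g).card : ℝ) ≤ 2 * N ^ 6 * √(card K : ℝ) := by
      have h3 : ((points f ∩ points g).card : ℝ) ≤ 2 * n ^ 3 := by
        exact_mod_cast card_points_inter_le hf hi hn hg hfg
      have h4 : (n : ℝ) ^ 3 ≤ N ^ 6 := by
        exact_mod_cast (Nat.pow_le_pow_left hnN 3).trans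
          (Nat.pow_le_pow_right (hn1.trans hnN) (by norm_num))
      calc ((points f ∩ points g).card : ℝ) ≤ 2 * N ^ 6 * 1 := by linarith
        _ ≤ _ := by gcongr; exact one_le_sqrt_card
    rw [sum_sub_distrib] at h1
    push_cast at hm ⊢
    rw [abs_le] at *
    constructor <;> linarith [h1.1, h1.2, hm.1, hm.2]
  have hz : ∀ g : K[X][X], f ∣ g → ∀ P : K × K, evalEval P.1 P.2 f = 0 →
      evalEval P.1 P.2 g = 0 := by
    rintro g ⟨h, rfl⟩ P hP
    rw [evalEval_mul, hP, zero_mul]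
  by_cases d₁ : f ∣ g₁
  · by_cases d₂ : f ∣ g₂
    · by_cases d₃ : f ∣ g₃
      · refine ⟨0, ?_⟩
        rw [sum_eq_zero]
        · rw [Int.cast_zero, zero_mul, sub_zero, abs_zero]; positivity
        · intro P hP
          rw [mem_points] at hP
          rw [hz _ d₁ P hP, hz _ d₂ P hP, hz _ d₃ P hP]
          simp [firstChar]
      · refine key g₃ h₃ d₃ _ (fun P => abs_firstChar_le_one _ _ _) fun P hP h => ?_
        rw [hz _ d₁ P hP, hz _ d₂ P hP]
        simp [firstChar]
    · refine key g₂ h₂ d₂ _ (fun P => abs_firstChar_le_one _ _ _) fun P hP h => ?_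
      rw [hz _ d₁ P hP]
      simp [firstChar, h]
  · refine key g₁ h₁ d₁ _ (fun P => abs_firstChar_le_one _ _ _) fun P hP h => ?_
    simp [firstChar, h]

theorem exists_sum_firstChar (hp2 : 2 < p) {N : ℕ} (hN : N = 2 * n ^ 2 + 2 * n)
    (hp : N < p) (hp' : (100 * N ^ 2) ^ 2 ≤ p) {f g₁ g₂ g₃ : K[X][X]}
    (hf : f.Monic) (hn : f ∈ (bideg K).S n) (h₁ : g₁ ∈ (bideg K).S n)
    (h₂ : g₂ ∈ (bideg K).S n) (h₃ : g₃ ∈ (bideg K).S n) :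
    ∃ m : ℤ, |∑ P ∈ points f, firstChar (evalEval P.1 P.2 g₁) (evalEval P.1 P.2 g₂)
      (evalEval P.1 P.2 g₃) - m * card K| ≤
      (416 * N ^ 7 : ℕ) * √(card K : ℝ) := by
  obtain ⟨m, hm⟩ := exists_sum_points (w := fun P => firstChar (evalEval P.1 P.2 g₁)
      (evalEval P.1 P.2 g₂) (evalEval P.1 P.2 g₃)) (q := card K)
    (b := (414 * N ^ 6 : ℕ) * √(card K : ℝ)) (fun _ => abs_firstChar_le_one _ _ _) hf hn
    (fun A hA hi hAn _ => exists_sum_firstChar_of_irreducible hp2 hN hp hp' hA hi hAn h₁ h₂ h₃)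
    (by positivity)
  refine ⟨m, hm.trans ?_⟩
  rcases Nat.eq_zero_or_pos n with rfl | h0
  · rw [Nat.cast_zero, zero_mul]; positivity
  have hnN : n ≤ N := by rw [hN]; nlinarith
  have h4 : (n : ℝ) ^ 3 ≤ N ^ 6 := by
    exact_mod_cast (Nat.pow_le_pow_left hnN 3).trans
      (Nat.pow_le_pow_right (h0.trans_le hnN) (by norm_num))
  have h5 : (n : ℝ) ^ 3 ≤ N ^ 6 * √(card K : ℝ) :=
    h4.trans (le_mul_of_one_le_right (by positivity) one_le_sqrt_card)
  have h6 : (n : ℝ) ≤ N := by exact_mod_cast hnN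
  push_cast
  calc (n : ℝ) * (414 * N ^ 6 * √(card K : ℝ) + 2 * n ^ 3)
      ≤ N * (414 * N ^ 6 * √(card K : ℝ) + 2 * (N ^ 6 * √(card K : ℝ))) := by gcongr
    _ = _ := by ring

end

section

variable {K : Type*} [Field K] [Fintype K]

theorem sum_comp_mul_add {M : Type*} [AddCommMonoid M] (φ : K → M) {A : K} (hA : A ≠ 0) (B : K) :
    ∑ t, φ (A * t + B) = ∑ t, φ t :=
  Fintype.sum_equiv ((Equiv.mulLeft₀ A hA).trans (Equiv.addRight B)) _ _ fun _ => rfl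

theorem sum_ite_sq_eq (hK : ringChar K ≠ 2) (a : K) :
    ∑ x : K, δ[x ^ 2 = a] = quadraticChar K a + 1 := by
  rw [← quadraticChar_card_sqrts hK a, sum_boole, Set.toFinset_setOf]

theorem sum_ite_mul_eq (D : K) : ∑ x : K, ∑ y : K, δ[x * y = D] =
      if D = 0 then 2 * (card K : ℤ) - 1 else card K - 1 := by
  have h : ∀ x : K, ∑ y : K, δ[x * y = D] =
      if x = 0 then (if D = 0 then (card K : ℤ) else 0) else 1 := by
    intro x
    split_ifs with h1 h2
    · subst h1; subst h2; simp
    · subst h1; simp [Ne.symm h2]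
    · rw [sum_boole]
      have : (univ.filter fun y => x * y = D) = {D / x} := by
        ext y
        rw [mem_filter, mem_singleton, eq_div_iff h1, mul_comm]
        simp
      rw [this]; simp
  simp_rw [h]
  rw [← add_sum_erase _ _ (mem_univ (0 : K)), if_pos rfl,
    sum_congr rfl (g := fun _ => (1 : ℤ)) fun x hx => if_neg (ne_of_mem_erase hx)]
  rw [sum_const, card_erase_of_mem (mem_univ _), card_univ,
    nsmul_eq_mul, mul_one, Nat.cast_sub Fintype.card_pos]
  split_ifs <;> push_cast <;> ring

theorem sum_quadraticChar_sq_sub (hK : ringChar K ≠ 2) (D : K) :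
    ∑ t : K, quadraticChar K (t ^ 2 - D) = if D = 0 then (card K : ℤ) - 1 else -1 := by
  have h2 : (2 : K) ≠ 0 := Ring.two_ne_zero hK
  have h1 : ∑ t : K, ∑ s : K, δ[s ^ 2 = t ^ 2 - D] = ∑ x : K, ∑ y : K, δ[x * y = D] := by
    have : ∀ t : K, ∑ s : K, δ[s ^ 2 = t ^ 2 - D] = ∑ y : K, δ[(2 * t - y) * y = D] := by
      intro t
      rw [← sum_comp_mul_add (fun s => δ[s ^ 2 = t ^ 2 - D]) one_ne_zero (-t)]
      refine sum_congr rfl fun y _ => if_congr ?_ rfl rfl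
      constructor <;> intro h <;> linear_combination -h
    simp_rw [this]
    rw [sum_comm]
    conv_rhs => rw [sum_comm]
    refine sum_congr rfl fun y _ => ?_
    rw [← sum_comp_mul_add (fun x => δ[x * y = D]) h2 (-y)]
    simp only [sub_eq_add_neg]
  simp_rw [sum_ite_sq_eq hK] at h1
  rw [sum_add_distrib, sum_const, card_univ, nsmul_eq_mul, mul_one, sum_ite_mul_eq] at h1
  split_ifs at h1 ⊢ <;> linarith

theorem sum_quadraticChar_quadratic (hK : ringChar K ≠ 2) {A : K} (hA : A ≠ 0) (B C : K) :
    ∑ t : K, quadraticChar K (A * t ^ 2 + 2 * B * t + C) =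
      quadraticChar K A * if B ^ 2 - A * C = 0 then (card K : ℤ) - 1 else -1 := by
  rw [← sum_quadraticChar_sq_sub hK, mul_sum,
    ← sum_comp_mul_add (fun t => quadraticChar K A * quadraticChar K (t ^ 2 - (B ^ 2 - A * C))) hA B]
  refine sum_congr rfl fun t _ => ?_
  have : (A * t + B) ^ 2 - (B ^ 2 - A * C) = A * (A * t ^ 2 + 2 * B * t + C) := by ring
  rw [this, map_mul, ← mul_assoc, ← sq, quadraticChar_sq_one hA, one_mul]

theorem sum_ite_quadratic (hK : ringChar K ≠ 2) {A : K} (hA : A ≠ 0) (B C : K) :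
    ∑ t : K, δ[A * t ^ 2 + 2 * B * t + C = 0] = quadraticChar K (B ^ 2 - A * C) + 1 := by
  rw [← sum_ite_sq_eq hK, ← sum_comp_mul_add (fun t => δ[t ^ 2 = B ^ 2 - A * C]) hA B]
  refine sum_congr rfl fun t _ => if_congr ?_ rfl rfl
  conv_rhs => rw [← sub_eq_zero]
  have : (A * t + B) ^ 2 - (B ^ 2 - A * C) = A * (A * t ^ 2 + 2 * B * t + C) := by ring
  rw [this, mul_eq_zero, or_iff_right hA]

theorem sum_ite_linear {A : K} (hA : A ≠ 0) (B : K) : ∑ t : K, δ[A * t + B = 0] = 1 := by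
  rw [sum_comp_mul_add (fun t => δ[t = 0]) hA]
  simp

/-- The number of affine points of a conic. -/
noncomputable def conicCount (a b c d e f : K) : ℤ := ∑ t : K, ∑ s : K,
    if a * s ^ 2 + 2 * b * s * t + c * t ^ 2 + 2 * d * s + 2 * e * t + f = 0 then 1 else 0

/-- The number of points at infinity of a conic. -/
noncomputable def dirCount (a b c : K) : ℤ :=
  (∑ t : K, if a + 2 * b * t + c * t ^ 2 = 0 then 1 else 0) + if c = 0 then 1 else 0

/-- The determinant of a symmetric `3 × 3` matrix. -/
def symDet {R : Type*} [CommRing R] (a b c d e f : R) : R :=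
  a * c * f + 2 * b * d * e - a * e ^ 2 - c * d ^ 2 - b ^ 2 * f

theorem conicCount_swap (a b c d e f : K) : conicCount a b c d e f = conicCount c b a e d f := by
  unfold conicCount
  rw [sum_comm]
  refine sum_congr rfl fun t _ => sum_congr rfl fun s _ => if_congr ?_ rfl rfl
  constructor <;> intro h <;> linear_combination h

theorem symDet_swap {R : Type*} [CommRing R] (a b c d e f : R) :
    symDet a b c d e f = symDet c b a e d f := by
  unfold symDet; ring

theorem dirCount_eq (hK : ringChar K ≠ 2) {a b c : K} (h : ¬ (a = 0 ∧ b = 0 ∧ c = 0)) :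
    dirCount a b c = 1 + quadraticChar K (b ^ 2 - a * c) := by
  have h2 : (2 : K) ≠ 0 := Ring.two_ne_zero hK
  unfold dirCount
  by_cases hc : c = 0
  · subst hc
    by_cases hb : b = 0
    · subst hb
      have ha : a ≠ 0 := fun ha => h ⟨ha, rfl, rfl⟩
      simp [ha]
    · have := sum_ite_linear (mul_ne_zero h2 hb) a
      have h3 : ∑ t : K, δ[a + 2 * b * t + 0 * t ^ 2 = 0] = 1 := by
        refine (sum_congr rfl fun t _ => if_congr ?_ rfl rfl).trans this
        constructor <;> intro h <;> linear_combination h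
      rw [h3, if_pos rfl, mul_zero, sub_zero, quadraticChar_sq_one' hb]
  · rw [if_neg hc, add_zero, add_comm, mul_comm a c, ← sum_ite_quadratic hK hc]
    refine sum_congr rfl fun t _ => if_congr ?_ rfl rfl
    constructor <;> intro h <;> linear_combination h

theorem conicCount_of_ne (hK : ringChar K ≠ 2) {a : K} (ha : a ≠ 0) (b c d e f : K) :
    conicCount a b c d e f = card K - quadraticChar K (b ^ 2 - a * c) +
      if symDet a b c d e f = 0 then card K *
        (if b ^ 2 - a * c = 0 then quadraticChar K (d ^ 2 - a * f)
          else quadraticChar K (b ^ 2 - a * c)) else 0 := by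
  have h2 : (2 : K) ≠ 0 := Ring.two_ne_zero hK
  have h1 : conicCount a b c d e f = card K + ∑ t : K, quadraticChar K
      ((b ^ 2 - a * c) * t ^ 2 + 2 * (b * d - a * e) * t + (d ^ 2 - a * f)) := by
    unfold conicCount
    have : ∀ t : K, (∑ s : K, δ[a * s ^ 2 + 2 * b * s * t + c * t ^ 2 + 2 * d * s + 2 * e * t + f
        = 0]) = quadraticChar K
        ((b ^ 2 - a * c) * t ^ 2 + 2 * (b * d - a * e) * t + (d ^ 2 - a * f)) + 1 := by
      intro t
      have h3 : (b ^ 2 - a * c) * t ^ 2 + 2 * (b * d - a * e) * t + (d ^ 2 - a * f) =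
          (b * t + d) ^ 2 - a * (c * t ^ 2 + 2 * e * t + f) := by ring
      rw [h3, ← sum_ite_quadratic hK ha]
      refine sum_congr rfl fun s _ => if_congr ?_ rfl rfl
      constructor <;> intro h <;> linear_combination h
    simp_rw [this]
    rw [sum_add_distrib, sum_const, card_univ, nsmul_eq_mul, mul_one, add_comm]
  have hD : (b * d - a * e) ^ 2 - (b ^ 2 - a * c) * (d ^ 2 - a * f) =
      (-a) * symDet a b c d e f := by unfold symDet; ring
  rw [h1]
  by_cases hA : b ^ 2 - a * c = 0
  · rw [if_pos hA, hA, MulChar.map_zero]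
    have hD' : symDet a b c d e f = 0 ↔ b * d - a * e = 0 := by
      rw [hA, zero_mul, sub_zero] at hD
      constructor
      · intro h; rw [h, mul_zero] at hD; exact pow_eq_zero_iff two_ne_zero |>.1 hD
      · intro h
        rw [h, zero_pow two_ne_zero] at hD
        exact (mul_eq_zero.1 hD.symm).resolve_left (neg_ne_zero.2 ha)
    by_cases hB : b * d - a * e = 0
    · rw [if_pos (hD'.2 hB), hB]
      simp
    · rw [if_neg (mt hD'.1 hB)]
      simp only [zero_mul, zero_add, sub_zero, add_zero]
      rw [sum_comp_mul_add (fun t => quadraticChar K t) (mul_ne_zero h2 hB), quadraticChar_sum_zero hK,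
        add_zero]
  · rw [sum_quadraticChar_quadratic hK hA, if_neg hA, hD]
    by_cases hd : symDet a b c d e f = 0
    · rw [if_pos hd, hd, mul_zero, if_pos rfl]; ring
    · rw [if_neg hd, if_neg (mul_ne_zero (neg_ne_zero.2 ha) hd)]; ring

theorem conicCount_eq (hK : ringChar K ≠ 2) (a b c d e f : K) :
    (conicCount a b c d e f : ℝ) = card K + 1 - dirCount a b c + if symDet a b c d e f = 0 then
        card K * firstChar (b ^ 2 - a * c) (d ^ 2 - a * f) (e ^ 2 - c * f) +
        (card K : ℝ) ^ 2 *
          (if a = 0 ∧ b = 0 ∧ c = 0 ∧ d = 0 ∧ e = 0 ∧ f = 0 then 1 else 0) else 0 := by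
  have h2 : (2 : K) ≠ 0 := Ring.two_ne_zero hK
  by_cases habc : a = 0 ∧ b = 0 ∧ c = 0
  · obtain ⟨rfl, rfl, rfl⟩ := habc
    have h0 : symDet 0 0 0 d e f = 0 := by unfold symDet; ring
    rw [if_pos h0]
    have hdir : dirCount (0 : K) 0 0 = card K + 1 := by simp [dirCount]
    rw [hdir]
    by_cases hd : d = 0
    · by_cases he : e = 0
      · subst hd; subst he
        by_cases hf : f = 0
        · subst hf
          simp [conicCount, firstChar]
          ring
        · simp [conicCount, firstChar, hf]
      · subst hd
        have : conicCount 0 0 0 0 e f = card K := by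
          have h3 := sum_ite_linear (mul_ne_zero h2 he) f
          unfold conicCount
          simp only [zero_mul, mul_zero, zero_add, sum_const, card_univ, nsmul_eq_mul,
            ← mul_sum, h3, mul_one]
        have he2 : e ^ 2 ≠ 0 := pow_ne_zero 2 he
        rw [this]
        simp [firstChar, he, quadraticChar_sq_one' he, -quadraticChar_apply]
    · have : conicCount 0 0 0 d e f = card K := by
        unfold conicCount
        have h3 : ∀ t : K, (∑ s : K, δ[0 * s ^ 2 + 2 * 0 * s * t + 0 * t ^ 2 + 2 * d * s + 2 * e * t
            + f = 0]) = 1 := by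
          intro t
          refine (sum_congr rfl fun s _ => if_congr ?_ rfl rfl).trans
            (sum_ite_linear (mul_ne_zero h2 hd) (2 * e * t + f))
          constructor <;> intro h <;> linear_combination h
        simp_rw [h3]
        simp
      rw [this]
      simp [firstChar, hd, quadraticChar_sq_one' hd, -quadraticChar_apply]
  rw [if_neg (fun h : a = 0 ∧ b = 0 ∧ c = 0 ∧ d = 0 ∧ e = 0 ∧ f = 0 => habc ⟨h.1, h.2.1, h.2.2.1⟩),
    mul_zero, add_zero, dirCount_eq hK habc]
  by_cases ha : a = 0
  · by_cases hc : c = 0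
    · subst ha; subst hc
      have hb : b ≠ 0 := fun hb => habc ⟨rfl, hb, rfl⟩
      have hb2 : b ^ 2 ≠ 0 := pow_ne_zero 2 hb
      have h3 : conicCount 0 b 0 d e f = card K - 1 +
          if symDet 0 b 0 d e f = 0 then (card K : ℤ) else 0 := by
        unfold conicCount
        have h4 : ∀ t : K, (∑ s : K, δ[0 * s ^ 2 + 2 * b * s * t + 0 * t ^ 2 + 2 * d * s + 2 * e * t
            + f = 0]) =
            if t = - d / b then (if symDet 0 b 0 d e f = 0 then (card K : ℤ) else 0) else 1 := by
          intro t
          split_ifs with ht hD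
          · rw [sum_congr rfl (g := fun _ => (1 : ℤ))]
            · simp
            · intro s _
              rw [if_pos]
              have h5 : b * t = -d := by rw [ht]; field_simp
              have h6 : b ^ 2 * (2 * e * t + f) = 0 := by
                unfold symDet at hD
                linear_combination (2 * b * e) * h5 - hD
              have h7 := (mul_eq_zero.1 h6).resolve_left hb2
              linear_combination (2 * s) * h5 + h7
          · rw [sum_eq_zero]
            intro s _
            rw [if_neg]
            intro h6
            have h5 : b * t = -d := by rw [ht]; field_simp
            apply hD
            unfold symDet
            linear_combination (2 * b * e + 2 * s * b ^ 2) * h5 - b ^ 2 * h6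
          · have h5 : b * t + d ≠ 0 := by
              intro h5; apply ht; rw [eq_div_iff hb]; linear_combination h5
            refine (sum_congr rfl fun s _ => if_congr ?_ rfl rfl).trans
              (sum_ite_linear (mul_ne_zero h2 h5) (2 * e * t + f))
            constructor <;> intro h <;> linear_combination h
        simp_rw [h4]
        rw [← add_sum_erase _ _ (mem_univ (-d / b)), if_pos rfl,
          sum_congr rfl (g := fun _ => (1 : ℤ)) fun x hx => if_neg (ne_of_mem_erase hx)]
        rw [sum_const, card_erase_of_mem (mem_univ _), card_univ,
          nsmul_eq_mul, mul_one, Nat.cast_sub Fintype.card_pos]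
        push_cast; ring
      rw [h3]
      simp only [firstChar, zero_mul, sub_zero, ne_eq, hb2, not_false_eq_true, if_true,
        quadraticChar_sq_one' hb]
      split_ifs <;> push_cast <;> ring
    · rw [conicCount_swap, conicCount_of_ne hK hc, ← symDet_swap, mul_comm c a]
      subst ha
      by_cases hb : b = 0
      · subst hb
        have h3 : symDet 0 0 c d e f = 0 ↔ d = 0 := by
          have : symDet 0 0 c d e f = - c * d ^ 2 := by unfold symDet; ring
          rw [this]; simp [hc]
        by_cases hd : d = 0
        · subst hd
          simp [firstChar, h3]
        · simp [h3, hd]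
      · have hb2 : b ^ 2 ≠ 0 := pow_ne_zero 2 hb
        simp only [firstChar, zero_mul, sub_zero, ne_eq, hb2, not_false_eq_true, if_true, if_false]
        split_ifs <;> push_cast <;> ring
  · rw [conicCount_of_ne hK ha]
    by_cases hA : b ^ 2 - a * c = 0
    · simp only [firstChar, hA, if_true, ne_eq, not_true_eq_false, if_false]
      by_cases hf : d ^ 2 - a * f = 0
      · simp only [hf, not_true_eq_false, if_false]
        by_cases hD : symDet a b c d e f = 0
        · have h3 : e ^ 2 - c * f = 0 := by
            have h4 : (b * d - a * e) ^ 2 = 0 := by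
              have : (b * d - a * e) ^ 2 - (b ^ 2 - a * c) * (d ^ 2 - a * f) =
                (-a) * symDet a b c d e f := by unfold symDet; ring
              rw [hA, hD, zero_mul, mul_zero, sub_zero] at this
              exact this
            have h5 : b * d - a * e = 0 := pow_eq_zero_iff two_ne_zero |>.1 h4
            have h6 : a ^ 2 * (e ^ 2 - c * f) = 0 := by
              linear_combination (-(a * e) - b * d) * h5 + d ^ 2 * hA + a * c * hf
            exact (mul_eq_zero.1 h6).resolve_left (pow_ne_zero 2 ha)
          rw [h3]
          simp [hD]
        · simp [hD]
      · simp only [hf, not_false_eq_true, if_true]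
        split_ifs <;> push_cast <;> simp
    · simp only [firstChar, hA, ne_eq, not_false_eq_true, if_true, if_false]
      split_ifs <;> push_cast <;> ring

end

section

variable {K : Type*} [Field K]

/-- The symmetric trilinear form of the diagonal cubic form with coefficients `g`. -/
def tri {R : Type*} [CommRing R] (g x y z : Fin 6 → R) : R := ∑ i, g i * x i * y i * z i

/-- The discriminant of the conics in the planes through the line spanned by `u` and `w`. -/
def conicDet {R : Type*} [CommRing R] (g u w x : Fin 6 → R) : R :=
  symDet (3 * tri g u u x) (3 * tri g u w x) (3 * tri g w w x) (3 * tri g u x x) (3 * tri g w x x)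
    (4 * tri g x x x)

/-- The hyperplane orthogonal to `c`. -/
def hyp (c : Fin 6 → K) : Submodule K (Fin 6 → K) :=
  LinearMap.ker (∑ i, c i • LinearMap.proj i : (Fin 6 → K) →ₗ[K] K)

theorem mem_hyp {c x : Fin 6 → K} : x ∈ hyp c ↔ ∑ i, c i * x i = 0 := by
  simp [hyp, LinearMap.sum_apply]

theorem finrank_hyp {c : Fin 6 → K} (hc : c ≠ 0) : Module.finrank K (hyp c) = 5 := by
  have h : (∑ i, c i • LinearMap.proj i : (Fin 6 → K) →ₗ[K] K) ≠ 0 := by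
    obtain ⟨i, hi⟩ := ne_iff.1 hc
    intro h
    have := congrArg (fun f => f (Pi.single i 1)) h
    simp [LinearMap.sum_apply, Pi.single_apply] at this
    exact hi this
  have := Module.Dual.finrank_ker_add_one_of_ne_zero (K := K) h
  rw [Module.finrank_fin_fun] at this
  unfold hyp
  omega

theorem sub_single_mem_hyp (c : Fin 6 → K) (i j : Fin 6) :
    Pi.single i (c j) - Pi.single j (c i) ∈ hyp c := by
  rw [mem_hyp]
  simp [mul_sub, sum_sub_distrib, Pi.single_apply, mul_comm]

/-- The binary forms `F(su+tw)` that vanish identically. -/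
structure IsLine (g u w : Fin 6 → K) : Prop where
  uuu : tri g u u u = 0
  uuw : tri g u u w = 0
  uww : tri g u w w = 0
  www : tri g w w w = 0

theorem tri_sub_single (g x : Fin 6 → K) (y : Fin 6 → K) (i j : Fin 6) (a b : K) :
    tri g x y (Pi.single i a - Pi.single j b) = g i * x i * y i * a - g j * x j * y j * b := by
  simp [tri, mul_sub, sum_sub_distrib, Pi.single_apply]

theorem tri_single (g x : Fin 6 → K) (y : Fin 6 → K) (i : Fin 6) (a : K) :
    tri g x y (Pi.single i a) = g i * x i * y i * a := by
  simp [tri, Pi.single_apply]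

variable {R : Type*} [CommRing R]

theorem tri_add_smul (g x y z v : Fin 6 → R) (r : R) :
    tri g x y (z + r • v) = tri g x y z + r * tri g x y v := by
  simp only [tri, mul_sum, ← sum_add_distrib]
  exact sum_congr rfl fun i _ => by simp; ring

theorem tri_add_smul_sq (g x z v : Fin 6 → R) (r : R) :
    tri g x (z + r • v) (z + r • v) = tri g x z z + 2 * r * tri g x z v + r ^ 2 * tri g x v v := by
  simp only [tri, mul_sum, ← sum_add_distrib]
  exact sum_congr rfl fun i _ => by simp; ring

theorem tri_add_smul_cube (g z v : Fin 6 → R) (r : R) :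
    tri g (z + r • v) (z + r • v) (z + r • v) = tri g z z z + 3 * r * tri g z z v +
      3 * r ^ 2 * tri g z v v + r ^ 3 * tri g v v v := by
  simp only [tri, mul_sum, ← sum_add_distrib]
  exact sum_congr rfl fun i _ => by simp; ring

theorem tri_comm₁ (g x y z : Fin 6 → R) : tri g x y z = tri g y x z :=
  sum_congr rfl fun i _ => by ring

theorem tri_comm₂ (g x y z : Fin 6 → R) : tri g x y z = tri g x z y :=
  sum_congr rfl fun i _ => by ring

theorem exists_mul_eq_of_tri_eq_zero {g c y : Fin 6 → K} (hc : c ≠ 0)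
    (h : ∀ z ∈ hyp c, tri g y y z = 0) : ∃ μ, ∀ i, g i * y i ^ 2 = μ * c i := by
  obtain ⟨j, hj⟩ := ne_iff.1 hc
  refine ⟨g j * y j ^ 2 / c j, fun i => ?_⟩
  have := h _ (sub_single_mem_hyp c i j)
  rw [tri_sub_single] at this
  have hj' : c j ≠ 0 := hj
  field_simp
  linear_combination this

theorem eq_zero_of_forall_tri {g c w : Fin 6 → K} (h2 : (2 : K) ≠ 0) (hg : ∀ i, g i ≠ 0)
    (hc : 3 ≤ (univ.filter fun i => c i ≠ 0).card)
    (h : ∀ x ∈ hyp c, tri g w x x = 0) : w = 0 := by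
  have h' : ∀ x ∈ hyp c, ∀ y ∈ hyp c, tri g w x y = 0 := by
    intro x hx y hy
    have h1 := h _ ((hyp c).add_mem hx ((hyp c).smul_mem 1 hy))
    rw [tri_add_smul_sq, h x hx, h y hy] at h1
    have h3 : 2 * tri g w x y = 0 := by linear_combination h1
    exact (mul_eq_zero.1 h3).resolve_left h2
  funext j
  by_contra hj
  have hj : w j ≠ 0 := hj
  by_cases hcj : c j = 0
  · have hm : Pi.single j (1 : K) ∈ hyp c := by rw [mem_hyp]; simp [Pi.single_apply, hcj]
    have h1 := h _ hm
    rw [tri_single, Pi.single_eq_same] at h1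
    exact mul_ne_zero (hg j) hj (by linear_combination h1)
  · have hj2 : 1 < ((univ.filter fun i => c i ≠ 0).erase j).card := by
      rw [card_erase_of_mem (by simpa using hcj)]; omega
    obtain ⟨k, hk, l, hl, hkl⟩ := one_lt_card.1 hj2
    simp only [mem_erase, mem_filter, mem_univ, true_and] at hk hl
    have h1 := h' _ (sub_single_mem_hyp c j k) _ (sub_single_mem_hyp c j l)
    rw [tri_sub_single] at h1
    have e1 : (Pi.single j (c k) - Pi.single k (c j) : Fin 6 → K) j = c k := by
      simp [Pi.single_apply, Ne.symm hk.1]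
    have e2 : (Pi.single j (c k) - Pi.single k (c j) : Fin 6 → K) l = 0 := by
      simp [Pi.single_apply, hl.1, Ne.symm hkl]
    rw [e1, e2] at h1
    exact mul_ne_zero (mul_ne_zero (mul_ne_zero (hg j) hj) hk.2) hl.2 (by linear_combination h1)

theorem card_singular_le [Fintype K] {g c : Fin 6 → K} (hg : ∀ i, g i ≠ 0) :
    (univ.filter fun y : Fin 6 → K => ∃ μ, ∀ i, g i * y i ^ 2 = μ * c i).card ≤ 64 * card K := by
  have h1 : ∀ a b : K, a ≠ 0 → (univ.filter fun y : K => a * y ^ 2 = b).card ≤ 2 := by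
    intro a b ha
    by_contra h
    push Not at h
    obtain ⟨x, hx, y, hy, z, hz, hxy, hxz, hyz⟩ := two_lt_card.1 h
    simp only [mem_filter, mem_univ, true_and] at hx hy hz
    have e1 : a * ((x - y) * (x + y)) = 0 := by linear_combination hx - hy
    have e2 : a * ((x - z) * (x + z)) = 0 := by linear_combination hx - hz
    have e3 := (mul_eq_zero.1 ((mul_eq_zero.1 e1).resolve_left ha)).resolve_left (sub_ne_zero.2 hxy)
    have e4 := (mul_eq_zero.1 ((mul_eq_zero.1 e2).resolve_left ha)).resolve_left (sub_ne_zero.2 hxz)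
    exact hyz (by linear_combination e3 - e4)
  have h2 : (univ.filter fun y : Fin 6 → K => ∃ μ, ∀ i, g i * y i ^ 2 = μ * c i) ⊆
      univ.biUnion fun μ : K =>
        Fintype.piFinset fun i => univ.filter fun y : K => g i * y ^ 2 = μ * c i := by
    intro y hy
    simp only [mem_filter, mem_univ, true_and] at hy
    obtain ⟨μ, hμ⟩ := hy
    simp only [mem_biUnion, mem_univ, true_and, Fintype.mem_piFinset, mem_filter]
    exact ⟨μ, hμ⟩
  refine (card_le_card h2).trans (card_biUnion_le.trans ?_)
  refine (sum_le_card_nsmul _ _ 64 fun μ _ => ?_).trans ?_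
  · rw [Fintype.card_piFinset]
    exact (prod_le_prod' fun i _ => h1 (g i) (μ * c i) (hg i)).trans (by simp)
  · rw [card_univ, smul_eq_mul, mul_comm]

theorem card_hyp [Fintype K] {c : Fin 6 → K} (hc : c ≠ 0) :
    (univ.filter fun x => x ∈ hyp c).card = card K ^ 5 := by
  rw [← finrank_hyp hc, ← Module.card_eq_pow_finrank (K := K) (V := hyp c), Fintype.card_subtype]

theorem exists_add_smul_tri_eq_zero (h2 : (2 : K) ≠ 0) {g u w : Fin 6 → K} (hl : IsLine g u w)
    {x : Fin 6 → K} (hx : tri g u u x * tri g w w x - tri g u w x ^ 2 ≠ 0) :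
    ∃ a b : K, tri g u (x + a • u + b • w) (x + a • u + b • w) = 0 ∧
      tri g w (x + a • u + b • w) (x + a • u + b • w) = 0 ∧
      tri g u u (x + a • u + b • w) = tri g u u x ∧
      tri g u w (x + a • u + b • w) = tri g u w x ∧
      tri g w w (x + a • u + b • w) = tri g w w x := by
  obtain ⟨d, hd⟩ : ∃ d, d = tri g u u x * tri g w w x - tri g u w x ^ 2 := ⟨_, rfl⟩
  rw [← hd] at hx
  obtain ⟨l1, l2, l3, l4⟩ := hl
  have e1 : tri g u w u = 0 := by rw [tri_comm₂, l2]
  have e2 : tri g w u u = 0 := by rw [tri_comm₁, e1]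
  have e3 : tri g w w u = 0 := by rw [tri_comm₂, tri_comm₁, l3]
  have e4 : tri g w u w = 0 := by rw [tri_comm₁, l3]
  have c1 : tri g u x u = tri g u u x := tri_comm₂ ..
  have c2 : tri g u x w = tri g u w x := tri_comm₂ ..
  have c3 : tri g w x u = tri g u w x := by rw [tri_comm₂, tri_comm₁]
  have c4 : tri g w x w = tri g w w x := tri_comm₂ ..
  have f1 : ∀ (z : Fin 6 → K) (a b : K), tri g z (x + a • u + b • w) (x + a • u + b • w) =
      tri g z x x + 2 * a * tri g z x u + 2 * b * tri g z x w + a ^ 2 * tri g z u u +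
      2 * a * b * tri g z u w + b ^ 2 * tri g z w w := by
    intro z a b
    rw [tri_add_smul_sq, tri_add_smul_sq, tri_comm₂ g z (x + a • u) w, tri_add_smul,
      tri_comm₂ g z w x, tri_comm₂ g z w u]
    ring
  refine ⟨(tri g u w x * tri g w x x - tri g w w x * tri g u x x) / (2 * d),
    (tri g u w x * tri g u x x - tri g u u x * tri g w x x) / (2 * d), ?_, ?_, ?_, ?_, ?_⟩
  · rw [f1, l1, l2, l3, c1, c2]
    field_simp
    rw [hd]; ring
  · rw [f1, e2, e4, l4, c3, c4]
    field_simp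
    rw [hd]; ring
  · rw [tri_add_smul, tri_add_smul, l1, l2]; ring
  · rw [tri_add_smul, tri_add_smul, e1, l3]; ring
  · rw [tri_add_smul, tri_add_smul, e3, l4]; ring

theorem eq_zero_of_forall_symDet [Fintype K] (h2 : (2 : K) ≠ 0) (h3 : (3 : K) ≠ 0)
    (hK : 6 < card K) {a₀ a₁ b₀ b₁ c₀ c₁ d₁ d₂ e₁ e₂ f₁ f₂ f₃ : K}
    (hd : a₀ * c₀ - b₀ ^ 2 ≠ 0)
    (h : ∀ t : K, symDet (3 * (a₀ + t * a₁)) (3 * (b₀ + t * b₁)) (3 * (c₀ + t * c₁))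
      (3 * (2 * t * d₁ + t ^ 2 * d₂)) (3 * (2 * t * e₁ + t ^ 2 * e₂))
      (4 * (3 * t * f₁ + 3 * t ^ 2 * f₂ + t ^ 3 * f₃)) = 0) : f₁ = 0 := by
  obtain ⟨P, hP⟩ : ∃ P : K[X], P =
      36 * ((C a₀ + C a₁ * X) * (C c₀ + C c₁ * X) - (C b₀ + C b₁ * X) ^ 2) *
        (C (3 * f₁) + C (3 * f₂) * X + C f₃ * X ^ 2) +
      27 * X * (2 * (C b₀ + C b₁ * X) * (C (2 * d₁) + C d₂ * X) * (C (2 * e₁) + C e₂ * X) -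
        (C a₀ + C a₁ * X) * (C (2 * e₁) + C e₂ * X) ^ 2 -
        (C c₀ + C c₁ * X) * (C (2 * d₁) + C d₂ * X) ^ 2) := ⟨_, rfl⟩
  have hdeg : (P * X).natDegree < card K := by
    refine lt_of_le_of_lt ?_ hK
    rw [hP]
    compute_degree
    norm_num
  have h0 : P * X = 0 := by
    refine eq_zero_of_natDegree_lt_card_of_eval_eq_zero _ Function.injective_id (fun t => ?_) hdeg
    have := h t
    rw [hP]
    unfold symDet at this
    simp only [id, eval_mul, eval_add, eval_sub, eval_pow, eval_C, eval_X, eval_ofNat]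
    linear_combination this
  have h1 : P = 0 := (mul_eq_zero.1 h0).resolve_right X_ne_zero
  have h4 := congrArg (eval 0) h1
  rw [hP] at h4
  simp only [eval_mul, eval_add, eval_sub, eval_pow, eval_C, eval_X, eval_ofNat, eval_zero] at h4
  have h5 : 2 ^ 2 * 3 ^ 3 * (a₀ * c₀ - b₀ ^ 2) * f₁ = 0 := by linear_combination h4
  exact (mul_eq_zero.1 h5).resolve_left (mul_ne_zero (mul_ne_zero (pow_ne_zero 2 h2)
    (pow_ne_zero 3 h3)) hd)

end

section

variable {K : Type*} [Field K]

theorem IsLine.swap {g u w : Fin 6 → K} (h : IsLine g u w) : IsLine g w u :=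
  ⟨h.www, by rw [tri_comm₂, tri_comm₁, h.uww], by rw [tri_comm₁, tri_comm₂, h.uuw], h.uuu⟩

theorem conicDet_swap (g u w x : Fin 6 → K) : conicDet g u w x = conicDet g w u x := by
  unfold conicDet
  rw [symDet_swap, tri_comm₁ g u w x]

theorem exists_mul_eq_of_conicDet_eq_zero [Fintype K] (h2 : (2 : K) ≠ 0) (h3 : (3 : K) ≠ 0)
    (hK : 6 < card K) {g c u w : Fin 6 → K} (hc : c ≠ 0) (hu : u ∈ hyp c) (hw : w ∈ hyp c)
    (hl : IsLine g u w) (h : ∀ x ∈ hyp c, conicDet g u w x = 0) {x : Fin 6 → K} (hx : x ∈ hyp c)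
    (hd : tri g u u x * tri g w w x - tri g u w x ^ 2 ≠ 0) :
    ∃ a b : K, ∃ μ, ∀ i, g i * (x + a • u + b • w) i ^ 2 = μ * c i := by
  obtain ⟨a, b, e1, e2, e3, e4, e5⟩ := exists_add_smul_tri_eq_zero h2 hl hd
  refine ⟨a, b, exists_mul_eq_of_tri_eq_zero hc ?_⟩
  obtain ⟨y, hy⟩ : ∃ y, y = x + a • u + b • w := ⟨_, rfl⟩
  rw [← hy] at e1 e2 e3 e4 e5 ⊢
  have hyc : y ∈ hyp c := hy ▸ (hyp c).add_mem ((hyp c).add_mem hx ((hyp c).smul_mem a hu))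
    ((hyp c).smul_mem b hw)
  rw [← e3, ← e4, ← e5] at hd
  have h0 : tri g y y y = 0 := by
    have := h y hyc
    rw [conicDet, e1, e2] at this
    unfold symDet at this
    have h5 : 2 ^ 2 * 3 ^ 2 * (tri g u u y * tri g w w y - tri g u w y ^ 2) * tri g y y y = 0 := by
      linear_combination this
    exact (mul_eq_zero.1 h5).resolve_left (mul_ne_zero (mul_ne_zero (pow_ne_zero 2 h2)
      (pow_ne_zero 2 h3)) hd)
  intro z hz
  refine eq_zero_of_forall_symDet h2 h3 hK hd (a₁ := tri g u u z) (b₁ := tri g u w z)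
    (c₁ := tri g w w z) (d₁ := tri g u y z) (d₂ := tri g u z z) (e₁ := tri g w y z)
    (e₂ := tri g w z z) (f₂ := tri g y z z) (f₃ := tri g z z z) fun t => ?_
  have := h _ ((hyp c).add_mem hyc ((hyp c).smul_mem t hz))
  rw [conicDet, tri_add_smul, tri_add_smul, tri_add_smul, tri_add_smul_sq, tri_add_smul_sq,
    tri_add_smul_cube, e1, e2, h0] at this
  simpa only [zero_add] using this

theorem eq_zero_of_cubic (h2 : (2 : K) ≠ 0) (h3 : (3 : K) ≠ 0) {a₀ a₁ e₀ e₁ e₂ : K} (ha : a₁ ≠ 0)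
    (h : ∀ t : K, (a₀ + t * a₁) * (e₀ + 2 * t * e₁ + t ^ 2 * e₂) = 0) : e₀ = 0 := by
  have p0 := h 0
  have p1 := h 1
  have p2 := h (-1)
  have p3 := h 2
  have q3 : 2 * 3 * a₁ * e₂ = 0 := by linear_combination p3 - 3 * p1 + 3 * p0 - p2
  have e2 : e₂ = 0 := (mul_eq_zero.1 q3).resolve_left (mul_ne_zero (mul_ne_zero h2 h3) ha)
  have q2 : 2 ^ 2 * a₁ * e₁ = 0 := by linear_combination p1 + p2 - 2 * p0 - 2 * a₀ * e2
  have e1 : e₁ = 0 := (mul_eq_zero.1 q2).resolve_left (mul_ne_zero (pow_ne_zero 2 h2) ha)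
  have q1 : a₁ * e₀ = 0 := by linear_combination p1 - p0 - 2 * (a₀ + a₁) * e1 - (a₀ + a₁) * e2
  exact (mul_eq_zero.1 q1).resolve_left ha

theorem exists_eq_smul_of_conicDet_eq_zero (h2 : (2 : K) ≠ 0) (h3 : (3 : K) ≠ 0)
    {g c u w : Fin 6 → K} (hg : ∀ i, g i ≠ 0)
    (hc : 3 ≤ (univ.filter fun i => c i ≠ 0).card)
    (h : ∀ x ∈ hyp c, conicDet g u w x = 0)
    (hd : ∀ x ∈ hyp c, tri g u u x * tri g w w x - tri g u w x ^ 2 = 0) {x : Fin 6 → K}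
    (hx : x ∈ hyp c) (ha : tri g u u x ≠ 0) : ∃ r : K, w = r • u := by
  obtain ⟨r, hr⟩ : ∃ r : K, tri g u w x = r * tri g u u x := ⟨_, (div_mul_cancel₀ _ ha).symm⟩
  have key1 : ∀ y ∈ hyp c, tri g w w y - 2 * r * tri g u w y + r ^ 2 * tri g u u y = 0 := by
    intro y hy
    have h0 := hd x hx
    have h1 := hd _ ((hyp c).add_mem hy ((hyp c).smul_mem 1 hx))
    have h4 := hd _ ((hyp c).add_mem hy ((hyp c).smul_mem (-1) hx))
    rw [tri_add_smul, tri_add_smul, tri_add_smul] at h1 h4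
    have h5 : 2 * tri g u u x ^ 2 *
        (tri g w w y - 2 * r * tri g u w y + r ^ 2 * tri g u u y) = 0 := by
      linear_combination tri g u u x * (h1 - h4) - 2 * tri g u u y * h0 +
        (4 * tri g u u x * tri g u w y - 2 * tri g u u y * (tri g u w x + r * tri g u u x)) * hr
    exact (mul_eq_zero.1 h5).resolve_left (mul_ne_zero h2 (pow_ne_zero 2 ha))
  have key2 : ∀ y ∈ hyp c, tri g u w y = r * tri g u u y := by
    intro y hy
    have h0 := hd y hy
    have h1 := key1 y hy
    have : (tri g u w y - r * tri g u u y) ^ 2 = 0 := by linear_combination tri g u u y * h1 - h0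
    exact sub_eq_zero.1 (pow_eq_zero_iff two_ne_zero |>.1 this)
  have key3 : ∀ y ∈ hyp c, tri g u u y * (tri g w y y - r * tri g u y y) = 0 := by
    intro y hy
    have h1 := key1 y hy
    have h4 := key2 y hy
    have h5 := h y hy
    unfold conicDet symDet at h5
    have h6 : tri g w w y = r ^ 2 * tri g u u y := by linear_combination h1 + 2 * r * h4
    rw [h4, h6] at h5
    have h7 : 3 ^ 3 * (tri g u u y * (tri g w y y - r * tri g u y y)) ^ 2 = 0 := by
      linear_combination - tri g u u y * h5
    exact pow_eq_zero_iff two_ne_zero |>.1 ((mul_eq_zero.1 h7).resolve_left (pow_ne_zero 3 h3))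
  have hw : ∀ y z : Fin 6 → K, tri g (w - r • u) y z = tri g w y z - r * tri g u y z := by
    intro y z
    simp only [tri, mul_sum, ← sum_sub_distrib]
    exact sum_congr rfl fun i _ => by simp; ring
  refine ⟨r, sub_eq_zero.1 (eq_zero_of_forall_tri (g := g) (c := c) h2 hg hc fun y hy => ?_)⟩
  refine eq_zero_of_cubic h2 h3 ha (a₀ := tri g u u y) (e₁ := tri g (w - r • u) y x)
    (e₂ := tri g (w - r • u) x x) fun t => ?_
  have := key3 _ ((hyp c).add_mem hy ((hyp c).smul_mem t hx))
  rw [← hw, tri_add_smul, tri_add_smul_sq] at this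
  exact this

theorem exists_conicDet_ne_zero [Fintype K] (h2 : (2 : K) ≠ 0) (h3 : (3 : K) ≠ 0)
    (hK : 192 < card K) {g c u w : Fin 6 → K} (hg : ∀ i, g i ≠ 0)
    (hc : 3 ≤ (univ.filter fun i => c i ≠ 0).card) (hu : u ∈ hyp c) (hw : w ∈ hyp c)
    (hl : IsLine g u w) (huw : LinearIndependent K ![u, w]) :
    ∃ x ∈ hyp c, conicDet g u w x ≠ 0 := by
  by_contra! h
  have hc0 : c ≠ 0 := by rintro rfl; simp at hc
  obtain ⟨S, hS⟩ : ∃ S : Finset (Fin 6 → K), S =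
    univ.filter fun y : Fin 6 → K => ∃ μ, ∀ i, g i * y i ^ 2 = μ * c i := ⟨_, rfl⟩
  have hSc : S.card ≤ 64 * card K := hS ▸ card_singular_le hg
  have hmem : ∀ y, y ∈ S ↔ ∃ μ, ∀ i, g i * y i ^ 2 = μ * c i := fun y => by simp [hS]
  by_cases hd : ∀ x ∈ hyp c, tri g u u x * tri g w w x - tri g u w x ^ 2 = 0
  · have ha : ∀ x ∈ hyp c, tri g u u x = 0 := by
      intro x hx
      by_contra ha
      obtain ⟨r, hr⟩ := exists_eq_smul_of_conicDet_eq_zero h2 h3 hg hc h hd hx ha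
      have := LinearIndependent.pair_iff.1 huw r (-1) (by rw [hr]; simp)
      simp at this
    have hw' : ∀ x ∈ hyp c, tri g w w x = 0 := by
      intro x hx
      by_contra ha
      obtain ⟨r, hr⟩ := exists_eq_smul_of_conicDet_eq_zero h2 h3 hg hc
        (fun x hx => conicDet_swap g u w x ▸ h x hx)
        (fun x hx => by rw [tri_comm₁ g w u x]; linear_combination hd x hx) hx ha
      have := LinearIndependent.pair_iff.1 huw (-1) r (by rw [hr]; simp)
      simp at this
    have hb : ∀ x ∈ hyp c, tri g u w x = 0 := by
      intro x hx
      have := hd x hx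
      rw [ha x hx, zero_mul, zero_sub, neg_eq_zero] at this
      exact pow_eq_zero_iff two_ne_zero |>.1 this
    have hinj : Injective fun st : K × K => st.1 • u + st.2 • w := by
      rintro ⟨s, t⟩ ⟨s', t'⟩ h
      simp only at h
      have := LinearIndependent.pair_iff.1 huw (s - s') (t - t') (by
        rw [sub_smul, sub_smul]
        have h' := sub_eq_zero.2 h
        rw [← h']; abel)
      rw [sub_eq_zero, sub_eq_zero] at this
      exact Prod.ext this.1 this.2
    have hsub : univ.image (fun st : K × K => st.1 • u + st.2 • w) ⊆ S := by
      intro y hy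
      obtain ⟨⟨s, t⟩, -, rfl⟩ := mem_image.1 hy
      rw [hmem]
      refine exists_mul_eq_of_tri_eq_zero hc0 fun z hz => ?_
      have : tri g (s • u + t • w) (s • u + t • w) z = s ^ 2 * tri g u u z +
          2 * s * t * tri g u w z + t ^ 2 * tri g w w z := by
        simp only [tri, mul_sum, ← sum_add_distrib]
        exact sum_congr rfl fun i _ => by simp; ring
      rw [this, ha z hz, hb z hz, hw' z hz]; ring
    have := (card_le_card hsub).trans hSc
    rw [card_image_of_injective _ hinj, card_univ, Fintype.card_prod] at this
    nlinarith
  · push Not at hd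
    obtain ⟨x₀, hx₀, hd₀⟩ := hd
    obtain ⟨T, hT⟩ : ∃ T : Finset K, T = {1, -1, 2⁻¹} := ⟨_, rfl⟩
    have hTc : T.card ≤ 3 := hT ▸ card_le_three
    have hsub : (univ.filter fun x => x ∈ hyp c) ⊆ (S ×ˢ T ×ˢ (univ : Finset (K × K))).image
          fun q => q.2.1 • (q.1 - q.2.2.1 • u - q.2.2.2 • w - x₀) := by
      intro x hx
      have hx : x ∈ hyp c := by simpa using hx
      have key : ∀ t : K, t⁻¹ ∈ T → t ≠ 0 → tri g u u (x₀ + t • x) * tri g w w (x₀ + t • x) -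
          tri g u w (x₀ + t • x) ^ 2 ≠ 0 → x ∈
          (S ×ˢ T ×ˢ (univ : Finset (K × K))).image
          fun q => q.2.1 • (q.1 - q.2.2.1 • u - q.2.2.2 • w - x₀) := by
        intro t htT ht hne
        obtain ⟨a, b, hμ⟩ := exists_mul_eq_of_conicDet_eq_zero h2 h3 (by omega) hc0 hu hw hl h
          ((hyp c).add_mem hx₀ ((hyp c).smul_mem t hx)) hne
        refine mem_image.2 ⟨(x₀ + t • x + a • u + b • w, t⁻¹, a, b), ?_, ?_⟩
        · simp only [mem_product, mem_univ, and_true]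
          exact ⟨(hmem _).2 hμ, htT⟩
        · simp only
          have : x₀ + t • x + a • u + b • w - a • u - b • w - x₀ = t • x := by abel
          rw [this, smul_smul, inv_mul_cancel₀ ht, one_smul]
      by_cases h1 : tri g u u (x₀ + (1 : K) • x) * tri g w w (x₀ + (1 : K) • x) -
          tri g u w (x₀ + (1 : K) • x) ^ 2 = 0
      · by_cases h4 : tri g u u (x₀ + (-1 : K) • x) * tri g w w (x₀ + (-1 : K) • x) -
          tri g u w (x₀ + (-1 : K) • x) ^ 2 = 0
        · by_cases h5 : tri g u u (x₀ + (2 : K) • x) * tri g w w (x₀ + (2 : K) • x) -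
            tri g u w (x₀ + (2 : K) • x) ^ 2 = 0
          · exfalso
            rw [tri_add_smul, tri_add_smul, tri_add_smul] at h1 h4 h5
            have h6 : 3 * (tri g u u x₀ * tri g w w x₀ - tri g u w x₀ ^ 2) = 0 := by
              linear_combination 3 * h1 + h4 - h5
            exact mul_ne_zero h3 hd₀ h6
          · exact key 2 (by simp [hT]) h2 h5
        · exact key (-1) (by simp [hT, inv_neg]) (by simp) h4
      · exact key 1 (by simp [hT]) one_ne_zero h1
    have h1 := (card_le_card hsub).trans card_image_le
    rw [card_hyp hc0, card_product, card_product, card_univ, Fintype.card_prod] at h1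
    have h4 : S.card * (T.card * (card K * card K)) ≤
        64 * card K * (3 * (card K * card K)) := by gcongr
    have h5 : card K ^ 3 * card K ^ 2 ≤ card K ^ 3 * 192 := by
      calc _ = card K ^ 5 := by ring
        _ ≤ _ := h1.trans h4
        _ = _ := by ring
    have h6 := Nat.le_of_mul_le_mul_left h5 (by positivity)
    nlinarith

end

section

variable {K : Type*} [Field K] [Fintype K]

theorem sum_comp_mul {M : Type*} [AddCommMonoid M] (φ : K → M) {A : K} (hA : A ≠ 0) :
    ∑ t, φ (A * t) = ∑ t, φ t := by
  simpa using sum_comp_mul_add φ hA 0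

theorem sum_ite_linear_form (α β γ : K) :
    ∃ k : ℤ, ∑ x : K, ∑ y : K, ∑ z : K, δ[α * x + β * y + γ * z = 0] =
      (card K : ℤ) ^ 2 + k * ((card K : ℤ) ^ 2 * (card K - 1)) := by
  by_cases hγ : γ = 0
  · by_cases hβ : β = 0
    · by_cases hα : α = 0
      · refine ⟨1, ?_⟩
        simp [hα, hβ, hγ]
        ring
      · refine ⟨0, ?_⟩
        simp only [hβ, hγ, zero_mul, sum_const, card_univ, nsmul_eq_mul, ← mul_sum, add_zero]
        have := sum_ite_linear hα 0
        simp only [add_zero] at this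
        rw [this]; ring
    · refine ⟨0, ?_⟩
      have : ∀ x, ∑ y : K, δ[α * x + β * y = 0] = 1 := fun x => by
        have := sum_ite_linear hβ (α * x)
        simpa only [add_comm] using this
      simp only [hγ, zero_mul, sum_const, card_univ, nsmul_eq_mul, ← mul_sum, add_zero, this]
      ring
  · refine ⟨0, ?_⟩
    have : ∀ x y, ∑ z : K, δ[α * x + β * y + γ * z = 0] = 1 := fun x y => by
      have := sum_ite_linear hγ (α * x + β * y)
      simpa only [add_comm (γ * _)] using this
    simp only [this, sum_const, card_univ, nsmul_eq_mul]
    ring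

theorem sum_eq_of_homogeneous₁ (h : K → ℝ) (hh : ∀ l x, l ≠ 0 → h (l * x) = h x) :
    ∑ x, h x = h 0 + (card K - 1) * h 1 := by
  rw [← add_sum_erase _ _ (mem_univ (0 : K)), sum_congr rfl (g := fun _ => h 1) fun x hx => ?_]
  · rw [sum_const, card_erase_of_mem (mem_univ _), card_univ,
      nsmul_eq_mul, Nat.cast_sub Fintype.card_pos, Nat.cast_one]
  · have := hh x 1 (ne_of_mem_erase hx)
    rwa [mul_one] at this

theorem sum_eq_of_homogeneous₃ (h : K → K → K → ℝ)
    (hh : ∀ l x y z, l ≠ 0 → h (l * x) (l * y) (l * z) = h x y z) :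
    ∑ x, ∑ y, ∑ z, h x y z = h 0 0 0 + (card K - 1) *
      (∑ y, ∑ z, h 1 y z + ∑ z, h 0 1 z + h 0 0 1) := by
  rw [sum_eq_of_homogeneous₁ (fun x => ∑ y, ∑ z, h x y z)]
  · rw [sum_eq_of_homogeneous₁ (fun y => ∑ z, h 0 y z), sum_eq_of_homogeneous₁ (fun z => h 0 0 z)]
    · ring
    · intro l z hl
      simpa using hh l 0 0 z hl
    · intro l y hl
      rw [← sum_comp_mul (fun z => h 0 (l * y) z) hl]
      refine sum_congr rfl fun z _ => ?_
      simpa using hh l 0 y z hl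
  · intro l x hl
    rw [← sum_comp_mul (fun y => ∑ z, h (l * x) y z) hl]
    refine sum_congr rfl fun y _ => ?_
    rw [← sum_comp_mul (fun z => h (l * x) (l * y) z) hl]
    exact sum_congr rfl fun z _ => hh l x y z hl

end

section

variable {A : Type*} [CommRing A]

/-- `P` has degree at most `n`, with `n`-th coefficient `v`. -/
def HasLead (n : ℕ) (P : A[X]) (v : A) : Prop := P.natDegree ≤ n ∧ P.coeff n = v

theorem HasLead.add {n : ℕ} {P Q : A[X]} {v w : A} (hP : HasLead n P v) (hQ : HasLead n Q w) :
    HasLead n (P + Q) (v + w) :=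
  ⟨natDegree_add_le_of_degree_le hP.1 hQ.1, by rw [coeff_add, hP.2, hQ.2]⟩

theorem HasLead.sub {n : ℕ} {P Q : A[X]} {v w : A} (hP : HasLead n P v) (hQ : HasLead n Q w) :
    HasLead n (P - Q) (v - w) :=
  ⟨(natDegree_sub_le _ _).trans (max_le hP.1 hQ.1), by rw [coeff_sub, hP.2, hQ.2]⟩

theorem HasLead.mul {n m : ℕ} {P Q : A[X]} {v w : A} (hP : HasLead n P v) (hQ : HasLead m Q w) :
    HasLead (n + m) (P * Q) (v * w) :=
  ⟨natDegree_mul_le_of_le hP.1 hQ.1, by rw [coeff_mul_add_eq_of_natDegree_le hP.1 hQ.1, hP.2, hQ.2]⟩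

theorem hasLead_C (a : A) : HasLead 0 (C a) a := ⟨by simp, by simp⟩

theorem HasLead.congr {n m : ℕ} {P Q : A[X]} {v w : A} (hP : HasLead n P v) (h1 : n = m)
    (h2 : P = Q) (h3 : v = w) : HasLead m Q w := by
  subst h1; subst h2; subst h3; exact hP

theorem HasLead.sum {ι : Type*} (s : Finset ι) {n : ℕ} {P : ι → A[X]} {v : ι → A}
    (h : ∀ i ∈ s, HasLead n (P i) (v i)) : HasLead n (∑ i ∈ s, P i) (∑ i ∈ s, v i) := by
  induction s using Finset.induction_on with
  | empty => exact ⟨by simp, by simp⟩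
  | insert a s ha ih =>
    rw [sum_insert ha, sum_insert ha]
    exact (h a (mem_insert_self a s)).add (ih fun i hi => h i (mem_insert_of_mem hi))

theorem HasLead.tri {n₁ n₂ n₃ : ℕ} {g : Fin 6 → A} {x y z : Fin 6 → A[X]} {x' y' z' : Fin 6 → A}
    (hx : ∀ i, HasLead n₁ (x i) (x' i)) (hy : ∀ i, HasLead n₂ (y i) (y' i))
    (hz : ∀ i, HasLead n₃ (z i) (z' i)) :
    HasLead (n₁ + n₂ + n₃) (tri (fun i => C (g i)) x y z) (tri g x' y' z') :=
  HasLead.sum _ fun i _ => ((((hasLead_C (g i)).mul (hx i)).mul (hy i)).mul (hz i)).congr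
    (by ring) rfl rfl

theorem HasLead.symDet {a b c d e f : A[X]} {a' b' c' d' e' f' : A} (ha : HasLead 1 a a')
    (hb : HasLead 1 b b') (hc : HasLead 1 c c') (hd : HasLead 2 d d') (he : HasLead 2 e e')
    (hf : HasLead 3 f f') : HasLead 5 (symDet a b c d e f) (symDet a' b' c' d' e' f') := by
  have h2 : HasLead 0 (2 : A[X]) (2 : A) := hasLead_C 2
  have h := (((((ha.mul hc).mul hf).add (((h2.mul hb).mul hd).mul he)).sub
    (ha.mul (he.mul he))).sub (hc.mul (hd.mul hd))).sub ((hb.mul hb).mul hf)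
  exact h.congr rfl (by unfold Stepanov.symDet; ring) (by unfold Stepanov.symDet; ring)

theorem HasLead.conicDet {g u w : Fin 6 → A} {x : Fin 6 → A[X]} {x' : Fin 6 → A}
    (hx : ∀ i, HasLead 1 (x i) (x' i)) :
    HasLead 5 (conicDet (fun i => C (g i)) (fun i => C (u i)) (fun i => C (w i)) x)
      (conicDet g u w x') := by
  have hu : ∀ i, HasLead 0 (C (u i)) (u i) := fun i => hasLead_C _
  have hw : ∀ i, HasLead 0 (C (w i)) (w i) := fun i => hasLead_C _
  have h3 : HasLead 0 (3 : A[X]) (3 : A) := hasLead_C 3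
  have h4 : HasLead 0 (4 : A[X]) (4 : A) := hasLead_C 4
  exact HasLead.symDet (h3.mul (HasLead.tri hu hu hx)) (h3.mul (HasLead.tri hu hw hx))
    (h3.mul (HasLead.tri hw hw hx)) (h3.mul (HasLead.tri hu hx hx)) (h3.mul (HasLead.tri hw hx hx))
    (h4.mul (HasLead.tri hx hx hx))

variable {B : Type*} [CommRing B]

theorem map_tri (φ : A →+* B) (g x y z : Fin 6 → A) :
    φ (tri g x y z) = tri (fun i => φ (g i)) (fun i => φ (x i)) (fun i => φ (y i))
      (fun i => φ (z i)) := by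
  simp only [tri, map_sum, map_mul]

theorem map_conicDet (φ : A →+* B) (g u w x : Fin 6 → A) :
    φ (conicDet g u w x) = conicDet (fun i => φ (g i)) (fun i => φ (u i)) (fun i => φ (w i))
      (fun i => φ (x i)) := by
  simp only [conicDet, symDet, map_sub, map_add, map_mul, map_pow, map_tri, map_ofNat]

variable (F : Filt A)

theorem tri_mem {g x y z : Fin 6 → A} {n₁ n₂ n₃ : ℤ} (hg : ∀ i, g i ∈ F.S 0)
    (hx : ∀ i, x i ∈ F.S n₁) (hy : ∀ i, y i ∈ F.S n₂) (hz : ∀ i, z i ∈ F.S n₃) :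
    tri g x y z ∈ F.S (n₁ + n₂ + n₃) :=
  sum_mem fun i _ => by
    have := F.mul_mem (F.mul_mem (F.mul_mem (hg i) (hx i)) (hy i)) (hz i)
    rwa [zero_add] at this

theorem natCast_mul_mem {n : ℤ} (m : ℕ) {x : A} (hx : x ∈ F.S n) : (m : A) * x ∈ F.S n := by
  rw [← nsmul_eq_mul]; exact nsmul_mem hx m

end

section

variable {K : Type*} [Field K] [Fintype K]

/-- The contribution of the degenerate conics to `conicCount`. -/
noncomputable def conicTerm (a b c d e f : K) : ℝ := if symDet a b c d e f = 0 then
    card K * firstChar (b ^ 2 - a * c) (d ^ 2 - a * f) (e ^ 2 - c * f) +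
      (card K : ℝ) ^ 2 * (if a = 0 ∧ b = 0 ∧ c = 0 ∧ d = 0 ∧ e = 0 ∧ f = 0 then 1 else 0)
  else 0

theorem firstChar_mul_sq {a b c : K} (ha : a ≠ 0) (hb : b ≠ 0) (hc : c ≠ 0) (x y z : K) :
    firstChar (a ^ 2 * x) (b ^ 2 * y) (c ^ 2 * z) = firstChar x y z := by
  have h : ∀ a x : K, a ≠ 0 → quadraticChar K (a ^ 2 * x) = quadraticChar K x := fun a x ha => by
    rw [map_mul, quadraticChar_sq_one' ha, one_mul]
  simp only [firstChar, h a x ha, h b y hb, h c z hc, ne_eq, mul_eq_zero, pow_eq_zero_iff,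
    ha, hb, hc, false_or, OfNat.ofNat_ne_zero, not_false_eq_true]

theorem conicTerm_mul {l : K} (hl : l ≠ 0) (a b c d e f : K) :
    conicTerm (l * a) (l * b) (l * c) (l ^ 2 * d) (l ^ 2 * e) (l ^ 3 * f) =
      conicTerm a b c d e f := by
  have h1 : symDet (l * a) (l * b) (l * c) (l ^ 2 * d) (l ^ 2 * e) (l ^ 3 * f) =
      l ^ 5 * symDet a b c d e f := by unfold symDet; ring
  have h2 : firstChar ((l * b) ^ 2 - l * a * (l * c)) ((l ^ 2 * d) ^ 2 - l * a * (l ^ 3 * f))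
      ((l ^ 2 * e) ^ 2 - l * c * (l ^ 3 * f)) =
      firstChar (b ^ 2 - a * c) (d ^ 2 - a * f) (e ^ 2 - c * f) := by
    rw [← firstChar_mul_sq hl (pow_ne_zero 2 hl) (pow_ne_zero 2 hl) (b ^ 2 - a * c)]
    congr 1 <;> ring
  unfold conicTerm
  rw [h1, h2]
  simp only [mul_eq_zero, pow_eq_zero_iff, ne_eq, OfNat.ofNat_ne_zero, not_false_eq_true, hl,
    false_or]

/-- The contribution of the plane through a line and the point `x`. -/
noncomputable def planeTerm (g u w x : Fin 6 → K) : ℝ :=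
  conicTerm (3 * tri g u u x) (3 * tri g u w x) (3 * tri g w w x) (3 * tri g u x x)
    (3 * tri g w x x) (4 * tri g x x x)

theorem tri_smul₁ {R : Type*} [CommRing R] (g x y z : Fin 6 → R) (r : R) :
    tri g (r • x) y z = r * tri g x y z := by
  simp only [tri, mul_sum]
  exact sum_congr rfl fun i _ => by simp; ring

theorem tri_smul₂ {R : Type*} [CommRing R] (g x y z : Fin 6 → R) (r : R) :
    tri g x (r • y) z = r * tri g x y z := by
  rw [tri_comm₁, tri_smul₁, tri_comm₁]

theorem tri_smul₃ {R : Type*} [CommRing R] (g x y z : Fin 6 → R) (r : R) :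
    tri g x y (r • z) = r * tri g x y z := by
  rw [tri_comm₂, tri_smul₂, tri_comm₂]

theorem planeTerm_smul (g u w x : Fin 6 → K) {l : K} (hl : l ≠ 0) :
    planeTerm g u w (l • x) = planeTerm g u w x := by
  unfold planeTerm
  simp only [tri_smul₁, tri_smul₂, tri_smul₃]
  rw [← conicTerm_mul hl (3 * tri g u u x)]
  congr 1 <;> ring

theorem planeTerm_zero (g u w : Fin 6 → K) : planeTerm g u w 0 = (card K : ℝ) ^ 2 := by
  have h : ∀ y z, tri g y z 0 = 0 := fun y z => by simp [tri]
  simp [planeTerm, conicTerm, h, symDet, firstChar, MulChar.map_zero]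

theorem planeTerm_of_ne {g u w x : Fin 6 → K} (h : conicDet g u w x ≠ 0) :
    planeTerm g u w x = 0 := if_neg h

theorem exists_sum_planeTerm {ι : Type*} (s : Finset ι) (x : ι → Fin 6 → K) (g u w : Fin 6 → K)
    (hs : ∀ i ∈ s, conicDet g u w (x i) = 0) : ∃ n : ℤ, ∑ i ∈ s, planeTerm g u w (x i) =
      card K * ∑ i ∈ s, firstChar
        ((3 * tri g u w (x i)) ^ 2 - 3 * tri g u u (x i) * (3 * tri g w w (x i)))
        ((3 * tri g u (x i) (x i)) ^ 2 - 3 * tri g u u (x i) * (4 * tri g (x i) (x i) (x i)))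
        ((3 * tri g w (x i) (x i)) ^ 2 - 3 * tri g w w (x i) * (4 * tri g (x i) (x i) (x i))) +
      n * (card K : ℝ) ^ 2 := by
  refine ⟨∑ i ∈ s, (if 3 * tri g u u (x i) = 0 ∧ 3 * tri g u w (x i) = 0 ∧ 3 * tri g w w (x i) = 0 ∧
    3 * tri g u (x i) (x i) = 0 ∧ 3 * tri g w (x i) (x i) = 0 ∧ 4 * tri g (x i) (x i) (x i) = 0
    then 1 else 0), ?_⟩
  rw [mul_sum, Int.cast_sum, sum_mul, ← sum_add_distrib]
  refine sum_congr rfl fun i hi => ?_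
  have h := hs i hi
  unfold conicDet at h
  rw [planeTerm, conicTerm, if_pos h, mul_comm ((card K : ℝ) ^ 2)]
  push_cast
  rfl

theorem exists_sum_planeTerm_line {g u w v e : Fin 6 → K} (hv : conicDet g u w v ≠ 0) :
    ∃ m : ℤ, |∑ z : K, planeTerm g u w (e + z • v) - m * (card K : ℝ) ^ 2| ≤ 5 * card K := by
  set s := univ.filter fun z : K => conicDet g u w (e + z • v) = 0 with hs
  have hsum : ∑ z : K, planeTerm g u w (e + z • v) = ∑ z ∈ s, planeTerm g u w (e + z • v) := by
    rw [hs, sum_filter]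
    refine sum_congr rfl fun z _ => ?_
    split_ifs with h
    · rfl
    · exact planeTerm_of_ne h
  obtain ⟨n, hn⟩ := exists_sum_planeTerm s (fun z => e + z • v) g u w
    (fun z hz => (mem_filter.1 hz).2)
  have hcard : s.card ≤ 5 := by
    set P : K[X] := conicDet (fun i => C (g i)) (fun i => C (u i)) (fun i => C (w i))
      (fun i => C (e i) + X * C (v i)) with hP
    have hl : HasLead 5 P (conicDet g u w v) := HasLead.conicDet fun i => ⟨by compute_degree, by simp⟩
    have hP0 : P ≠ 0 := fun h => hv (by rw [← hl.2, h, coeff_zero])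
    refine (card_le_card (t := P.roots.toFinset) fun z hz => ?_).trans
      ((Multiset.toFinset_card_le _).trans ((card_roots' P).trans hl.1))
    rw [Multiset.mem_toFinset, mem_roots hP0, IsRoot.def, hP, ← coe_evalRingHom, map_conicDet]
    have := (mem_filter.1 hz).2
    rw [← this]
    simp only [coe_evalRingHom, eval_C, eval_add, eval_mul, eval_X]
    rfl
  refine ⟨n, ?_⟩
  rw [hsum, hn, add_sub_cancel_right, abs_mul, Nat.abs_cast, mul_comm]
  refine mul_le_mul_of_nonneg_right ?_ (Nat.cast_nonneg _)
  refine (abs_sum_le_sum_abs _ _).trans ((sum_le_card_nsmul _ _ 1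
    fun i _ => abs_firstChar_le_one _ _ _).trans ?_)
  rw [nsmul_one]
  exact_mod_cast hcard

section

variable {A : Type*} [CommRing A] (F : Filt A)

theorem ofNat_mul_mem {n : ℤ} (m : ℕ) [m.AtLeastTwo] {x : A} (hx : x ∈ F.S n) :
    (OfNat.ofNat m : A) * x ∈ F.S n := by
  rw [← Nat.cast_ofNat]; exact natCast_mul_mem F _ hx

variable {F}

theorem symDet_mem {a b c d e f : A} (ha : a ∈ F.S 1)
    (hb : b ∈ F.S 1) (hc : c ∈ F.S 1) (hd : d ∈ F.S 2) (he : e ∈ F.S 2) (hf : f ∈ F.S 3) :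
    symDet a b c d e f ∈ F.S 5 := by
  have h1 := F.mul_mem (F.mul_mem ha hc) hf
  have h2 := ofNat_mul_mem F 2 (F.mul_mem (F.mul_mem hb hd) he)
  have h3 := F.mul_mem ha (F.mul_mem he he)
  have h4 := F.mul_mem hc (F.mul_mem hd hd)
  have h5 := F.mul_mem (F.mul_mem hb hb) hf
  have h := sub_mem (sub_mem (sub_mem (add_mem h1 h2) h3) h4) h5
  have e1 : symDet a b c d e f = a * c * f + OfNat.ofNat 2 * (b * d * e) - a * (e * e) -
      c * (d * d) - b * b * f := by unfold symDet; ring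
  rw [e1]
  exact h

theorem sq_sub_mul_mem {a b c : A} {i j k n : ℤ} (hb : b ∈ F.S i) (ha : a ∈ F.S j)
    (hc : c ∈ F.S k) (h : i + i ≤ n) (h' : j + k ≤ n) : b ^ 2 - a * c ∈ F.S n := by
  rw [pow_two]
  exact sub_mem (F.mono h (F.mul_mem hb hb)) (F.mono h' (F.mul_mem ha hc))

variable (F) {g u w x : Fin 6 → A}

theorem conicDet_mem (hg : ∀ i, g i ∈ F.S 0) (hu : ∀ i, u i ∈ F.S 0)
    (hw : ∀ i, w i ∈ F.S 0) (hx : ∀ i, x i ∈ F.S 1) :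
    conicDet g u w x ∈ F.S 5 :=
  symDet_mem (ofNat_mul_mem _ 3 (tri_mem _ hg hu hu hx)) (ofNat_mul_mem _ 3 (tri_mem _ hg hu hw hx))
    (ofNat_mul_mem _ 3 (tri_mem _ hg hw hw hx)) (ofNat_mul_mem _ 3 (tri_mem _ hg hu hx hx))
    (ofNat_mul_mem _ 3 (tri_mem _ hg hw hx hx)) (ofNat_mul_mem _ 4 (tri_mem _ hg hx hx hx))

theorem minor_mem (hg : ∀ i, g i ∈ F.S 0) (hu : ∀ i, u i ∈ F.S 0)
    (hw : ∀ i, w i ∈ F.S 0) (hx : ∀ i, x i ∈ F.S 1) :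
    (3 * tri g u w x) ^ 2 - 3 * tri g u u x * (3 * tri g w w x) ∈ F.S (5 : ℕ) ∧
    (3 * tri g u x x) ^ 2 - 3 * tri g u u x * (4 * tri g x x x) ∈ F.S (5 : ℕ) ∧
    (3 * tri g w x x) ^ 2 - 3 * tri g w w x * (4 * tri g x x x) ∈ F.S (5 : ℕ) :=
  ⟨sq_sub_mul_mem (ofNat_mul_mem _ 3 (tri_mem _ hg hu hw hx))
      (ofNat_mul_mem _ 3 (tri_mem _ hg hu hu hx)) (ofNat_mul_mem _ 3 (tri_mem _ hg hw hw hx))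
      (by norm_num) (by norm_num),
    sq_sub_mul_mem (ofNat_mul_mem _ 3 (tri_mem _ hg hu hx hx))
      (ofNat_mul_mem _ 3 (tri_mem _ hg hu hu hx)) (ofNat_mul_mem _ 4 (tri_mem _ hg hx hx hx))
      (by norm_num) (by norm_num),
    sq_sub_mul_mem (ofNat_mul_mem _ 3 (tri_mem _ hg hw hx hx))
      (ofNat_mul_mem _ 3 (tri_mem _ hg hw hw hx)) (ofNat_mul_mem _ 4 (tri_mem _ hg hx hx hx))
      (by norm_num) (by norm_num)⟩

end

variable {p : ℕ} [Fact p.Prime] [CharP K p]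

theorem exists_sum_planeTerm_plane (hp2 : 2 < p) {N : ℕ} (hN : N = 2 * 5 ^ 2 + 2 * 5) (hp : N < p)
    (hp' : (100 * N ^ 2) ^ 2 ≤ p) {g u w v e e' : Fin 6 → K} (hv : conicDet g u w v ≠ 0) :
    ∃ m : ℤ, |∑ y : K, ∑ z : K, planeTerm g u w (e + y • e' + z • v) - m * (card K : ℝ) ^ 2| ≤
      card K * ((416 * N ^ 7 : ℕ) * √(card K : ℝ)) := by
  set x : Fin 6 → K[X][X] := fun i => C (C (e i) + X * C (e' i)) + X * C (C (v i)) with hx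
  set gg : Fin 6 → K[X][X] := fun i => C (C (g i)) with hgg
  set uu : Fin 6 → K[X][X] := fun i => C (C (u i)) with huu
  set ww : Fin 6 → K[X][X] := fun i => C (C (w i)) with hww
  have hev : ∀ (P : K × K) i, evalEvalRingHom P.1 P.2 (x i) = (e + P.1 • e' + P.2 • v) i := by
    intro P i
    simp only [hx, coe_evalEvalRingHom, evalEval, eval_add, eval_mul, eval_C, eval_X,
      Pi.add_apply, Pi.smul_apply, smul_eq_mul]
  have hCC : ∀ (P : K × K) (a : K), evalEvalRingHom P.1 P.2 (C (C a)) = a := by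
    intro P a
    simp [coe_evalEvalRingHom, evalEval]
  have hC : ∀ a : K, C (C a) ∈ (bideg K).S 0 := bideg_C_C_mem
  have hxS : ∀ i, x i ∈ (bideg K).S 1 := by
    intro i
    simp only [hx, map_add, map_mul]
    have h1 := (bideg K).mul_mem bideg_C_X_mem (hC (e' i))
    have h2 := (bideg K).mul_mem bideg_X_mem (hC (v i))
    rw [add_zero] at h1 h2
    exact add_mem (add_mem ((bideg K).mono zero_le_one (hC _)) h1) h2
  have htri : ∀ (P : K × K) (y z t : Fin 6 → K[X][X]), evalEvalRingHom P.1 P.2 (tri gg y z t) =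
      tri g (fun i => evalEvalRingHom P.1 P.2 (y i)) (fun i => evalEvalRingHom P.1 P.2 (z i))
        (fun i => evalEvalRingHom P.1 P.2 (t i)) := by
    intro P y z t
    rw [map_tri]
    simp only [hgg, hCC]
  have hevx : ∀ P : K × K, (fun i => evalEvalRingHom P.1 P.2 (x i)) = e + P.1 • e' + P.2 • v :=
    fun P => by ext i; exact hev P i
  have hevu : ∀ P : K × K, (fun i => evalEvalRingHom P.1 P.2 (uu i)) = u :=
    fun P => by ext i; exact hCC P _
  have hevw : ∀ P : K × K, (fun i => evalEvalRingHom P.1 P.2 (ww i)) = w :=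
    fun P => by ext i; exact hCC P _
  have hg0 : ∀ i, gg i ∈ (bideg K).S 0 := fun i => hC _
  have hu0 : ∀ i, uu i ∈ (bideg K).S 0 := fun i => hC _
  have hw0 : ∀ i, ww i ∈ (bideg K).S 0 := fun i => hC _
  set f : K[X][X] := C (C (conicDet g u w v)⁻¹) * conicDet gg uu ww x with hf
  have hlead : HasLead 5 (conicDet gg uu ww x) (C (conicDet g u w v)) := by
    have h : ∀ i, HasLead 1 (x i) (C (v i)) := fun i =>
      ⟨by simp only [hx]; compute_degree, by simp [hx]⟩
    rw [map_conicDet]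
    exact HasLead.conicDet h
  have hmonic : f.Monic := by
    refine monic_of_natDegree_le_of_coeff_eq_one 5 ?_ ?_
    · exact natDegree_C_mul_le _ _ |>.trans hlead.1
    · rw [hf, coeff_C_mul, hlead.2, ← C_mul, inv_mul_cancel₀ hv, C_1]
  have hfS : f ∈ (bideg K).S 5 := by
    have h := conicDet_mem (bideg K) hg0 hu0 hw0 hxS
    have := (bideg K).mul_mem (hC (conicDet g u w v)⁻¹) h
    rwa [zero_add] at this
  have hpts : ∀ P : K × K, P ∈ points f ↔ conicDet g u w (e + P.1 • e' + P.2 • v) = 0 := by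
    intro P
    rw [mem_points, ← coe_evalEvalRingHom, hf, map_mul, hCC, map_conicDet, hevx, hevu, hevw]
    simp only [hgg, hCC, mul_eq_zero, inv_eq_zero, hv, false_or]
  obtain ⟨m, hm⟩ := exists_sum_firstChar (p := p) (n := 5) hp2 hN hp hp' hmonic hfS
    (minor_mem (bideg K) hg0 hu0 hw0 hxS).1 (minor_mem (bideg K) hg0 hu0 hw0 hxS).2.1
    (minor_mem (bideg K) hg0 hu0 hw0 hxS).2.2
  have hee : ∀ (P : K × K) (F : K[X][X]), evalEval P.1 P.2 F = evalEvalRingHom P.1 P.2 F :=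
    fun _ _ => rfl
  simp only [hee, map_sub, map_pow, map_mul, map_ofNat, htri, hevx, hevu, hevw] at hm
  obtain ⟨n, hn⟩ := exists_sum_planeTerm (points f) (fun P => e + P.1 • e' + P.2 • v) g u w
    fun P hP => (hpts P).1 hP
  have hsum : ∑ y : K, ∑ z : K, planeTerm g u w (e + y • e' + z • v) =
      ∑ P ∈ points f, planeTerm g u w (e + P.1 • e' + P.2 • v) := by
    rw [← Fintype.sum_prod_type', ← sum_filter_of_ne (p := fun P => P ∈ points f)]
    · simp
    · intro P _ hP
      rw [hpts]
      by_contra h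
      exact hP (planeTerm_of_ne h)
  refine ⟨m + n, ?_⟩
  rw [hsum, hn]
  push_cast
  set S := ∑ P ∈ points f, firstChar ((3 * tri g u w (e + P.1 • e' + P.2 • v)) ^ 2 - _) _ _
  have : (card K : ℝ) * S + n * (card K : ℝ) ^ 2 -
      (m + n) * (card K : ℝ) ^ 2 = card K * (S - m * card K) := by ring
  rw [this, abs_mul, Nat.abs_cast]
  refine mul_le_mul_of_nonneg_left ?_ (Nat.cast_nonneg _)
  exact_mod_cast hm

end

section

variable {K : Type*} [Field K]

theorem conicDet_of_mem_span {g u w v : Fin 6 → K} (hl : IsLine g u w)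
    (hv : v ∈ Submodule.span K {u, w}) : conicDet g u w v = 0 := by
  obtain ⟨α, β, rfl⟩ := Submodule.mem_span_pair.1 hv
  have h1 : tri g u u (α • u + β • w) = 0 := by rw [tri_add_smul, tri_smul₃, hl.uuu, hl.uuw]; ring
  have h2 : tri g u w (α • u + β • w) = 0 := by
    rw [tri_add_smul, tri_smul₃, hl.uww, tri_comm₂, hl.uuw]; ring
  have h3 : tri g w w (α • u + β • w) = 0 := by
    rw [tri_add_smul, tri_smul₃, hl.www, tri_comm₂ g w w u, tri_comm₁ g w u w, hl.uww]; ring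
  rw [conicDet, h1, h2, h3, symDet]
  ring

theorem tri_line_add {g u w x : Fin 6 → K} (hl : IsLine g u w) (s t : K) :
    tri g (s • u + t • w + (2 : K) • x) (s • u + t • w + (2 : K) • x)
      (s • u + t • w + (2 : K) • x) = 2 * (3 * tri g u u x * s ^ 2 + 2 * (3 * tri g u w x) * s * t +
        3 * tri g w w x * t ^ 2 + 2 * (3 * tri g u x x) * s + 2 * (3 * tri g w x x) * t +
        4 * tri g x x x) := by
  have h : tri g (s • u + t • w + (2 : K) • x) (s • u + t • w + (2 : K) • x)
      (s • u + t • w + (2 : K) • x) = s ^ 3 * tri g u u u + 3 * s ^ 2 * t * tri g u u w +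
        3 * s * t ^ 2 * tri g u w w + t ^ 3 * tri g w w w +
        2 * (3 * tri g u u x * s ^ 2 + 2 * (3 * tri g u w x) * s * t +
        3 * tri g w w x * t ^ 2 + 2 * (3 * tri g u x x) * s + 2 * (3 * tri g w x x) * t +
        4 * tri g x x x) := by
    simp only [tri, mul_sum, sum_mul, ← sum_add_distrib]
    exact sum_congr rfl fun i _ => by simp only [Pi.add_apply, Pi.smul_apply, smul_eq_mul]; ring
  rw [h, hl.uuu, hl.uuw, hl.uww, hl.www]
  ring

variable [Fintype K]

theorem exists_frame (h2 : (2 : K) ≠ 0) {g c u w v : Fin 6 → K} (hc : c ≠ 0) (hu : u ∈ hyp c)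
    (hw : w ∈ hyp c) (hl : IsLine g u w) (huw : LinearIndependent K ![u, w]) (hv : v ∈ hyp c)
    (hvD : conicDet g u w v ≠ 0) : ∃ e e' : Fin 6 → K, ∀ φ : (Fin 6 → K) → ℤ,
      ∑ x ∈ univ.filter (· ∈ hyp c), φ x = ∑ x : K, ∑ y : K, ∑ z : K, ∑ t : K, ∑ s : K,
        φ (s • u + t • w + (2 : K) • (x • e + y • e' + z • v)) := by
  have h0 : LinearIndependent K ![(⟨u, hu⟩ : hyp c), ⟨w, hw⟩] := by
    refine LinearIndependent.of_comp (hyp c).subtype ?_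
    convert huw using 1
    ext i j; fin_cases i <;> rfl
  have h1 : LinearIndependent K ![(⟨v, hv⟩ : hyp c), ⟨u, hu⟩, ⟨w, hw⟩] := by
    refine linearIndependent_finCons.2 ⟨h0, fun h => hvD (conicDet_of_mem_span hl ?_)⟩
    have := Submodule.mem_map_of_mem (f := (hyp c).subtype) h
    rw [Submodule.map_span, ← Set.range_comp] at this
    convert this using 2
    · simp [Set.range_comp, Matrix.range_cons, Set.image_pair, Set.pair_comm]
    · rfl
  have hr := finrank_hyp hc
  obtain ⟨e', he'⟩ := exists_linearIndependent_cons_of_lt_finrank h1 (by omega)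
  obtain ⟨e, he⟩ := exists_linearIndependent_cons_of_lt_finrank he' (by omega)
  refine ⟨e, e', fun φ => ?_⟩
  have hli := Fintype.linearIndependent_iff.1 he
  let Φ : K × K × K × K × K → hyp c := fun P =>
    P.2.2.2.2 • ⟨u, hu⟩ + P.2.2.2.1 • ⟨w, hw⟩ + (2 : K) • (P.1 • e + P.2.1 • e' + P.2.2.1 • ⟨v, hv⟩)
  have hinj : Injective Φ := by
    rintro ⟨x, y, z, t, s⟩ ⟨x', y', z', t', s'⟩ h
    have h' := hli ![2 * (x - x'), 2 * (y - y'), 2 * (z - z'), s - s', t - t'] (by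
      rw [← sub_eq_zero] at h
      rw [← h, Fin.sum_univ_five]
      change (2 * (x - x')) • e + (2 * (y - y')) • e' + (2 * (z - z')) • (⟨v, hv⟩ : hyp c) +
        (s - s') • ⟨u, hu⟩ + (t - t') • ⟨w, hw⟩ = _
      simp only [Φ]
      module)
    have a0 := h' 0
    have a1 := h' 1
    have a2 := h' 2
    have a3 := h' 3
    have a4 := h' 4
    simp [h2, sub_eq_zero] at a0 a1 a2 a3 a4
    simp [a0, a1, a2, a3, a4]
  have hbij : Function.Bijective Φ := by
    rw [Fintype.bijective_iff_injective_and_card]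
    refine ⟨hinj, ?_⟩
    rw [Fintype.card_subtype, card_hyp hc]
    simp only [Fintype.card_prod]; ring
  rw [sum_subtype (p := (· ∈ hyp c)) _ (fun x => by simp), ← hbij.sum_comp fun x => φ x]
  simp only [Fintype.sum_prod_type]
  rfl

end

section

variable {K : Type*} [Field K] [Fintype K]

theorem sum_line_eq (hK : ringChar K ≠ 2) {g u w : Fin 6 → K} (hl : IsLine g u w)
    (x : Fin 6 → K) : ((∑ t : K, ∑ s : K,
      if tri g (s • u + t • w + (2 : K) • x) (s • u + t • w + (2 : K) • x)
        (s • u + t • w + (2 : K) • x) = 0 then 1 else 0 : ℤ) : ℝ) = card K + 1 -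
      dirCount (3 * tri g u u x) (3 * tri g u w x) (3 * tri g w w x) + planeTerm g u w x := by
  rw [planeTerm, conicTerm, ← conicCount_eq hK, conicCount]
  simp only [tri_line_add hl, mul_eq_zero, Ring.two_ne_zero hK, false_or]

theorem exists_sum_dirCount (g u w e e' v : Fin 6 → K) : ∃ k : ℤ, ∑ x : K, ∑ y : K, ∑ z : K,
    dirCount (3 * tri g u u (x • e + y • e' + z • v)) (3 * tri g u w (x • e + y • e' + z • v))
      (3 * tri g w w (x • e + y • e' + z • v)) = ((card K : ℤ) + 1) * (card K) ^ 2 +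
      k * ((card K : ℤ) ^ 2 * (card K - 1)) := by
  have key : ∀ a b c : K, ∃ k : ℤ, ∑ x : K, ∑ y : K, ∑ z : K,
      δ[a * (3 * tri g u u (x • e + y • e' + z • v)) +
        b * (3 * tri g u w (x • e + y • e' + z • v)) +
        c * (3 * tri g w w (x • e + y • e' + z • v)) = 0] =
      (card K : ℤ) ^ 2 + k * ((card K : ℤ) ^ 2 * (card K - 1)) := by
    intro a b c
    let L : (Fin 6 → K) → K := fun x => a * (3 * tri g u u x) + b * (3 * tri g u w x) +
      c * (3 * tri g w w x)
    obtain ⟨k, hk⟩ := sum_ite_linear_form (L e) (L e') (L v)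
    refine ⟨k, hk ▸ ?_⟩
    refine sum_congr rfl fun x _ => sum_congr rfl fun y _ => sum_congr rfl fun z _ => ?_
    congr 1
    simp only [tri_add_smul, tri_smul₃, L]
    exact propext ⟨fun h => by linear_combination h, fun h => by linear_combination h⟩
  choose k hk using fun t : K => key 1 (2 * t) (t ^ 2)
  obtain ⟨k', hk'⟩ := key 0 0 1
  refine ⟨∑ t, k t + k', ?_⟩
  simp only [zero_mul, zero_add, one_mul] at hk' hk
  have : ∀ a b c : K, dirCount a b c =
      (∑ t : K, if a + 2 * t * b + t ^ 2 * c = 0 then 1 else 0) + if c = 0 then 1 else 0 := by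
    intro a b c
    rw [dirCount]
    congr 1
    exact sum_congr rfl fun t _ => by congr 1; rw [mul_right_comm, mul_comm c]
  simp only [this, sum_add_distrib, hk']
  have h1 : ∀ φ : K → K → K → K → ℤ, ∑ x, ∑ y, ∑ z, ∑ t, φ x y z t = ∑ t, ∑ x, ∑ y, ∑ z, φ x y z t := by
    intro φ
    have h2 : ∀ x y, ∑ z, ∑ t, φ x y z t = ∑ t, ∑ z, φ x y z t := fun x y => sum_comm
    simp only [h2]
    have h3 : ∀ x, ∑ y, ∑ t, ∑ z, φ x y z t = ∑ t, ∑ y, ∑ z, φ x y z t := fun x => sum_comm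
    simp only [h3]
    exact sum_comm
  rw [h1]
  simp only [hk, sum_add_distrib, sum_const, card_univ, nsmul_eq_mul, ← sum_mul]
  ring

variable {p : ℕ} [Fact p.Prime] [CharP K p]

/-- Counting points on a hyperplane section of a diagonal cubic fourfold containing a rational
line. -/
theorem exists_card_of_isLine {N : ℕ} (hN : N = 2 * 5 ^ 2 + 2 * 5) (hp3 : 3 < p) (hp : N < p)
    (hp' : (100 * N ^ 2) ^ 2 ≤ p) (hK : 192 < card K) {g c u w : Fin 6 → K}
    (hg : ∀ i, g i ≠ 0) (hc : 3 ≤ (univ.filter fun i => c i ≠ 0).card) (hu : u ∈ hyp c)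
    (hw : w ∈ hyp c) (hl : IsLine g u w) (huw : LinearIndependent K ![u, w]) :
    ∃ m : ℤ, |((univ.filter fun x : Fin 6 → K => x ∈ hyp c ∧ tri g x x x = 0).card : ℝ) -
      (card K : ℝ) ^ 4 - m * ((card K : ℝ) ^ 2 * (card K - 1))| ≤
      (card K - 1) * ((416 * N ^ 7 + 5 : ℕ) * (card K * √(card K : ℝ))) := by
  have hchar : ringChar K = p := ringChar.eq K p ▸ rfl
  have hK2 : ringChar K ≠ 2 := by rw [hchar]; omega
  have h2 : (2 : K) ≠ 0 := Ring.two_ne_zero hK2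
  have h3 : (3 : K) ≠ 0 := by
    have := (CharP.cast_eq_zero_iff K p 3).not.2 fun h => by
      have := Nat.le_of_dvd (by norm_num) h; omega
    exact_mod_cast this
  have hc0 : c ≠ 0 := by rintro rfl; simp at hc
  obtain ⟨v, hv, hvD⟩ := exists_conicDet_ne_zero h2 h3 hK hg hc hu hw hl huw
  obtain ⟨e, e', he⟩ := exists_frame h2 hc0 hu hw hl huw hv hvD
  obtain ⟨k, hk⟩ := exists_sum_dirCount g u w e e' v
  obtain ⟨m₁, hm₁⟩ := exists_sum_planeTerm_plane (p := p) (by omega) hN hp hp' (e := e)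
    (e' := e') hvD
  obtain ⟨m₂, hm₂⟩ := exists_sum_planeTerm_line (e := e') hvD
  have hcard : ((univ.filter fun x : Fin 6 → K => x ∈ hyp c ∧ tri g x x x = 0).card : ℤ) =
      ∑ x ∈ univ.filter (· ∈ hyp c), if tri g x x x = 0 then 1 else 0 := by
    rw [sum_boole, filter_filter]
  rw [he] at hcard
  have hcard' : ((univ.filter fun x : Fin 6 → K => x ∈ hyp c ∧ tri g x x x = 0).card : ℝ) =
      (card K : ℝ) ^ 3 * (card K + 1) -
      (((card K : ℝ) + 1) * (card K) ^ 2 +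
      k * ((card K : ℝ) ^ 2 * (card K - 1))) +
      ∑ x : K, ∑ y : K, ∑ z : K, planeTerm g u w (x • e + y • e' + z • v) := by
    have hk' := congrArg (fun n : ℤ => (n : ℝ)) hk
    rw [← Int.cast_natCast, hcard]
    simp only [Int.cast_sum] at hk' ⊢
    have := fun x => sum_line_eq hK2 hl x
    simp only [Int.cast_sum] at this
    simp only [this, sum_add_distrib, sum_sub_distrib, hk', sum_const, card_univ, nsmul_eq_mul]
    push_cast
    ring
  have hhom := sum_eq_of_homogeneous₃ (fun x y z => planeTerm g u w (x • e + y • e' + z • v))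
    fun l x y z hl => by
      rw [← planeTerm_smul g u w (x • e + y • e' + z • v) hl]
      congr 1
      module
  simp only [zero_smul, one_smul, zero_add, add_zero, planeTerm_zero, planeTerm_of_ne hvD] at hhom
  set q : ℝ := (card K : ℝ) with hq
  set A := ∑ y : K, ∑ z : K, planeTerm g u w (e + y • e' + z • v)
  set B := ∑ z : K, planeTerm g u w (e' + z • v)
  refine ⟨m₁ + m₂ - k, ?_⟩
  have hq1 : 1 ≤ q := by rw [hq]; exact_mod_cast Fintype.card_pos
  have hsq : 1 ≤ √q := Real.one_le_sqrt.2 hq1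
  rw [hcard', hhom]
  push_cast
  have : q ^ 3 * (q + 1) - ((q + 1) * q ^ 2 + k * (q ^ 2 * (q - 1))) + (q ^ 2 + (q - 1) * (A + B)) -
      q ^ 4 - (m₁ + m₂ - k) * (q ^ 2 * (q - 1)) =
      (q - 1) * ((A - m₁ * q ^ 2) + (B - m₂ * q ^ 2)) := by ring
  rw [this, abs_mul, abs_of_nonneg (sub_nonneg.2 hq1)]
  refine mul_le_mul_of_nonneg_left ((abs_add_le _ _).trans ((add_le_add hm₁ hm₂).trans ?_))
    (sub_nonneg.2 hq1)
  push_cast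
  nlinarith [mul_nonneg (sub_nonneg.2 hsq) (zero_le_one.trans hq1)]

end

section

variable {K : Type*} [Field K] [Fintype K]

/-- The ordered bases of the planes in the hyperplane orthogonal to `c`. -/
noncomputable def frames (c : Fin 6 → K) : Finset ((Fin 6 → K) × (Fin 6 → K)) :=
  univ.filter fun P => P.1 ∈ hyp c ∧ P.2 ∈ hyp c ∧ LinearIndependent K ![P.1, P.2]

theorem mem_frames {c : Fin 6 → K} {P : (Fin 6 → K) × (Fin 6 → K)} :
    P ∈ frames c ↔ P.1 ∈ hyp c ∧ P.2 ∈ hyp c ∧ LinearIndependent K ![P.1, P.2] := by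
  simp [frames]

theorem comb_mem_frames {c : Fin 6 → K} {P : (Fin 6 → K) × (Fin 6 → K)} (hP : P ∈ frames c)
    {α β γ δ : K} (h : α * δ - β * γ ≠ 0) :
    (α • P.1 + β • P.2, γ • P.1 + δ • P.2) ∈ frames c := by
  rw [mem_frames] at hP ⊢
  obtain ⟨h1, h2, h3⟩ := hP
  rw [LinearIndependent.pair_iff] at h3
  refine ⟨add_mem (Submodule.smul_mem _ _ h1) (Submodule.smul_mem _ _ h2),
    add_mem (Submodule.smul_mem _ _ h1) (Submodule.smul_mem _ _ h2),
    LinearIndependent.pair_iff.2 fun s t hst => ?_⟩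
  obtain ⟨e1, e2⟩ := h3 (s * α + t * γ) (s * β + t * δ) (by rw [← hst]; simp only; module)
  have e3 : (α * δ - β * γ) * s = 0 := by linear_combination δ * e1 - γ * e2
  have e4 : (α * δ - β * γ) * t = 0 := by linear_combination α * e2 - β * e1
  exact ⟨(mul_eq_zero.1 e3).resolve_left h, (mul_eq_zero.1 e4).resolve_left h⟩

theorem sum_frames_comb {c : Fin 6 → K} (φ : (Fin 6 → K) → (Fin 6 → K) → ℤ) {α β γ δ : K}
    (h : α * δ - β * γ ≠ 0) :
    ∑ P ∈ frames c, φ (α • P.1 + β • P.2) (γ • P.1 + δ • P.2) = ∑ P ∈ frames c, φ P.1 P.2 := by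
  set D := α * δ - β * γ with hD
  have h' : D⁻¹ * δ * (D⁻¹ * α) - -(D⁻¹ * β) * -(D⁻¹ * γ) ≠ 0 := by
    have : D⁻¹ * δ * (D⁻¹ * α) - -(D⁻¹ * β) * -(D⁻¹ * γ) = D⁻¹ * D⁻¹ * D := by rw [hD]; ring
    rw [this]; exact mul_ne_zero (mul_ne_zero (inv_ne_zero h) (inv_ne_zero h)) h
  have hDD : D⁻¹ * D = 1 := inv_mul_cancel₀ h
  refine sum_bij' (fun P _ => (α • P.1 + β • P.2, γ • P.1 + δ • P.2))
    (fun P _ => ((D⁻¹ * δ) • P.1 + (-(D⁻¹ * β)) • P.2, (-(D⁻¹ * γ)) • P.1 + (D⁻¹ * α) • P.2))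
    (fun P hP => comb_mem_frames hP h) (fun P hP => comb_mem_frames hP h') ?_ ?_ fun _ _ => rfl
  · rintro ⟨u, w⟩ -
    rw [Prod.mk.injEq]
    constructor <;>
    · ext i
      simp only [Pi.add_apply, Pi.smul_apply, smul_eq_mul]
      first
      | linear_combination u i * (hDD - D⁻¹ * hD)
      | linear_combination w i * (hDD - D⁻¹ * hD)
  · rintro ⟨u, w⟩ -
    rw [Prod.mk.injEq]
    constructor <;>
    · ext i
      simp only [Pi.add_apply, Pi.smul_apply, smul_eq_mul]
      first
      | linear_combination u i * (hDD - D⁻¹ * hD)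
      | linear_combination w i * (hDD - D⁻¹ * hD)

/-- The vanishing of the cubic form at `w + √ν u`. -/
def ConjZero (g : Fin 6 → K) (ν : K) (w u : Fin 6 → K) : Prop :=
  tri g w w w + 3 * ν * tri g w u u = 0 ∧ 3 * tri g w w u + ν * tri g u u u = 0

theorem card_sq_add_card_nonsq (hK : ringChar K ≠ 2) {ν : K} (hν : ¬ IsSquare ν) (D : K) :
    (∑ s : K, δ[s ^ 2 = D]) +
      (∑ b : K, δ[b ≠ 0 ∧ ν * b ^ 2 = D]) + (if D = 0 then 1 else 0) = 2 := by
  have hν0 : ν ≠ 0 := by rintro rfl; exact hν (IsSquare.zero)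
  have hχ : quadraticChar K ν = -1 := quadraticChar_neg_one_iff_not_isSquare.2 hν
  have h1 := sum_ite_sq_eq hK D
  by_cases hD : D = 0
  · have : ∀ b : K, ¬ (b ≠ 0 ∧ ν * b ^ 2 = D) := by
      rintro b ⟨hb, h⟩
      rw [hD] at h
      exact mul_ne_zero hν0 (pow_ne_zero 2 hb) h
    rw [sum_eq_zero fun b _ => if_neg (this b), h1, hD, MulChar.map_zero, if_pos rfl]
    norm_num
  · have : ∀ b : K, (b ≠ 0 ∧ ν * b ^ 2 = D) ↔ b ^ 2 = ν⁻¹ * D := by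
      intro b
      rw [eq_inv_mul_iff_mul_eq₀ hν0]
      refine ⟨fun h => h.2, fun h => ⟨?_, h⟩⟩
      rintro rfl
      exact hD (by rw [← h]; ring)
    have h3 : quadraticChar K (ν⁻¹ * D) = - quadraticChar K D := by
      have e : quadraticChar K (ν * (ν⁻¹ * D)) = quadraticChar K D := by
        rw [mul_inv_cancel_left₀ hν0]
      rw [map_mul, hχ] at e
      linear_combination -e
    simp only [this, sum_ite_sq_eq hK, h3, if_neg hD]
    ring

theorem card_roots_quadratic (hK : ringChar K ≠ 2) {ν : K} (hν : ¬ IsSquare ν) {b₀ b₁ b₂ : K}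
    (hb : ¬ (b₀ = 0 ∧ b₁ = 0 ∧ b₂ = 0)) :
    (∑ s : K, δ[b₀ + b₁ * s + b₂ * s ^ 2 = 0]) +
      (∑ a : K, ∑ b : K, δ[b ≠ 0 ∧ b₀ + b₁ * a + b₂ * (a ^ 2 + ν * b ^ 2) = 0 ∧
        b₁ + 2 * b₂ * a = 0]) +
      (∑ s : K, δ[b₀ + b₁ * s + b₂ * s ^ 2 = 0 ∧ b₁ + 2 * b₂ * s = 0]) +
      (if b₂ = 0 then 1 else 0) + (if b₂ = 0 ∧ b₁ = 0 then 1 else 0) = 2 := by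
  have h2 : (2 : K) ≠ 0 := Ring.two_ne_zero hK
  by_cases hb2 : b₂ = 0
  · subst hb2
    by_cases hb1 : b₁ = 0
    · subst hb1
      have hb0 : b₀ ≠ 0 := fun h => hb ⟨h, rfl, rfl⟩
      simp [hb0]
    · have := sum_ite_linear hb1 b₀
      simp only [zero_mul, add_zero, mul_zero, hb1, and_false, if_false, sum_const_zero,
        if_true, add_comm b₀, this]
      norm_num
  · set α := -b₁ / (2 * b₂) with hα
    set D := α ^ 2 - b₀ / b₂ with hD
    have e1 : b₁ = -2 * b₂ * α := by rw [hα]; field_simp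
    have e0 : b₀ = b₂ * (α ^ 2 - D) := by rw [hD]; field_simp; ring
    have hder : ∀ s, b₁ + 2 * b₂ * s = 0 ↔ s = α := by
      intro s
      have : b₁ + 2 * b₂ * s = 2 * b₂ * (s - α) := by rw [e1]; ring
      rw [this, mul_eq_zero, or_iff_right (mul_ne_zero h2 hb2), sub_eq_zero]
    have hroot : ∀ s, b₀ + b₁ * s + b₂ * s ^ 2 = 0 ↔ (1 * s + -α) ^ 2 = D := by
      intro s
      have : b₀ + b₁ * s + b₂ * s ^ 2 = b₂ * ((1 * s + -α) ^ 2 - D) := by rw [e0, e1]; ring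
      rw [this, mul_eq_zero, or_iff_right hb2, sub_eq_zero]
    have hpair : ∀ b, b₀ + b₁ * α + b₂ * (α ^ 2 + ν * b ^ 2) = 0 ↔ ν * b ^ 2 = D := by
      intro b
      have : b₀ + b₁ * α + b₂ * (α ^ 2 + ν * b ^ 2) = b₂ * (ν * b ^ 2 - D) := by rw [e0, e1]; ring
      rw [this, mul_eq_zero, or_iff_right hb2, sub_eq_zero]
    have s1 : (∑ s : K, δ[b₀ + b₁ * s + b₂ * s ^ 2 = 0]) = ∑ s : K, δ[s ^ 2 = D] := by
      simp only [hroot]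
      exact sum_comp_mul_add (fun s => δ[s ^ 2 = D]) one_ne_zero (-α)
    have s2 : (∑ a : K, ∑ b : K, δ[b ≠ 0 ∧ b₀ + b₁ * a + b₂ * (a ^ 2 + ν * b ^ 2) = 0 ∧
        b₁ + 2 * b₂ * a = 0]) =
        ∑ b : K, δ[b ≠ 0 ∧ ν * b ^ 2 = D] := by
      simp only [hder]
      rw [sum_eq_single α]
      · simp only [hpair, and_true]
      · intro a _ ha; simp [ha]
      · simp
    have s3 : (∑ s : K, δ[b₀ + b₁ * s + b₂ * s ^ 2 = 0 ∧ b₁ + 2 * b₂ * s = 0]) =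
        if D = 0 then 1 else 0 := by
      simp only [hder]
      rw [sum_eq_single α]
      · simp only [hroot, and_true]
        congr 1
        simp [eq_comm]
      · intro a _ ha; simp [ha]
      · simp
    have s5 : ¬ (b₂ = 0 ∧ b₁ = 0) := fun h => hb2 h.1
    rw [s1, s2, s3, if_neg hb2, if_neg s5, add_zero, add_zero]
    exact card_sq_add_card_nonsq hK hν D

theorem sum_frames_swap {c : Fin 6 → K} (φ : (Fin 6 → K) → (Fin 6 → K) → ℤ) :
    ∑ P ∈ frames c, φ P.2 P.1 = ∑ P ∈ frames c, φ P.1 P.2 := by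
  simpa using sum_frames_comb (c := c) φ (α := 0) (β := 1) (γ := 1) (δ := 0) (by simp)

theorem sum_frames_smul_add {c : Fin 6 → K} (φ : (Fin 6 → K) → (Fin 6 → K) → ℤ) (a : K) {b : K}
    (hb : b ≠ 0) :
    ∑ P ∈ frames c, φ (b • P.1) (P.2 + a • P.1) = ∑ P ∈ frames c, φ P.1 P.2 := by
  simpa [add_comm] using sum_frames_comb (c := c) φ (α := b) (β := 0) (γ := a) (δ := 1) (by simpa)

theorem sum_frames_add {c : Fin 6 → K} (φ : (Fin 6 → K) → (Fin 6 → K) → ℤ) (a : K) :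
    ∑ P ∈ frames c, φ P.1 (P.2 + a • P.1) = ∑ P ∈ frames c, φ P.1 P.2 := by
  simpa using sum_frames_smul_add φ a one_ne_zero

theorem conjZero_mul {g : Fin 6 → K} {ν : K} {w u : Fin 6 → K} (h : ConjZero g ν w u) (s : K) :
    ConjZero g ν (ν • u + s • w) (s • u + (1 : K) • w) := by
  obtain ⟨h1, h2⟩ := h
  have e1 : tri g (ν • u + s • w) (ν • u + s • w) (ν • u + s • w) +
      3 * ν * tri g (ν • u + s • w) (s • u + (1 : K) • w) (s • u + (1 : K) • w) =
      (s ^ 3 + 3 * s * ν) * (tri g w w w + 3 * ν * tri g w u u) +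
      ν * (3 * s ^ 2 + ν) * (3 * tri g w w u + ν * tri g u u u) := by
    simp only [tri, mul_sum, ← sum_add_distrib]
    exact sum_congr rfl fun i _ => by simp; ring
  have e2 : 3 * tri g (ν • u + s • w) (ν • u + s • w) (s • u + (1 : K) • w) +
      ν * tri g (s • u + (1 : K) • w) (s • u + (1 : K) • w) (s • u + (1 : K) • w) =
      (3 * s ^ 2 + ν) * (tri g w w w + 3 * ν * tri g w u u) +
      (s ^ 3 + 3 * s * ν) * (3 * tri g w w u + ν * tri g u u u) := by
    simp only [tri, mul_sum, ← sum_add_distrib]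
    exact sum_congr rfl fun i _ => by simp; ring
  exact ⟨by rw [e1, h1, h2]; ring, by rw [e2, h1, h2]; ring⟩

theorem conjZero_smul_add {g : Fin 6 → K} {ν : K} {w u : Fin 6 → K} (hu : tri g u u u = 0)
    (a : K) {b : K} (hb : b ≠ 0) :
    ConjZero g ν (w + a • u) (b • u) ↔
      tri g w w w + 3 * tri g u w w * a + 3 * tri g u u w * (a ^ 2 + ν * b ^ 2) = 0 ∧
        3 * tri g u w w + 2 * (3 * tri g u u w) * a = 0 := by
  have e1 : tri g (w + a • u) (w + a • u) (w + a • u) + 3 * ν * tri g (w + a • u) (b • u) (b • u) =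
      tri g w w w + 3 * tri g u w w * a + 3 * tri g u u w * (a ^ 2 + ν * b ^ 2) +
      (a ^ 3 + 3 * ν * a * b ^ 2) * tri g u u u := by
    simp only [tri, mul_sum, sum_mul, ← sum_add_distrib]
    exact sum_congr rfl fun i _ => by simp; ring
  have e2 : 3 * tri g (w + a • u) (w + a • u) (b • u) + ν * tri g (b • u) (b • u) (b • u) =
      b * (3 * tri g u w w + 2 * (3 * tri g u u w) * a) +
      (3 * a ^ 2 * b + ν * b ^ 3) * tri g u u u := by
    simp only [tri, mul_sum, sum_mul, ← sum_add_distrib]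
    exact sum_congr rfl fun i _ => by simp; ring
  rw [ConjZero, e1, e2, hu, mul_zero, add_zero, mul_zero, add_zero, mul_eq_zero, or_iff_right hb]

/-- Counting frames by the roots of the form along the lines they span. -/
theorem sum_frames_le {g c : Fin 6 → K} {ν : K} (hK : ringChar K ≠ 2) (h3 : (3 : K) ≠ 0)
    (hν : ¬ IsSquare ν) (hl : ∀ P ∈ frames c, ¬ IsLine g P.1 P.2) :
    (card K : ℤ) * (∑ P ∈ frames c,
        if tri g P.1 P.1 P.1 = 0 ∧ tri g P.2 P.2 P.2 = 0 then 1 else 0) +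
      card K * (card K - 1) * (∑ P ∈ frames c,
        if tri g P.1 P.1 P.1 = 0 ∧ ConjZero g ν P.2 P.1 then 1 else 0) +
      2 * (∑ P ∈ frames c, if tri g P.1 P.1 P.1 = 0 ∧ tri g P.1 P.1 P.2 = 0 then 1 else 0) ≤
      2 * ∑ P ∈ frames c, δ[tri g P.1 P.1 P.1 = 0] := by
  set S2 : ℤ := ∑ P ∈ frames c,
        if tri g P.1 P.1 P.1 = 0 ∧ tri g P.2 P.2 P.2 = 0 then 1 else 0 with hS2
  set W0 : ℤ := ∑ P ∈ frames c,
        if tri g P.1 P.1 P.1 = 0 ∧ ConjZero g ν P.2 P.1 then 1 else 0 with hW0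
  set S4 : ℤ := ∑ P ∈ frames c,
        if tri g P.1 P.1 P.1 = 0 ∧ tri g P.1 P.1 P.2 = 0 then 1 else 0 with hS4
  set S5 : ℤ := ∑ P ∈ frames c, if tri g P.1 P.1 P.1 = 0 ∧ tri g P.1 P.1 P.2 = 0 ∧
    tri g P.2 P.2 P.2 = 0 then 1 else 0 with hS5
  set S6 : ℤ := ∑ P ∈ frames c, if tri g P.1 P.1 P.1 = 0 ∧ tri g P.1 P.1 P.2 = 0 ∧
    tri g P.1 P.2 P.2 = 0 then 1 else 0 with hS6
  have q0 : (0 : ℤ) ≤ card K := by positivity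
  -- the roots of the form along the lines
  have main : card K * S2 + card K * (card K - 1) * W0 + card K * S5 + S4 + S6 =
      2 * ∑ P ∈ frames c, δ[tri g P.1 P.1 P.1 = 0] := by
    have t2 : card K * S2 = ∑ P ∈ frames c, ∑ s : K, δ[tri g P.1 P.1 P.1 = 0 ∧
        tri g (P.2 + s • P.1) (P.2 + s • P.1) (P.2 + s • P.1) = 0] := by
      rw [sum_comm, sum_congr rfl fun s _ => sum_frames_add (c := c)
        (fun u w => δ[tri g u u u = 0 ∧ tri g w w w = 0]) s]
      simp [hS2]
    have t3 : card K * (card K - 1) * W0 = ∑ P ∈ frames c, ∑ a : K, ∑ b : K,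
        δ[b ≠ 0 ∧ tri g (b • P.1) (b • P.1) (b • P.1) = 0 ∧
        ConjZero g ν (P.2 + a • P.1) (b • P.1)] := by
      rw [sum_comm]
      have : ∀ a : K, (∑ P ∈ frames c, ∑ b : K, δ[b ≠ 0 ∧ tri g (b • P.1) (b • P.1) (b • P.1) = 0 ∧
          ConjZero g ν (P.2 + a • P.1) (b • P.1)]) =
          ((card K : ℤ) - 1) * W0 := by
        intro a
        rw [sum_comm]
        have : ∀ b : K, (∑ P ∈ frames c, δ[b ≠ 0 ∧ tri g (b • P.1) (b • P.1) (b • P.1) = 0 ∧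
          ConjZero g ν (P.2 + a • P.1) (b • P.1)]) =
          W0 - (if b = 0 then W0 else 0) := by
          intro b
          by_cases hb : b = 0
          · simp [hb]
          · simp only [ne_eq, hb, not_false_eq_true, true_and, if_false, sub_zero]
            exact sum_frames_smul_add (c := c)
              (fun u w => δ[tri g u u u = 0 ∧ ConjZero g ν w u]) a hb
        rw [sum_congr rfl fun b _ => this b, sum_sub_distrib, sum_ite_eq' univ (0 : K) fun _ => W0]
        simp
        ring
      rw [sum_congr rfl fun a _ => this a]
      simp
      ring
    have t5 : card K * S5 = ∑ P ∈ frames c, ∑ s : K, δ[tri g P.1 P.1 P.1 = 0 ∧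
        tri g (P.2 + s • P.1) (P.2 + s • P.1) P.1 = 0 ∧
        tri g (P.2 + s • P.1) (P.2 + s • P.1) (P.2 + s • P.1) = 0] := by
      rw [sum_comm, sum_congr rfl fun s _ => sum_frames_add (c := c)
        (fun u w => δ[tri g u u u = 0 ∧ tri g w w u = 0 ∧ tri g w w w = 0]) s,
        sum_const, card_univ, nsmul_eq_mul, hS5, ← sum_frames_swap
        (fun u w => δ[tri g u u u = 0 ∧ tri g u u w = 0 ∧ tri g w w w = 0])]
      congr 1
      refine sum_congr rfl fun P _ => ?_
      congr 1
      exact propext (by tauto)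
    rw [t2, t3, t5, hS4, hS6, mul_sum, ← sum_add_distrib, ← sum_add_distrib,
      ← sum_add_distrib, ← sum_add_distrib]
    refine sum_congr rfl fun P hP => ?_
    obtain ⟨u, w⟩ := P
    simp only
    by_cases hu : tri g u u u = 0
    · have hb : ¬ (tri g w w w = 0 ∧ 3 * tri g u w w = 0 ∧ 3 * tri g u u w = 0) := by
        rintro ⟨h0, h1, h2⟩
        exact hl _ hP ⟨hu, (mul_eq_zero.1 h2).resolve_left h3, (mul_eq_zero.1 h1).resolve_left h3,
          h0⟩
      have := card_roots_quadratic hK hν hb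
      have r1 : ∀ s, tri g (w + s • u) (w + s • u) (w + s • u) =
          tri g w w w + 3 * tri g u w w * s + 3 * tri g u u w * s ^ 2 := by
        intro s
        rw [tri_add_smul_cube, hu, tri_comm₂ g w w u, tri_comm₁ g w u w, tri_comm₁ g w u u,
          tri_comm₂ g u w u]
        ring
      have r2 : ∀ s, tri g (w + s • u) (w + s • u) u = 0 ↔
          3 * tri g u w w + 2 * (3 * tri g u u w) * s = 0 := by
        intro s
        rw [tri_comm₂, tri_comm₁, tri_add_smul_sq, hu, tri_comm₂ g u w u]
        have : 3 * tri g u w w + 2 * (3 * tri g u u w) * s =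
          3 * (tri g u w w + 2 * s * tri g u u w + s ^ 2 * 0) := by ring
        rw [this, mul_eq_zero, or_iff_right h3]
      have r3 : ∀ a b : K, (b ≠ 0 ∧ tri g (b • u) (b • u) (b • u) = 0 ∧
          ConjZero g ν (w + a • u) (b • u)) ↔ (b ≠ 0 ∧
          tri g w w w + 3 * tri g u w w * a + 3 * tri g u u w * (a ^ 2 + ν * b ^ 2) = 0 ∧
          3 * tri g u w w + 2 * (3 * tri g u u w) * a = 0) := by
        intro a b
        refine and_congr_right fun hb => ?_
        rw [conjZero_smul_add hu a hb, and_iff_right]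
        rw [tri_smul₁, tri_smul₂, tri_smul₃, hu]
        ring
      have r4 : (3 * tri g u u w = 0) ↔ tri g u u w = 0 := by rw [mul_eq_zero, or_iff_right h3]
      have r5 : (3 * tri g u w w = 0) ↔ tri g u w w = 0 := by rw [mul_eq_zero, or_iff_right h3]
      rw [r4, r5] at this
      simp only [hu, true_and, r1, r2, r3, if_true]
      simp only [and_comm (a := _ + _ = (0 : K)) (b := _ + _ + _ = (0 : K))] at this ⊢
      linarith
    · have r3 : ∀ a b : K, ¬ (b ≠ 0 ∧ tri g (b • u) (b • u) (b • u) = 0 ∧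
          ConjZero g ν (w + a • u) (b • u)) := by
        rintro a b ⟨hb, h, -⟩
        rw [tri_smul₁, tri_smul₂, tri_smul₃] at h
        exact mul_ne_zero hb (mul_ne_zero hb (mul_ne_zero hb hu)) h
      simp only [hu, false_and, if_false, r3]
      simp
  -- the third root along tangent lines
  have tang : S4 ≤ S6 + card K * S5 := by
    have t5 : card K * S5 = ∑ P ∈ frames c, ∑ s : K, δ[tri g P.1 P.1 P.1 = 0 ∧
        tri g P.1 P.1 (P.2 + s • P.1) = 0 ∧
        tri g (P.2 + s • P.1) (P.2 + s • P.1) (P.2 + s • P.1) = 0] := by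
      rw [sum_comm, sum_congr rfl fun s _ => sum_frames_add (c := c)
        (fun u w => δ[tri g u u u = 0 ∧ tri g u u w = 0 ∧ tri g w w w = 0]) s]
      simp [hS5]
    rw [t5, hS4, hS6, ← sum_add_distrib]
    refine sum_le_sum fun P hP => ?_
    obtain ⟨u, w⟩ := P
    simp only
    have n5 : ∀ s : K, (0 : ℤ) ≤ δ[tri g u u u = 0 ∧ tri g u u (w + s • u) = 0 ∧
        tri g (w + s • u) (w + s • u) (w + s • u) = 0] := fun s => by
      split_ifs <;> simp
    have n6 : (0 : ℤ) ≤ δ[tri g u u u = 0 ∧ tri g u u w = 0 ∧ tri g u w w = 0] := by split_ifs <;> simp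
    by_cases h : tri g u u u = 0 ∧ tri g u u w = 0
    · obtain ⟨hu, huw⟩ := h
      by_cases hw : tri g u w w = 0
      · have := sum_nonneg fun s (_ : s ∈ univ) => n5 s
        rw [if_pos ⟨hu, huw⟩, if_pos ⟨hu, huw, hw⟩]
        linarith
      · have hs := single_le_sum (fun s _ => n5 s) (mem_univ (-(tri g w w w) / (3 * tri g u w w)))
        rw [if_pos] at hs
        · rw [if_pos ⟨hu, huw⟩]; linarith
        · refine ⟨hu, ?_, ?_⟩
          · rw [tri_add_smul, hu, huw]; ring
          · rw [tri_add_smul_cube, hu, tri_comm₂ g w w u, tri_comm₁ g w u w, tri_comm₁ g w u u,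
              tri_comm₂ g u w u, huw]
            field_simp
            ring
    · rw [if_neg h]
      have := sum_nonneg fun s (_ : s ∈ univ) => n5 s
      linarith
  linarith

theorem sum_frames_conjZero_le {g c : Fin 6 → K} {ν : K} (hν : ¬ IsSquare ν) :
    (∑ P ∈ frames c, δ[ConjZero g ν P.2 P.1]) ≤ (card K + 1) * ∑ P ∈ frames c,
        δ[tri g P.1 P.1 P.1 = 0 ∧ ConjZero g ν P.2 P.1] := by
  set W0 : ℤ := ∑ P ∈ frames c,
        if tri g P.1 P.1 P.1 = 0 ∧ ConjZero g ν P.2 P.1 then 1 else 0 with hW0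
  have h1 : (∑ P ∈ frames c, δ[ConjZero g ν P.2 P.1]) ≤
      ∑ P ∈ frames c, (δ[tri g P.1 P.1 P.1 = 0 ∧ ConjZero g ν P.2 P.1] +
        ∑ s : K, δ[tri g (P.2 + s • P.1) (P.2 + s • P.1) (P.2 + s • P.1) = 0 ∧
          ConjZero g ν P.2 P.1]) := by
    refine sum_le_sum fun P hP => ?_
    obtain ⟨u, w⟩ := P
    simp only
    have n5 : ∀ s : K, (0 : ℤ) ≤ δ[tri g (w + s • u) (w + s • u) (w + s • u) = 0 ∧
        ConjZero g ν w u] := fun s => by split_ifs <;> simp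
    have n6 := sum_nonneg fun s (_ : s ∈ univ) => n5 s
    by_cases h : ConjZero g ν w u
    · by_cases hu : tri g u u u = 0
      · rw [if_pos h, if_pos ⟨hu, h⟩]; linarith
      · have hs := single_le_sum (fun s _ => n5 s) (mem_univ (-(3 * tri g u u w) / tri g u u u))
        rw [if_pos] at hs
        · rw [if_pos h, if_neg fun h => hu h.1]; linarith
        · refine ⟨?_, h⟩
          obtain ⟨h1, h2⟩ := h
          rw [tri_comm₁ g w u u, tri_comm₂ g u w u] at h1
          rw [tri_comm₂ g w w u, tri_comm₁ g w u w] at h2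
          rw [tri_add_smul_cube, tri_comm₂ g w w u, tri_comm₁ g w u w, tri_comm₁ g w u u,
              tri_comm₂ g u w u]
          field_simp
          linear_combination tri g u u u ^ 2 * h1 - 3 * tri g u u w * tri g u u u * h2
    · rw [if_neg h, if_neg fun h' => h h'.2]; linarith
  refine h1.trans ?_
  rw [sum_add_distrib, sum_comm, add_comm, add_mul, one_mul]
  gcongr
  have h2 : ∀ s : K, (∑ P ∈ frames c, δ[tri g (P.2 + s • P.1) (P.2 + s • P.1) (P.2 + s • P.1) = 0 ∧
          ConjZero g ν P.2 P.1]) ≤ W0 := by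
    intro s
    have hdet : s * s - 1 * ν ≠ 0 := fun h => hν ⟨s, by linear_combination -h⟩
    rw [hW0, ← sum_frames_comb (c := c) (fun u w => δ[tri g u u u = 0 ∧ ConjZero g ν w u]) hdet]
    refine sum_le_sum fun P hP => ?_
    have e : s • P.1 + (1 : K) • P.2 = P.2 + s • P.1 := by rw [one_smul, add_comm]
    split_ifs with ha hb
    · rfl
    · refine absurd ⟨?_, conjZero_mul ha.2 s⟩ hb
      rw [e]; exact ha.1
    · simp
    · rfl
  refine (sum_le_card_nsmul _ _ _ fun s _ => h2 s).trans ?_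
  simp

theorem card_filter_linearIndependent {u : Fin 6 → K} (hu : u ≠ 0) (T : Finset (Fin 6 → K))
    (hT : ∀ s : K, s • u ∈ T) :
    ((T.filter fun w => LinearIndependent K ![u, w]).card : ℤ) = T.card - card K := by
  have h1 : T.filter (fun w => LinearIndependent K ![u, w]) =
      T \ univ.image fun s : K => s • u := by
    ext w
    simp [LinearIndependent.pair_iff' hu]
  have h2 : (univ.image fun s : K => s • u).card = card K := by
    rw [card_image_of_injective _ (smul_left_injective K hu), card_univ]
  have h3 : (univ.image fun s : K => s • u) ⊆ T := by
    intro x hx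
    obtain ⟨s, -, rfl⟩ := mem_image.1 hx
    exact hT s
  rw [h1, cast_card_sdiff h3, h2]

theorem sum_frames_ite {c : Fin 6 → K} (A : (Fin 6 → K) → Prop)
    (B : (Fin 6 → K) → (Fin 6 → K) → Prop) (hB : ∀ u, A u → ∀ s : K, B u (s • u)) :
    (∑ P ∈ frames c, δ[A P.1 ∧ B P.1 P.2]) = ∑ u ∈ univ.filter fun u => u ∈ hyp c ∧ u ≠ 0 ∧ A u,
        (((univ.filter fun w => w ∈ hyp c ∧ B u w).card : ℤ) - card K) := by
  rw [← sum_filter, sum_finset_product ((frames c).filter fun P => A P.1 ∧ B P.1 P.2)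
    (univ.filter fun u => u ∈ hyp c ∧ u ≠ 0 ∧ A u)
    (fun u => (univ.filter fun w => w ∈ hyp c ∧ B u w).filter
      fun w => LinearIndependent K ![u, w])]
  · refine sum_congr rfl fun u hu => ?_
    simp only [mem_filter, mem_univ, true_and] at hu
    rw [← card_filter_linearIndependent hu.2.1]
    · simp
    · intro s
      simp only [mem_filter, mem_univ, true_and]
      exact ⟨Submodule.smul_mem _ _ hu.1, hB u hu.2.2 s⟩
  · rintro ⟨u, w⟩
    simp only [mem_filter, mem_univ, true_and, mem_frames]
    constructor
    · rintro ⟨⟨h1, h2, h3⟩, h4, h5⟩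
      exact ⟨⟨h1, h3.ne_zero 0, h4⟩, ⟨h2, h5⟩, h3⟩
    · rintro ⟨⟨h1, -, h4⟩, ⟨h2, h5⟩, h3⟩
      exact ⟨⟨h1, h2, h3⟩, h4, h5⟩

theorem pow_le_card_tangent {g c : Fin 6 → K} (hc : c ≠ 0) (u : Fin 6 → K) :
    card K ^ 4 ≤ (univ.filter fun w => w ∈ hyp c ∧ tri g u u w = 0).card := by
  let f : hyp c →ₗ[K] K :=
    (∑ i, (g i * u i * u i) • LinearMap.proj i : (Fin 6 → K) →ₗ[K] K).comp (hyp c).subtype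
  have h1 : 4 ≤ Module.finrank K (LinearMap.ker f) := by
    have h2 := LinearMap.finrank_range_add_finrank_ker f
    have h3 : Module.finrank K (LinearMap.range f) ≤ 1 := by
      simpa using Submodule.finrank_le (LinearMap.range f)
    rw [finrank_hyp hc] at h2
    omega
  have h2 : card K ^ 4 ≤ card (LinearMap.ker f) := by
    rw [Module.card_eq_pow_finrank (K := K) (V := LinearMap.ker f)]
    exact Nat.pow_le_pow_right Fintype.card_pos h1
  refine h2.trans ?_
  rw [← card_univ]
  refine card_le_card_of_injOn (fun w => ((w : hyp c) : Fin 6 → K)) ?_ ?_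
  · intro w _
    simp only [coe_filter, mem_univ, true_and, Set.mem_setOf_eq]
    refine ⟨(w : hyp c).2, ?_⟩
    have e : ∀ x : hyp c, f x = tri g u u x := fun x => by simp [f, LinearMap.sum_apply, tri]
    rw [← e]
    exact LinearMap.mem_ker.1 w.2
  · intro a _ b _ h
    exact Subtype.ext (Subtype.ext h)

theorem conjZero_smul_left {g : Fin 6 → K} {ν : K} (hν : ¬ IsSquare ν) {u : Fin 6 → K} {s : K}
    (h : ConjZero g ν (s • u) u) : tri g u u u = 0 := by
  obtain ⟨h1, h2⟩ := h
  simp only [tri_smul₁, tri_smul₂, tri_smul₃] at h1 h2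
  have e1 : (s ^ 3 + 3 * ν * s) * tri g u u u = 0 := by linear_combination h1
  have e2 : (3 * s ^ 2 + ν) * tri g u u u = 0 := by linear_combination h2
  by_contra hu
  have f1 := (mul_eq_zero.1 e1).resolve_right hu
  have f2 := (mul_eq_zero.1 e2).resolve_right hu
  have f3 : (s ^ 2 - ν) ^ 3 = 0 := by linear_combination (s ^ 3 + 3 * ν * s) * f1 - ν * (3 * s ^ 2 + ν) * f2
  exact hν ⟨s, by linear_combination -(pow_eq_zero_iff (by norm_num)).1 f3⟩

theorem card_conjZero_le {g c : Fin 6 → K} {ν : K} (hν : ¬ IsSquare ν) :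
    ((univ.filter fun P : (Fin 6 → K) × (Fin 6 → K) =>
        P.1 ∈ hyp c ∧ P.2 ∈ hyp c ∧ P ≠ 0 ∧ ConjZero g ν P.2 P.1).card : ℤ) ≤
      (∑ P ∈ frames c, δ[ConjZero g ν P.2 P.1]) + (card K + 1) *
          (univ.filter fun u => u ∈ hyp c ∧ u ≠ 0 ∧ tri g u u u = 0).card := by
  set Z := univ.filter fun u => u ∈ hyp c ∧ u ≠ 0 ∧ tri g u u u = 0 with hZ
  have hsub : (univ.filter fun P : (Fin 6 → K) × (Fin 6 → K) =>
        P.1 ∈ hyp c ∧ P.2 ∈ hyp c ∧ P ≠ 0 ∧ ConjZero g ν P.2 P.1) ⊆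
      ((frames c).filter fun P => ConjZero g ν P.2 P.1) ∪
        (((Z ×ˢ (univ : Finset K)).image fun P => (P.1, P.2 • P.1)) ∪ Z.image fun w => (0, w)) := by
    rintro ⟨u, w⟩ hP
    simp only [mem_filter, mem_univ, true_and] at hP
    obtain ⟨h1, h2, h3, h4⟩ := hP
    simp only [mem_union, mem_filter, mem_frames, mem_image,
      mem_product, mem_univ, and_true, Prod.exists, Prod.mk.injEq]
    by_cases hu : u = 0
    · subst hu
      refine Or.inr (Or.inr ⟨w, ?_, rfl, rfl⟩)
      have hw : w ≠ 0 := by rintro rfl; exact h3 rfl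
      simp only [hZ, mem_filter, mem_univ, true_and]
      refine ⟨h2, hw, ?_⟩
      have := h4.1
      simpa [tri] using this
    · by_cases hl : LinearIndependent K ![u, w]
      · exact Or.inl ⟨⟨h1, h2, hl⟩, h4⟩
      · rw [LinearIndependent.pair_iff' hu] at hl
        push Not at hl
        obtain ⟨s, rfl⟩ := hl
        refine Or.inr (Or.inl ⟨u, s, ?_, rfl, rfl⟩)
        simp only [hZ, mem_filter, mem_univ, true_and]
        exact ⟨h1, hu, conjZero_smul_left hν h4⟩
  have hcard := (card_le_card hsub).trans ((card_union_le _ _).trans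
    (Nat.add_le_add_left ((card_union_le _ _).trans
      (Nat.add_le_add card_image_le card_image_le)) _))
  rw [card_product, card_univ] at hcard
  have : (∑ P ∈ frames c, δ[ConjZero g ν P.2 P.1]) =
      ((frames c).filter fun P => ConjZero g ν P.2 P.1).card := by simp
  rw [this]
  zify at hcard
  linarith

/-- A cubic threefold with enough points over the quadratic extension contains a rational line. -/
theorem exists_isLine {g c : Fin 6 → K} {ν : K} (hK : ringChar K ≠ 2) (h3 : (3 : K) ≠ 0)
    (hν : ¬ IsSquare ν) (hc : c ≠ 0)
    (hcard : ((card K : ℤ) ^ 2 - 1) * (1 + (card K : ℤ) ^ 3) ^ 2 <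
      (univ.filter fun P : (Fin 6 → K) × (Fin 6 → K) =>
        P.1 ∈ hyp c ∧ P.2 ∈ hyp c ∧ P ≠ 0 ∧ ConjZero g ν P.2 P.1).card) :
    ∃ u ∈ hyp c, ∃ w ∈ hyp c, LinearIndependent K ![u, w] ∧ IsLine g u w := by
  by_contra hcon
  push Not at hcon
  have hl : ∀ P ∈ frames c, ¬ IsLine g P.1 P.2 := by
    rintro ⟨u, w⟩ hP
    rw [mem_frames] at hP
    exact hcon u hP.1 w hP.2.1 hP.2.2
  have m1 := sum_frames_le hK h3 hν hl
  have m2 := sum_frames_conjZero_le (g := g) (c := c) hν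
  have m3 := card_conjZero_le (g := g) (c := c) hν
  set n2 := (univ.filter fun P : (Fin 6 → K) × (Fin 6 → K) =>
        P.1 ∈ hyp c ∧ P.2 ∈ hyp c ∧ P ≠ 0 ∧ ConjZero g ν P.2 P.1).card
  set Z := univ.filter fun u => u ∈ hyp c ∧ u ≠ 0 ∧ tri g u u u = 0 with hZ
  have hq : (1 : ℤ) < card K := by exact_mod_cast Fintype.one_lt_card
  have e1 : (∑ P ∈ frames c, δ[tri g P.1 P.1 P.1 = 0]) = Z.card * ((card K : ℤ) ^ 5 - card K) := by
    have := sum_frames_ite (c := c) (fun u => tri g u u u = 0) (fun _ _ => True)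
      (fun _ _ _ => trivial)
    simp only [and_true] at this
    rw [this, card_hyp hc, sum_const, nsmul_eq_mul]
    push_cast
    rfl
  have e2 : (∑ P ∈ frames c, δ[tri g P.1 P.1 P.1 = 0 ∧ tri g P.2 P.2 P.2 = 0])
      = Z.card * (Z.card + 1 - card K) := by
    have := sum_frames_ite (c := c) (fun u => tri g u u u = 0) (fun _ w => tri g w w w = 0)
      (fun u hu s => by simp only [tri_smul₁, tri_smul₂, tri_smul₃, hu, mul_zero])
    have h0 : (univ.filter fun w => w ∈ hyp c ∧ tri g w w w = 0) = insert 0 Z := by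
      ext w
      simp only [hZ, mem_filter, mem_univ, true_and, mem_insert]
      by_cases hw : w = 0
      · subst hw; simp [tri]
      · simp [hw]
    rw [this, h0, card_insert_of_notMem (by simp [hZ]), sum_const, nsmul_eq_mul]
    push_cast
    rfl
  have e4 : (Z.card : ℤ) * ((card K : ℤ) ^ 4 - card K) ≤
      ∑ P ∈ frames c, δ[tri g P.1 P.1 P.1 = 0 ∧ tri g P.1 P.1 P.2 = 0] := by
    rw [sum_frames_ite (c := c) (fun u => tri g u u u = 0) (fun u w => tri g u u w = 0)
      (fun u hu s => by simp only [tri_smul₃, hu, mul_zero]), ← nsmul_eq_mul]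
    refine card_nsmul_le_sum _ _ _ fun u _ => ?_
    have := pow_le_card_tangent (g := g) hc u
    zify at this
    linarith
  rw [e1, e2] at m1
  generalize (Z.card : ℤ) = n at *
  generalize (card K : ℤ) = q at *
  generalize (n2 : ℤ) = N at *
  generalize (∑ P ∈ frames c, δ[ConjZero g ν P.2 P.1]) = S3 at *
  generalize (∑ P ∈ frames c, δ[tri g P.1 P.1 P.1 = 0 ∧ ConjZero g ν P.2 P.1])
    = W0 at *
  generalize (∑ P ∈ frames c, δ[tri g P.1 P.1 P.1 = 0 ∧ tri g P.1 P.1 P.2 = 0])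
    = S4 at *
  have k1 := mul_le_mul_of_nonneg_left m1 (by linarith : 0 ≤ q + 1)
  have k2 := mul_le_mul_of_nonneg_left (m3.trans (add_le_add_left m2 _))
    (mul_nonneg (by linarith) (by linarith) : 0 ≤ q * (q - 1))
  have k4 := mul_le_mul_of_nonneg_left e4 (by linarith : 0 ≤ 2 * (q + 1))
  have k5 : 0 < q * (q - 1) * (N - (q ^ 2 - 1) * (1 + q ^ 3) ^ 2) :=
    mul_pos (mul_pos (by linarith) (by linarith)) (by linarith)
  have k6 : 0 ≤ q * (q + 1) * (n - (q - 1) * (1 + q ^ 3)) ^ 2 :=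
    mul_nonneg (mul_nonneg (by linarith) (by linarith)) (sq_nonneg _)
  nlinarith [k1, k2, k4, k5, k6]

/-- The cubic exponential sums `∑ ψ(ux³ + cx)`. -/
noncomputable def expSum (ψ : AddChar K ℂ) (u c : K) : ℝ := (∑ x, ψ (u * x ^ 3 + c * x)).re

theorem coe_expSum (ψ : AddChar K ℂ) (u c : K) :
    (expSum ψ u c : ℂ) = ∑ x, ψ (u * x ^ 3 + c * x) := by
  refine Complex.conj_eq_iff_re.1 ?_
  rw [map_sum]
  refine Fintype.sum_equiv (Equiv.neg K) _ _ fun x => ?_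
  rw [← AddChar.map_neg_eq_conj, Equiv.neg_apply]
  congr 1
  ring

theorem expSum_smul (ψ : AddChar K ℂ) {t : K} (ht : t ≠ 0) (u c : K) :
    expSum ψ (u * t ^ 3) (c * t) = expSum ψ u c := by
  unfold expSum
  congr 1
  refine Fintype.sum_equiv (Equiv.mulLeft₀ t ht) _ _ fun x => ?_
  simp only [Equiv.mulLeft₀_apply]
  congr 1
  ring

theorem expSum_zero_left {ψ : AddChar K ℂ} (hψ : ψ.IsPrimitive) {c : K} (hc : c ≠ 0) :
    expSum ψ 0 c = 0 := by
  have := AddChar.sum_mulShift c hψ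
  rw [if_neg hc, Nat.cast_zero] at this
  have h : (∑ x, ψ (0 * x ^ 3 + c * x)) = 0 := by
    rw [← this]; exact sum_congr rfl fun x _ => by rw [zero_mul, zero_add, mul_comm]
  rw [expSum, h, Complex.zero_re]

theorem expSum_zero_zero (ψ : AddChar K ℂ) : expSum ψ 0 0 = card K := by simp [expSum]

/-- The number of common zeros of a diagonal cubic form and a linear form. -/
noncomputable def cubicCount {ι : Type*} [Fintype ι] (g c : ι → K) : ℕ :=
  (univ.filter fun x : ι → K => ∑ i, g i * x i ^ 3 = 0 ∧ ∑ i, c i * x i = 0).card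

theorem sum_ite_mul {ψ : AddChar K ℂ} (hψ : ψ.IsPrimitive) (A : K) :
    ∑ a, ψ (a * A) = if A = 0 then (card K : ℂ) else 0 := by
  rw [AddChar.sum_mulShift A hψ]
  split_ifs <;> simp

theorem sum_sum_prod_expSum {ψ : AddChar K ℂ} (hψ : ψ.IsPrimitive) {ι : Type*} [Fintype ι] (g c : ι → K) :
    ∑ b, ∑ a, ∏ i, expSum ψ (a * g i) (b * c i) = (card K : ℝ) ^ 2 * cubicCount g c := by
  have h : ∀ a b : K, ∏ i, (expSum ψ (a * g i) (b * c i) : ℂ) =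
      ∑ x : ι → K, ψ (a * ∑ i, g i * x i ^ 3) * ψ (b * ∑ i, c i * x i) := by
    intro a b
    simp only [coe_expSum]
    rw [prod_univ_sum, Fintype.piFinset_univ]
    refine sum_congr rfl fun x _ => ?_
    rw [← AddChar.map_add_eq_mul, mul_sum, mul_sum, ← sum_add_distrib]
    induction (univ : Finset ι) using Finset.induction_on with
    | empty => simp
    | insert j s hj ih =>
      rw [prod_insert hj, sum_insert hj, AddChar.map_add_eq_mul, ih,
        AddChar.map_add_eq_mul, AddChar.map_add_eq_mul]
      simp only [mul_assoc]
  have e : ((∑ b, ∑ a, ∏ i, expSum ψ (a * g i) (b * c i) : ℝ) : ℂ) =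
      (card K : ℂ) ^ 2 * cubicCount g c := by
    push_cast
    simp only [h]
    have : ∀ b : K, (∑ a : K, ∑ x : ι → K, ψ (a * ∑ i, g i * x i ^ 3) *
        ψ (b * ∑ i, c i * x i)) = ∑ x : ι → K, (∑ a : K, ψ (a * ∑ i, g i * x i ^ 3)) *
        ψ (b * ∑ i, c i * x i) := by
      intro b
      rw [sum_comm]
      exact sum_congr rfl fun x _ => (sum_mul _ _ _).symm
    simp only [this]
    rw [sum_comm]
    simp only [← mul_sum, sum_ite_mul hψ]
    rw [cubicCount, card_filter]
    push_cast
    rw [mul_sum]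
    refine sum_congr rfl fun x _ => ?_
    by_cases h1 : ∑ i, g i * x i ^ 3 = 0 <;> by_cases h2 : ∑ i, c i * x i = 0 <;> simp [h1, h2, sq]
  exact_mod_cast e

theorem sum_prod_expSum {ψ : AddChar K ℂ} (hψ : ψ.IsPrimitive) {ι : Type*} [Fintype ι]
    {g c : ι → K} (hc : c ≠ 0) :
    ((card K : ℝ) - 1) * ∑ a ∈ univ.erase 0, ∏ i, expSum ψ (a * g i) (c i) =
      (card K : ℝ) ^ 2 * cubicCount g c - (card K : ℝ) ^ card ι -
        ∑ a ∈ univ.erase 0, ∏ i, expSum ψ (a * g i) 0 := by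
  rw [← sum_sum_prod_expSum hψ, ← add_sum_erase _ _ (mem_univ (0 : K))]
  have h1 : ∀ b ∈ univ.erase (0 : K), ∑ a, ∏ i, expSum ψ (a * g i) (b * c i) =
      ∑ a ∈ univ.erase 0, ∏ i, expSum ψ (a * g i) (c i) := by
    intro b hb
    have hb : b ≠ 0 := by simpa using hb
    have e : ∑ a, ∏ i, expSum ψ (a * g i) (b * c i) = ∑ a, ∏ i, expSum ψ (a * g i) (c i) := by
      refine (Fintype.sum_equiv (Equiv.mulRight₀ (b ^ 3) (pow_ne_zero 3 hb)) _ _ fun a => ?_).symm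
      refine prod_congr rfl fun i _ => ?_
      rw [Equiv.mulRight₀_apply, ← expSum_smul ψ hb (a * g i) (c i), mul_comm b]
      congr 1
      ring
    obtain ⟨j, hj⟩ := ne_iff.1 hc
    have e0 : ∏ i, expSum ψ (0 * g i) (c i) = 0 :=
      prod_eq_zero (mem_univ j) (by rw [zero_mul]; exact expSum_zero_left hψ hj)
    rw [e, ← add_sum_erase _ _ (mem_univ (0 : K)), e0, zero_add]
  rw [sum_congr rfl h1, sum_const, card_erase_of_mem (mem_univ _),
    card_univ, nsmul_eq_mul, Nat.cast_sub Fintype.card_pos, Nat.cast_one,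
    ← add_sum_erase _ _ (mem_univ (0 : K))]
  have e2 : ∏ i, expSum ψ (0 * g i) (0 * c i) = (card K : ℝ) ^ card ι := by simp [expSum_zero_zero]
  simp only [zero_mul] at e2 ⊢
  rw [e2]
  ring

theorem card_filter_pow_three_le (b : K) : (univ.filter fun x : K => x ^ 3 = b).card ≤ 3 := by
  have h : (X ^ 3 - C b : K[X]) ≠ 0 := X_pow_sub_C_ne_zero (by norm_num) b
  refine (card_le_card ?_).trans ((X ^ 3 - C b : K[X]).roots.toFinset_card_le.trans
    ((card_roots' _).trans (by rw [natDegree_X_pow_sub_C])))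
  intro x hx
  simp only [mem_filter, mem_univ, true_and] at hx
  simp [mem_roots h, hx]

theorem expSum_sq_le {ψ : AddChar K ℂ} (hψ : ψ.IsPrimitive) (hK : 4 ≤ card K) {u : K}
    (hu : u ≠ 0) : expSum ψ u 0 ^ 2 ≤ 12 * card K := by
  have hq : (4 : ℝ) ≤ card K := by exact_mod_cast hK
  -- the second moment over all coefficients
  have h1 : ∑ a, expSum ψ a 0 ^ 2 ≤ 3 * (card K : ℝ) ^ 2 := by
    have e : ((∑ a, expSum ψ a 0 ^ 2 : ℝ) : ℂ) =
        (((card K : ℝ) * ∑ x : K, ((univ.filter fun y : K => y ^ 3 = -x ^ 3).card : ℝ)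
          : ℝ) : ℂ) := by
      push_cast
      simp only [coe_expSum, zero_mul, add_zero, sq, sum_mul_sum]
      rw [sum_comm, mul_sum]
      refine sum_congr rfl fun x _ => ?_
      rw [sum_comm, card_filter, Nat.cast_sum, mul_sum]
      refine sum_congr rfl fun y _ => ?_
      have : ∀ a : K, ψ (a * x ^ 3) * ψ (a * y ^ 3) = ψ (a * (x ^ 3 + y ^ 3)) := fun a => by
        rw [← AddChar.map_add_eq_mul, mul_add]
      simp only [this, sum_ite_mul hψ, eq_neg_iff_add_eq_zero, add_comm (y ^ 3)]
      split_ifs <;> simp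
    have e' := Complex.ofReal_injective e
    rw [e']
    have : ∑ x : K, ((univ.filter fun y : K => y ^ 3 = -x ^ 3).card : ℝ) ≤
        ∑ x : K, (3 : ℝ) := sum_le_sum fun x _ => by
          exact_mod_cast card_filter_pow_three_le (-x ^ 3)
    simp only [sum_const, card_univ, nsmul_eq_mul] at this
    nlinarith
  -- cubic twists do not change the sums
  have h2 : ((card K : ℝ) - 1) * expSum ψ u 0 ^ 2 ≤ 3 * ∑ a, expSum ψ a 0 ^ 2 := by
    have e1 : ((card K : ℝ) - 1) * expSum ψ u 0 ^ 2 =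
        ∑ t ∈ univ.erase (0 : K), expSum ψ (u * t ^ 3) 0 ^ 2 := by
      rw [sum_congr rfl fun t ht => by rw [← zero_mul t, expSum_smul ψ (ne_of_mem_erase ht)]]
      rw [sum_const, card_erase_of_mem (mem_univ _), card_univ,
        nsmul_eq_mul, Nat.cast_sub Fintype.card_pos, Nat.cast_one]
    rw [e1, ← sum_fiberwise_of_maps_to (s := univ.erase (0 : K)) (t := univ)
      (g := fun t => u * t ^ 3) (fun _ _ => mem_univ _), mul_sum]
    refine sum_le_sum fun a _ => ?_
    rw [sum_congr rfl fun t ht => by rw [(mem_filter.1 ht).2], sum_const, nsmul_eq_mul]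
    refine mul_le_mul_of_nonneg_right ?_ (sq_nonneg _)
    have : ((univ.erase (0 : K)).filter fun t => u * t ^ 3 = a).card ≤ 3 := by
      refine (card_le_card ?_).trans (card_filter_pow_three_le (u⁻¹ * a))
      intro t ht
      simp only [mem_filter, mem_univ, true_and] at ht ⊢
      rw [← ht.2, inv_mul_cancel_left₀ hu]
    exact_mod_cast this
  nlinarith

/-- The normalized cubic exponential sums. -/
noncomputable def nsum (ψ : AddChar K ℂ) (g c a : K) : ℝ := expSum ψ (a * g) c / √(card K)

/-- The mean over the nonzero elements of the field. -/
noncomputable def mean (f : K → ℝ) : ℝ := (card K : ℝ)⁻¹ * ∑ a ∈ univ.erase 0, f a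

theorem nsum_zero_sq_le {ψ : AddChar K ℂ} (hψ : ψ.IsPrimitive) (hK : 4 ≤ card K) {g a : K}
    (hg : g ≠ 0) (ha : a ≠ 0) : nsum ψ g 0 a ^ 2 ≤ 12 := by
  have hq : (0 : ℝ) < card K := by exact_mod_cast Fintype.card_pos
  rw [nsum, div_pow, Real.sq_sqrt hq.le, div_le_iff₀ hq]
  exact expSum_sq_le hψ hK (mul_ne_zero ha hg)

theorem nsum_eq (ψ : AddChar K ℂ) (g a : K) {c : K} (hc : c ≠ 0) :
    nsum ψ g c a = nsum ψ (g / c ^ 3) 1 a := by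
  rw [nsum, nsum, ← expSum_smul ψ hc (a * (g / c ^ 3)) 1, one_mul, mul_assoc,
    div_mul_cancel₀ _ (pow_ne_zero 3 hc)]

theorem abs_mean_sub_le {ψ : AddChar K ℂ} (hψ : ψ.IsPrimitive) (hK : 4 ≤ card K) {ι : Type*}
    [Fintype ι] {h : ℕ} (hι : card ι = 2 * h) {g c : ι → K} (hg : ∀ i, g i ≠ 0) (hc : c ≠ 0) :
    |mean (fun a => ∏ i, nsum ψ (g i) (c i) a) -
      ((card K : ℝ) ^ 2 * cubicCount g c - (card K : ℝ) ^ (2 * h)) /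
        (((card K : ℝ) - 1) * (card K : ℝ) ^ (h + 1))| ≤
      (12 : ℝ) ^ h / (card K : ℝ) := by
  have hm := sum_prod_expSum hψ (g := g) hc
  rw [hι] at hm
  set q : ℝ := (card K : ℝ) with hq
  have hq4 : (4 : ℝ) ≤ q := by rw [hq]; exact_mod_cast hK
  have e : ∀ (d : ι → K) a, ∏ i, nsum ψ (g i) (d i) a =
      (∏ i, expSum ψ (a * g i) (d i)) / q ^ h := by
    intro d a
    simp only [nsum]
    rw [prod_div_distrib, prod_const, card_univ, hι, pow_mul, ← hq, Real.sq_sqrt (by linarith)]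
  have hE : |∑ a ∈ univ.erase 0, ∏ i, expSum ψ (a * g i) 0| ≤ (q - 1) * (12 * q) ^ h := by
    refine (abs_sum_le_sum_abs _ _).trans ?_
    have : ∀ a ∈ univ.erase (0 : K), |∏ i, expSum ψ (a * g i) 0| ≤ (12 * q) ^ h := by
      intro a ha
      rw [abs_prod]
      calc ∏ i, |expSum ψ (a * g i) 0| ≤ ∏ _i : ι, √(12 * q) := by
            refine prod_le_prod (fun _ _ => abs_nonneg _) fun i _ => ?_
            exact Real.abs_le_sqrt (expSum_sq_le hψ hK (mul_ne_zero (ne_of_mem_erase ha) (hg i)))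
        _ = (12 * q) ^ h := by
            rw [prod_const, card_univ, hι, pow_mul, Real.sq_sqrt (by linarith)]
    refine (sum_le_card_nsmul _ _ _ this).trans ?_
    rw [card_erase_of_mem (mem_univ _), card_univ,
        nsmul_eq_mul, Nat.cast_sub Fintype.card_pos, Nat.cast_one]
  have e2 : mean (fun a => ∏ i, nsum ψ (g i) (c i) a) -
      (q ^ 2 * cubicCount g c - q ^ (2 * h)) / ((q - 1) * q ^ (h + 1)) =
      -(∑ a ∈ univ.erase 0, ∏ i, expSum ψ (a * g i) 0) / ((q - 1) * q ^ (h + 1)) := by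
    have hq1 : q - 1 ≠ 0 := by linarith
    have hq0 : q ≠ 0 := by linarith
    rw [mean, ← hq]
    simp only [e]
    rw [← sum_div]
    have : ∑ a ∈ univ.erase (0 : K), ∏ i, expSum ψ (a * g i) (c i) = (q ^ 2 * cubicCount g c
        - q ^ (2 * h) - ∑ a ∈ univ.erase 0, ∏ i, expSum ψ (a * g i) 0) / (q - 1) := by
      rw [eq_div_iff hq1, ← hm]; ring
    rw [this]
    field_simp
    ring
  have hpos : 0 < (q - 1) * q ^ (h + 1) := mul_pos (by linarith) (by positivity)
  rw [e2, abs_div, abs_neg, abs_of_pos hpos, div_le_div_iff₀ hpos (by linarith)]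
  calc _ ≤ (q - 1) * (12 * q) ^ h * q := by gcongr
    _ = _ := by rw [mul_pow]; ring

theorem sum_fin_succ_arrow {M : Type*} [AddCommMonoid M] {n : ℕ} (F : (Fin (n + 1) → K) → M) :
    ∑ x, F x = ∑ a : K, ∑ y : Fin n → K, F (Matrix.vecCons a y) := by
  rw [← Fintype.sum_prod_type' (f := fun a y => F (Matrix.vecCons a y))]
  exact (Fintype.sum_equiv (Fin.consEquiv fun _ => K) _ _ fun _ => rfl).symm

/-- The number of zeros counted by `cubicCount` when every coefficient is repeated. -/
noncomputable def doubleCount {k : ℕ} (g : Fin k → K) : ℤ := ∑ s : Fin k → K, if ∑ i, s i = 0 then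
    ∑ u : Fin k → K, (if ∑ i, g i * (s i ^ 3 + 3 * s i * u i ^ 2) = 0 then 1 else 0) else 0

theorem cubicCount_sum_elim (hK : ringChar K ≠ 2) {k : ℕ} (g : Fin k → K) :
    (cubicCount (Sum.elim g g) (fun _ => 1) : ℤ) = doubleCount g := by
  have h2 : (2 : K) ≠ 0 := Ring.two_ne_zero hK
  rw [cubicCount, card_filter, doubleCount]
  push_cast
  let e : (Fin k ⊕ Fin k → K) ≃ (Fin k → K) × (Fin k → K) :=
    { toFun := fun x => (fun i => (x (Sum.inl i) + x (Sum.inr i)) / 2,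
        fun i => (x (Sum.inl i) - x (Sum.inr i)) / 2)
      invFun := fun p => Sum.elim (fun i => p.1 i + p.2 i) (fun i => p.1 i - p.2 i)
      left_inv := fun x => by
        funext i
        cases i <;> simp <;> field_simp <;> ring
      right_inv := fun p => by ext i <;> simp <;> field_simp <;> ring }
  refine (@Fintype.sum_equiv _ _ _ (_) _ _ e _ (fun p => δ[∑ i, Sum.elim g g i * e.symm p i ^ 3 = 0 ∧
    ∑ i, 1 * e.symm p i = 0]) fun x => by rw [e.symm_apply_apply]).trans ?_
  rw [Fintype.sum_prod_type]
  refine sum_congr rfl fun s _ => ?_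
  have h1 : ∀ u, ∑ i, 1 * e.symm (s, u) i = 2 * ∑ i, s i := fun u => by
    simp only [one_mul, Fintype.sum_sum_type, e, Equiv.coe_fn_symm_mk, Sum.elim_inl, Sum.elim_inr]
    rw [← sum_add_distrib, mul_sum]
    exact sum_congr rfl fun i _ => by ring
  have h3 : ∀ u, ∑ i, Sum.elim g g i * e.symm (s, u) i ^ 3 =
      2 * ∑ i, g i * (s i ^ 3 + 3 * s i * u i ^ 2) := fun u => by
    simp only [Fintype.sum_sum_type, e, Equiv.coe_fn_symm_mk, Sum.elim_inl, Sum.elim_inr]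
    rw [← sum_add_distrib, mul_sum]
    exact sum_congr rfl fun i _ => by ring
  simp only [h1, h3, mul_eq_zero, h2, false_or]
  split_ifs with h <;> simp [h]

theorem abs_mean_prod_sq_sub_le (hK2 : ringChar K ≠ 2) {ψ : AddChar K ℂ} (hψ : ψ.IsPrimitive)
    (hK : 4 ≤ card K) {k : ℕ} (hk : k ≠ 0) {g : Fin k → K} (hg : ∀ i, g i ≠ 0) :
    |mean (fun a => ∏ i, nsum ψ (g i) 1 a ^ 2) -
      ((card K : ℝ) ^ 2 * doubleCount g - (card K : ℝ) ^ (2 * k)) /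
        (((card K : ℝ) - 1) * (card K : ℝ) ^ (k + 1))| ≤
      (12 : ℝ) ^ k / (card K : ℝ) := by
  have : NeZero k := ⟨hk⟩
  have h := abs_mean_sub_le hψ hK (ι := Fin k ⊕ Fin k) (h := k) (by simp [two_mul])
    (g := Sum.elim g g) (c := fun _ => 1) (by rintro (i | i) <;> exact hg i)
    (fun h => one_ne_zero (congrFun h (Sum.inl 0)))
  rw [← cubicCount_sum_elim hK2, Int.cast_natCast]
  simp only [Fintype.prod_sum_type, Sum.elim_inl, Sum.elim_inr, ← sq] at h
  simpa only [prod_pow] using h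

theorem sum_ite_quadric_one (hK : ringChar K ≠ 2) {a : K} (ha : a ≠ 0) (e : K) :
    ∑ u : K, δ[e + a * u ^ 2 = 0] = 1 + quadraticChar K (-(a * e)) := by
  have := sum_ite_quadratic hK ha 0 e
  rw [add_comm 1, show -(a * e) = 0 ^ 2 - a * e by ring, ← this]
  exact sum_congr rfl fun u _ => if_congr (by ring_nf) rfl rfl

theorem sum_ite_quadric_two (hK : ringChar K ≠ 2) {a b : K} (ha : a ≠ 0) (hb : b ≠ 0) (e : K) :
    ∑ u : K, ∑ v : K, δ[e + a * u ^ 2 + b * v ^ 2 = 0] = card K + quadraticChar K (-(a * b)) *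
        if e = 0 then (card K : ℤ) - 1 else -1 := by
  have h : ∀ u : K, ∑ v : K, δ[e + a * u ^ 2 + b * v ^ 2 = 0] =
      1 + quadraticChar K (-(a * b) * u ^ 2 + 2 * 0 * u + -(b * e)) := fun u => by
    rw [sum_ite_quadric_one hK hb]
    congr 2; ring
  simp only [h]
  rw [sum_add_distrib, sum_quadraticChar_quadratic hK (neg_ne_zero.2 (mul_ne_zero ha hb))]
  simp [ha, hb]

theorem sum_quadraticChar_quadric (hK : ringChar K ≠ 2) {a : K} (ha : a ≠ 0) (c e : K) :
    ∑ u : K, quadraticChar K (c * (e + a * u ^ 2)) =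
      quadraticChar K (c * a) * if e = 0 then (card K : ℤ) - 1 else -1 := by
  simp only [map_mul, ← mul_sum, mul_assoc]
  congr 1
  have := sum_quadraticChar_quadratic hK ha 0 e
  simp only [mul_zero, zero_mul, add_zero, ne_eq, OfNat.ofNat_ne_zero, not_false_eq_true, zero_pow,
    zero_sub, neg_eq_zero, mul_eq_zero, ha, false_or] at this
  rw [← this]
  exact sum_congr rfl fun u _ => by rw [add_comm]

theorem sum_ite_eq_zero_quadric (hK : ringChar K ≠ 2) {a : K} (ha : a ≠ 0) (c : ℤ) (e : K) :
    ∑ u : K, (c * if e + a * u ^ 2 = 0 then (card K : ℤ) - 1 else -1) =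
      c * (card K * quadraticChar K (-(a * e))) := by
  have h : ∀ u : K, (if e + a * u ^ 2 = 0 then (card K : ℤ) - 1 else -1) =
      card K * δ[e + a * u ^ 2 = 0] - 1 := fun u => by
    split_ifs <;> ring
  simp only [h]
  rw [← mul_sum, sum_sub_distrib, ← mul_sum, sum_ite_quadric_one hK ha]
  simp only [sum_const, card_univ, nsmul_eq_mul]
  ring

theorem sum_ite_quadric_three (hK : ringChar K ≠ 2) {a b c : K} (ha : a ≠ 0) (hb : b ≠ 0)
    (hc : c ≠ 0) (e : K) :
    ∑ u : K, ∑ v : K, ∑ w : K, δ[e + a * u ^ 2 + b * v ^ 2 + c * w ^ 2 = 0] =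
      (card K : ℤ) ^ 2 + card K * quadraticChar K (a * b * c * e) := by
  simp only [sum_ite_quadric_two hK hb hc, sum_add_distrib, sum_ite_eq_zero_quadric hK ha]
  simp only [sum_const, card_univ, nsmul_eq_mul]
  rw [show a * b * c * e = -(b * c) * -(a * e) by ring, map_mul]
  ring

theorem sum_ite_quadric_four (hK : ringChar K ≠ 2) {a b c d : K} (ha : a ≠ 0) (hb : b ≠ 0)
    (hc : c ≠ 0) (hd : d ≠ 0) (e : K) :
    ∑ u : K, ∑ v : K, ∑ w : K, ∑ z : K, δ[e + a * u ^ 2 + b * v ^ 2 + c * w ^ 2 + d * z ^ 2 = 0] =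
      (card K : ℤ) ^ 3 + card K * (quadraticChar K (a * b * c * d) *
        if e = 0 then (card K : ℤ) - 1 else -1) := by
  simp only [sum_ite_quadric_three hK hb hc hd, sum_add_distrib, ← mul_sum,
    sum_quadraticChar_quadric hK ha]
  simp only [sum_const, card_univ, nsmul_eq_mul]
  rw [show b * c * d * a = a * b * c * d by ring]
  ring

theorem sum_fin_zero_arrow {M : Type*} [AddCommMonoid M] (F : (Fin 0 → K) → M) : ∑ x, F x = F ![] := by
  rw [Fintype.sum_unique]
  exact congrArg F (Subsingleton.elim _ _)

theorem doubleCount_one (l : K) : doubleCount ![l] = card K := by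
  simp [doubleCount, sum_fin_succ_arrow]

theorem doubleCount_two_eq (l m : K) : doubleCount ![l, m] =
    ∑ s : K, ∑ u : K, ∑ v : K, δ[l * (s ^ 3 + 3 * s * u ^ 2) - m * (s ^ 3 + 3 * s * v ^ 2) = 0] := by
  have h : ∀ s t : K, s + t = 0 ↔ t = -s := fun s t => by rw [add_comm, eq_neg_iff_add_eq_zero]
  simp only [doubleCount, sum_fin_succ_arrow, sum_fin_zero_arrow, Fin.sum_univ_two,
    Matrix.cons_val_zero, Matrix.cons_val_one, sum_ite_eq', mem_univ, if_true]
  refine sum_congr rfl fun s _ => ?_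
  simp only [h s, sum_ite_eq', mem_univ, if_true]
  refine sum_congr rfl fun u _ => sum_congr rfl
    fun v _ => if_congr ?_ rfl rfl
  constructor <;> intro h <;> linear_combination h

theorem doubleCount_two_of_ne (hK : ringChar K ≠ 2) (h3 : (3 : K) ≠ 0) {l m : K} (hl : l ≠ 0)
    (hm : m ≠ 0) (hlm : l ≠ m) :
    |doubleCount ![l, m] - 2 * (card K : ℤ) ^ 2| ≤ 2 * (card K : ℤ) := by
  have h : ∀ s : K, (∑ u : K, ∑ v : K, δ[l * (s ^ 3 + 3 * s * u ^ 2) - m * (s ^ 3 + 3 * s * v ^ 2) = 0]) = if s = 0 then (card K : ℤ) ^ 2 else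
        (card K : ℤ) - quadraticChar K (l * m) := by
    intro s
    split_ifs with hs
    · simp [hs, sq]
    · have := sum_ite_quadric_two hK (a := 3 * l) (b := -(3 * m)) (by simp [*]) (by simp [*])
        ((l - m) * s ^ 2)
      rw [if_neg (mul_ne_zero (sub_ne_zero.2 hlm) (pow_ne_zero 2 hs)),
        show -(3 * l * -(3 * m)) = 3 ^ 2 * (l * m) by ring, map_mul, quadraticChar_sq_one' h3,
        one_mul, mul_neg_one, ← sub_eq_add_neg] at this
      rw [← this]
      refine sum_congr rfl fun u _ => sum_congr rfl fun v _ => if_congr ?_ rfl rfl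
      rw [show l * (s ^ 3 + 3 * s * u ^ 2) - m * (s ^ 3 + 3 * s * v ^ 2) =
        s * ((l - m) * s ^ 2 + 3 * l * u ^ 2 + -(3 * m) * v ^ 2) by ring, mul_eq_zero,
        or_iff_right hs]
  rw [doubleCount_two_eq]
  simp only [h]
  rw [← add_sum_erase _ _ (mem_univ (0 : K)), if_pos rfl,
    sum_congr rfl fun s hs => if_neg (ne_of_mem_erase hs), sum_const,
    card_erase_of_mem (mem_univ _), card_univ, nsmul_eq_mul,
    Nat.cast_sub Fintype.card_pos, Nat.cast_one, abs_le]
  have hq : (1 : ℤ) ≤ card K := by exact_mod_cast Fintype.card_pos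
  rcases quadraticChar_dichotomy (mul_ne_zero hl hm) with h | h <;> rw [h] <;>
    constructor <;> nlinarith

/-- Counts the points `u` with `∑ (sᵢ³ + 3sᵢuᵢ²) = 0`. -/
noncomputable def fiberTwo (a b : K) : ℤ := ∑ u : K, ∑ v : K,
  (if a ^ 3 + 3 * a * u ^ 2 + (b ^ 3 + 3 * b * v ^ 2) = 0 then 1 else 0)

noncomputable def fiberThree (a b c : K) : ℤ := ∑ u : K, ∑ v : K, ∑ w : K,
  (if a ^ 3 + 3 * a * u ^ 2 + (b ^ 3 + 3 * b * v ^ 2 + (c ^ 3 + 3 * c * w ^ 2)) = 0 then 1 else 0)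

noncomputable def fiberFour (a b c d : K) : ℤ := ∑ u : K, ∑ v : K, ∑ w : K, ∑ z : K,
  (if a ^ 3 + 3 * a * u ^ 2 + (b ^ 3 + 3 * b * v ^ 2 + (c ^ 3 + 3 * c * w ^ 2 +
    (d ^ 3 + 3 * d * z ^ 2))) = 0 then 1 else 0)

theorem fiberTwo_neg (hK : ringChar K ≠ 2) (h3 : (3 : K) ≠ 0) (s : K) :
    fiberTwo s (-s) = if s = 0 then (card K : ℤ) ^ 2 else 2 * card K - 1 := by
  unfold fiberTwo
  split_ifs with hs
  · simp [hs, sq]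
  · have := sum_ite_quadric_two hK (a := (3 : K)) (b := -3) h3 (neg_ne_zero.2 h3) 0
    rw [if_pos rfl, show -((3 : K) * -3) = 3 ^ 2 by ring, quadraticChar_sq_one' h3, one_mul] at this
    rw [two_mul, add_sub_assoc, ← this]
    refine sum_congr rfl fun u _ => sum_congr rfl fun v _ => if_congr ?_ rfl rfl
    rw [show s ^ 3 + 3 * s * u ^ 2 + ((-s) ^ 3 + 3 * -s * v ^ 2) =
      s * (0 + 3 * u ^ 2 + -3 * v ^ 2) by ring, mul_eq_zero, or_iff_right hs]

theorem fiberThree_zero (b c : K) : fiberThree 0 b c = card K * fiberTwo b c := by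
  simp [fiberThree, fiberTwo]

theorem fiberThree_swap (a b c : K) : fiberThree a b c = fiberThree b a c := by
  unfold fiberThree
  rw [sum_comm]
  exact sum_congr rfl fun u _ => sum_congr rfl fun v _ => sum_congr rfl
    fun w _ => if_congr (by rw [add_left_comm]) rfl rfl

theorem fiberThree_swap' (a b c : K) : fiberThree a b c = fiberThree a c b := by
  unfold fiberThree
  refine sum_congr rfl fun u _ => ?_
  rw [sum_comm]
  exact sum_congr rfl fun v _ => sum_congr rfl
    fun w _ => if_congr (by rw [add_comm (b ^ 3 + _)]) rfl rfl

theorem fiberFour_zero (b c d : K) : fiberFour 0 b c d = card K * fiberThree b c d := by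
  simp [fiberFour, fiberThree]

theorem fiberFour_swap (a b c d : K) : fiberFour a b c d = fiberFour b a c d := by
  unfold fiberFour
  rw [sum_comm]
  exact sum_congr rfl fun u _ => sum_congr rfl fun v _ => sum_congr rfl
    fun w _ => sum_congr rfl fun z _ => if_congr (by rw [add_left_comm]) rfl rfl

theorem fiberFour_swap' (a b c d : K) : fiberFour a b c d = fiberFour a c b d := by
  unfold fiberFour
  refine sum_congr rfl fun u _ => ?_
  rw [sum_comm]
  exact sum_congr rfl fun v _ => sum_congr rfl
    fun w _ => sum_congr rfl fun z _ => if_congr (by rw [add_left_comm (b ^ 3 + _)]) rfl rfl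

theorem fiberFour_swap'' (a b c d : K) : fiberFour a b c d = fiberFour a b d c := by
  unfold fiberFour
  refine sum_congr rfl fun u _ => sum_congr rfl fun v _ => ?_
  rw [sum_comm]
  exact sum_congr rfl
    fun w _ => sum_congr rfl fun z _ => if_congr (by rw [add_comm (c ^ 3 + _)]) rfl rfl

theorem fiberThree_le (hK : ringChar K ≠ 2) (h3 : (3 : K) ≠ 0) {a b c : K} (h : a + (b + c) = 0) :
    fiberThree a b c ≤ (card K : ℤ) ^ 2 + card K + (card K : ℤ) ^ 2 *
      ((if a = 0 then 1 else 0) + (if b = 0 then 1 else 0) + (if c = 0 then 1 else 0)) +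
      (if a = 0 ∧ b = 0 then (card K : ℤ) ^ 3 else 0) := by
  have hq : (1 : ℤ) ≤ card K := by exact_mod_cast Fintype.card_pos
  have key : ∀ s : K, card K * fiberTwo s (-s) ≤ (card K : ℤ) ^ 2 +
      (card K : ℤ) ^ 2 + if s = 0 then (card K : ℤ) ^ 3 else 0 := fun s => by
    rw [fiberTwo_neg hK h3]
    split_ifs <;> nlinarith
  by_cases ha : a = 0
  · rw [ha, zero_add] at h
    have e : c = -b := by rw [add_comm] at h; exact eq_neg_of_add_eq_zero_left h
    subst ha e
    rw [fiberThree_zero]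
    have := key b
    simp only [if_true, true_and]
    split_ifs at this ⊢ <;> simp_all <;> nlinarith
  by_cases hb : b = 0
  · rw [hb, zero_add] at h
    have e : c = -a := by rw [add_comm] at h; exact eq_neg_of_add_eq_zero_left h
    subst hb e
    rw [fiberThree_swap, fiberThree_zero]
    have := key a
    simp [ha] at this ⊢
    nlinarith
  by_cases hc : c = 0
  · rw [hc, add_zero] at h
    have e : b = -a := by rw [add_comm] at h; exact eq_neg_of_add_eq_zero_left h
    subst hc e
    rw [fiberThree_swap', fiberThree_swap, fiberThree_zero]
    have := key a
    simp [ha] at this ⊢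
    nlinarith
  have e : fiberThree a b c = (card K : ℤ) ^ 2 + card K *
      quadraticChar K (3 * a * (3 * b) * (3 * c) * (a ^ 3 + b ^ 3 + c ^ 3)) := by
    rw [← sum_ite_quadric_three hK (mul_ne_zero h3 ha) (mul_ne_zero h3 hb) (mul_ne_zero h3 hc)
      (a ^ 3 + b ^ 3 + c ^ 3)]
    exact sum_congr rfl fun u _ => sum_congr rfl fun v _ => sum_congr rfl
      fun w _ => if_congr (by ring_nf) rfl rfl
  rw [e]
  simp only [ha, hb, hc, if_false, false_and]
  have : quadraticChar K (3 * a * (3 * b) * (3 * c) * (a ^ 3 + b ^ 3 + c ^ 3)) ≤ 1 := by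
    by_cases hz : 3 * a * (3 * b) * (3 * c) * (a ^ 3 + b ^ 3 + c ^ 3) = 0
    · rw [hz, MulChar.map_zero]; norm_num
    · rcases quadraticChar_dichotomy hz with h | h <;> rw [h]
      norm_num
  nlinarith

theorem fiberFour_le (hK : ringChar K ≠ 2) (h3 : (3 : K) ≠ 0) {a b c d : K}
    (h : a + (b + (c + d)) = 0) :
    fiberFour a b c d ≤ (card K : ℤ) ^ 3 + card K + (card K : ℤ) ^ 2 *
      ((if b = -a then 1 else 0) + (if c = -b then 1 else 0) + (if c = -a then 1 else 0)) +
      (card K : ℤ) ^ 2 *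
      ((if a = 0 then 1 else 0) + (if b = 0 then 1 else 0) + (if c = 0 then 1 else 0) +
        (if d = 0 then 1 else 0)) + (card K : ℤ) ^ 3 *
      ((if a = 0 ∧ b = 0 then 1 else 0) + (if a = 0 ∧ c = 0 then 1 else 0) +
        (if a = 0 ∧ d = 0 then 1 else 0) + (if b = 0 ∧ c = 0 then 1 else 0) +
        (if b = 0 ∧ d = 0 then 1 else 0) + (if c = 0 ∧ d = 0 then 1 else 0)) +
      (if a = 0 ∧ b = 0 ∧ c = 0 then (card K : ℤ) ^ 4 else 0) := by
  have hq : (1 : ℤ) ≤ card K := by exact_mod_cast Fintype.card_pos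
  have key : ∀ {x y z : K}, x + (y + z) = 0 → card K * fiberThree x y z ≤
      (card K : ℤ) ^ 3 + (card K : ℤ) ^ 2 + (card K : ℤ) ^ 3 *
      ((if x = 0 then 1 else 0) + (if y = 0 then 1 else 0) + (if z = 0 then 1 else 0)) +
      (if x = 0 ∧ y = 0 then (card K : ℤ) ^ 4 else 0) := fun hs => by
    refine (mul_le_mul_of_nonneg_left (fiberThree_le hK h3 hs) (by positivity)).trans (le_of_eq ?_)
    split_ifs <;> ring
  have hrel : 0 ≤ (card K : ℤ) ^ 2 *
      ((if b = -a then 1 else 0) + (if c = -b then 1 else 0) + (if c = -a then 1 else 0)) := by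
    positivity
  have hall : 0 ≤ (if a = 0 ∧ b = 0 ∧ c = 0 then (card K : ℤ) ^ 4 else 0) := by positivity
  by_cases ha : a = 0
  · have := key (show b + (c + d) = 0 by rw [← h, ha]; ring)
    have e : fiberFour a b c d = card K * fiberThree b c d := by rw [ha, fiberFour_zero]
    rw [e]
    simp only [ha, if_true, true_and] at hrel hall ⊢
    have h1 : 0 ≤ (card K : ℤ) ^ 3 * ((if b = 0 ∧ c = 0 then 1 else 0) +
      (if b = 0 ∧ d = 0 then 1 else 0) + (if c = 0 ∧ d = 0 then 1 else 0)) := by positivity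
    have h2 : 0 ≤ (card K : ℤ) ^ 2 * ((if b = 0 then 1 else 0) +
      (if c = 0 then 1 else 0) + (if d = 0 then 1 else 0)) := by positivity
    linarith
  by_cases hb : b = 0
  · have := key (show a + (c + d) = 0 by rw [← h, hb]; ring)
    have e : fiberFour a b c d = card K * fiberThree a c d := by
      rw [hb, fiberFour_swap, fiberFour_zero]
    rw [e]
    simp only [ha, hb, if_true, if_false, true_and, false_and, and_true, and_false] at this hrel hall ⊢
    have h1 : 0 ≤ (card K : ℤ) ^ 3 * (if c = 0 ∧ d = 0 then 1 else 0) := by positivity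
    have h2 : 0 ≤ (card K : ℤ) ^ 2 * ((if c = 0 then 1 else 0) + (if d = 0 then 1 else 0)) := by
      positivity
    linarith
  by_cases hc : c = 0
  · have := key (show a + (b + d) = 0 by rw [← h, hc]; ring)
    have e : fiberFour a b c d = card K * fiberThree a b d := by
      rw [hc, fiberFour_swap', fiberFour_swap, fiberFour_zero]
    rw [e]
    simp only [ha, hb, hc, if_true, if_false, true_and, false_and, and_true, and_false] at this hrel hall ⊢
    have h2 : 0 ≤ (card K : ℤ) ^ 2 * (if d = 0 then 1 else 0) := by positivity
    linarith
  by_cases hd : d = 0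
  · have := key (show a + (b + c) = 0 by rw [← h, hd]; ring)
    have e : fiberFour a b c d = card K * fiberThree a b c := by
      rw [hd, fiberFour_swap'', fiberFour_swap', fiberFour_swap, fiberFour_zero]
    rw [e]
    simp only [ha, hb, hc, hd, if_true, if_false, true_and, false_and, and_true, and_false] at this hrel hall ⊢
    linarith
  have e : fiberFour a b c d = (card K : ℤ) ^ 3 + card K *
      (quadraticChar K (3 * a * (3 * b) * (3 * c) * (3 * d)) *
        if a ^ 3 + b ^ 3 + c ^ 3 + d ^ 3 = 0 then (card K : ℤ) - 1 else -1) := by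
    rw [← sum_ite_quadric_four hK (mul_ne_zero h3 ha) (mul_ne_zero h3 hb) (mul_ne_zero h3 hc)
      (mul_ne_zero h3 hd)]
    exact sum_congr rfl fun u _ => sum_congr rfl fun v _ => sum_congr rfl
      fun w _ => sum_congr rfl fun z _ => if_congr (by ring_nf) rfl rfl
  have h0 : 3 * a * (3 * b) * (3 * c) * (3 * d) ≠ 0 := by simp [h3, ha, hb, hc, hd]
  rw [e]
  simp only [ha, hb, hc, hd, if_false, false_and] at hrel ⊢
  by_cases hz : a ^ 3 + b ^ 3 + c ^ 3 + d ^ 3 = 0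
  · have hd' : d = -(a + b + c) := by linear_combination h
    have hp : 3 * ((a + b) * ((b + c) * (a + c))) = 0 := by
      rw [hd'] at hz
      linear_combination -hz
    have : (1 : ℤ) ≤ (if b = -a then 1 else 0) + (if c = -b then 1 else 0) +
        (if c = -a then 1 else 0) := by
      rcases mul_eq_zero.1 ((mul_eq_zero.1 hp).resolve_left h3) with h | h
      · rw [if_pos (by linear_combination h)]; split_ifs <;> norm_num
      rcases mul_eq_zero.1 h with h | h
      · rw [if_pos (show c = -b by linear_combination h)]; split_ifs <;> norm_num
      · rw [if_pos (show c = -a by linear_combination h)]; split_ifs <;> norm_num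
    rw [if_pos hz]
    rcases quadraticChar_dichotomy h0 with h | h <;> rw [h] <;> nlinarith
  · rw [if_neg hz]
    rcases quadraticChar_dichotomy h0 with h | h <;> rw [h] <;> nlinarith

theorem sum_fin_three_arrow {M : Type*} [AddCommMonoid M] (F : (Fin 3 → K) → M) :
    ∑ x, F x = ∑ a, ∑ b, ∑ c, F ![a, b, c] := by
  simp only [sum_fin_succ_arrow, sum_fin_zero_arrow]

theorem sum_fin_four_arrow {M : Type*} [AddCommMonoid M] (F : (Fin 4 → K) → M) :
    ∑ x, F x = ∑ a, ∑ b, ∑ c, ∑ d, F ![a, b, c, d] := by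
  simp only [sum_fin_succ_arrow, sum_fin_zero_arrow]

theorem doubleCount_three {l : K} (hl : l ≠ 0) :
    doubleCount (fun _ : Fin 3 => l) = ∑ a : K, ∑ b : K, fiberThree a b (-(a + b)) := by
  rw [doubleCount, sum_fin_three_arrow]
  refine sum_congr rfl fun a _ => sum_congr rfl fun b _ => ?_
  have h : ∀ c, ∑ i, ![a, b, c] i = 0 ↔ c = -(a + b) := fun c => by
    rw [eq_neg_iff_add_eq_zero, add_comm c, Fin.sum_univ_three]
    rfl
  simp only [h, sum_ite_eq', mem_univ, if_true]
  rw [sum_fin_three_arrow, fiberThree]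
  refine sum_congr rfl fun u _ => sum_congr rfl fun v _ => sum_congr rfl
    fun w _ => if_congr ?_ rfl rfl
  rw [← mul_sum, mul_eq_zero, or_iff_right hl, Fin.sum_univ_three, add_assoc (_ + _)]
  rfl

theorem doubleCount_four {l : K} (hl : l ≠ 0) : doubleCount (fun _ : Fin 4 => l) =
      ∑ a : K, ∑ b : K, ∑ c : K, fiberFour a b c (-(a + b + c)) := by
  rw [doubleCount, sum_fin_four_arrow]
  refine sum_congr rfl fun a _ => sum_congr rfl fun b _ => sum_congr rfl
    fun c _ => ?_
  have h : ∀ d, ∑ i, ![a, b, c, d] i = 0 ↔ d = -(a + b + c) := fun d => by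
    rw [eq_neg_iff_add_eq_zero, add_comm d, Fin.sum_univ_four]
    rfl
  simp only [h, sum_ite_eq', mem_univ, if_true]
  rw [sum_fin_four_arrow, fiberFour]
  refine sum_congr rfl fun u _ => sum_congr rfl fun v _ => sum_congr rfl
    fun w _ => sum_congr rfl fun z _ => if_congr ?_ rfl rfl
  rw [← mul_sum, mul_eq_zero, or_iff_right hl, Fin.sum_univ_four, add_assoc (_ + _ + _), add_assoc (_ + _)]
  rfl

theorem doubleCount_three_le (hK : ringChar K ≠ 2) (h3 : (3 : K) ≠ 0) {l : K} (hl : l ≠ 0) :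
    doubleCount (fun _ : Fin 3 => l) ≤ (card K : ℤ) ^ 4 + 5 * (card K : ℤ) ^ 3 := by
  rw [doubleCount_three hl]
  refine (sum_le_sum fun a _ => sum_le_sum fun b _ =>
    fiberThree_le hK h3 (c := -(a + b)) (by ring)).trans ?_
  have h : ∀ a b : K, -(a + b) = 0 ↔ b = -a := fun a b => by
    rw [neg_eq_zero, add_comm, eq_neg_iff_add_eq_zero]
  simp only [h, sum_add_distrib, ← mul_sum, ite_and, sum_ite_eq',
    mem_univ, if_true, sum_const, card_univ, nsmul_eq_mul, mul_one, mul_zero,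
    sum_ite_irrel, sum_const_zero]
  generalize (card K : ℤ) = q
  exact le_of_eq (by ring)

theorem doubleCount_four_le (hK : ringChar K ≠ 2) (h3 : (3 : K) ≠ 0) {l : K} (hl : l ≠ 0) :
    doubleCount (fun _ : Fin 4 => l) ≤ (card K : ℤ) ^ 6 + 15 * (card K : ℤ) ^ 4 := by
  rw [doubleCount_four hl]
  refine (sum_le_sum fun a _ => sum_le_sum fun b _ => sum_le_sum fun c _ =>
    fiberFour_le hK h3 (d := -(a + b + c)) (by ring)).trans ?_
  have h : ∀ a b c : K, -(a + b + c) = 0 ↔ c = -(a + b) := fun a b c => by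
    rw [neg_eq_zero, add_comm, eq_neg_iff_add_eq_zero]
  have h' : ∀ a b : K, -(a + b) = 0 ↔ b = -a := fun a b => by
    rw [neg_eq_zero, add_comm, eq_neg_iff_add_eq_zero]
  simp only [h, sum_add_distrib, ← mul_sum, ite_and, sum_ite_eq',
    mem_univ, if_true, sum_const, card_univ, nsmul_eq_mul, mul_one, mul_zero,
    sum_ite_irrel, sum_const_zero, eq_comm (a := (0 : K)), h']
  generalize (card K : ℤ) = q
  exact le_of_eq (by ring)

theorem doubleCount_two_self (hK : ringChar K ≠ 2) (h3 : (3 : K) ≠ 0) {l : K} (hl : l ≠ 0) :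
    doubleCount ![l, l] = 3 * (card K : ℤ) ^ 2 - 3 * card K + 1 := by
  have h : doubleCount ![l, l] = ∑ s : K, fiberTwo s (-s) := by
    rw [doubleCount_two_eq]
    refine sum_congr rfl fun s _ => sum_congr rfl fun u _ => sum_congr rfl
      fun v _ => if_congr ?_ rfl rfl
    rw [← mul_sub, mul_eq_zero, or_iff_right hl]
    ring_nf
  rw [h, ← add_sum_erase _ _ (mem_univ (0 : K)), sum_congr rfl fun s hs => by
      rw [fiberTwo_neg hK h3, if_neg (ne_of_mem_erase hs)], sum_const,
    card_erase_of_mem (mem_univ _), card_univ, nsmul_eq_mul,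
    Nat.cast_sub Fintype.card_pos, Nat.cast_one, fiberTwo_neg hK h3, if_pos rfl]
  ring

section moments

variable {ψ : AddChar K ℂ} {l m : K}

theorem mean_one : mean (fun _ : K => 1) = 1 - 1 / (card K : ℝ) := by
  have hq : (card K : ℝ) ≠ 0 := by exact_mod_cast Fintype.card_ne_zero
  rw [mean, sum_const, card_erase_of_mem (mem_univ _), card_univ,
    nsmul_eq_mul, Nat.cast_sub Fintype.card_pos, Nat.cast_one]
  field_simp

theorem abs_mean_sq_sub_one_le (hK2 : ringChar K ≠ 2) (hψ : ψ.IsPrimitive)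
    (hK : 4 ≤ card K) (hl : l ≠ 0) :
    |mean (fun a => nsum ψ l 1 a ^ 2) - 1| ≤ 12 / (card K : ℝ) := by
  have h := abs_mean_prod_sq_sub_le hK2 hψ hK one_ne_zero (g := ![l]) (by simpa using hl)
  have hq : (4 : ℝ) ≤ card K := by exact_mod_cast hK
  rw [doubleCount_one] at h
  simp only [univ_unique, prod_singleton, Int.cast_natCast, pow_one,
    Fin.default_eq_zero, Matrix.cons_val_zero] at h
  generalize (card K : ℝ) = q at *
  rwa [show (q ^ 2 * q - q ^ (2 * 1)) / ((q - 1) * q ^ (1 + 1)) = 1 by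
    have : q - 1 ≠ 0 := by linarith
    have : q ≠ 0 := by linarith
    field_simp
    ring] at h

theorem le_mean_pow_four (hK2 : ringChar K ≠ 2) (h3 : (3 : K) ≠ 0) (hψ : ψ.IsPrimitive)
    (hK : 4 ≤ card K) (hl : l ≠ 0) :
    2 - 145 / (card K : ℝ) ≤ mean (fun a => nsum ψ l 1 a ^ 4) := by
  have h := abs_mean_prod_sq_sub_le hK2 hψ hK two_ne_zero (g := ![l, l]) (by simpa using hl)
  have hq : (4 : ℝ) ≤ card K := by exact_mod_cast hK
  rw [doubleCount_two_self hK2 h3 hl] at h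
  simp only [Fin.prod_univ_two, Matrix.cons_val_zero, Matrix.cons_val_one, ← pow_add] at h
  push_cast at h
  generalize (card K : ℝ) = q at *
  rw [show (q ^ 2 * (3 * q ^ 2 - 3 * q + 1) - q ^ (2 * 2)) / ((q - 1) * q ^ (2 + 1)) = 2 - 1 / q by
    have : q - 1 ≠ 0 := by linarith
    have : q ≠ 0 := by linarith
    field_simp; ring] at h
  have := (abs_le.1 h).1
  rw [show (145 : ℝ) / q = 12 ^ 2 / q + 1 / q by ring]
  linarith

theorem abs_mean_sq_mul_sq_sub_one_le (hK2 : ringChar K ≠ 2) (h3 : (3 : K) ≠ 0) (hψ : ψ.IsPrimitive)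
    (hK : 4 ≤ card K) (hl : l ≠ 0) (hm : m ≠ 0) (hlm : l ≠ m) :
    |mean (fun a => nsum ψ l 1 a ^ 2 * nsum ψ m 1 a ^ 2) - 1| ≤ 148 / (card K : ℝ) := by
  have h := abs_mean_prod_sq_sub_le hK2 hψ hK two_ne_zero (g := ![l, m]) (by simp [Fin.forall_fin_two, *])
  have hq : (4 : ℝ) ≤ card K := by exact_mod_cast hK
  have hN : |(doubleCount ![l, m] : ℝ) - 2 * (card K : ℝ) ^ 2| ≤ 2 * (card K : ℝ) := by
    exact_mod_cast doubleCount_two_of_ne hK2 h3 hl hm hlm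
  simp only [Fin.prod_univ_two, Matrix.cons_val_zero, Matrix.cons_val_one] at h
  generalize (card K : ℝ) = q at *
  generalize (doubleCount ![l, m] : ℝ) = N at *
  have e : |(q ^ 2 * N - q ^ (2 * 2)) / ((q - 1) * q ^ (2 + 1)) - 1| ≤ 4 / q := by
    have h1 : 0 < q - 1 := by linarith
    have h2 : 0 < q := by linarith
    rw [show (q ^ 2 * N - q ^ (2 * 2)) / ((q - 1) * q ^ (2 + 1)) - 1 =
      (N - 2 * q ^ 2 + q) / ((q - 1) * q) by field_simp; ring, abs_div, abs_of_pos (mul_pos h1 h2),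
      div_le_div_iff₀ (mul_pos h1 h2) h2]
    have := abs_add_le (N - 2 * q ^ 2) q
    rw [abs_of_pos h2] at this
    nlinarith
  have := abs_sub_le (mean fun a => nsum ψ l 1 a ^ 2 * nsum ψ m 1 a ^ 2)
    ((q ^ 2 * N - q ^ (2 * 2)) / ((q - 1) * q ^ (2 + 1))) 1
  rw [show (148 : ℝ) / q = 12 ^ 2 / q + 4 / q by ring]
  linarith

theorem mean_pow_six_le (hK2 : ringChar K ≠ 2) (h3 : (3 : K) ≠ 0) (hψ : ψ.IsPrimitive)
    (hK : 4 ≤ card K) (hl : l ≠ 0) :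
    mean (fun a => nsum ψ l 1 a ^ 6) ≤ 5 + 1735 / (card K : ℝ) := by
  have h := abs_mean_prod_sq_sub_le hK2 hψ hK three_ne_zero (g := fun _ => l) (fun _ => hl)
  have hq : (4 : ℝ) ≤ card K := by exact_mod_cast hK
  have hN : (doubleCount (fun _ : Fin 3 => l) : ℝ) ≤ (card K : ℝ) ^ 4 + 5 * (card K : ℝ) ^ 3 := by
    exact_mod_cast doubleCount_three_le hK2 h3 hl
  simp only [prod_const, card_univ, Fintype.card_fin, ← pow_mul] at h
  generalize (card K : ℝ) = q at *
  generalize (doubleCount (fun _ : Fin 3 => l) : ℝ) = N at *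
  have e : (q ^ 2 * N - q ^ (2 * 3)) / ((q - 1) * q ^ (3 + 1)) ≤ 5 + 7 / q := by
    have h1 : 0 < q - 1 := by linarith
    have h2 : 0 < q := by linarith
    rw [div_le_iff₀ (by positivity), show (5 + 7 / q) * ((q - 1) * q ^ (3 + 1)) =
      (5 * q + 7) * (q - 1) * q ^ 3 by field_simp]
    have h3 : q ^ 2 * N ≤ q ^ 2 * (q ^ 4 + 5 * q ^ 3) := by gcongr
    have : 0 ≤ q ^ 3 * (2 * q - 7) := mul_nonneg (by positivity) (by linarith)
    linear_combination h3 + this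
  have := (abs_le.1 h).2
  rw [show (1735 : ℝ) / q = 12 ^ 3 / q + 7 / q by ring]
  linarith

theorem mean_pow_eight_le (hK2 : ringChar K ≠ 2) (h3 : (3 : K) ≠ 0) (hψ : ψ.IsPrimitive)
    (hK : 4 ≤ card K) (hl : l ≠ 0) :
    mean (fun a => nsum ψ l 1 a ^ 8) ≤ 5204 := by
  have h := abs_mean_prod_sq_sub_le hK2 hψ hK four_ne_zero (g := fun _ => l) (fun _ => hl)
  have hq : (4 : ℝ) ≤ card K := by exact_mod_cast hK
  have hN : (doubleCount (fun _ : Fin 4 => l) : ℝ) ≤ (card K : ℝ) ^ 6 + 15 * (card K : ℝ) ^ 4 := by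
    exact_mod_cast doubleCount_four_le hK2 h3 hl
  simp only [prod_const, card_univ, Fintype.card_fin, ← pow_mul] at h
  generalize (card K : ℝ) = q at *
  generalize (doubleCount (fun _ : Fin 4 => l) : ℝ) = N at *
  have h1 : 0 < q - 1 := by linarith
  have h2 : 0 < q := by linarith
  have e : (q ^ 2 * N - q ^ (2 * 4)) / ((q - 1) * q ^ (4 + 1)) ≤ 20 := by
    rw [div_le_iff₀ (by positivity)]
    have h3 : q ^ 2 * N ≤ q ^ 2 * (q ^ 6 + 15 * q ^ 4) := by gcongr
    have : 0 ≤ q ^ 5 * (q - 4) := mul_nonneg (by positivity) (by linarith)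
    linear_combination h3 + 5 * this
  have e' : 12 ^ 4 / q ≤ 5184 := by rw [div_le_iff₀ h2]; linarith
  have := (abs_le.1 h).2
  linarith

end moments

end

section

variable {k : Type*} [Field k]

/-- The plane cubic curve `(1 + a)y³ + bx³ + c = a(x + y + 1)³`. -/
noncomputable def cubicCurve (a b c : k) : k[X][X] :=
  (⟨1, C (-(3 * a)) * (X + 1), C (-(3 * a)) * (X + 1) ^ 2,
    C b * X ^ 3 + C c - C a * (X + 1) ^ 3⟩ : Cubic k[X]).toPoly

theorem cubicCurve_monic (a b c : k) : (cubicCurve a b c).Monic := Cubic.monic_of_a_eq_one rfl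

theorem natDegree_cubicCurve (a b c : k) : (cubicCurve a b c).natDegree = 3 :=
  Cubic.natDegree_of_a_ne_zero one_ne_zero

theorem eval_cubicCurve (a b c : k) (P : k[X]) : (cubicCurve a b c).eval P =
    C (1 + a) * P ^ 3 + C b * X ^ 3 + C c - C a * (X + P + 1) ^ 3 := by
  simp only [cubicCurve, Cubic.toPoly, eval_add, eval_mul, eval_C, eval_pow, eval_X]
  simp only [map_add, map_neg, map_mul, map_one, map_ofNat]
  ring

theorem evalEval_cubicCurve (a b c x y : k) : evalEval x y (cubicCurve a b c) =
    (1 + a) * y ^ 3 + b * x ^ 3 + c - a * (x + y + 1) ^ 3 := by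
  rw [evalEval, eval_cubicCurve]
  simp

theorem bmap_cubicCurve {L : Type*} [Field L] (φ : k →+* L) (a b c : k) :
    bmap φ (cubicCurve a b c) = cubicCurve (φ a) (φ b) (φ c) := by
  rw [bmap_apply, cubicCurve, cubicCurve, ← Cubic.map_toPoly, Cubic.map]
  simp [map_ofNat φ 3]

theorem cubicCurve_mem (a b c : k) : cubicCurve a b c ∈ (bideg k).S (3 : ℕ) := by
  rw [mem_bideg]
  refine ⟨fun i => ?_, (natDegree_cubicCurve a b c).le⟩
  have h : ∀ i, (cubicCurve a b c).coeff i = 1 ∨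
    (cubicCurve a b c).coeff i = C (-(3 * a)) * (X + 1) ∨
    (cubicCurve a b c).coeff i = C (-(3 * a)) * (X + 1) ^ 2 ∨
    (cubicCurve a b c).coeff i = C b * X ^ 3 + C c - C a * (X + 1) ^ 3 ∨
    (cubicCurve a b c).coeff i = 0 := by
    intro i
    rcases i with _ | _ | _ | _ | i
    · exact Or.inr (Or.inr (Or.inr (Or.inl Cubic.coeff_eq_d)))
    · exact Or.inr (Or.inr (Or.inl Cubic.coeff_eq_c))
    · exact Or.inr (Or.inl Cubic.coeff_eq_b)
    · exact Or.inl Cubic.coeff_eq_a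
    · exact Or.inr (Or.inr (Or.inr (Or.inr (Cubic.coeff_eq_zero (by omega)))))
  rcases h i with h | h | h | h | h <;> rw [h]
  · simp
  · compute_degree; norm_num
  · compute_degree; norm_num
  · compute_degree
  · simp

theorem natDegree_root_cubicCurve_le {a b c : k} {P : k[X]} (h : (cubicCurve a b c).eval P = 0) :
    P.natDegree ≤ 1 := by
  by_contra! hP
  have e : P ^ 3 = C (3 * a) * (X + 1) * P ^ 2 + C (3 * a) * (X + 1) ^ 2 * P
      - (C b * X ^ 3 + C c - C a * (X + 1) ^ 3) := by
    rw [eval_cubicCurve] at h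
    simp only [map_add, map_mul, map_one, map_ofNat] at h ⊢
    linear_combination h
  have h1 : (P ^ 3).natDegree ≤ 2 * P.natDegree + 1 := by
    rw [e]
    refine (natDegree_sub_le_of_le (natDegree_add_le_of_degree_le (n := 2 * P.natDegree + 1) ?_ ?_)
      (n := 2 * P.natDegree + 1) ?_).trans (max_self _).le
    · refine natDegree_mul_le.trans ?_
      have h1 : (C (3 * a) * (X + 1) : k[X]).natDegree ≤ 1 := by compute_degree
      have h2 := natDegree_pow_le (p := P) (n := 2)
      omega
    · refine natDegree_mul_le.trans ?_
      have h1 : (C (3 * a) * (X + 1) ^ 2 : k[X]).natDegree ≤ 2 := by compute_degree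
      omega
    · have : (C b * X ^ 3 + C c - C a * (X + 1) ^ 3 : k[X]).natDegree ≤ 3 := by compute_degree
      omega
  rw [natDegree_pow] at h1
  omega

theorem irreducible_cubicCurve (h3 : (3 : k) ≠ 0) {a b c : k} (ha : a ≠ 0) (ha' : 1 + a ≠ 0) (hb : b ≠ 0)
    (h1 : ¬ (b = a ∧ c = 1 + a)) (h2 : ¬ (b = 1 + a ∧ c = a)) : Irreducible (cubicCurve a b c) := by
  rw [(cubicCurve_monic a b c).irreducible_iff_roots_eq_zero_of_degree_le_three
    (by rw [natDegree_cubicCurve]; norm_num) (natDegree_cubicCurve a b c).le]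
  refine Multiset.eq_zero_of_forall_notMem fun P hP => ?_
  have hP := (mem_roots'.1 hP).2
  rw [IsRoot.def] at hP
  obtain ⟨s, t, rfl⟩ := exists_eq_X_add_C_of_natDegree_le_one (natDegree_root_cubicCurve_le hP)
  rw [eval_cubicCurve] at hP
  have e : C ((1 + a) * s ^ 3 + b - a * (1 + s) ^ 3) * X ^ 3 +
      C (3 * ((1 + a) * s ^ 2 * t - a * (1 + s) ^ 2 * (1 + t))) * X ^ 2 +
      C (3 * ((1 + a) * s * t ^ 2 - a * (1 + s) * (1 + t) ^ 2)) * X +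
      C ((1 + a) * t ^ 3 + c - a * (1 + t) ^ 3) = 0 := by
    rw [← hP]
    simp only [map_add, map_mul, map_one, map_ofNat, map_sub, map_pow]
    ring
  have e' := (Cubic.toPoly_eq_zero_iff (⟨_, _, _, _⟩ : Cubic k)).1 e
  simp only [Cubic.ext_iff] at e'
  obtain ⟨e3, e2, e1, e0⟩ := e'
  change _ = (0 : k) at e3 e2 e1 e0
  replace e2 := (mul_eq_zero.1 e2).resolve_left h3
  replace e1 := (mul_eq_zero.1 e1).resolve_left h3
  by_cases hs : s = 0
  · subst hs
    have : 1 + t = 0 := by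
      have : a * (1 + t) = 0 := by linear_combination -e2
      exact (mul_eq_zero.1 this).resolve_left ha
    have ht : t = -1 := by linear_combination this
    subst ht
    exact h1 ⟨by linear_combination e3, by linear_combination e0⟩
  by_cases hs' : 1 + s = 0
  · have hs1 : s = -1 := by linear_combination hs'
    subst hs1
    have ht : t = 0 := by
      have : (1 + a) * t = 0 := by linear_combination e2
      exact (mul_eq_zero.1 this).resolve_left ha'
    subst ht
    exact h2 ⟨by linear_combination e3, by linear_combination e0⟩
  have ht' : 1 + t ≠ 0 := by
    intro h
    have ht : t = -1 := by linear_combination h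
    subst ht
    have : (1 + a) * s ^ 2 = 0 := by linear_combination -e2
    simp [ha', hs] at this
  have hst : s = t := by
    have : a * (1 + s) * (1 + t) * (s - t) = 0 := by linear_combination t * e2 - s * e1
    simp [ha, hs', ht', sub_eq_zero] at this
    exact this
  subst hst
  exact hb (by linear_combination e3 - e2)

end

section

variable {K : Type*} [Field K] [Fintype K]

theorem card_filter_cubic_le {a : K} (ha : a ≠ 0) (b c d : K) :
    (univ.filter fun y => a * y ^ 3 + b * y ^ 2 + c * y + d = 0).card ≤ 3 := by
  have h0 := Cubic.ne_zero_of_a_ne_zero (P := ⟨a, b, c, d⟩) ha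
  refine (card_le_card (t := (Cubic.toPoly ⟨a, b, c, d⟩).roots.toFinset) fun y hy => ?_).trans
    ((Multiset.toFinset_card_le _).trans ((card_roots' _).trans (Cubic.natDegree_of_a_ne_zero ha).le))
  rw [Multiset.mem_toFinset, mem_roots h0, IsRoot.def]
  simpa [Cubic.toPoly] using hy

theorem cubicCount_four (a b c d : K) : (cubicCount ![a, b, c, -d] (fun _ => 1) : ℤ) =
    ∑ z : K, ∑ x : K, ∑ y : K,
      if a * x ^ 3 + b * y ^ 3 + c * z ^ 3 + d * (x + y + z) ^ 3 = 0 then 1 else 0 := by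
  have h : ∀ x y z w : K, x + y + z + w = 0 ↔ w = -(x + y + z) := fun x y z w => by
    rw [add_comm, eq_neg_iff_add_eq_zero]
  rw [cubicCount, card_filter]
  push_cast
  rw [@Fintype.sum_equiv _ _ _ (_) _ (_) (Equiv.refl (Fin 4 → K)) _ (fun x =>
    if ∑ i, (1 : K) * x i = 0 then δ[∑ i, ![a, b, c, -d] i * x i ^ 3 = 0] else 0)
    fun x => by rw [← ite_and]; exact if_congr and_comm rfl rfl, sum_fin_four_arrow, sum_comm]
  conv_rhs => rw [sum_comm]; enter [2, x]; rw [sum_comm]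
  rw [sum_comm]
  refine sum_congr rfl fun x _ => sum_congr rfl fun y _ => sum_congr rfl fun z _ => ?_
  simp only [Fin.sum_univ_four, one_mul]
  change (∑ w : K, if x + y + z + w = 0 then
    δ[a * x ^ 3 + b * y ^ 3 + c * z ^ 3 + -d * w ^ 3 = 0] else 0) = _
  simp only [h, sum_ite_eq', mem_univ, if_true]
  exact if_congr (by ring_nf) rfl rfl

theorem abs_points_cubicCurve_sub_le {p r : ℕ} [Fact p.Prime] [CharP K p] (hK : card K = p ^ r)
    (hp : 3 < p) (hq : 810000 ≤ p ^ r) {a b c : K} (ha : a ≠ 0) (ha' : 1 + a ≠ 0) (hb : b ≠ 0)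
    (h1 : ¬ (b = a ∧ c = 1 + a)) (h2 : ¬ (b = 1 + a ∧ c = a)) :
    |((points (cubicCurve a b c)).card : ℝ) - (card K : ℝ)| ≤ 49086 * √(card K : ℝ) := by
  have hinj := (algebraMap K (AlgebraicClosure K)).injective
  have h3 : ((3 : ℕ) : K) ≠ 0 := fun h => by
    have := Nat.le_of_dvd (by norm_num) ((CharP.cast_eq_zero_iff K p 3).1 h)
    omega
  have h := abs_card_points_sub_le hK (cubicCurve_monic a b c)
    (by rw [natDegree_cubicCurve]; norm_num) (cubicCurve_mem a b c) hp (by simpa using hq) (by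
      rw [bmap_cubicCurve]
      refine irreducible_cubicCurve ?_ ?_ ?_ ?_ ?_ ?_
      · rw [← map_ofNat (algebraMap K (AlgebraicClosure K)), _root_.map_ne_zero]
        exact_mod_cast h3
      · rwa [_root_.map_ne_zero]
      · rwa [← map_one (algebraMap K (AlgebraicClosure K)), ← map_add, _root_.map_ne_zero]
      · rwa [_root_.map_ne_zero]
      · rwa [← map_one (algebraMap K (AlgebraicClosure K)), ← map_add, hinj.eq_iff, hinj.eq_iff]
      · rwa [← map_one (algebraMap K (AlgebraicClosure K)), ← map_add, hinj.eq_iff, hinj.eq_iff])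
  have h' : |((points (cubicCurve a b c)).card : ℝ) - (p ^ r : ℕ)| ≤
    202 * 3 ^ 5 * ((p ^ r).sqrt : ℝ) := by exact_mod_cast h
  rw [hK]
  have := Real.nat_sqrt_le_real_sqrt (a := p ^ r)
  linarith

theorem card_points_eq (F : K[X][X]) :
    ((points F).card : ℤ) = ∑ x : K, ∑ y : K, if evalEval x y F = 0 then 1 else 0 := by
  have : points F = univ.filter fun P : K × K => evalEval P.1 P.2 F = 0 := by
    ext P; simp [mem_points]
  rw [this, card_filter, Fintype.sum_prod_type]
  push_cast
  rfl

theorem abs_cubicCount_four_sub_le {p r : ℕ} [Fact p.Prime] [CharP K p] (hK : card K = p ^ r)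
    (hp : 3 < p) (hq : 810000 ≤ p ^ r) {a b c d : K} (ha : a ≠ 0) (hb : b ≠ 0) (hd : d ≠ 0)
    (hbd : b ≠ d) (h1 : ¬ (a = d ∧ c = b)) (h2 : ¬ (a = b ∧ c = d)) :
    |(cubicCount ![a, b, c, -(-d)] (fun _ => 1) : ℝ) - (card K : ℝ) ^ 2| ≤
      49090 * (card K : ℝ) * √(card K : ℝ) := by
  have hbd' : b - d ≠ 0 := sub_ne_zero.2 hbd
  set N := (points (cubicCurve (d / (b - d)) (a / (b - d)) (c / (b - d)))).card
  have e1 : 1 + d / (b - d) = b / (b - d) := by field_simp; ring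
  have hN := abs_points_cubicCurve_sub_le hK hp hq (a := d / (b - d)) (b := a / (b - d))
    (c := c / (b - d)) (div_ne_zero hd hbd') (e1 ▸ div_ne_zero hb hbd') (div_ne_zero ha hbd')
    (by rwa [e1, div_left_inj' hbd', div_left_inj' hbd'])
    (by rwa [e1, div_left_inj' hbd', div_left_inj' hbd'])
  have hz : ∀ z : K, z ≠ 0 → (∑ x : K, ∑ y : K,
      δ[a * x ^ 3 + b * y ^ 3 + c * z ^ 3 + -d * (x + y + z) ^ 3 = 0]) = N := by
    intro z hz
    rw [card_points_eq, ← Equiv.sum_comp (Equiv.mulLeft₀ z hz)]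
    refine sum_congr rfl fun x _ => ?_
    rw [← Equiv.sum_comp (Equiv.mulLeft₀ z hz)]
    refine sum_congr rfl fun y _ => if_congr ?_ rfl rfl
    rw [evalEval_cubicCurve, e1]
    change a * (z * x) ^ 3 + b * (z * y) ^ 3 + c * z ^ 3 + -d * (z * x + z * y + z) ^ 3 = 0 ↔ _
    have : a * (z * x) ^ 3 + b * (z * y) ^ 3 + c * z ^ 3 + -d * (z * x + z * y + z) ^ 3 =
      z ^ 3 * (b - d) * (b / (b - d) * y ^ 3 + a / (b - d) * x ^ 3 + c / (b - d) -
        d / (b - d) * (x + y + 1) ^ 3) := by field_simp; ring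
    rw [this, mul_eq_zero, or_iff_right (mul_ne_zero (pow_ne_zero 3 hz) hbd')]
  obtain ⟨M, hM⟩ : ∃ M : ℤ, M = ∑ x : K, ∑ y : K,
    δ[a * x ^ 3 + b * y ^ 3 + c * 0 ^ 3 + -d * (x + y + 0) ^ 3 = 0] := ⟨_, rfl⟩
  have hM0 : 0 ≤ M := hM ▸ sum_nonneg fun x _ => sum_nonneg fun y _ => by split_ifs <;> norm_num
  have hM3 : M ≤ card K * 3 := by
    rw [hM]
    refine (sum_le_card_nsmul _ _ 3 fun x _ => ?_).trans (by simp)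
    have := card_filter_cubic_le hbd' (-(3 * d * x)) (-(3 * d * x ^ 2)) (a * x ^ 3 - d * x ^ 3)
    rw [card_filter] at this
    refine le_trans (le_of_eq ?_) (Int.ofNat_le.2 this)
    push_cast
    exact sum_congr rfl fun y _ => if_congr (by ring_nf) rfl rfl
  have e : (cubicCount ![a, b, c, -(-d)] (fun _ => 1) : ℤ) = M + ((card K : ℤ) - 1) * N := by
    rw [cubicCount_four, ← add_sum_erase _ _ (mem_univ (0 : K)), ← hM,
      sum_congr rfl fun z h => hz z (ne_of_mem_erase h), sum_const,
      card_erase_of_mem (mem_univ _), card_univ, nsmul_eq_mul,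
      Nat.cast_sub Fintype.card_pos, Nat.cast_one]
  have e' : (cubicCount ![a, b, c, -(-d)] (fun _ => 1) : ℝ) = M + ((card K : ℝ) - 1) * N := by
    exact_mod_cast e
  have hM0' : (0 : ℝ) ≤ M := by exact_mod_cast hM0
  have hM3' : (M : ℝ) ≤ (card K : ℝ) * 3 := by exact_mod_cast hM3
  have hs : (1 : ℝ) ≤ √(card K : ℝ) := by
    rw [Real.one_le_sqrt]
    exact_mod_cast Fintype.card_pos
  have hq1 : (1 : ℝ) ≤ (card K : ℝ) := by exact_mod_cast Fintype.card_pos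
  rw [e']
  generalize √(card K : ℝ) = s at *
  generalize (card K : ℝ) = q at *
  generalize (M : ℝ) = M' at *
  generalize (N : ℝ) = N' at *
  rw [abs_le] at hN ⊢
  constructor <;> nlinarith [mul_le_mul_of_nonneg_left hs (by linarith : 0 ≤ q)]

theorem abs_mean_mul_le {p r : ℕ} [Fact p.Prime] [CharP K p] (hK : card K = p ^ r)
    (hp : 3 < p) (hq : 810000 ≤ p ^ r) {ψ : AddChar K ℂ} (hψ : ψ.IsPrimitive) {a b c d : K}
    (ha : a ≠ 0) (hb : b ≠ 0) (hc : c ≠ 0) (hd : d ≠ 0)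
    (hbd : b ≠ d) (h1 : ¬ (a = d ∧ c = b)) (h2 : ¬ (a = b ∧ c = d)) :
    |mean (fun x => nsum ψ a 1 x * nsum ψ b 1 x * nsum ψ c 1 x * nsum ψ d 1 x)| ≤
      50000 / √(card K : ℝ) := by
  have h := abs_mean_sub_le hψ (by rw [hK]; omega) (h := 2) (ι := Fin 4) (by simp)
    (g := ![a, b, c, d]) (c := fun _ => 1)
    (by simp [Fin.forall_fin_succ, *]) (fun h => one_ne_zero (congrFun h 0))
  have hN := abs_cubicCount_four_sub_le hK hp hq ha hb hd hbd h1 h2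
  rw [neg_neg] at hN
  have hs := Real.sq_sqrt (Nat.cast_nonneg (card K) : (0 : ℝ) ≤ (card K : ℝ))
  have hs1 : (900 : ℝ) ≤ √(card K : ℝ) := by
    rw [Real.le_sqrt' (by norm_num), hK]
    exact_mod_cast (by omega : 900 ^ 2 ≤ p ^ r)
  have e : ∀ x, ∏ i, nsum ψ (![a, b, c, d] i) 1 x =
      nsum ψ a 1 x * nsum ψ b 1 x * nsum ψ c 1 x * nsum ψ d 1 x := fun x => Fin.prod_univ_four _
  simp only [e] at h
  generalize √(card K : ℝ) = s at *
  generalize (cubicCount ![a, b, c, d] (fun _ => 1) : ℝ) = N at *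
  generalize mean (fun x => nsum ψ a 1 x * nsum ψ b 1 x * nsum ψ c 1 x * nsum ψ d 1 x) = M at *
  rw [← hs] at h hN
  clear hs hK
  have hA : |((s ^ 2) ^ 2 * N - (s ^ 2) ^ (2 * 2)) / ((s ^ 2 - 1) * (s ^ 2) ^ (2 + 1))| ≤ 49091 / s := by
    have h1 : 0 < s ^ 2 - 1 := by nlinarith
    have h2 : 0 < s := by linarith
    rw [show (s ^ 2) ^ 2 * N - (s ^ 2) ^ (2 * 2) = s ^ 4 * (N - (s ^ 2) ^ 2) by ring, abs_div, abs_mul,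
      abs_of_pos (by positivity : 0 < s ^ 4), abs_of_pos (by positivity : 0 < (s ^ 2 - 1) * (s ^ 2) ^ (2 + 1)),
      div_le_div_iff₀ (by positivity) h2]
    calc s ^ 4 * |N - (s ^ 2) ^ 2| * s ≤ s ^ 4 * (49090 * s ^ 2 * s) * s := by gcongr
      _ ≤ _ := by
        rw [show s ^ 4 * (49090 * s ^ 2 * s) * s = s ^ 6 * (49090 * s ^ 2) by ring,
          show 49091 * ((s ^ 2 - 1) * (s ^ 2) ^ (2 + 1)) = s ^ 6 * (49091 * (s ^ 2 - 1)) by ring]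
        refine mul_le_mul_of_nonneg_left ?_ (by positivity)
        nlinarith
  have hB : (12 : ℝ) ^ 2 / s ^ 2 ≤ 1 / s := by
    rw [div_le_div_iff₀ (by positivity) (by linarith)]
    nlinarith
  have hC : (50000 : ℝ) / s = 49091 / s + 909 * (1 / s) := by ring
  have hD : 0 ≤ 1 / s := by positivity
  rw [hC]
  rw [abs_le] at *
  constructor <;> linarith

end

section avg

variable {Ω : Type} (A : Finset Ω) (W : ℝ)

/-- The sum of `f` over `A`, scaled by `W`. -/
noncomputable def avg (f : Ω → ℝ) : ℝ := W * ∑ a ∈ A, f a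

theorem avg_add (f g : Ω → ℝ) : avg A W (fun a => f a + g a) = avg A W f + avg A W g := by
  simp only [avg, sum_add_distrib, mul_add]

theorem avg_sub (f g : Ω → ℝ) : avg A W (fun a => f a - g a) = avg A W f - avg A W g := by
  simp only [avg, sum_sub_distrib, mul_sub]

theorem avg_const_mul (c : ℝ) (f : Ω → ℝ) : avg A W (fun a => c * f a) = c * avg A W f := by
  simp only [avg, ← mul_sum]
  ring

theorem avg_sum {ι : Type*} (s : Finset ι) (f : ι → Ω → ℝ) :
    avg A W (fun a => ∑ i ∈ s, f i a) = ∑ i ∈ s, avg A W (f i) := by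
  simp only [avg, mul_sum]
  rw [sum_comm]

variable {A W}

theorem avg_congr {f g : Ω → ℝ} (h : ∀ a ∈ A, f a = g a) : avg A W f = avg A W g := by
  rw [avg, avg, sum_congr rfl h]

theorem avg_mono (hW : 0 ≤ W) {f g : Ω → ℝ} (h : ∀ a ∈ A, f a ≤ g a) : avg A W f ≤ avg A W g :=
  mul_le_mul_of_nonneg_left (sum_le_sum h) hW

theorem avg_mul_sq_le (hW : 0 ≤ W) (f g : Ω → ℝ) :
    avg A W (fun a => f a * g a) ^ 2 ≤ avg A W (fun a => f a ^ 2) * avg A W (fun a => g a ^ 2) := by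
  have h := mul_le_mul_of_nonneg_left (sum_mul_sq_le_sq_mul_sq A f g) (sq_nonneg W)
  simp only [avg]
  linarith

/-- A large-sieve inequality for almost orthogonal functions. -/
theorem card_mul_sq_le (hW : 0 ≤ W) {J : Type} (s : Finset J) (h : J → Ω → ℝ) (f : Ω → ℝ) {δ η F H : ℝ}
    (D : ℕ) (hδ : 0 < δ) (hη0 : 0 ≤ η) (hH : 0 ≤ H)
    (hf : avg A W (fun a => f a ^ 2) ≤ F) (hFη : F * η ≤ δ ^ 2 / 2)
    (hJ : ∀ j ∈ s, δ ≤ |avg A W (fun a => f a * h j a)|)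
    (hle : ∀ i ∈ s, ∀ j ∈ s, |avg A W (fun a => h i a * h j a)| ≤ H)
    (hη : ∀ i ∈ s, (s.filter fun j => η < |avg A W (fun a => h i a * h j a)|).card ≤ D) :
    (s.card : ℝ) * δ ^ 2 ≤ 2 * F * D * H := by
  rcases s.eq_empty_or_nonempty with rfl | hs
  · have : 0 ≤ F := le_trans (mul_nonneg hW (sum_nonneg fun a _ => sq_nonneg (f a))) hf
    simp only [card_empty, Nat.cast_zero, zero_mul]
    positivity
  have hF : 0 ≤ F := le_trans (mul_nonneg hW (sum_nonneg fun a _ => sq_nonneg (f a))) hf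
  obtain ⟨e, he⟩ : ∃ e : J → ℝ, ∀ j, |e j| = 1 ∧
      e j * avg A W (fun a => f a * h j a) = |avg A W (fun a => f a * h j a)| := by
    have : ∀ x : ℝ, ∃ e : ℝ, |e| = 1 ∧ e * x = |x| := fun x => by
      rcases le_total 0 x with hx | hx
      · exact ⟨1, by simp, by simp [abs_of_nonneg hx]⟩
      · exact ⟨-1, by simp, by simp [abs_of_nonpos hx]⟩
    choose e he using this
    exact ⟨fun j => e _, fun j => he _⟩
  have h1 : (s.card : ℝ) * δ ≤ avg A W (fun a => f a * ∑ j ∈ s, e j * h j a) := by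
    calc (s.card : ℝ) * δ ≤ ∑ j ∈ s, |avg A W (fun a => f a * h j a)| := by
          rw [← nsmul_eq_mul]; exact card_nsmul_le_sum _ _ _ hJ
      _ = ∑ j ∈ s, avg A W (fun a => e j * (f a * h j a)) :=
          sum_congr rfl fun j _ => by rw [avg_const_mul, (he j).2]
      _ = _ := by
          rw [← avg_sum]
          exact avg_congr fun a _ => by rw [mul_sum]; exact sum_congr rfl fun j _ => by ring
  have h2 : avg A W (fun a => (∑ j ∈ s, e j * h j a) ^ 2) ≤ (s.card : ℝ) * (D * H + s.card * η) := by
    calc avg A W (fun a => (∑ j ∈ s, e j * h j a) ^ 2)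
        = ∑ i ∈ s, ∑ j ∈ s, e i * e j * avg A W (fun a => h i a * h j a) := by
          simp only [← avg_const_mul, ← avg_sum]
          refine avg_congr fun a _ => ?_
          rw [sq, sum_mul_sum]
          exact sum_congr rfl fun i _ => sum_congr rfl fun j _ => by ring
      _ ≤ ∑ i ∈ s, (D * H + s.card * η) := by
          refine sum_le_sum fun i hi => ?_
          have key : ∀ j ∈ s, e i * e j * avg A W (fun a => h i a * h j a) ≤
              (if η < |avg A W (fun a => h i a * h j a)| then H else 0) + η := fun j hj => by
            refine (le_abs_self _).trans ?_
            rw [abs_mul, abs_mul, (he i).1, (he j).1, one_mul, one_mul]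
            have := hle i hi j hj
            split_ifs <;> linarith
          refine (sum_le_sum key).trans ?_
          rw [sum_add_distrib, ← sum_filter, sum_const, sum_const, nsmul_eq_mul, nsmul_eq_mul]
          have : ((s.filter fun j => η < |avg A W (fun a => h i a * h j a)|).card : ℝ) ≤ D := by
            exact_mod_cast hη i hi
          gcongr
      _ = _ := by rw [sum_const, nsmul_eq_mul]
  have h3 := avg_mul_sq_le hW (A := A) f (fun a => ∑ j ∈ s, e j * h j a)
  have hs' : (0 : ℝ) < s.card := by exact_mod_cast hs.card_pos
  have h4 : ((s.card : ℝ) * δ) ^ 2 ≤ F * ((s.card : ℝ) * (D * H + s.card * η)) :=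
    (pow_le_pow_left₀ (by positivity) h1 2).trans (h3.trans
      (mul_le_mul hf h2 (mul_nonneg hW (sum_nonneg fun a _ => sq_nonneg _)) hF))
  have h5 : (s.card : ℝ) * ((s.card : ℝ) * δ ^ 2) ≤ s.card * (2 * F * D * H) := by
    nlinarith [mul_le_mul_of_nonneg_left hFη (sq_nonneg (s.card : ℝ))]
  exact le_of_mul_le_mul_left h5 hs'

theorem prod_le_sum_pow {ι : Type*} {s : Finset ι} (hs : s.Nonempty) {a : ι → ℝ} (ha : ∀ i, 0 ≤ a i) :
    ∏ i ∈ s, a i ≤ ∑ i ∈ s, a i ^ s.card := by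
  obtain ⟨m, hm, h⟩ := s.exists_max_image a hs
  calc ∏ i ∈ s, a i ≤ ∏ _i ∈ s, a m := prod_le_prod (fun i _ => ha i) h
    _ = a m ^ s.card := prod_const _
    _ ≤ _ := single_le_sum (f := fun i => a i ^ s.card) (fun i _ => pow_nonneg (ha i) _) hm

end avg

section moments

variable {Ω S : Type} {A : Finset Ω} {W : ℝ} {v : S → Ω → ℝ} {η B : ℝ}

/-- Moments of a family of functions, up to an error `η`. -/
structure Moments (A : Finset Ω) (W : ℝ) (v : S → Ω → ℝ) (η B : ℝ) : Prop where
  nonneg : 0 ≤ W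
  one : |avg A W (fun _ => 1) - 1| ≤ η
  two : ∀ s, |avg A W (fun a => v s a ^ 2) - 1| ≤ η
  four : ∀ s, 2 - η ≤ avg A W (fun a => v s a ^ 4)
  two_two : ∀ s t, s ≠ t → |avg A W (fun a => v s a ^ 2 * v t a ^ 2) - 1| ≤ η
  six : ∀ s, avg A W (fun a => v s a ^ 6) ≤ 5 + η
  eight : ∀ s, avg A W (fun a => v s a ^ 8) ≤ B
  quad : ∀ a b c d, b ≠ d → ¬ (a = d ∧ c = b) → ¬ (a = b ∧ c = d) →
    |avg A W (fun x => v a x * v b x * v c x * v d x)| ≤ η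

theorem Moments.eta_nonneg (h : Moments A W v η B) : 0 ≤ η := (abs_nonneg _).trans h.one

/-- The pairs of distinct symbols which correlate with a given function. -/
theorem Moments.card_pairs_le [Fintype S] (h : Moments A W v η B) (hη : η ≤ 1) {F : ℝ} {f : Ω → ℝ}
    (hf : avg A W (fun a => f a ^ 2) ≤ F) (hFη : F * η ≤ 1 / 8) :
    ((univ.filter fun P : S × S => P.1 ≠ P.2 ∧
      1 / 2 ≤ |avg A W (fun a => f a * (v P.1 a * v P.2 a))|).card : ℝ) ≤ 32 * F := by
  have hD : ∀ P : S × S, ∀ T : Finset (S × S), (∀ Q ∈ T, Q = P ∨ Q = P.swap) → T.card ≤ 2 :=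
    fun P T hT => (card_le_card (t := {P, P.swap}) fun Q hQ => by
      simpa using hT Q hQ).trans card_le_two
  have hη0 := h.eta_nonneg
  have := card_mul_sq_le h.nonneg (univ.filter fun P : S × S => P.1 ≠ P.2 ∧
      1 / 2 ≤ |avg A W (fun a => f a * (v P.1 a * v P.2 a))|)
    (fun P a => v P.1 a * v P.2 a) f (δ := 1 / 2) (η := η) (H := 2) 2 (by norm_num) hη0
    (by norm_num) hf (by linarith) (fun P hP => (mem_filter.1 hP).2.2) ?_ ?_
  · push_cast at this
    linarith
  · intro P hP Q hQ
    by_cases hPQ : Q = P ∨ Q = P.swap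
    · have e := h.two_two P.1 P.2 (mem_filter.1 hP).2.1
      have : avg A W (fun a => v P.1 a * v P.2 a * (v Q.1 a * v Q.2 a)) =
          avg A W (fun a => v P.1 a ^ 2 * v P.2 a ^ 2) := avg_congr fun a _ => by
        rcases hPQ with rfl | rfl
        · ring
        · simp only [Prod.fst_swap, Prod.snd_swap]; ring
      rw [this]
      rw [abs_le] at e ⊢
      constructor <;> linarith
    · have e := h.quad P.1 Q.1 P.2 Q.2 (mem_filter.1 hQ).2.1
        (fun e => hPQ (Or.inr (Prod.ext e.2.symm e.1.symm)))
        (fun e => hPQ (Or.inl (Prod.ext e.1.symm e.2.symm)))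
      have e' : avg A W (fun a => v P.1 a * v P.2 a * (v Q.1 a * v Q.2 a)) =
          avg A W (fun a => v P.1 a * v Q.1 a * v P.2 a * v Q.2 a) := avg_congr fun a _ => by ring
      rw [e']
      linarith
  · intro P hP
    refine hD P _ fun Q hQ => ?_
    rw [mem_filter] at hQ
    by_contra hPQ
    have e := h.quad P.1 Q.1 P.2 Q.2 (mem_filter.1 hQ.1).2.1
        (fun e => hPQ (Or.inr (Prod.ext e.2.symm e.1.symm)))
        (fun e => hPQ (Or.inl (Prod.ext e.1.symm e.2.symm)))
    have e' : avg A W (fun a => v P.1 a * v P.2 a * (v Q.1 a * v Q.2 a)) =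
        avg A W (fun a => v P.1 a * v Q.1 a * v P.2 a * v Q.2 a) := avg_congr fun a _ => by ring
    rw [e'] at hQ
    linarith [hQ.2]

/-- The symbols whose square correlates with a given function. -/
theorem Moments.card_symbols_le [Fintype S] (h : Moments A W v η B) (hη : η ≤ 1) {F δ : ℝ}
    (hδ : 0 < δ) {f : Ω → ℝ} (hf : avg A W (fun a => f a ^ 2) ≤ F) (hB : 0 ≤ B)
    (hFη : F * (4 * η) ≤ δ ^ 2 / 2) :
    ((univ.filter fun s : S => δ ≤ |avg A W (fun a => f a * (v s a ^ 2 - 1))|).card : ℝ)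
      * δ ^ 2 ≤ 2 * F * (B + 4) := by
  have hη0 := h.eta_nonneg
  have h4 : ∀ s, 0 ≤ avg A W (fun a => v s a ^ 4) ∧ avg A W (fun a => v s a ^ 4) ≤ B + 2 := fun s => by
    refine ⟨mul_nonneg h.nonneg (sum_nonneg fun a _ => by positivity), ?_⟩
    have : avg A W (fun a => v s a ^ 4) ≤ avg A W (fun a => v s a ^ 8 + 1) :=
      avg_mono h.nonneg fun a _ => by nlinarith [sq_nonneg (v s a ^ 4 - 1)]
    rw [avg_add] at this
    have h1 := (abs_le.1 h.one).2
    linarith [h.eight s]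
  have e : ∀ s t, avg A W (fun a => (v s a ^ 2 - 1) * (v t a ^ 2 - 1)) =
      avg A W (fun a => v s a ^ 2 * v t a ^ 2) - avg A W (fun a => v s a ^ 2) -
        avg A W (fun a => v t a ^ 2) + avg A W (fun _ => 1) := fun s t => by
    rw [← avg_sub, ← avg_sub, ← avg_add]
    exact avg_congr fun a _ => by ring
  have hne : ∀ s t, s ≠ t → |avg A W (fun a => (v s a ^ 2 - 1) * (v t a ^ 2 - 1))| ≤ 4 * η :=
    fun s t hst => by
      rw [e]
      have h1 := abs_le.1 h.one
      have h2 := abs_le.1 (h.two s)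
      have h3 := abs_le.1 (h.two t)
      have h4 := abs_le.1 (h.two_two s t hst)
      rw [abs_le]
      constructor <;> linarith
  have := card_mul_sq_le h.nonneg (univ.filter fun s : S =>
      δ ≤ |avg A W (fun a => f a * (v s a ^ 2 - 1))|)
    (fun s a => v s a ^ 2 - 1) f (δ := δ) (η := 4 * η) (H := B + 4) 1 hδ (by linarith)
    (by linarith) hf hFη (fun P hP => (mem_filter.1 hP).2) ?_ ?_
  · push_cast at this
    linarith
  · intro s _ t _
    by_cases hst : s = t
    · subst hst
      rw [e]
      have h1 := abs_le.1 h.one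
      have h2 := abs_le.1 (h.two s)
      have h3 := h4 s
      have e : avg A W (fun a => v s a ^ 2 * v s a ^ 2) = avg A W (fun a => v s a ^ 4) :=
        avg_congr fun a _ => by ring
      rw [e, abs_le]
      constructor <;> linarith
    · linarith [hne s t hst]
  · intro s _
    refine (card_le_card (t := {s}) fun t ht => ?_).trans (card_singleton s).le
    rw [mem_filter] at ht
    by_contra hst
    rw [mem_singleton] at hst
    linarith [ht.2, hne s t (Ne.symm hst)]

/-- Three symbols whose joint moments deviate from those of independent ones. -/
def Resonant (A : Finset Ω) (W : ℝ) (v : S → Ω → ℝ) (θ : ℝ) (a b c : S) : Prop :=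
  c = b ∨ (a ≠ b ∧ 1 + 2 * θ < avg A W (fun x => v a x ^ 2 * v b x ^ 2 * v c x ^ 2)) ∨
    avg A W (fun x => v b x ^ 4 * v c x ^ 2) < 2 - 2 * θ

theorem Moments.card_resonant_le [Fintype S] (h : Moments A W v η B) (hη : η ≤ 1) {θ : ℝ} (hθ : 0 < θ)
    (hηθ : η ≤ θ) (hB : 0 ≤ B) (hBη : 2 * B * (4 * η) ≤ θ ^ 2 / 2) (a b : S) :
    ((univ.filter fun c => Resonant A W v θ a b c).card : ℝ) ≤ 1 + 8 * B * (B + 4) / θ ^ 2 := by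
  have f1 : avg A W (fun x => (v a x ^ 2 * v b x ^ 2) ^ 2) ≤ 2 * B := by
    have : avg A W (fun x => (v a x ^ 2 * v b x ^ 2) ^ 2) ≤
        avg A W (fun x => v a x ^ 8 + v b x ^ 8) :=
      avg_mono h.nonneg fun x _ => by
        nlinarith [sq_nonneg (v a x ^ 4 - v b x ^ 4), sq_nonneg (v a x ^ 4), sq_nonneg (v b x ^ 4)]
    rw [avg_add] at this
    linarith [h.eight a, h.eight b]
  have f2 : avg A W (fun x => (v b x ^ 4) ^ 2) ≤ 2 * B := by
    have : avg A W (fun x => (v b x ^ 4) ^ 2) = avg A W (fun x => v b x ^ 8) :=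
      avg_congr fun x _ => by ring
    linarith [h.eight b]
  have c1 := h.card_symbols_le hη hθ f1 hB hBη
  have c2 := h.card_symbols_le hη hθ f2 hB hBη
  have hsub : (univ.filter fun c => Resonant A W v θ a b c) ⊆ ({b} ∪ (univ.filter fun s : S =>
        θ ≤ |avg A W (fun x => v a x ^ 2 * v b x ^ 2 * (v s x ^ 2 - 1))|)) ∪
      (univ.filter fun s : S => θ ≤ |avg A W (fun x => v b x ^ 4 * (v s x ^ 2 - 1))|) := by
    intro c hc
    rw [mem_filter] at hc
    simp only [mem_union, mem_singleton, mem_filter, mem_univ, true_and]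
    rcases hc.2 with hc | ⟨hab, hc⟩ | hc
    · exact Or.inl (Or.inl hc)
    · refine Or.inl (Or.inr (le_trans ?_ (le_abs_self _)))
      have e : avg A W (fun x => v a x ^ 2 * v b x ^ 2 * (v c x ^ 2 - 1)) =
          avg A W (fun x => v a x ^ 2 * v b x ^ 2 * v c x ^ 2) -
            avg A W (fun x => v a x ^ 2 * v b x ^ 2) := by
        rw [← avg_sub]; exact avg_congr fun x _ => by ring
      have := (abs_le.1 (h.two_two a b hab)).2
      linarith
    · refine Or.inr (le_trans ?_ (neg_le_abs _))
      have e : avg A W (fun x => v b x ^ 4 * (v c x ^ 2 - 1)) =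
          avg A W (fun x => v b x ^ 4 * v c x ^ 2) - avg A W (fun x => v b x ^ 4) := by
        rw [← avg_sub]; exact avg_congr fun x _ => by ring
      linarith [h.four b]
  have hc := (card_le_card hsub).trans ((card_union_le _ _).trans
    (Nat.add_le_add_right (card_union_le _ _) _))
  rw [card_singleton] at hc
  have hc' : ((univ.filter fun c => Resonant A W v θ a b c).card : ℝ) ≤
      1 + ((univ.filter fun s : S =>
        θ ≤ |avg A W (fun x => v a x ^ 2 * v b x ^ 2 * (v s x ^ 2 - 1))|).card : ℝ) +
      ((univ.filter fun s : S =>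
        θ ≤ |avg A W (fun x => v b x ^ 4 * (v s x ^ 2 - 1))|).card : ℝ) := by exact_mod_cast hc
  rw [← le_div_iff₀ (by positivity)] at c1 c2
  rw [show 8 * B * (B + 4) / θ ^ 2 = 2 * (2 * B) * (B + 4) / θ ^ 2 + 2 * (2 * B) * (B + 4) / θ ^ 2 by
    ring]
  linarith

end moments

section sextic

/-- The symmetric sextic form whose mean is negative for independent Sato–Tate variables. -/
def sextic (v : Fin 6 → ℝ) : ℝ :=
  (∑ i, v i ^ 2) ^ 3 - 8 * (∑ i, v i ^ 2) * (∑ i, v i ^ 4) + 12 * ∑ i, v i ^ 6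

/-- The defect in the equality of complementary triple products. -/
def defect (m : ℝ) (v : Fin 6 → ℝ) : ℝ :=
  ∑ T ∈ powersetCard 3 univ, (∏ i ∈ T, v i - m * ∏ i ∈ Tᶜ, v i) ^ 2

theorem defect_nonneg (m : ℝ) (v : Fin 6 → ℝ) : 0 ≤ defect m v := sum_nonneg fun _ _ => sq_nonneg _

theorem mul_eq_zero_of_defect_eq_zero {m : ℝ} {v : Fin 6 → ℝ} (h : defect m v = 0)
    {i j k l : Fin 6} (hij : i ≠ j) (hik : i ≠ k) (hil : i ≠ l) (hjk : j ≠ k) (hjl : j ≠ l)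
    (hkl : k ≠ l) : v k * v l * (v i ^ 2 - v j ^ 2) = 0 := by
  rw [defect, sum_eq_zero_iff_of_nonneg fun _ _ => sq_nonneg _] at h
  have key : ∀ i j : Fin 6, i ≠ j → i ≠ k → i ≠ l → j ≠ k → j ≠ l →
      v i * v k * v l = m * (v j * ∏ x ∈ ({i, j, k, l} : Finset (Fin 6))ᶜ, v x) := by
    intro i j hij hik hil hjk hjl
    have h1 := h {i, k, l} (mem_powersetCard.2 ⟨subset_univ _,
      card_eq_three.2 ⟨i, k, l, hik, hil, hkl, rfl⟩⟩)
    have e : ({i, k, l} : Finset (Fin 6))ᶜ = insert j ({i, j, k, l} : Finset (Fin 6))ᶜ := by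
      ext x
      simp only [mem_compl, mem_insert, mem_singleton]
      by_cases hx : x = j
      · subst hx; simp [*, Ne.symm hij]
      · simp [hx]
    have e1 : ∏ x ∈ ({i, k, l} : Finset (Fin 6)), v x = v i * (v k * v l) := by
      rw [prod_insert (by simp [hik, hil]), prod_insert (by simpa using hkl), prod_singleton]
    rw [e, e1, prod_insert (by simp)] at h1
    linear_combination pow_eq_zero_iff two_ne_zero |>.1 h1
  have h1 := key i j hij hik hil hjk hjl
  have h2 := key j i hij.symm hjk hjl hik hil
  rw [show ({j, i, k, l} : Finset (Fin 6)) = {i, j, k, l} from insert_comm _ _ _] at h2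
  linear_combination v i * h1 - v j * h2

theorem sextic_nonneg_of_defect_eq_zero {m : ℝ} {v : Fin 6 → ℝ} (h : defect m v = 0) :
    0 ≤ sextic v := by
  by_cases h3 : ∃ k l n : Fin 6, k ≠ l ∧ k ≠ n ∧ l ≠ n ∧ v k ≠ 0 ∧ v l ≠ 0 ∧ v n ≠ 0
  · obtain ⟨k, l, n, hkl, hkn, hln, hk, hl, hn⟩ := h3
    have hne : ∀ j, v j ≠ 0 := by
      intro j
      by_cases h1 : j = k
      · exact h1 ▸ hk
      by_cases h2 : j = l
      · exact h2 ▸ hl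
      by_cases h3 : j = n
      · exact h3 ▸ hn
      have := mul_eq_zero_of_defect_eq_zero h (Ne.symm h3) hkn.symm hln.symm h1 h2 hkl
      intro h0
      simp [hk, hl, hn, h0] at this
    have heq : ∀ i, v i ^ 2 = v 0 ^ 2 := by
      intro i
      by_cases hi : i = 0
      · rw [hi]
      obtain ⟨k, l, h1, h2, h3, h4, h5⟩ : ∃ k l : Fin 6, i ≠ k ∧ i ≠ l ∧ 0 ≠ k ∧ 0 ≠ l ∧ k ≠ l := by
        revert i; decide
      have := mul_eq_zero_of_defect_eq_zero h hi h1 h2 h3 h4 h5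
      simp only [mul_eq_zero, hne, or_self, false_or] at this
      linarith
    have h4 : ∀ i, v i ^ 4 = (v 0 ^ 2) ^ 2 := fun i => by rw [← heq i]; ring
    have h6 : ∀ i, v i ^ 6 = (v 0 ^ 2) ^ 3 := fun i => by rw [← heq i]; ring
    simp only [sextic, heq, h4, h6, sum_const, card_univ, Fintype.card_fin]
    refine le_of_eq ?_
    ring
  · push Not at h3
    obtain ⟨k, l, hkl, h0⟩ : ∃ k l : Fin 6, k ≠ l ∧ ∀ n, n ≠ k → n ≠ l → v n = 0 := by
      by_cases h2 : ∃ k l : Fin 6, k ≠ l ∧ v k ≠ 0 ∧ v l ≠ 0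
      · obtain ⟨k, l, hkl, hk, hl⟩ := h2
        exact ⟨k, l, hkl, fun n hnk hnl => h3 k l n hkl hnk.symm hnl.symm hk hl⟩
      · push Not at h2
        by_cases h1 : ∃ k, v k ≠ 0
        · obtain ⟨k, hk⟩ := h1
          obtain ⟨l, hl⟩ := exists_ne k
          exact ⟨k, l, hl.symm, fun n hn _ => h2 k n hn.symm hk⟩
        · push Not at h1
          exact ⟨0, 1, by decide, fun n _ _ => h1 n⟩
    have hs : ∀ e : ℕ, e ≠ 0 → ∑ i, v i ^ e = v k ^ e + v l ^ e := fun e he =>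
      sum_eq_add k l hkl (fun n _ hn => by rw [h0 n hn.1 hn.2, zero_pow he])
        (fun h => absurd (mem_univ _) h) (fun h => absurd (mem_univ _) h)
    rw [sextic, hs 2 (by norm_num), hs 4 (by norm_num), hs 6 (by norm_num)]
    have : (v k ^ 2 + v l ^ 2) ^ 3 - 8 * (v k ^ 2 + v l ^ 2) * (v k ^ 4 + v l ^ 4) +
      12 * (v k ^ 6 + v l ^ 6) = 5 * ((v k ^ 2 + v l ^ 2) * (v k ^ 2 - v l ^ 2) ^ 2) := by ring
    rw [this]
    positivity

theorem continuous_sextic : Continuous sextic := by unfold sextic; fun_prop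

theorem continuous_defect (m : ℝ) : Continuous (defect m) := by unfold defect; fun_prop

theorem sextic_smul (t : ℝ) (v : Fin 6 → ℝ) : sextic (t • v) = t ^ 6 * sextic v := by
  simp only [sextic, Pi.smul_apply, smul_eq_mul, mul_pow, ← mul_sum]
  ring

theorem defect_smul (m t : ℝ) (v : Fin 6 → ℝ) : defect m (t • v) = t ^ 6 * defect m v := by
  rw [defect, defect, mul_sum]
  refine sum_congr rfl fun T hT => ?_
  have h1 := (mem_powersetCard.1 hT).2
  have h2 : Tᶜ.card = 3 := by rw [card_compl, h1, Fintype.card_fin]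
  simp only [Pi.smul_apply, smul_eq_mul, prod_mul_distrib, prod_const, h1, h2]
  ring

theorem exists_neg_le_sextic (m : ℝ) {κ : ℝ} (hκ : 0 < κ) : ∃ C : ℝ, 0 ≤ C ∧ ∀ v : Fin 6 → ℝ,
    -(κ * ∑ i, v i ^ 6) - C * defect m v ≤ sextic v := by
  suffices H : ∃ C : ℝ, 0 ≤ C ∧ ∀ v ∈ Metric.sphere (0 : Fin 6 → ℝ) 1,
      -(κ * ∑ i, v i ^ 6) - C * defect m v ≤ sextic v by
    obtain ⟨C, hC, H⟩ := H
    refine ⟨C, hC, fun v => ?_⟩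
    by_cases hv : v = 0
    · subst hv
      have := H
      simp [sextic, mul_nonneg hC (defect_nonneg m _)]
    have hn := norm_pos_iff.2 hv
    have h1 := H (‖v‖⁻¹ • v) (by simp [norm_smul, hn.ne'])
    have e : v = ‖v‖ • (‖v‖⁻¹ • v) := by rw [smul_smul, mul_inv_cancel₀ hn.ne', one_smul]
    generalize ‖v‖⁻¹ • v = w at *
    generalize ‖v‖ = t at *
    subst e
    simp only [sextic_smul, defect_smul, Pi.smul_apply, smul_eq_mul, mul_pow, ← mul_sum]
    nlinarith [mul_le_mul_of_nonneg_left h1 (pow_nonneg hn.le 6)]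
  set P : Set (Fin 6 → ℝ) := {v | v ∈ Metric.sphere (0 : Fin 6 → ℝ) 1 ∧
    sextic v ≤ -(κ * ∑ i, v i ^ 6)} with hP
  have hPc : IsCompact P := (isCompact_sphere 0 1).inter_right
    (isClosed_le continuous_sextic (by fun_prop))
  rcases P.eq_empty_or_nonempty with h0 | hne
  · refine ⟨0, le_rfl, fun v hv => ?_⟩
    by_contra! h
    have : v ∈ P := ⟨hv, by linarith⟩
    rw [h0] at this
    exact this
  obtain ⟨x, hx, hxmin⟩ := hPc.exists_isMinOn hne (continuous_defect m).continuousOn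
  obtain ⟨y, hy, hymin⟩ := hPc.exists_isMinOn hne continuous_sextic.continuousOn
  have hpos : ∀ v ∈ Metric.sphere (0 : Fin 6 → ℝ) 1, 0 < ∑ i, v i ^ 6 := by
    intro v hv
    have h0 : v ≠ 0 := by rintro rfl; simp at hv
    obtain ⟨i, hi⟩ := ne_iff.1 h0
    exact sum_pos' (fun i _ => by positivity) ⟨i, mem_univ i, by
      have : v i ≠ 0 := hi
      positivity⟩
  have hd : 0 < defect m x := by
    refine lt_of_le_of_ne (defect_nonneg m x) fun h => ?_
    have h1 := sextic_nonneg_of_defect_eq_zero h.symm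
    have h2 := hpos x hx.1
    nlinarith [hx.2]
  have hy0 : sextic y ≤ 0 := hy.2.trans (by have := hpos y hy.1; nlinarith)
  refine ⟨-sextic y / defect m x, div_nonneg (by linarith) hd.le, fun v hv => ?_⟩
  have hv6 := hpos v hv
  by_cases hvP : v ∈ P
  · have h1 : defect m x ≤ defect m v := hxmin hvP
    have h2 : sextic y ≤ sextic v := hymin hvP
    have h3 : -sextic y ≤ -sextic y / defect m x * defect m v := by
      rw [div_mul_eq_mul_div, le_div_iff₀ hd]
      exact mul_le_mul_of_nonneg_left h1 (by linarith)
    nlinarith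
  · have h1 : -(κ * ∑ i, v i ^ 6) < sextic v := not_le.1 fun h => hvP ⟨hv, h⟩
    have h2 : 0 ≤ -sextic y / defect m x * defect m v :=
      mul_nonneg (div_nonneg (by linarith) hd.le) (defect_nonneg m v)
    linarith

end sextic

section

variable {Ω S : Type} {A : Finset Ω} {W : ℝ} {v : S → Ω → ℝ} {η B : ℝ}

theorem sextic_eq (v : Fin 6 → ℝ) : sextic v =
    ∑ i, ∑ j ∈ univ.erase i, ∑ k ∈ (univ.erase i).erase j, v i ^ 2 * v j ^ 2 * v k ^ 2 -
      5 * ∑ i, ∑ j ∈ univ.erase i, v i ^ 4 * v j ^ 2 + 5 * ∑ i, v i ^ 6 := by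
  have h1 : ∀ i, ∑ j ∈ univ.erase i, ∑ k ∈ (univ.erase i).erase j,
      v i ^ 2 * v j ^ 2 * v k ^ 2 = v i ^ 2 * ((∑ j, v j ^ 2) ^ 2 - 2 * (∑ j, v j ^ 2) * v i ^ 2 +
        2 * v i ^ 4 - ∑ j, v j ^ 4) := by
    intro i
    have : ∀ j ∈ univ.erase i, ∑ k ∈ (univ.erase i).erase j,
        v i ^ 2 * v j ^ 2 * v k ^ 2 = v i ^ 2 * (v j ^ 2 * (∑ j, v j ^ 2 - v i ^ 2) - v j ^ 4) := by
      intro j hj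
      rw [← mul_sum, sum_erase_eq_sub hj, sum_erase_eq_sub (mem_univ i)]
      ring
    rw [sum_congr rfl this, ← mul_sum, sum_sub_distrib, ← sum_mul,
      sum_erase_eq_sub (mem_univ i), sum_erase_eq_sub (mem_univ i)]
    ring
  have h2 : ∀ i, ∑ j ∈ univ.erase i, v i ^ 4 * v j ^ 2 = v i ^ 4 * (∑ j, v j ^ 2) - v i ^ 6 := by
    intro i
    rw [← mul_sum, sum_erase_eq_sub (mem_univ i)]
    ring
  simp only [h1, h2, sum_sub_distrib, ← sum_mul, mul_sub, mul_add, sum_add_distrib]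
  have e1 : ∀ c : ℝ, ∑ i, v i ^ 2 * (c * v i ^ 2) = c * ∑ i, v i ^ 4 := fun c => by
    rw [mul_sum]; exact sum_congr rfl fun i _ => by ring
  have e2 : ∑ i, v i ^ 2 * (2 * v i ^ 4) = 2 * ∑ i, v i ^ 6 := by
    rw [mul_sum]; exact sum_congr rfl fun i _ => by ring
  rw [e1, e2, sextic]
  ring

theorem avg_sextic_le {u : Fin 6 → Ω → ℝ} {θ : ℝ} (h6 : ∀ i, avg A W (fun x => u i x ^ 6) ≤ 5 + θ)
    (h42 : ∀ i j, i ≠ j → 2 - 2 * θ ≤ avg A W (fun x => u i x ^ 4 * u j x ^ 2))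
    (h222 : ∀ i j k, i ≠ j → i ≠ k → j ≠ k →
      avg A W (fun x => u i x ^ 2 * u j x ^ 2 * u k x ^ 2) ≤ 1 + 2 * θ) :
    avg A W (fun x => sextic fun i => u i x) ≤ -30 + 570 * θ := by
  simp only [sextic_eq, avg_add, avg_sub, avg_const_mul, avg_sum]
  have h1 : ∑ i, ∑ j ∈ univ.erase i, ∑ k ∈ (univ.erase i).erase j,
      avg A W (fun x => u i x ^ 2 * u j x ^ 2 * u k x ^ 2) ≤ 120 * (1 + 2 * θ) := by
    refine (sum_le_card_nsmul _ _ (20 * (1 + 2 * θ)) fun i _ => ?_).trans (le_of_eq (by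
      rw [nsmul_eq_mul, card_univ, Fintype.card_fin]; push_cast; ring))
    refine (sum_le_card_nsmul _ _ (4 * (1 + 2 * θ)) fun j hj => ?_).trans (le_of_eq (by
      rw [nsmul_eq_mul, card_erase_of_mem (mem_univ i), card_univ,
        Fintype.card_fin]; push_cast; ring))
    refine (sum_le_card_nsmul _ _ (1 + 2 * θ) fun k hk => ?_).trans (le_of_eq (by
      rw [nsmul_eq_mul, card_erase_of_mem hj, card_erase_of_mem (mem_univ i),
        card_univ, Fintype.card_fin]; push_cast; ring))
    simp only [mem_erase, mem_univ, and_true] at hj hk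
    exact h222 i j k hj.symm hk.2.symm hk.1.symm
  have h2 : 30 * (2 - 2 * θ) ≤ ∑ i, ∑ j ∈ univ.erase i,
      avg A W (fun x => u i x ^ 4 * u j x ^ 2) := by
    refine le_trans (le_of_eq (by
      rw [nsmul_eq_mul, card_univ, Fintype.card_fin]; push_cast; ring))
      (card_nsmul_le_sum _ _ (5 * (2 - 2 * θ)) fun i _ => ?_)
    refine le_trans (le_of_eq (by
      rw [nsmul_eq_mul, card_erase_of_mem (mem_univ i), card_univ,
        Fintype.card_fin]; push_cast; ring))
      (card_nsmul_le_sum _ _ (2 - 2 * θ) fun j hj => h42 i j (ne_of_mem_erase hj).symm)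
  have h3 : ∑ i, avg A W (fun x => u i x ^ 6) ≤ 6 * (5 + θ) :=
    (sum_le_card_nsmul _ _ (5 + θ) fun i _ => h6 i).trans (le_of_eq (by
      rw [nsmul_eq_mul, card_univ, Fintype.card_fin]; push_cast; ring))
  linarith

theorem avg_defect_le {u : Fin 6 → Ω → ℝ} {θ δ m : ℝ} (hm : m ^ 2 = 1)
    (hδ : 1 - δ ≤ m * avg A W (fun x => ∏ i, u i x))
    (h222 : ∀ i j k, i ≠ j → i ≠ k → j ≠ k →
      avg A W (fun x => u i x ^ 2 * u j x ^ 2 * u k x ^ 2) ≤ 1 + 2 * θ) :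
    avg A W (fun x => defect m fun i => u i x) ≤ 80 * θ + 40 * δ := by
  simp only [defect, avg_sum]
  refine (sum_le_card_nsmul _ _ (4 * θ + 2 * δ) fun T hT => ?_).trans (le_of_eq (by
    rw [nsmul_eq_mul, card_powersetCard, card_univ, Fintype.card_fin]
    norm_num [Nat.choose]; ring))
  have key : ∀ T : Finset (Fin 6), T.card = 3 → avg A W (fun x => (∏ i ∈ T, u i x) ^ 2) ≤ 1 + 2 * θ := by
    intro T hT
    obtain ⟨i, j, k, hij, hik, hjk, rfl⟩ := card_eq_three.1 hT
    rw [avg_congr fun x _ => by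
      rw [prod_insert (by simp [hij, hik]), prod_insert (by simpa using hjk),
        prod_singleton, ← mul_assoc, mul_pow, mul_pow]]
    exact h222 i j k hij hik hjk
  have hT3 := (mem_powersetCard.1 hT).2
  have h1 := key T hT3
  have h2 := key Tᶜ (by rw [card_compl, hT3, Fintype.card_fin])
  have e : avg A W (fun x => (∏ i ∈ T, u i x - m * ∏ i ∈ Tᶜ, u i x) ^ 2) =
      avg A W (fun x => (∏ i ∈ T, u i x) ^ 2) + avg A W (fun x => (∏ i ∈ Tᶜ, u i x) ^ 2) -
        2 * (m * avg A W (fun x => ∏ i, u i x)) := by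
    rw [← avg_const_mul, ← avg_const_mul, ← avg_add, ← avg_sub]
    refine avg_congr fun x _ => ?_
    rw [← prod_mul_prod_compl T]
    linear_combination (∏ i ∈ Tᶜ, u i x) ^ 2 * hm
  rw [e]
  linarith

theorem exists_resonant : ∃ δ : ℝ, 0 < δ ∧ δ ≤ 1 / 2 ∧
    ∀ {Ω S : Type} {A : Finset Ω} {W : ℝ} {v : S → Ω → ℝ} {η B : ℝ}, Moments A W v η B → η ≤ δ →
      ∀ s : Fin 6 → S, 1 - δ ≤ |avg A W (fun x => ∏ i, v (s i) x)| →
        ∃ a b c : Fin 6, a ≠ b ∧ a ≠ c ∧ b ≠ c ∧ Resonant A W v δ (s a) (s b) (s c) := by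
  obtain ⟨C₁, hC₁, H₁⟩ := exists_neg_le_sextic 1 (κ := 1 / 2) (by norm_num)
  obtain ⟨C₂, hC₂, H₂⟩ := exists_neg_le_sextic (-1) (κ := 1 / 2) (by norm_num)
  have hδ : 0 < 1 / (100 * (1 + C₁ + C₂)) := by positivity
  have hδ' : 1 / (100 * (1 + C₁ + C₂)) * (100 * (1 + C₁ + C₂)) = 1 :=
    div_mul_cancel₀ _ (by positivity)
  have hδ2 : 1 / (100 * (1 + C₁ + C₂)) ≤ 1 / 2 := by
    rw [div_le_div_iff₀ (by positivity) (by norm_num)]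
    linarith
  refine ⟨1 / (100 * (1 + C₁ + C₂)), hδ, hδ2, ?_⟩
  generalize 1 / (100 * (1 + C₁ + C₂)) = δ at *
  intro Ω S A W v η B h hη s hs
  by_contra! hR
  have hinj : ∀ i j, i ≠ j → s i ≠ s j := by
    intro i j hij he
    obtain ⟨a, h1, h2⟩ : ∃ a : Fin 6, a ≠ i ∧ a ≠ j := by
      clear hR he
      revert i j; decide
    exact hR a j i h2 h1 hij.symm (Or.inl he)
  have h222 : ∀ i j k, i ≠ j → i ≠ k → j ≠ k →
      avg A W (fun x => v (s i) x ^ 2 * v (s j) x ^ 2 * v (s k) x ^ 2) ≤ 1 + 2 * δ := by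
    intro i j k hij hik hjk
    by_contra! hc
    exact hR i j k hij hik hjk (Or.inr (Or.inl ⟨hinj i j hij, hc⟩))
  have h42 : ∀ i j, i ≠ j → 2 - 2 * δ ≤ avg A W (fun x => v (s i) x ^ 4 * v (s j) x ^ 2) := by
    intro i j hij
    by_contra! hc
    obtain ⟨a, h1, h2⟩ : ∃ a : Fin 6, a ≠ i ∧ a ≠ j := by
      clear hc
      revert i j; decide
    exact hR a i j h1 h2 hij (Or.inr (Or.inr hc))
  have h6 : ∀ i, avg A W (fun x => v (s i) x ^ 6) ≤ 5 + δ := fun i => (h.six _).trans (by linarith)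
  have hS := avg_sextic_le h6 h42 h222
  have key : ∀ m C : ℝ, m ^ 2 = 1 → 0 ≤ C → C ≤ C₁ + C₂ → (∀ v : Fin 6 → ℝ,
      -(1 / 2 * ∑ i, v i ^ 6) - C * defect m v ≤ sextic v) →
      m * avg A W (fun x => ∏ i, v (s i) x) < 1 - δ := by
    intro m C hm hC hCC H
    by_contra! hc
    have hD := avg_defect_le hm hc h222
    have h1 : avg A W (fun x => -1 / 2 * (∑ i, v (s i) x ^ 6) - C * defect m fun i => v (s i) x) ≤
        avg A W (fun x => sextic fun i => v (s i) x) :=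
      avg_mono h.nonneg fun x _ => by have := H fun i => v (s i) x; linarith
    simp only [avg_sub, avg_const_mul, avg_sum] at h1
    have h3 : ∑ i, avg A W (fun x => v (s i) x ^ 6) ≤ 6 * (5 + δ) :=
      (sum_le_card_nsmul _ _ (5 + δ) fun i _ => h6 i).trans (le_of_eq (by
        rw [nsmul_eq_mul, card_univ, Fintype.card_fin]; push_cast; ring))
    nlinarith [mul_le_mul_of_nonneg_left hD hC, mul_le_mul_of_nonneg_right hCC hδ.le]
  have k1 := key 1 C₁ (by norm_num) hC₁ (by linarith) H₁
  have k2 := key (-1) C₂ (by norm_num) hC₂ (by linarith) H₂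
  rcases le_abs.1 hs with h | h <;> linarith

/-- The family `v` extended by a function `w` at a degenerate symbol. -/
def extend (v : S → Ω → ℝ) (w : Ω → ℝ) (s : Option S) : Ω → ℝ := s.elim w v

theorem Moments.avg_extend_pow_eight_le (h : Moments A W v η B) (hη : η ≤ 1) (hB : 0 ≤ B) {w : Ω → ℝ}
    (hw : ∀ a ∈ A, w a ^ 2 ≤ 12) (s : Option S) :
    avg A W (fun a => extend v w s a ^ 8) ≤ B + 12 ^ 4 * 2 := by
  cases s with
  | some s => exact (h.eight s).trans (by norm_num)
  | none =>
    have h1 : avg A W (fun a => w a ^ 8) ≤ avg A W (fun _ => 12 ^ 4 * 1) :=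
      avg_mono h.nonneg fun a ha => by
        have := pow_le_pow_left₀ (sq_nonneg _) (hw a ha) 4
        linarith [(by ring : (w a ^ 2) ^ 4 = w a ^ 8)]
    rw [avg_const_mul] at h1
    have h2 := (abs_le.1 h.one).2
    exact h1.trans (by linarith)

/-- The averages of products of six functions. -/
noncomputable def avgProd (A : Finset Ω) (W : ℝ) (v : S → Ω → ℝ) (w : Fin 6 → Ω → ℝ)
    (s : Fin 6 → Option S) : ℝ := avg A W fun a => ∏ i, extend v (w i) (s i) a

theorem Moments.card_update_le [Fintype S] (h : Moments A W v η B) (hη : η ≤ 1) (hB : 0 ≤ B)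
    (hBη : 4 * (B + 12 ^ 4 * 2) * η ≤ 1 / 8) {w : Fin 6 → Ω → ℝ}
    (hw : ∀ i, ∀ a ∈ A, w i a ^ 2 ≤ 12) {k l : Fin 6} (hkl : k ≠ l) (s : Fin 6 → Option S) :
    ((univ.filter fun P : S × S => P.1 ≠ P.2 ∧ 1 / 2 ≤ |avgProd A W v w
      (Function.update (Function.update s k (some P.1)) l (some P.2))|).card : ℝ) ≤
      32 * (4 * (B + 12 ^ 4 * 2)) := by
  set T := (univ.erase k).erase l
  have hT : T.card = 4 := by
    rw [card_erase_of_mem (by simpa using hkl.symm),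
      card_erase_of_mem (mem_univ k), card_univ, Fintype.card_fin]
  have e : ∀ P : S × S, avgProd A W v w (Function.update (Function.update s k (some P.1)) l (some P.2)) =
      avg A W (fun a => (∏ i ∈ T, extend v (w i) (s i) a) * (v P.1 a * v P.2 a)) := by
    intro P
    refine avg_congr fun a _ => ?_
    have hl : l ∈ univ.erase k := by simpa using hkl.symm
    rw [← mul_prod_erase _ _ (mem_univ k), ← mul_prod_erase _ _ hl,
      update_self, update_of_ne hkl, update_self]
    have : ∏ i ∈ T, extend v (w i) (Function.update (Function.update s k (some P.1)) l (some P.2) i) a =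
        ∏ i ∈ T, extend v (w i) (s i) a := prod_congr rfl fun i hi => by
      have hi := mem_erase.1 hi
      rw [update_of_ne hi.1, update_of_ne (ne_of_mem_erase hi.2)]
    change v P.1 a * (v P.2 a * ∏ i ∈ T, _) = _
    rw [this]
    ring
  simp only [e]
  refine h.card_pairs_le hη ?_ hBη
  calc avg A W (fun a => (∏ i ∈ T, extend v (w i) (s i) a) ^ 2)
      ≤ avg A W (fun a => ∑ i ∈ T, extend v (w i) (s i) a ^ 8) := avg_mono h.nonneg fun a _ => by
        rw [← prod_pow]
        refine (prod_le_sum_pow (card_pos.1 (by omega)) fun i => sq_nonneg _).trans (le_of_eq ?_)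
        rw [hT]
        exact sum_congr rfl fun i _ => by ring
    _ = ∑ i ∈ T, avg A W (fun a => extend v (w i) (s i) a ^ 8) := avg_sum _ _ _ _
    _ ≤ _ := (sum_le_card_nsmul _ _ _ fun i _ =>
        h.avg_extend_pow_eight_le hη hB (hw i) (s i)).trans (le_of_eq (by
          rw [hT, nsmul_eq_mul]; norm_num))

/-- Replacement of one symbol by the degenerate one. -/
noncomputable def clear (i : Fin 6) (s : Fin 6 → Option S) : Fin 6 → Option S := Function.update s i none

theorem clear_self (i : Fin 6) (s : Fin 6 → Option S) : clear i s i = none := update_self ..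

theorem clear_of_ne {i j : Fin 6} (h : j ≠ i) (s : Fin 6 → Option S) : clear i s j = s j :=
  update_of_ne h ..

theorem card_le_mul_card_image_clear_clear [Fintype S] {w : Fin 6 → Ω → ℝ} {k l : Fin 6} (hkl : k ≠ l)
    {n : ℕ} (hn : ∀ s, (univ.filter fun P : S × S => P.1 ≠ P.2 ∧ 1 / 2 ≤ |avgProd A W v w
      (Function.update (Function.update s k (some P.1)) l (some P.2))|).card ≤ n)
    {P : Finset (Fin 6 → Option S)} (hP : ∀ s ∈ P, 1 / 2 ≤ |avgProd A W v w s| ∧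
      ∃ x y, x ≠ y ∧ s k = some x ∧ s l = some y) :
    P.card ≤ n * (P.image fun s => clear k (clear l s)).card := by
  refine card_le_mul_card_image _ _ fun t _ => ?_
  refine (card_le_card (t := image (fun P : S × S =>
    Function.update (Function.update t k (some P.1)) l (some P.2)) _) fun s hs => ?_).trans
    (card_image_le.trans (hn t))
  rw [mem_filter] at hs
  obtain ⟨h1, x, y, hxy, hk, hl⟩ := hP s hs.1
  have e : Function.update (Function.update t k (some x)) l (some y) = s := by
    rw [← hs.2]
    funext i
    by_cases hi : i = l
    · rw [hi, update_self, hl]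
    · rw [update_of_ne hi]
      by_cases hi' : i = k
      · rw [hi', update_self, hk]
      · rw [update_of_ne hi', clear_of_ne hi', clear_of_ne hi]
  exact mem_image.2 ⟨(x, y), by simpa only [mem_filter, mem_univ, true_and, e] using ⟨hxy, h1⟩, e⟩

theorem card_le_mul_card_image_clear [Fintype S] {R : S → S → S → Prop} {a b c : Fin 6} (hac : a ≠ c)
    (hbc : b ≠ c) {n : ℕ} (hn : ∀ x y, (univ.filter fun z => R x y z).card ≤ n)
    {P : Finset (Fin 6 → Option S)} (hP : ∀ s ∈ P, ∃ x y z, s a = some x ∧ s b = some y ∧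
      s c = some z ∧ R x y z) :
    P.card ≤ n * (P.image (clear c)).card := by
  refine card_le_mul_card_image _ _ fun t ht => ?_
  obtain ⟨s₀, hs₀, rfl⟩ := mem_image.1 ht
  obtain ⟨x, y, z, ha, hb, hc, hR⟩ := hP s₀ hs₀
  refine (card_le_card (t := image (fun z =>
    Function.update (clear c s₀) c (some z)) _) fun s hs => ?_).trans
    (card_image_le.trans (hn x y))
  rw [mem_filter] at hs
  obtain ⟨x', y', z', ha', hb', hc', hR'⟩ := hP s hs.1
  have h1 : ∀ i, i ≠ c → s i = s₀ i := fun i hi => by rw [← clear_of_ne hi s, hs.2, clear_of_ne hi]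
  rw [h1 a hac, ha, Option.some_inj] at ha'
  rw [h1 b hbc, hb, Option.some_inj] at hb'
  subst ha' hb'
  refine mem_image.2 ⟨z', by simpa using hR', ?_⟩
  funext i
  by_cases hi : i = c
  · rw [hi, update_self, hc']
  · rw [update_of_ne hi, clear_of_ne hi, h1 i hi]

end

section

variable {S : Type} [Fintype S]

theorem card_filter_eq_none_le {i j k : Fin 6} (hij : i ≠ j) (hik : i ≠ k) (hjk : j ≠ k) :
    (univ.filter fun s : Fin 6 → Option S => s i = none ∧ s j = none ∧ s k = none).card ≤
      (card S + 1) ^ 3 := by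
  set T : Finset (Fin 6) := {i, j, k}
  have hT : T.card = 3 := card_eq_three.2 ⟨i, j, k, hij, hik, hjk, rfl⟩
  refine (card_le_card (t := Fintype.piFinset fun x => if x ∈ T then {none} else univ)
    fun s hs => ?_).trans (le_of_eq ?_)
  · rw [Fintype.mem_piFinset]
    intro x
    simp only [mem_filter, mem_univ, true_and] at hs
    split_ifs with hx
    · simp only [T, mem_insert, mem_singleton] at hx
      rcases hx with rfl | rfl | rfl <;> simp [hs]
    · exact mem_univ _
  · rw [Fintype.card_piFinset]
    have : ∀ x, (if x ∈ T then ({none} : Finset (Option S)) else univ).card =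
        if x ∈ T then 1 else card S + 1 := fun x => by
      split_ifs
      · exact card_singleton _
      · rw [card_univ, Fintype.card_option]
    simp only [this]
    rw [prod_ite, prod_const_one, one_mul, prod_const]
    congr 1
    rw [filter_not, card_sdiff_of_subset (filter_subset _ _),
      filter_mem_eq_inter, univ_inter, hT, card_univ, Fintype.card_fin]

/-- The tuples with at least three degenerate symbols. -/
noncomputable def degenerate (S : Type) [Fintype S] : Finset (Fin 6 → Option S) :=
  univ.filter fun s => ∃ i j k, i ≠ j ∧ i ≠ k ∧ j ≠ k ∧ s i = none ∧ s j = none ∧ s k = none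

theorem card_degenerate_le : (degenerate S).card ≤ 216 * (card S + 1) ^ 3 := by
  refine (card_le_card (t := (univ : Finset (Fin 6 × Fin 6 × Fin 6)).biUnion fun T =>
    if T.1 ≠ T.2.1 ∧ T.1 ≠ T.2.2 ∧ T.2.1 ≠ T.2.2 then
      univ.filter fun s : Fin 6 → Option S => s T.1 = none ∧ s T.2.1 = none ∧ s T.2.2 = none else ∅)
    fun s hs => ?_).trans ((card_biUnion_le_card_mul _ _ ((card S + 1) ^ 3) fun T _ => ?_).trans
      (le_of_eq ?_))
  · obtain ⟨i, j, k, h1, h2, h3, h⟩ := (mem_filter.1 hs).2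
    exact mem_biUnion.2 ⟨(i, j, k), mem_univ _, by
      rw [if_pos ⟨h1, h2, h3⟩]; exact mem_filter.2 ⟨mem_univ _, h⟩⟩
  · split_ifs with h
    · exact card_filter_eq_none_le h.1 h.2.1 h.2.2
    · simp
  · simp [card_univ]

/-- The tuples with at most one nondegenerate symbol, possibly repeated. -/
noncomputable def monochrome (S : Type) [Fintype S] : Finset (Fin 6 → Option S) :=
  univ.filter fun s => ∃ x, ∀ i, s i = none ∨ s i = x

theorem card_monochrome_le : (monochrome S).card ≤ 64 * (card S + 1) ^ 3 := by
  refine (card_le_card (t := (univ : Finset (Option S)).biUnion fun x =>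
    Fintype.piFinset fun _ => {none, x}) fun s hs => ?_).trans
      ((card_biUnion_le_card_mul _ _ 64 fun x _ => ?_).trans ?_)
  · obtain ⟨x, hx⟩ := (mem_filter.1 hs).2
    exact mem_biUnion.2 ⟨x, mem_univ _, Fintype.mem_piFinset.2 fun i => by simpa using hx i⟩
  · rw [Fintype.card_piFinset, prod_const, card_univ, Fintype.card_fin]
    exact Nat.pow_le_pow_left card_le_two 6
  · rw [card_univ, Fintype.card_option, mul_comm]
    exact Nat.mul_le_mul_left _ (Nat.le_self_pow (by norm_num) _)

end

section

variable {Ω S : Type} {A : Finset Ω} {W : ℝ} {v : S → Ω → ℝ} {η B : ℝ}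

theorem exists_pair_and_triple {R : S → S → S → Prop} (hR : ∀ x y, R x y y) {s : Fin 6 → S}
    (hs : ∃ i j, s i ≠ s j) (h : ∃ a b c : Fin 6, a ≠ b ∧ a ≠ c ∧ b ≠ c ∧ R (s a) (s b) (s c)) :
    ∃ T : Fin 5 → Fin 6, T.Injective ∧ s (T 0) ≠ s (T 1) ∧ R (s (T 2)) (s (T 3)) (s (T 4)) := by
  obtain ⟨a, b, c, hab, hac, hbc, h⟩ := h
  have hT : ∀ a b c : Fin 6, a ≠ b → a ≠ c → b ≠ c → ∃ l m n : Fin 6,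
      Injective ![a, b, c, l, m, n] := by decide
  obtain ⟨l, m, n, hi⟩ := hT a b c hab hac hbc
  have hsurj := Finite.injective_iff_surjective.1 hi
  have key : ∀ f : Fin 5 → Fin 6, f.Injective → s (![a, b, c, l, m, n] (f 0)) ≠ s (![a, b, c, l, m, n] (f 1)) →
      R (s (![a, b, c, l, m, n] (f 2))) (s (![a, b, c, l, m, n] (f 3))) (s (![a, b, c, l, m, n] (f 4))) →
      ∃ T : Fin 5 → Fin 6, T.Injective ∧ s (T 0) ≠ s (T 1) ∧ R (s (T 2)) (s (T 3)) (s (T 4)) :=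
    fun f hf h1 h2 => ⟨_, hi.comp hf, h1, h2⟩
  by_cases hlm : s l = s m
  swap
  · exact key ![3, 4, 0, 1, 2] (by decide) hlm h
  by_cases hln : s l = s n
  swap
  · exact key ![3, 5, 0, 1, 2] (by decide) hln h
  have hR' : ∀ x, R x (s l) (s m) := fun x => by rw [hlm]; exact hR _ _
  by_cases ha : s a = s n
  swap
  · exact key ![0, 5, 1, 3, 4] (by decide) ha (hR' _)
  by_cases hb : s b = s n
  swap
  · exact key ![1, 5, 0, 3, 4] (by decide) hb (hR' _)
  by_cases hc : s c = s n
  swap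
  · exact key ![2, 5, 0, 3, 4] (by decide) hc (hR' _)
  have hall : ∀ i, s i = s n := fun i => by
    obtain ⟨j, rfl⟩ := hsurj i
    fin_cases j
    exacts [ha, hb, hc, hln, hlm.symm.trans hln, rfl]
  obtain ⟨i, j, hij⟩ := hs
  exact absurd ((hall i).trans (hall j).symm) hij

theorem exists_card_avgProd_le {B : ℝ} (hB : 0 ≤ B) : ∃ δ : ℝ, 0 < δ ∧ δ ≤ 1 / 2 ∧ ∃ η : ℝ, 0 < η ∧
    ∃ N : ℕ, ∀ {Ω S : Type} [Fintype S] {A : Finset Ω} {W : ℝ} {v : S → Ω → ℝ}, Moments A W v η B →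
      ∀ w : Fin 6 → Ω → ℝ, (∀ i, ∀ a ∈ A, w i a ^ 2 ≤ 12) →
        (univ.filter fun s : Fin 6 → Option S => 1 - δ ≤ |avgProd A W v w s|).card ≤
          N * (card S + 1) ^ 3 := by
  obtain ⟨δ, hδ, hδ2, hres⟩ := exists_resonant
  have hB1 : 0 < 4 * (B + 12 ^ 4 * 2) := by positivity
  set η := min (min δ (1 / (8 * (4 * (B + 12 ^ 4 * 2))))) (δ ^ 2 / (16 * (B + 1))) with hη
  have h1 : η ≤ δ := (min_le_left _ _).trans (min_le_left _ _)
  have h2 : 4 * (B + 12 ^ 4 * 2) * η ≤ 1 / 8 :=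
    (mul_le_mul_of_nonneg_left ((min_le_left _ _).trans (min_le_right _ _)) hB1.le).trans
      (le_of_eq (by field_simp))
  have h0 : 0 < η := by positivity
  have h3 : 2 * B * (4 * η) ≤ δ ^ 2 / 2 := by
    have : η * (16 * (B + 1)) ≤ δ ^ 2 := (le_div_iff₀ (by positivity)).1 (min_le_right _ _)
    linarith
  clear_value η
  set n₁ := ⌈32 * (4 * (B + 12 ^ 4 * 2))⌉₊
  set n₂ := ⌈1 + 8 * B * (B + 4) / δ ^ 2⌉₊
  refine ⟨δ, hδ, hδ2, η, h0, 64 + 36 * (n₁ * 216) + 6 ^ 5 * (n₁ * (n₂ * 216)), ?_⟩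
  intro Ω S _ A W v h w hw
  have hn₁ : ∀ {k l : Fin 6}, k ≠ l → ∀ s, (univ.filter fun P : S × S => P.1 ≠ P.2 ∧
      1 / 2 ≤ |avgProd A W v w
        (Function.update (Function.update s k (some P.1)) l (some P.2))|).card ≤ n₁ := fun hkl s =>
    Nat.cast_le.1 ((h.card_update_le (h1.trans (by linarith)) hB h2 hw hkl s).trans (Nat.le_ceil _))
  have hn₂ : ∀ x y, (univ.filter fun z => Resonant A W v δ x y z).card ≤ n₂ := fun x y =>
    Nat.cast_le.1 ((h.card_resonant_le (h1.trans (by linarith)) hδ h1 hB h3 x y).trans (Nat.le_ceil _))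
  set P := univ.filter fun s : Fin 6 → Option S => 1 - δ ≤ |avgProd A W v w s|
  have hP : ∀ s ∈ P, 1 / 2 ≤ |avgProd A W v w s| := fun s hs => by linarith [(mem_filter.1 hs).2]
  set P₁ : Fin 6 × Fin 6 → Finset (Fin 6 → Option S) := fun T => P.filter fun s =>
    (∃ x y, x ≠ y ∧ s T.1 = some x ∧ s T.2 = some y) ∧ ∃ i, s i = none
  set P₂ : (Fin 5 → Fin 6) → Finset (Fin 6 → Option S) := fun T => P.filter fun s =>
    T.Injective ∧ (∃ x y, x ≠ y ∧ s (T 0) = some x ∧ s (T 1) = some y) ∧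
      ∃ x y z, s (T 2) = some x ∧ s (T 3) = some y ∧ s (T 4) = some z ∧ Resonant A W v δ x y z
  have c₁ : ∀ T, (P₁ T).card ≤ n₁ * (216 * (card S + 1) ^ 3) := fun T => by
    by_cases hT : T.1 = T.2
    · rw [card_eq_zero.2 (filter_eq_empty_iff.2 fun s _ hs => ?_)]
      · exact Nat.zero_le _
      · obtain ⟨⟨x, y, hxy, hx, hy⟩, -⟩ := hs
        rw [hT, hy, Option.some_inj] at hx
        exact hxy hx.symm
    refine (card_le_mul_card_image_clear_clear hT (hn₁ hT) fun s hs => ?_).trans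
      (Nat.mul_le_mul_left _ ((card_le_card fun t ht => ?_).trans card_degenerate_le))
    · exact ⟨hP s (mem_filter.1 hs).1, (mem_filter.1 hs).2.1⟩
    · obtain ⟨s, hs, rfl⟩ := mem_image.1 ht
      obtain ⟨-, ⟨x, y, -, hx, hy⟩, i, hi⟩ := mem_filter.1 hs
      have i1 : i ≠ T.1 := fun e => by rw [e, hx] at hi; cases hi
      have i2 : i ≠ T.2 := fun e => by rw [e, hy] at hi; cases hi
      refine mem_filter.2 ⟨mem_univ _, T.1, T.2, i, hT, i1.symm, i2.symm, clear_self .., ?_, ?_⟩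
      · rw [clear_of_ne (Ne.symm hT), clear_self]
      · rw [clear_of_ne i1, clear_of_ne i2, hi]
  have c₂ : ∀ T, (P₂ T).card ≤ n₁ * (n₂ * (216 * (card S + 1) ^ 3)) := fun T => by
    by_cases hT : T.Injective
    swap
    · rw [card_eq_zero.2 (filter_eq_empty_iff.2 fun s _ hs => hT hs.1)]
      exact Nat.zero_le _
    have hT' : ∀ {i j}, i ≠ j → T i ≠ T j := fun hij => hT.ne hij
    refine (card_le_mul_card_image_clear_clear (hT' (by decide)) (hn₁ (hT' (by decide)))
      (k := T 0) (l := T 1) fun s hs => ?_).trans (Nat.mul_le_mul_left _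
        ((card_le_mul_card_image_clear (R := Resonant A W v δ) (a := T 2) (b := T 3) (c := T 4)
          (hT' (by decide)) (hT' (by decide)) hn₂ fun s hs => ?_).trans (Nat.mul_le_mul_left _
            ((card_le_card fun t ht => ?_).trans card_degenerate_le))))
    · exact ⟨hP s (mem_filter.1 hs).1, (mem_filter.1 hs).2.2.1⟩
    · obtain ⟨t, ht, rfl⟩ := mem_image.1 hs
      obtain ⟨-, -, -, x, y, z, hx, hy, hz, hr⟩ := mem_filter.1 ht
      refine ⟨x, y, z, ?_, ?_, ?_, hr⟩
      all_goals rwa [clear_of_ne (hT' (by decide)), clear_of_ne (hT' (by decide))]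
    · obtain ⟨s, hs, rfl⟩ := mem_image.1 ht
      obtain ⟨t, ht, rfl⟩ := mem_image.1 hs
      refine mem_filter.2 ⟨mem_univ _, T 0, T 1, T 4, hT' (by decide), hT' (by decide),
        hT' (by decide), ?_, ?_, clear_self ..⟩
      · rw [clear_of_ne (hT' (by decide)), clear_self]
      · rw [clear_of_ne (hT' (by decide)), clear_of_ne (hT' (by decide)), clear_self]
  have hcov : P ⊆ monochrome S ∪ (univ.biUnion P₁ ∪ univ.biUnion P₂) := fun s hs => by
    by_cases hm : s ∈ monochrome S
    · exact mem_union_left _ hm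
    refine mem_union_right _ ?_
    have hm' : ∀ x, ∃ i, s i ≠ none ∧ s i ≠ x := fun x => by
      by_contra! hx
      exact hm (mem_filter.2 ⟨mem_univ _, x, fun i => by
        by_cases hi : s i = none
        · exact Or.inl hi
        · exact Or.inr (hx i hi)⟩)
    obtain ⟨i, hi, -⟩ := hm' none
    obtain ⟨j, hj, hji⟩ := hm' (s i)
    obtain ⟨x, hx⟩ := Option.ne_none_iff_exists'.1 hi
    obtain ⟨y, hy⟩ := Option.ne_none_iff_exists'.1 hj
    have hxy : x ≠ y := fun e => hji (by rw [hy, hx, e])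
    by_cases hnone : ∃ i, s i = none
    · exact mem_union_left _ (mem_biUnion.2 ⟨(i, j), mem_univ _,
        mem_filter.2 ⟨hs, ⟨x, y, hxy, hx, hy⟩, hnone⟩⟩)
    · push Not at hnone
      choose t ht using fun i => Option.ne_none_iff_exists'.1 (hnone i)
      have hst : s = fun i => some (t i) := _root_.funext ht
      obtain ⟨T, hT, h01, hr⟩ := exists_pair_and_triple (R := Resonant A W v δ) (fun _ _ => Or.inl rfl)
        (s := t) ⟨i, j, fun e => hji (by rw [ht i, ht j, e])⟩ (hres h h1 t (by
          have := (mem_filter.1 hs).2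
          rw [hst] at this
          exact this))
      exact mem_union_right _ (mem_biUnion.2 ⟨T, mem_univ _,
        mem_filter.2 ⟨hs, hT, ⟨_, _, h01, ht _, ht _⟩, _, _, _, ht _, ht _, ht _, hr⟩⟩)
  calc P.card ≤ (monochrome S).card + ((univ.biUnion P₁).card + (univ.biUnion P₂).card) :=
        (card_le_card hcov).trans ((card_union_le _ _).trans
          (Nat.add_le_add_left (card_union_le _ _) _))
    _ ≤ 64 * (card S + 1) ^ 3 + (36 * (n₁ * (216 * (card S + 1) ^ 3)) +
        6 ^ 5 * (n₁ * (n₂ * (216 * (card S + 1) ^ 3)))) := by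
      refine Nat.add_le_add card_monochrome_le (Nat.add_le_add ?_ ?_)
      · refine (card_biUnion_le_card_mul _ _ _ fun T _ => c₁ T).trans (le_of_eq ?_)
        simp [card_univ]
      · refine (card_biUnion_le_card_mul _ _ _ fun T _ => c₂ T).trans (le_of_eq ?_)
        simp [card_univ]
    _ = _ := by ring

end

section

variable {K L S : Type} [Field K] [Fintype K] [Field L] [Fintype L]

theorem three_ne_zero_of_charP {p : ℕ} [Fact p.Prime] [CharP L p] (hp : 3 < p) : (3 : L) ≠ 0 := by
  intro h
  have h := (CharP.cast_eq_zero_iff L p 3).1 (by exact_mod_cast h)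
  exact absurd (Nat.le_of_dvd (by norm_num) h) (by omega)

theorem ringChar_ne_two_of_charP {p : ℕ} [CharP L p] (hp : 3 < p) : ringChar L ≠ 2 := by
  rw [ringChar.eq L p]
  omega

theorem moments_nsum {p r : ℕ} [Fact p.Prime] [CharP L p] (hL : card L = p ^ r) (hp : 3 < p)
    (hq : 810000 ≤ p ^ r) {ψ : AddChar L ℂ} (hψ : ψ.IsPrimitive) {ι : S → L} (hι : ι.Injective)
    (h0 : ∀ s, ι s ≠ 0) :
    Moments (univ.erase 0) (card L : ℝ)⁻¹ (fun s => nsum ψ (ι s) 1)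
      (50000 / √(card L : ℝ)) 5204 := by
  have hK2 := ringChar_ne_two_of_charP (L := L) hp
  have h3 := three_ne_zero_of_charP (L := L) hp
  have h4 : 4 ≤ card L := by omega
  have hq1 : (1 : ℝ) ≤ card L := by exact_mod_cast (by omega : 1 ≤ card L)
  have hle : ∀ {c : ℝ}, 0 ≤ c → c ≤ 50000 → c / (card L : ℝ) ≤ 50000 / √(card L : ℝ) :=
    fun h0 h1 => div_le_div₀ (by norm_num) h1 (by positivity) (Real.sqrt_le_iff.2 ⟨by positivity, by nlinarith⟩)
  refine ⟨by positivity, ?_, fun s => ?_, fun s => ?_, fun s t hst => ?_, fun s => ?_, fun s => ?_, ?_⟩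
  · change |mean (fun _ : L => 1) - 1| ≤ _
    rw [mean_one, sub_sub_cancel_left, abs_neg, abs_of_nonneg (by positivity)]
    exact hle (by norm_num) (by norm_num)
  · exact (abs_mean_sq_sub_one_le hK2 hψ h4 (h0 s)).trans (hle (by norm_num) (by norm_num))
  · refine le_trans ?_ (le_mean_pow_four hK2 h3 hψ h4 (h0 s))
    linarith [hle (c := 145) (by norm_num) (by norm_num)]
  · exact (abs_mean_sq_mul_sq_sub_one_le hK2 h3 hψ h4 (h0 s) (h0 t) (hι.ne hst)).trans
      (hle (by norm_num) (by norm_num))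
  · refine (mean_pow_six_le hK2 h3 hψ h4 (h0 s)).trans ?_
    linarith [hle (c := 1735) (by norm_num) (by norm_num)]
  · exact mean_pow_eight_le hK2 h3 hψ h4 (h0 s)
  · intro a b c d h1 h2 h3
    exact abs_mean_mul_le hL hp hq hψ (h0 a) (h0 b) (h0 c) (h0 d) (hι.ne h1)
      (fun h => h2 ⟨hι h.1, hι h.2⟩) (fun h => h3 ⟨hι h.1, hι h.2⟩)

/-- The symbol of a coordinate: the class of `g / c ^ 3` if `c` is nonzero. -/
noncomputable def symbol (g c : Fin 6 → K) (hg : ∀ i, g i ≠ 0) (i : Fin 6) : Option {x : K // x ≠ 0} :=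
  if h : c i = 0 then none else some ⟨g i / c i ^ 3, div_ne_zero (hg i) (pow_ne_zero 3 h)⟩

theorem card_symbol_eq_le {g : Fin 6 → K} (hg : ∀ i, g i ≠ 0) (s : Fin 6 → Option {x : K // x ≠ 0}) :
    (univ.filter fun c => symbol g c hg = s).card ≤ 729 := by
  refine (card_le_card (t := Fintype.piFinset fun i =>
    (s i).elim {0} fun x => univ.filter fun y => y ^ 3 = g i / x) fun c hc => ?_).trans ?_
  · rw [Fintype.mem_piFinset]
    intro i
    have hs := congrFun (mem_filter.1 hc).2 i
    rw [← hs, symbol]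
    split_ifs with h
    · simpa using h
    · have : c i ^ 3 ≠ 0 := pow_ne_zero 3 h
      simp only [Option.elim_some, mem_filter, mem_univ, true_and]
      field_simp [hg i]
  · rw [Fintype.card_piFinset]
    refine (prod_le_pow_card _ _ 3 fun i _ => ?_).trans (le_of_eq (by simp))
    cases s i with
    | none => simp
    | some x => exact card_filter_pow_three_le _

theorem avgProd_symbol (φ : K →+* L) (ψ : AddChar L ℂ) {g : Fin 6 → K} (c : Fin 6 → K) (hg : ∀ i, g i ≠ 0) :
    avgProd (univ.erase 0) (card L : ℝ)⁻¹ (fun s : {x : K // x ≠ 0} => nsum ψ (φ s) 1)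
      (fun i => nsum ψ (φ (g i)) 0) (symbol g c hg) =
        mean (fun a => ∏ i, nsum ψ (φ (g i)) (φ (c i)) a) := by
  refine avg_congr fun a _ => prod_congr rfl fun i _ => ?_
  rw [symbol]
  split_ifs with h
  · rw [h, map_zero]
    rfl
  · rw [nsum_eq ψ (φ (g i)) a ((_root_.map_ne_zero φ).2 h), ← map_pow, ← map_div₀]
    rfl

theorem exists_card_mean_le : ∃ δ : ℝ, 0 < δ ∧ δ ≤ 1 / 2 ∧ ∃ N Q : ℕ, ∀ {K L : Type} [Field K] [Fintype K]
    [Field L] [Fintype L] (φ : K →+* L) {p r : ℕ} [Fact p.Prime] [CharP L p], card L = p ^ r →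
      3 < p → Q ≤ p ^ r → ∀ {ψ : AddChar L ℂ}, ψ.IsPrimitive → ∀ {g : Fin 6 → K}, (∀ i, g i ≠ 0) →
        (univ.filter fun c : Fin 6 → K => 1 - δ ≤
          |mean (fun a => ∏ i, nsum ψ (φ (g i)) (φ (c i)) a)|).card ≤ N * card K ^ 3 := by
  obtain ⟨δ, hδ, hδ2, η, hη, N, H⟩ := exists_card_avgProd_le (B := 5204) (by norm_num)
  refine ⟨δ, hδ, hδ2, 729 * N, max 810000 ⌈(50000 / η) ^ 2⌉₊, ?_⟩
  intro K L _ _ _ _ φ p r _ _ hL hp hQ ψ hψ g hg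
  have hq := (le_max_left _ _).trans hQ
  have h := moments_nsum hL hp hq hψ (ι := fun s : {x : K // x ≠ 0} => φ s)
    (fun x y h => Subtype.ext (φ.injective h)) (fun s => (_root_.map_ne_zero φ).2 s.2)
  have hle : 50000 / √(card L : ℝ) ≤ η := by
    have h1 : (50000 / η) ^ 2 ≤ (card L : ℝ) := by
      rw [hL]
      exact (Nat.le_ceil _).trans (by exact_mod_cast (le_max_right _ _).trans hQ)
    have h2 := Real.le_sqrt_of_sq_le h1
    rw [div_le_iff₀ hη] at h2
    rw [div_le_iff₀ (Real.sqrt_pos.2 (by exact_mod_cast Fintype.card_pos))]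
    linarith
  have h : Moments (univ.erase 0) (card L : ℝ)⁻¹
      (fun s : {x : K // x ≠ 0} => nsum ψ (φ s) 1) η 5204 :=
    ⟨h.nonneg, h.one.trans hle, fun s => (h.two s).trans hle, fun s => by linarith [h.four s],
      fun s t hst => (h.two_two s t hst).trans hle, fun s => by linarith [h.six s], h.eight,
      fun a b c d h1 h2 h3 => (h.quad a b c d h1 h2 h3).trans hle⟩
  have := H h (fun i => nsum ψ (φ (g i)) 0) fun i a ha =>
    nsum_zero_sq_le hψ (by omega) ((_root_.map_ne_zero φ).2 (hg i)) (ne_of_mem_erase ha)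
  rw [Fintype.card_subtype_compl, Fintype.card_subtype_eq, Nat.sub_add_cancel Fintype.card_pos] at this
  refine (card_le_mul_card_image_of_maps_to (t := univ.filter fun s => 1 - δ ≤ |avgProd
    (univ.erase 0) (card L : ℝ)⁻¹ (fun s : {x : K // x ≠ 0} => nsum ψ (φ s) 1)
      (fun i => nsum ψ (φ (g i)) 0) s|) (f := fun c => symbol g c hg) (fun c hc => ?_) 729
        fun s _ => ?_).trans ?_
  · rw [mem_filter] at hc ⊢
    exact ⟨mem_univ _, by rw [avgProd_symbol]; exact hc.2⟩
  · exact (card_le_card (filter_subset_filter _ (subset_univ _))).trans (card_symbol_eq_le hg s)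
  · rw [mul_assoc]
    exact Nat.mul_le_mul_left _ this

theorem abs_mean_prod_le {p r : ℕ} [Fact p.Prime] [CharP K p] (hp : 3 < p) (hq : 1735 ≤ card K)
    {ψ : AddChar K ℂ} (hψ : ψ.IsPrimitive) {g : Fin 6 → K} (hg : ∀ i, g i ≠ 0) (c : Fin 6 → K) :
    |mean (fun a => ∏ i, nsum ψ (g i) (c i) a)| ≤ 10368 := by
  have hq' : (1735 : ℝ) ≤ card K := by exact_mod_cast hq
  have hW : (0 : ℝ) ≤ (card K : ℝ)⁻¹ := by positivity
  have h6 : ∀ i, mean (fun a => nsum ψ (g i) (c i) a ^ 6) ≤ 1728 := fun i => by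
    by_cases h : c i = 0
    · have h1 : mean (fun a => nsum ψ (g i) (c i) a ^ 6) ≤ mean (fun _ : K => 1728 * 1) :=
        avg_mono hW fun a ha => by
          have := pow_le_pow_left₀ (sq_nonneg _)
            (nsum_zero_sq_le hψ (by omega) (hg i) (ne_of_mem_erase ha)) 3
          rw [h]
          linarith [(by ring : (nsum ψ (g i) 0 a ^ 2) ^ 3 = nsum ψ (g i) 0 a ^ 6)]
      refine h1.trans ?_
      change avg _ _ _ ≤ _
      rw [avg_const_mul]
      have h2 : avg (univ.erase 0) (card K : ℝ)⁻¹ (fun _ : K => 1) ≤ 1 :=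
        (mean_one (K := K)).le.trans (by linarith [show 0 ≤ 1 / (card K : ℝ) by positivity])
      linarith
    · simp only [fun a => nsum_eq ψ (g i) a h]
      refine (mean_pow_six_le (ringChar_ne_two_of_charP hp) (three_ne_zero_of_charP hp) hψ (by omega)
        (div_ne_zero (hg i) (pow_ne_zero 3 h))).trans ?_
      have : 1735 / (card K : ℝ) ≤ 1 := div_le_one_of_le₀ hq' (by positivity)
      linarith
  have h7 : ∀ a, |∏ i, nsum ψ (g i) (c i) a| ≤ ∑ i, nsum ψ (g i) (c i) a ^ 6 := fun a => by
    rw [abs_prod]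
    refine (prod_le_sum_pow univ_nonempty fun i => abs_nonneg _).trans (le_of_eq ?_)
    exact sum_congr rfl fun i _ => by rw [card_univ, Fintype.card_fin, Even.pow_abs (by decide)]
  calc |mean (fun a => ∏ i, nsum ψ (g i) (c i) a)|
      ≤ (card K : ℝ)⁻¹ * ∑ a ∈ univ.erase 0, |∏ i, nsum ψ (g i) (c i) a| := by
        rw [mean, abs_mul, abs_of_nonneg hW]
        exact mul_le_mul_of_nonneg_left (abs_sum_le_sum_abs _ _) hW
    _ ≤ avg (univ.erase 0) (card K : ℝ)⁻¹ (fun a => ∑ i, nsum ψ (g i) (c i) a ^ 6) :=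
        avg_mono hW fun a _ => h7 a
    _ = ∑ i, mean (fun a => nsum ψ (g i) (c i) a ^ 6) := avg_sum _ _ _ _
    _ ≤ _ := (sum_le_card_nsmul _ _ _ fun i _ => h6 i).trans (le_of_eq (by norm_num))

end

section

variable {K : Type} [Field K] [Fintype K]

theorem cubicCount_quadraticAlgebra {ν : K} [Fact (∀ r : K, r ^ 2 ≠ ν + 0 * r)]
    [Fintype (QuadraticAlgebra K ν 0)] (g c : Fin 6 → K) :
    cubicCount (fun i => algebraMap K (QuadraticAlgebra K ν 0) (g i)) (fun i => algebraMap K _ (c i)) =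
      (univ.filter fun P : (Fin 6 → K) × (Fin 6 → K) =>
        P.1 ∈ hyp c ∧ P.2 ∈ hyp c ∧ P ≠ 0 ∧ ConjZero g ν P.2 P.1).card + 1 := by
  have h0 : ((0, 0) : (Fin 6 → K) × (Fin 6 → K)) ∉ univ.filter fun P : (Fin 6 → K) × (Fin 6 → K) =>
      P.1 ∈ hyp c ∧ P.2 ∈ hyp c ∧ P ≠ 0 ∧ ConjZero g ν P.2 P.1 := fun h =>
    (mem_filter.1 h).2.2.2.1 rfl
  rw [← card_insert_of_notMem h0, cubicCount]
  have hre : ∀ f : Fin 6 → QuadraticAlgebra K ν 0, (∑ i, f i).re = ∑ i, (f i).re :=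
    fun f => map_sum (⟨⟨fun z => z.re, rfl⟩, fun _ _ => rfl⟩ : QuadraticAlgebra K ν 0 →+ K) f univ
  have him : ∀ f : Fin 6 → QuadraticAlgebra K ν 0, (∑ i, f i).im = ∑ i, (f i).im :=
    fun f => map_sum (⟨⟨fun z => z.im, rfl⟩, fun _ _ => rfl⟩ : QuadraticAlgebra K ν 0 →+ K) f univ
  have mre : ∀ (a : K) (z : QuadraticAlgebra K ν 0), (algebraMap K _ a * z).re = a * z.re := fun a z => by
    rw [← Algebra.smul_def]; rfl
  have mim : ∀ (a : K) (z : QuadraticAlgebra K ν 0), (algebraMap K _ a * z).im = a * z.im := fun a z => by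
    rw [← Algebra.smul_def]; rfl
  have pre : ∀ z : QuadraticAlgebra K ν 0, (z ^ 3).re = z.re ^ 3 + 3 * ν * z.re * z.im ^ 2 := fun z => by
    have : (z * (z * z)).re = z.re ^ 3 + 3 * ν * z.re * z.im ^ 2 := by simp; ring
    rw [← this, pow_three]
  have pim : ∀ z : QuadraticAlgebra K ν 0, (z ^ 3).im = 3 * z.re ^ 2 * z.im + ν * z.im ^ 3 := fun z => by
    have : (z * (z * z)).im = 3 * z.re ^ 2 * z.im + ν * z.im ^ 3 := by simp; ring
    rw [← this, pow_three]
  have hz : ∀ z : Fin 6 → QuadraticAlgebra K ν 0,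
      (∑ i, algebraMap K _ (g i) * z i ^ 3 = 0 ∧ ∑ i, algebraMap K _ (c i) * z i = 0) ↔
      (fun i => (z i).im) ∈ hyp c ∧ (fun i => (z i).re) ∈ hyp c ∧
        ConjZero g ν (fun i => (z i).re) (fun i => (z i).im) := fun z => by
    rw [QuadraticAlgebra.ext_iff, QuadraticAlgebra.ext_iff, hre, hre, him, him, mem_hyp, mem_hyp, ConjZero]
    have e1 : ∑ i, (algebraMap K _ (g i) * z i ^ 3).re = tri g (fun i => (z i).re) (fun i => (z i).re)
        (fun i => (z i).re) + 3 * ν * tri g (fun i => (z i).re) (fun i => (z i).im) (fun i => (z i).im) := by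
      simp only [tri, mul_sum, ← sum_add_distrib, mre, pre]
      exact sum_congr rfl fun i _ => by ring
    have e2 : ∑ i, (algebraMap K _ (g i) * z i ^ 3).im = 3 * tri g (fun i => (z i).re) (fun i => (z i).re)
        (fun i => (z i).im) + ν * tri g (fun i => (z i).im) (fun i => (z i).im) (fun i => (z i).im) := by
      simp only [tri, mul_sum, ← sum_add_distrib, mim, pim]
      exact sum_congr rfl fun i _ => by ring
    rw [e1, e2]
    simp only [mre, mim]
    exact ⟨fun h => ⟨h.2.2, h.2.1, h.1⟩, fun h => ⟨h.2.2, h.2.1, h.1⟩⟩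
  refine card_bij' (fun z _ => ((fun i => (z i).im), fun i => (z i).re))
    (fun P _ i => ⟨P.2 i, P.1 i⟩) (fun z h => ?_) (fun P hP => ?_) (fun z _ => rfl) (fun P _ => rfl)
  · obtain ⟨h1, h2, h3⟩ := (hz z).1 ((@mem_filter _ _ (_) _ _).1 h).2
    by_cases h : ((fun i => (z i).im, fun i => (z i).re) : (Fin 6 → K) × (Fin 6 → K)) = 0
    · exact mem_insert.2 (Or.inl h)
    · exact mem_insert_of_mem (mem_filter.2 ⟨mem_univ _, h1, h2, h, h3⟩)
  · refine (@mem_filter _ _ (_) _ _).2 ⟨@mem_univ _ (_) _, (hz _).2 ?_⟩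
    rcases mem_insert.1 hP with rfl | hP
    · exact ⟨zero_mem _, zero_mem _, by simp [ConjZero, tri]⟩
    · obtain ⟨-, h1, h2, -, h3⟩ := mem_filter.1 hP
      exact ⟨h1, h2, h3⟩

theorem exists_quadratic {ν : K} (hν : ¬ IsSquare ν) : ∃ (L : Type) (_ : Field L) (_ : Fintype L)
    (φ : K →+* L), card L = card K ^ 2 ∧ ∀ g c : Fin 6 → K,
      cubicCount (fun i => φ (g i)) (fun i => φ (c i)) =
        (univ.filter fun P : (Fin 6 → K) × (Fin 6 → K) =>
          P.1 ∈ hyp c ∧ P.2 ∈ hyp c ∧ P ≠ 0 ∧ ConjZero g ν P.2 P.1).card + 1 := by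
  have hf : Fact (∀ r : K, r ^ 2 ≠ ν + 0 * r) := ⟨fun r h => hν ⟨r, by rw [← sq, h]; ring⟩⟩
  let hL : Fintype (QuadraticAlgebra K ν 0) := Fintype.ofEquiv _ (QuadraticAlgebra.equivProd ν 0).symm
  refine ⟨QuadraticAlgebra K ν 0, inferInstance, hL, algebraMap K _, ?_, cubicCount_quadraticAlgebra⟩
  rw [Fintype.card_congr (QuadraticAlgebra.equivProd ν 0), Fintype.card_prod, sq]

end

section

theorem abs_cubicCount_sub_le {K : Type} [Field K] [Fintype K] {ψ : AddChar K ℂ} (hψ : ψ.IsPrimitive)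
    (hK : 4 ≤ card K) {g c : Fin 6 → K} (hg : ∀ i, g i ≠ 0) (hc : c ≠ 0) {t : ℝ}
    (ht : |mean (fun a => ∏ i, nsum ψ (g i) (c i) a)| ≤ t) :
    |(cubicCount g c : ℝ) - (card K : ℝ) ^ 4| ≤
      ((card K : ℝ) - 1) * (card K : ℝ) ^ 2 * (t + 1728 / (card K : ℝ)) := by
  have h := abs_mean_sub_le hψ hK (h := 3) (by simp) hg hc
  have hq : (4 : ℝ) ≤ card K := by exact_mod_cast hK
  generalize (card K : ℝ) = q at *
  generalize (cubicCount g c : ℝ) = N at *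
  generalize mean (fun a => ∏ i, nsum ψ (g i) (c i) a) = M at *
  have hq1 : 0 < q - 1 := by linarith
  have hq2 : 0 < (q - 1) * q ^ 2 := by positivity
  have e : (q ^ 2 * N - q ^ (2 * 3)) / ((q - 1) * q ^ (3 + 1)) = (N - q ^ 4) / ((q - 1) * q ^ 2) := by
    field_simp
    ring
  rw [e, show (12 : ℝ) ^ 3 = 1728 by norm_num, abs_sub_comm] at h
  have := (abs_sub_abs_le_abs_sub ((N - q ^ 4) / ((q - 1) * q ^ 2)) M).trans h
  rw [abs_div, abs_of_pos hq2, sub_le_iff_le_add, div_le_iff₀ hq2] at this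
  have := mul_le_mul_of_nonneg_right ht hq2.le
  linarith

theorem card_small_support_le {K : Type} [Field K] [Fintype K] {g : Fin 6 → K} (hg : ∀ i, g i ≠ 0) :
    (univ.filter fun c : Fin 6 → K => (univ.filter fun i => c i ≠ 0).card < 3).card ≤
      729 * 216 * card K ^ 3 := by
  have h := card_degenerate_le (S := {x : K // x ≠ 0})
  rw [Fintype.card_subtype_compl, Fintype.card_subtype_eq, Nat.sub_add_cancel Fintype.card_pos] at h
  rw [mul_assoc]
  refine (card_le_mul_card_image_of_maps_to (t := degenerate {x : K // x ≠ 0})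
    (f := fun c => symbol g c hg) (fun c hc => ?_) 729 fun s _ => ?_).trans (Nat.mul_le_mul_left _ h)
  · have hc := (mem_filter.1 hc).2
    have h := card_filter_add_card_filter_not (s := univ) fun i => c i ≠ 0
    rw [card_univ, Fintype.card_fin] at h
    obtain ⟨i, hi, j, hj, k, hk, hij, hik, hjk⟩ := two_lt_card.1
      (show 2 < (univ.filter fun i => ¬ c i ≠ 0).card by omega)
    have hn : ∀ i ∈ univ.filter fun i => ¬ c i ≠ 0, symbol g c hg i = none := fun i hi => by
      rw [symbol, dif_pos (not_not.1 (mem_filter.1 hi).2)]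
    exact mem_filter.2 ⟨mem_univ _, i, j, k, hij, hik, hjk, hn i hi, hn j hj, hn k hk⟩
  · exact (card_le_card (filter_subset_filter _ (subset_univ _))).trans (card_symbol_eq_le hg s)

theorem lt_of_count_bound {q δ n : ℝ} (hq : 1 < q) (hδ : 4000 ≤ δ * q)
    (h : -((q ^ 2 - 1) * (q ^ 2) ^ 2 * (1 - δ + 1728 / q ^ 2)) ≤ n + 1 - (q ^ 2) ^ 4) :
    (q ^ 2 - 1) * (1 + q ^ 3) ^ 2 < n := by
  have e : (q ^ 2 - 1) * (q ^ 2) ^ 2 * (1 - δ + 1728 / q ^ 2) =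
      (q ^ 2 - 1) * (q ^ 4 - (δ * q) * q ^ 3 + 1728 * q ^ 2) := by
    field_simp
  rw [e] at h
  have h1 : 0 < q ^ 2 - 1 := by nlinarith
  have h2 : 0 < (q ^ 2 - 1) * q ^ 2 := by positivity
  have h3 := mul_le_mul_of_nonneg_right hδ (by positivity : 0 ≤ (q ^ 2 - 1) * q ^ 3)
  have h4 := mul_lt_mul_of_pos_left hq h2
  nlinarith

theorem eq_zero_of_count_bound {q s δ N A : ℝ} {m : ℤ} (hs : 1 < s) (hq : s ^ 2 = q)
    (hδ : A + 4000 ≤ δ * s) (h : |N - q ^ 4 - m * (q ^ 2 * (q - 1))| ≤ (q - 1) * (A * (q * s)))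
    (h' : |N - q ^ 4| ≤ (q - 1) * q ^ 2 * (1 - δ + 1728 / q)) : m = 0 := by
  by_contra hm
  have hm : (1 : ℝ) ≤ |(m : ℝ)| := by exact_mod_cast Int.one_le_abs hm
  have hq1 : 1 < q := by nlinarith
  have hB : 0 < (q - 1) * q := mul_pos (by linarith) (by linarith)
  have h1 := (abs_sub_abs_le_abs_sub ((m : ℝ) * (q ^ 2 * (q - 1))) (N - q ^ 4)).trans
    ((abs_sub_comm _ _).trans_le h)
  rw [abs_mul, abs_of_pos (by nlinarith : 0 < q ^ 2 * (q - 1))] at h1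
  have e : (q - 1) * q ^ 2 * (1 - δ + 1728 / q) = (q - 1) * q * (q - δ * q + 1728) := by field_simp
  rw [e] at h'
  have h2 := mul_le_mul_of_nonneg_right hm (by nlinarith : 0 ≤ q ^ 2 * (q - 1))
  have h3 : (q - 1) * q * (δ * q) ≤ (q - 1) * q * (1728 + A * s) := by linarith
  have h4 := le_of_mul_le_mul_left h3 hB
  have h5 := mul_le_mul_of_nonneg_right hδ (by linarith : 0 ≤ s)
  rw [← hq] at h4
  nlinarith

theorem exists_bounds : ∃ C N Q : ℕ, ∀ {K : Type} [Field K] [Fintype K] {p r : ℕ} [Fact p.Prime] [CharP K p],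
    card K = p ^ r → 1 ≤ r → Q ≤ p → ∀ {g : Fin 6 → K}, (∀ i, g i ≠ 0) →
      ∃ T : Finset (Fin 6 → K), T.card ≤ N * card K ^ 3 ∧
        (∀ c ≠ 0, |(cubicCount g c : ℝ) - (card K : ℝ) ^ 4| ≤
          ((card K : ℝ) - 1) * (C * (card K : ℝ) ^ 2)) ∧
        ∀ c ≠ 0, c ∉ T → |(cubicCount g c : ℝ) - (card K : ℝ) ^ 4| ≤
          ((card K : ℝ) - 1) * (C * ((card K : ℝ) * √(card K : ℝ))) := by
  obtain ⟨δ, hδ, hδ2, N, Q, H⟩ := exists_card_mean_le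
  have hB := @exists_card_of_isLine
  generalize hC : 416 * 60 ^ 7 + 5 = C₀
  generalize hP : (100 * 60 ^ 2) ^ 2 = P₀
  refine ⟨max C₀ 10369, 729 * 216 + N + N, max (max Q P₀) ⌈((C₀ + 4000) / δ) ^ 2⌉₊, ?_⟩
  intro K _ _ p r _ _ hK hr hQ g hg
  have hpr : p ≤ p ^ r := Nat.le_self_pow (by omega) p
  have hQ1 : Q ≤ p := ((le_max_left _ _).trans (le_max_left _ _)).trans hQ
  have hQ2 : P₀ ≤ p := ((le_max_right _ _).trans (le_max_left _ _)).trans hQ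
  have hQ3 : ((C₀ + 4000) / δ) ^ 2 ≤ (card K : ℝ) := (Nat.le_ceil _).trans (by
      rw [hK]; exact_mod_cast ((le_max_right _ _).trans hQ).trans hpr)
  have hP0 : 10000 ≤ p := (by rw [← hP]; norm_num : 10000 ≤ P₀).trans hQ2
  have hK4 : 10000 ≤ card K := by omega
  have h3 := three_ne_zero_of_charP (L := K) (p := p) (by omega)
  have h2 := ringChar_ne_two_of_charP (L := K) (p := p) (by omega)
  obtain ⟨ν, hν⟩ := FiniteField.exists_nonsquare h2
  obtain ⟨L, _, _, φ, hL, hcount⟩ := exists_quadratic hν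
  have : CharP L p := charP_of_injective_ringHom φ.injective p
  have hψ := AddChar.FiniteField.primitiveChar_to_Complex_isPrimitive K
  have hχ := AddChar.FiniteField.primitiveChar_to_Complex_isPrimitive L
  generalize AddChar.FiniteField.primitiveChar_to_Complex K = ψ at hψ
  generalize AddChar.FiniteField.primitiveChar_to_Complex L = χ at hχ
  have hL' : card L = p ^ (2 * r) := by rw [hL, hK]; ring
  have cK := H (RingHom.id K) hK (by omega) (hQ1.trans hpr) hψ hg
  have cL := H φ hL' (by omega) (hQ1.trans (Nat.le_self_pow (by omega) p)) hχ hg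
  refine ⟨(univ.filter fun c => (univ.filter fun i => c i ≠ 0).card < 3) ∪ _ ∪ _,
    (card_union_le _ _).trans ((Nat.add_le_add ((card_union_le _ _).trans
      (Nat.add_le_add (card_small_support_le hg) cK)) cL).trans (le_of_eq (by ring))),
    fun c hc => ?_, fun c hc hcT => ?_⟩
  · have hq : (10000 : ℝ) ≤ card K := by exact_mod_cast hK4
    refine (abs_cubicCount_sub_le hψ (by omega) hg hc
      (abs_mean_prod_le (p := p) (r := r) (by omega) (by omega) hψ hg c)).trans ?_
    rw [mul_assoc]
    refine mul_le_mul_of_nonneg_left ?_ (by linarith)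
    rw [mul_comm]
    refine mul_le_mul_of_nonneg_right ?_ (by positivity)
    have : 1728 / (card K : ℝ) ≤ 1 := div_le_one_of_le₀ (by linarith) (by positivity)
    have : (10369 : ℝ) ≤ (max C₀ 10369 : ℕ) := by exact_mod_cast le_max_right _ _
    linarith
  simp only [mem_union, mem_filter, mem_univ, true_and, not_or, not_lt, not_le,
    RingHom.id_apply] at hcT
  obtain ⟨⟨hs, hmK⟩, hmL⟩ := hcT
  have bK := abs_cubicCount_sub_le hψ (by omega) hg hc hmK.le
  have bL := abs_cubicCount_sub_le hχ (by rw [hL]; nlinarith) (g := fun i => φ (g i)) (c := fun i => φ (c i))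
    (fun i => (_root_.map_ne_zero φ).2 (hg i)) (fun h => hc (by
      funext i; exact (map_eq_zero φ).1 (congrFun h i))) hmL.le
  rw [hcount, hL] at bL
  have bL := (abs_le.1 bL).1
  push_cast at bL
  have hq : (10000 : ℝ) ≤ card K := by exact_mod_cast hK4
  have hs1 : (1 : ℝ) < √(card K : ℝ) := Real.lt_sqrt_of_sq_lt (by linarith)
  have hδs : (C₀ : ℝ) + 4000 ≤ δ * √(card K : ℝ) := by
    rw [mul_comm, ← div_le_iff₀ hδ]
    exact Real.le_sqrt_of_sq_le hQ3
  obtain ⟨u, hu, w, hw, huw, hl⟩ := exists_isLine h2 h3 hν hc (g := g) (by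
    have hδq : 4000 ≤ δ * (card K : ℝ) := by
      rw [← Real.mul_self_sqrt (by linarith : (0 : ℝ) ≤ card K)]
      have : (0 : ℝ) ≤ C₀ := by positivity
      nlinarith
    exact_mod_cast lt_of_count_bound (by linarith) hδq bL)
  obtain ⟨m, hm⟩ := hB (N := 60) (by norm_num) (by omega) (by omega) (by rw [hP]; omega) (by omega)
    hg hs hu hw hl huw
  have hN : (univ.filter fun x => x ∈ hyp c ∧ tri g x x x = 0).card = cubicCount g c := by
    rw [cubicCount]
    congr 1
    ext x
    simp only [mem_filter, mem_univ, true_and, mem_hyp, tri, and_comm]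
    simp only [pow_succ, pow_zero, one_mul, mul_assoc]
  rw [hN, hC] at hm
  rw [eq_zero_of_count_bound hs1 (Real.sq_sqrt (by linarith)) hδs hm bK, Int.cast_zero, zero_mul, sub_zero] at hm
  refine hm.trans (mul_le_mul_of_nonneg_left (mul_le_mul_of_nonneg_right ?_ (by positivity)) (by linarith))
  exact_mod_cast le_max_left C₀ 10369

end

section

theorem abs_Ec_le {K : Type} [Field K] [Fintype K] {G₀ : Fin 6 → ℤ} {c : Fin 6 → K} {B : ℝ}
    (h : |(cubicCount (fun i => (G₀ i : K)) c : ℝ) - (card K : ℝ) ^ 4| ≤ ((card K : ℝ) - 1) * B) :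
    |(Ec K (∑ i, MvPolynomial.C (G₀ i) * MvPolynomial.X i ^ 3) c : ℝ)| ≤ B + 1 := by
  have hq : 1 < card K := Fintype.one_lt_card
  obtain ⟨n, hn⟩ : ∃ n, cubicCount (fun i => (G₀ i : K)) c = n + 1 ∧
      Nat.card {x : Fin 6 → K // x ≠ 0 ∧ MvPolynomial.eval x (MvPolynomial.map (Int.castRingHom K)
        (∑ i, MvPolynomial.C (G₀ i) * MvPolynomial.X i ^ 3)) = 0 ∧ ∑ i, c i * x i = 0} = n := by
    refine ⟨_, ?_, rfl⟩
    rw [cubicCount, Nat.card_eq_fintype_card, Fintype.card_subtype]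
    rw [← card_erase_add_one (a := 0) (by simp)]
    congr 2
    ext x
    simp [map_sum, mem_erase]
  rw [hn.1] at h
  have e : Ec K (∑ i, MvPolynomial.C (G₀ i) * MvPolynomial.X i ^ 3) c =
      ((n / (card K - 1) : ℕ) : ℤ) - (projCard (card K) 3 : ℤ) := by
    rw [Ec, projCount, hn.2, Nat.card_eq_fintype_card]
  obtain ⟨q, hq'⟩ : ∃ q, card K = q + 1 := ⟨_, (Nat.sub_add_cancel hq.le).symm⟩
  rw [e]
  rw [hq'] at h hq ⊢
  have h1 := Nat.div_mul_le_self n q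
  have h2 := Nat.lt_div_mul_add (a := n) (b := q) (by omega)
  rw [Nat.add_sub_cancel]
  generalize n / q = k at h1 h2 ⊢
  have h1 : (k : ℝ) * q ≤ n := by exact_mod_cast h1
  have h2 : (n : ℝ) < k * q + q := by exact_mod_cast h2
  have hq : (0 : ℝ) < q := by exact_mod_cast (by omega : 0 < q)
  simp only [projCard, sum_range_succ, sum_range_zero]
  push_cast at h ⊢
  rw [add_sub_cancel_right] at h
  rw [abs_le] at h ⊢
  constructor <;> refine le_of_mul_le_mul_left ?_ hq <;> nlinarith

theorem intCast_ne_zero_of_lt {K : Type} [Field K] {p : ℕ} [CharP K p] {a : ℤ} (ha : a ≠ 0) (h : |a| < p) :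
    (a : K) ≠ 0 := fun h0 =>
  ha (Int.eq_zero_of_abs_lt_dvd ((CharP.intCast_eq_zero_iff K p a).1 h0) h)

end

end Polynomial.Stepanov

/-- Theorem 1.5(3): `m = 6`, `d = 3`, diagonal `G = G₁x₁³ + ⋯ + G₆x₆³`. -/
theorem stmt4 (G₀ : Fin 6 → ℤ) (hG₀ : ∀ i, G₀ i ≠ 0)
    (ε : ℝ) (hε : 0 < ε) :
    ∃ C : ℝ, 0 < C ∧ ∀ (p : ℕ), p.Prime → C ≤ (p : ℝ) → ∀ (r : ℕ), 1 ≤ r →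
      ∀ (K : Type) [Field K] [Fintype K], Nat.card K = p ^ r →
        (Nat.card {c : Fin 6 → K // c ≠ 0 ∧
            ((p : ℝ) ^ r) ^ (ε + ((6 : ℝ) - 3) / 2) ≤
              |(Ec K (∑ i, MvPolynomial.C (G₀ i) * X i ^ 3) c : ℝ)|} : ℝ) ≤
          C * ((p : ℝ) ^ r) ^ 3 ∧
        (∑ c : Fin 6 → K, if c = 0 then (0 : ℝ) else
            |(Ec K (∑ i, MvPolynomial.C (G₀ i) * X i ^ 3) c : ℝ) /
              ((p : ℝ) ^ r) ^ (((6 : ℝ) - 3) / 2)| ^ 6) ≤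
          C * ((p : ℝ) ^ r) ^ 6 := by
  obtain ⟨C, N, Q, H⟩ := Polynomial.Stepanov.exists_bounds
  have hS : 0 ≤ ∑ i, |G₀ i| := Finset.sum_nonneg fun i _ => abs_nonneg _
  have hSr : (0 : ℝ) ≤ (∑ i, |G₀ i| : ℤ) := by exact_mod_cast hS
  have hE : (0 : ℝ) ≤ (C + 2 : ℝ) ^ (1 / ε) := by positivity
  have hM : (0 : ℝ) ≤ (N + 1) * (C + 1) ^ 6 := by positivity
  have hN0 : (0 : ℝ) ≤ N := N.cast_nonneg
  have hQ0 : (0 : ℝ) ≤ Q := Q.cast_nonneg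
  refine ⟨Q + (∑ i, |G₀ i| : ℤ) + 1 + (C + 2 : ℝ) ^ (1 / ε) + (N + 1) * (C + 1) ^ 6 + N, by linarith, ?_⟩
  intro p hp hCp r hr K _ _ hK
  have : Fact p.Prime := ⟨hp⟩
  rw [Nat.card_eq_fintype_card] at hK
  have : CharP K p := charP_of_card_eq_prime_pow hK
  have hKr : (Fintype.card K : ℝ) = (p : ℝ) ^ r := by exact_mod_cast hK
  have hg : ∀ i, ((G₀ i : ℤ) : K) ≠ 0 := fun i => by
    refine Polynomial.Stepanov.intCast_ne_zero_of_lt (p := p) (hG₀ i) ?_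
    have h1 := Finset.single_le_sum (f := fun i => |G₀ i|) (fun i _ => abs_nonneg _) (Finset.mem_univ i)
    have h2 : ((∑ i, |G₀ i| : ℤ) : ℝ) < ((p : ℤ) : ℝ) := by push_cast; push_cast at hCp; linarith
    exact lt_of_le_of_lt h1 (by exact_mod_cast h2)
  have hQp : Q ≤ p := by
    have : (Q : ℝ) ≤ p := by linarith
    exact_mod_cast this
  obtain ⟨T, hT, h1, h2⟩ := H hK hr hQp hg
  have hp1 : (1 : ℝ) ≤ p := by exact_mod_cast hp.one_le
  have hpq : (p : ℝ) ≤ Fintype.card K := hKr ▸ le_self_pow₀ hp1 (by omega)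
  have hqε : (C : ℝ) + 2 ≤ (Fintype.card K : ℝ) ^ ε := by
    have h := Real.rpow_le_rpow hE (show (C + 2 : ℝ) ^ (1 / ε) ≤ Fintype.card K by linarith) hε.le
    rwa [← Real.rpow_mul (by positivity), one_div_mul_cancel hε.ne', Real.rpow_one] at h
  have hTr : (T.card : ℝ) ≤ N * (Fintype.card K : ℝ) ^ 3 := by exact_mod_cast hT
  have hcard : (Fintype.card (Fin 6 → K) : ℝ) = (Fintype.card K : ℝ) ^ 6 := by simp
  rw [← hKr]
  have h3 : ∀ c ≠ 0, |(Ec K (∑ i, MvPolynomial.C (G₀ i) * X i ^ 3) c : ℝ)| ≤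
      C * (Fintype.card K : ℝ) ^ 2 + 1 := fun c hc => Polynomial.Stepanov.abs_Ec_le (h1 c hc)
  have h4 : ∀ c ≠ 0, c ∉ T → |(Ec K (∑ i, MvPolynomial.C (G₀ i) * X i ^ 3) c : ℝ)| ≤
      C * ((Fintype.card K : ℝ) * √(Fintype.card K : ℝ)) + 1 := fun c hc hcT => Polynomial.Stepanov.abs_Ec_le (h2 c hc hcT)
  have hq : (1 : ℝ) ≤ Fintype.card K := hp1.trans hpq
  clear h1 h2 H hT hpq hg hK hKr
  generalize (Fintype.card K : ℝ) = q at *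
  have hs : (1 : ℝ) ≤ √q := Real.one_le_sqrt.2 hq
  have hss : √q * √q = q := Real.mul_self_sqrt (by linarith)
  have hpow : q ^ (((6 : ℝ) - 3) / 2) = q * √q := by
    rw [show ((6 : ℝ) - 3) / 2 = 1 + 1 / 2 by norm_num, Real.rpow_add (by linarith), Real.rpow_one,
      ← Real.sqrt_eq_rpow]
  have hqs : 1 ≤ q * √q := by nlinarith
  have hC0 : (0 : ℝ) ≤ C := C.cast_nonneg
  constructor
  · rw [Nat.card_eq_fintype_card, Fintype.card_subtype]
    refine (Nat.cast_le.2 (Finset.card_le_card (t := T) fun c hc => ?_)).trans (hTr.trans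
      (mul_le_mul_of_nonneg_right (by linarith) (by positivity)))
    obtain ⟨hc, h⟩ := (Finset.mem_filter.1 hc).2
    by_contra hcT
    have h := h.trans (h4 c hc hcT)
    rw [Real.rpow_add (by linarith), hpow] at h
    nlinarith
  · have h5 : ∀ c : Fin 6 → K, (if c = 0 then (0 : ℝ) else
        |(Ec K (∑ i, MvPolynomial.C (G₀ i) * X i ^ 3) c : ℝ) / q ^ (((6 : ℝ) - 3) / 2)| ^ 6) ≤
        (if c ∈ T then ((C : ℝ) + 1) ^ 6 * q ^ 3 else 0) + (C + 1) ^ 6 := fun c => by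
      have hA : (0 : ℝ) ≤ ((C : ℝ) + 1) ^ 6 := by positivity
      rw [hpow, abs_div, abs_of_pos (by linarith : 0 < q * √q)]
      split_ifs with hc hcT hcT
      · positivity
      · positivity
      · have h6 : |(Ec K (∑ i, MvPolynomial.C (G₀ i) * X i ^ 3) c : ℝ)| / (q * √q) ≤ (C + 1) * √q := by
          rw [div_le_iff₀ (by linarith)]
          have := h3 c hc
          have e : (C + 1) * √q * (q * √q) = (C + 1) * (q * (√q * √q)) := by ring
          rw [e, hss]
          nlinarith
        refine (pow_le_pow_left₀ (by positivity) h6 6).trans ?_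
        rw [mul_pow, show √q ^ 6 = (√q * √q) ^ 3 by ring, hss]
        linarith
      · have h6 : |(Ec K (∑ i, MvPolynomial.C (G₀ i) * X i ^ 3) c : ℝ)| / (q * √q) ≤ C + 1 := by
          rw [div_le_iff₀ (by linarith)]
          have := h4 c hc hcT
          nlinarith
        exact (pow_le_pow_left₀ (by positivity) h6 6).trans (by linarith)
    refine (Finset.sum_le_sum fun c _ => h5 c).trans ?_
    rw [Finset.sum_add_distrib, ← Finset.sum_filter, Finset.sum_const, Finset.sum_const, Finset.card_univ,
      nsmul_eq_mul, nsmul_eq_mul, hcard, Finset.filter_mem_eq_inter, Finset.univ_inter]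
    have h6 := mul_le_mul_of_nonneg_right hTr (by positivity : 0 ≤ ((C : ℝ) + 1) ^ 6 * q ^ 3)
    have h7 : (N + 1) * (C + 1) ^ 6 * q ^ 6 ≤
        (Q + (∑ i, |G₀ i| : ℤ) + 1 + (C + 2 : ℝ) ^ (1 / ε) + (N + 1) * (C + 1) ^ 6 + N) * q ^ 6 :=
      mul_le_mul_of_nonneg_right (by linarith) (by positivity)
    refine le_trans (le_trans (add_le_add h6 le_rfl) (le_of_eq ?_)) h7
    ring
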